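/- Let n ≥ 1 and (λ,μ,ν) ∈ (Par_n)^3. Then there exists a positive integer t with N_{tλ,tμ,tν} ≠ 0 if and only if for every choice of subsets A,A',B,B',C,C' ⊆ [n] = {1,…,n} satisfying (1) A∩A' = B∩B' = C∩C' = ∅, (2) |A|+|A'| = |B|+|B'| = |C|+|C'| = |A'|+|B'|+|C'| =: r, and (3) c^{τ⁰(C,C')}_{τ⁰(A,A')^{∨[(2n−2r)^r]}, τ⁰(B,B')^{∨[(2n−2r)^r]}} = 1 and c^{τ²(C,C')}_{τ²(A,A')^{∨[r^r]}, τ²(B,B')^{∨[r^r]}} = 1, the inequality 0 ≤ |λ_A| − |λ_{A'}| + |μ_B| − |μ_{B'}| + |ν_C| − |ν_{C'}| holds. -/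

import Mathlib

/-- `f : ℕ → ℕ` is a partition: weakly decreasing and eventually zero
(the parts are `f 0 ≥ f 1 ≥ …`, 0-indexed). -/
def IsPartition (f : ℕ → ℕ) : Prop :=
  (∀ i j, i ≤ j → f j ≤ f i) ∧ ∃ N, ∀ i, N ≤ i → f i = 0

/-- The cell in row `i`, column `j` (0-indexed) lies in the skew shape `ν/λ`. -/
def InSkew (lam nu : ℕ → ℕ) (i j : ℕ) : Prop :=
  lam i ≤ j ∧ j < nu i

/-- `p` is read weakly before `q` in the row reading word of a (skew) tableau:
right to left along rows, top to bottom. -/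
def ReadBefore (p q : ℕ × ℕ) : Prop :=
  p.1 < q.1 ∨ (p.1 = q.1 ∧ q.2 ≤ p.2)

/-- `T` is a Littlewood–Richardson witness for `c^ν_{λ,μ}`: a semistandard skew
tableau of shape `ν/λ` (entries `≥ 1` on the shape, `0` off the shape) with
content `μ`, whose (reverse) row reading word is ballot.  The conditions that
`λ, μ, ν` are partitions with `λ ⊆ ν` are built in, so that the associated
count vanishes on non-partitions. -/
def IsLRTableau (lam mu nu : ℕ → ℕ) (T : ℕ → ℕ → ℕ) : Prop :=
  IsPartition lam ∧ IsPartition mu ∧ IsPartition nu ∧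
  (∀ i, lam i ≤ nu i) ∧
  (∀ i j, ¬ InSkew lam nu i j → T i j = 0) ∧
  (∀ i j, InSkew lam nu i j → 1 ≤ T i j) ∧
  (∀ i j j', InSkew lam nu i j → InSkew lam nu i j' → j ≤ j' → T i j ≤ T i j') ∧
  (∀ i i' j, InSkew lam nu i j → InSkew lam nu i' j → i < i' → T i j < T i' j) ∧
  (∀ k, {p : ℕ × ℕ | InSkew lam nu p.1 p.2 ∧ T p.1 p.2 = k + 1}.ncard = mu k) ∧
  (∀ k, ∀ q : ℕ × ℕ, InSkew lam nu q.1 q.2 → T q.1 q.2 = k + 2 →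
    {p : ℕ × ℕ | InSkew lam nu p.1 p.2 ∧ T p.1 p.2 = k + 2 ∧ ReadBefore p q}.ncard ≤
      {p : ℕ × ℕ | InSkew lam nu p.1 p.2 ∧ T p.1 p.2 = k + 1 ∧ ReadBefore p q}.ncard)

/-- The Littlewood–Richardson coefficient `c^ν_{λ,μ}` (inner shape `λ`,
content `μ`, outer shape `ν`). -/
noncomputable def lrCoeff (lam mu nu : ℕ → ℕ) : ℕ :=
  Nat.card {T : ℕ → ℕ → ℕ // IsLRTableau lam mu nu T}

/-- The Newell–Littlewood number `N_{λ,μ,ν} = ∑ c^λ_{α,β} c^μ_{β,γ} c^ν_{γ,α}`. -/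
noncomputable def NL (lam mu nu : ℕ → ℕ) : ℕ :=
  ∑ᶠ (a : ℕ → ℕ) (b : ℕ → ℕ) (c : ℕ → ℕ),
    lrCoeff a b lam * lrCoeff b c mu * lrCoeff c a nu

/-- Membership in `Par_n`: a partition with at most `n` parts. -/
def MemParN (n : ℕ) (f : ℕ → ℕ) : Prop :=
  IsPartition f ∧ ∀ i, n ≤ i → f i = 0

/-- `|λ_A| = ∑_{i ∈ A} λ_i` for `A ⊆ [n] = {1,…,n}` (1-indexed subset,
0-indexed parts). -/
def sumParts (f : ℕ → ℕ) (A : Finset ℕ) : ℕ := ∑ i ∈ A, f (i - 1)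

/-- `|λ| = ∑ λ_i`. -/
noncomputable def sizeP (f : ℕ → ℕ) : ℕ := ∑ᶠ i, f i
/-- The `k`-th smallest element of `A` (0-indexed `k`). -/
def nthSmall (A : Finset ℕ) (k : ℕ) : ℕ := (A.sort (· ≤ ·)).getD k 0

/-- `τ(A) = (i_r − r ≥ … ≥ i_1 − 1)` for `A = {i_1 < … < i_r}` (0-indexed parts). -/
def tauP (A : Finset ℕ) : ℕ → ℕ := fun k =>
  if k < A.card then nthSmall A (A.card - 1 - k) - (A.card - k) else 0
/-- The complement `λ^{∨[a^b]}` of a partition `λ ⊆ (a^b)`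
(rectangle with `a` columns and `b` rows). -/
def compP (a b : ℕ) (f : ℕ → ℕ) : ℕ → ℕ := fun k =>
  if k < b then a - f (b - 1 - k) else 0

/-- `τ²(A,A')` for disjoint `A, A' ⊆ [n]` (0-indexed parts):
`τ²(A,A')_k = |A| + #(A' ∩ [α_k,n])` for `1 ≤ k ≤ |A|`, and
`τ²(A,A')_{|A|+l} = #(A ∩ [1,α'_{|A'|+1−l}])` for `1 ≤ l ≤ |A'|`. -/
def tau2 (n : ℕ) (A A' : Finset ℕ) : ℕ → ℕ := fun k =>
  if k < A.card then A.card + (A' ∩ Finset.Icc (nthSmall A k) n).card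
  else if k < A.card + A'.card then
    (A ∩ Finset.Icc 1 (nthSmall A' (A'.card + A.card - 1 - k))).card
  else 0

/-- `τ⁰(A,A')` for disjoint `A, A' ⊆ [n]` (0-indexed parts):
`τ⁰(A,A')_k = n − |A| − |A'| + #([α_k,n] \ (A∪A'))` for `1 ≤ k ≤ |A|`, and
`τ⁰(A,A')_{|A|+l} = #([1,α'_{|A'|+1−l}] \ (A∪A'))` for `1 ≤ l ≤ |A'|`. -/
def tau0 (n : ℕ) (A A' : Finset ℕ) : ℕ → ℕ := fun k =>
  if k < A.card then
    n - A.card - A'.card + ((Finset.Icc (nthSmall A k) n) \ (A ∪ A')).card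
  else if k < A.card + A'.card then
    ((Finset.Icc 1 (nthSmall A' (A'.card + A.card - 1 - k))) \ (A ∪ A')).card
  else 0


set_option linter.unusedSectionVars false
set_option linter.unnecessarySeqFocus false

/-- Triples of rational sequences. -/
abbrev Bdry := Fin 3 → ℕ → ℚ

/-- Triples of index sets. -/
abbrev Triple := Fin 3 → Finset ℕ

section

open Finset

/-! ### Hives: concave functions on the triangular grid -/

/-- Points of the triangular grid in barycentric coordinates. -/
abbrev Pt := Fin 3 → ℕ

/-- The size of a point, i.e. the size of the triangle it belongs to. -/
def wt (p : Pt) : ℕ := p 0 + p 1 + p 2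

/-- The unit vectors. -/
def e (a : Fin 3) : Pt := fun b => if b = a then 1 else 0

/-- The point on side `c` with coordinates `j` at `c + 1` and `l` at `c + 2`. -/
def sd (c : Fin 3) (j l : ℕ) : Pt := fun b => if b = c + 1 then j else if b = c + 2 then l else 0

theorem pt_ext {p q : Pt} (c : Fin 3) (h0 : p c = q c) (h1 : p (c + 1) = q (c + 1))
    (h2 : p (c + 2) = q (c + 2)) : p = q := by
  funext a
  fin_cases c <;> fin_cases a <;> simp_all

theorem wt_cyc (p : Pt) (c : Fin 3) : wt p = p c + p (c + 1) + p (c + 2) := by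
  fin_cases c <;> simp [wt] <;> omega

theorem sum_cyc {M : Type*} [AddCommMonoid M] (f : Fin 3 → M) (c : Fin 3) :
    ∑ a, f a = f c + f (c + 1) + f (c + 2) := by
  rw [Fin.sum_univ_three]
  fin_cases c <;> simp <;> abel

@[simp] theorem wt_add (p q : Pt) : wt (p + q) = wt p + wt q := by
  simp only [wt, Pi.add_apply]; omega

@[simp] theorem wt_e (a : Fin 3) : wt (e a) = 1 := by fin_cases a <;> simp [wt, e]

@[simp] theorem wt_smul (k : ℕ) (p : Pt) : wt (k • p) = k * wt p := by
  simp [wt]; ring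

@[simp] theorem wt_sd (c : Fin 3) (j l : ℕ) : wt (sd c j l) = j + l := by
  fin_cases c <;> simp [wt, sd] <;> omega

@[simp] theorem e_self (a : Fin 3) : e a a = 1 := by simp [e]
@[simp] theorem e_01 (c : Fin 3) : e c (c + 1) = 0 := by fin_cases c <;> simp [e]
@[simp] theorem e_02 (c : Fin 3) : e c (c + 2) = 0 := by fin_cases c <;> simp [e]
@[simp] theorem e_10 (c : Fin 3) : e (c + 1) c = 0 := by fin_cases c <;> simp [e]
@[simp] theorem e_12 (c : Fin 3) : e (c + 1) (c + 2) = 0 := by fin_cases c <;> simp [e]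
@[simp] theorem e_20 (c : Fin 3) : e (c + 2) c = 0 := by fin_cases c <;> simp [e]
@[simp] theorem e_21 (c : Fin 3) : e (c + 2) (c + 1) = 0 := by fin_cases c <;> simp [e]
@[simp] theorem sd_0 (c : Fin 3) (j l : ℕ) : sd c j l c = 0 := by fin_cases c <;> simp [sd]
@[simp] theorem sd_1 (c : Fin 3) (j l : ℕ) : sd c j l (c + 1) = j := by
  fin_cases c <;> simp [sd]
@[simp] theorem sd_2 (c : Fin 3) (j l : ℕ) : sd c j l (c + 2) = l := by
  fin_cases c <;> simp [sd]

theorem fin3_cases (c a : Fin 3) : a = c ∨ a = c + 1 ∨ a = c + 2 := by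
  fin_cases c <;> fin_cases a <;> simp

theorem fin3_add_assoc (c : Fin 3) : c + 1 + 1 = c + 2 ∧ c + 1 + 2 = c ∧ c + 2 + 1 = c ∧
    c + 2 + 2 = c + 1 := by fin_cases c <;> simp

@[simp] theorem c11 (c : Fin 3) : c + 1 + 1 = c + 2 := (fin3_add_assoc c).1
@[simp] theorem c12 (c : Fin 3) : c + 1 + 2 = c := (fin3_add_assoc c).2.1
@[simp] theorem c21 (c : Fin 3) : c + 2 + 1 = c := (fin3_add_assoc c).2.2.1
@[simp] theorem c22 (c : Fin 3) : c + 2 + 2 = c + 1 := (fin3_add_assoc c).2.2.2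

theorem pt_pred {p : Pt} {a : Fin 3} (h : 0 < p a) : ∃ w, p = w + e a := by
  refine ⟨fun b => p b - e a b, ?_⟩
  funext b
  simp only [Pi.add_apply, e]
  split_ifs with hb
  · subst hb; omega
  · omega

theorem eq_sd {p : Pt} {c : Fin 3} (h : p c = 0) : p = sd c (p (c + 1)) (p (c + 2)) :=
  pt_ext c (by simp [h]) (by simp) (by simp)

theorem finite_le_wt (n : ℕ) : {p : Pt | wt p = n}.Finite := by
  apply Set.Finite.subset (Set.finite_Iic (fun _ => n : Pt))
  intro p hp a
  simp only [Set.mem_ofPred_eq, wt] at hp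
  fin_cases a <;> simp <;> omega

section Hive

variable {R : Type*} [CommRing R] [LinearOrder R] [IsStrictOrderedRing R]

/-- The increment of `A` across the unit triangle at `z`, parallel to side `c`. -/
def dif (A : Pt → R) (c : Fin 3) (z : Pt) : R := A (z + e (c + 2)) - A (z + e (c + 1))

/-- `A` is a hive of size `n`: the increments parallel to each side are monotone. -/
def IsHive (n : ℕ) (A : Pt → R) : Prop :=
  ∀ c p q, wt p + 1 = n → wt q + 1 = n → q (c + 2) ≤ p (c + 2) → p (c + 1) ≤ q (c + 1) →
    dif A c p ≤ dif A c q

/-- The boundary increments of `A` are `x`. -/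
def HasBd (n : ℕ) (A : Pt → R) (x : Fin 3 → ℕ → R) : Prop :=
  ∀ c j l, j + l + 1 = n → A (sd c j (l + 1)) - A (sd c (j + 1) l) = x c l

/-- `x` is the boundary of a hive of size `n`. -/
def LR (n : ℕ) (x : Fin 3 → ℕ → R) : Prop := ∃ A, IsHive n A ∧ HasBd n A x

/-- `x` dominates the boundary of a hive of size `n`. -/
def UpLR (n : ℕ) (x : Fin 3 → ℕ → R) : Prop := ∃ y, LR n y ∧ ∀ c, ∀ i < n, y c i ≤ x c i

theorem sd_add_e1 (c : Fin 3) (j l : ℕ) : sd c j l + e (c + 1) = sd c (j + 1) l :=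
  pt_ext c (by simp) (by simp) (by simp)

theorem sd_add_e2 (c : Fin 3) (j l : ℕ) : sd c j l + e (c + 2) = sd c j (l + 1) :=
  pt_ext c (by simp) (by simp) (by simp)

theorem HasBd.dif {n : ℕ} {A : Pt → R} {x : Fin 3 → ℕ → R} (h : HasBd n A x) {c : Fin 3}
    {j l : ℕ} (hj : j + l + 1 = n) : dif A c (sd c j l) = x c l := by
  rw [_root_.dif, sd_add_e1, sd_add_e2, h c j l hj]

theorem sum_dif (A : Pt → R) (z : Pt) : ∑ c, dif A c z = 0 := by
  simp only [Fin.sum_univ_three, dif]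
  simp

theorem sum_dif_down (A : Pt → R) (w : Pt) : ∑ c, dif A c (w + e c) = 0 := by
  simp only [Fin.sum_univ_three, dif]
  have h1 : w + e 0 + e 2 = w + e 2 + e 0 := by abel
  have h2 : w + e 0 + e 1 = w + e 1 + e 0 := by abel
  have h3 : w + e 2 + e 1 = w + e 1 + e 2 := by abel
  simp only [zero_add, Fin.reduceAdd, h1, h2, h3]
  ring

/-- The rhombus inequalities suffice. -/
theorem isHive_of_rhombus {n : ℕ} {A : Pt → R}
    (h : ∀ w c, wt w + 2 = n → A (w + e c + e c) + A (w + e (c + 1) + e (c + 2)) ≤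
      A (w + e c + e (c + 1)) + A (w + e c + e (c + 2))) : IsHive n A := by
  have key : ∀ m c p q, wt p + 1 = n → wt q + 1 = n → q (c + 2) ≤ p (c + 2) →
      p (c + 1) ≤ q (c + 1) → (p (c + 2) - q (c + 2)) + (q (c + 1) - p (c + 1)) = m →
      dif A c p ≤ dif A c q := by
    intro m
    induction m with
    | zero =>
      intro c p q hp hq h2 h1 hm
      have : p = q := by
        rw [wt_cyc _ c] at hp hq
        exact pt_ext c (by omega) (by omega) (by omega)
      rw [this]
    | succ m ih =>
      intro c p q hp hq h2 h1 hm
      by_cases hc : q (c + 2) < p (c + 2)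
      · obtain ⟨w, rfl⟩ := pt_pred (p := p) (a := c + 2) (by omega)
        simp only [wt_add, wt_e, Pi.add_apply, e_self, e_21] at hp h2 h1 hm hc
        have := ih c (w + e c) q (by simpa using hp) hq (by simp; omega) (by simp; omega)
          (by simp; omega)
        refine le_trans ?_ this
        have h' := h w (c + 2) (by omega)
        simp only [c21, c22] at h'
        simp only [dif]
        rw [add_right_comm w (e (c + 2)) (e c), add_right_comm w (e (c + 2)) (e (c + 1))] at h'
        rw [add_right_comm w (e (c + 2)) (e (c + 1))]
        linarith
      · have : 0 < p c := by rw [wt_cyc _ c] at hp hq; omega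
        obtain ⟨w, rfl⟩ := pt_pred this
        simp only [wt_add, wt_e, Pi.add_apply, e_01, e_02] at hp h2 h1 hm hc
        have := ih c (w + e (c + 1)) q (by simpa using hp) hq (by simp; omega) (by simp; omega)
          (by simp; omega)
        refine le_trans ?_ this
        have h' := h w (c + 1) (by omega)
        simp only [c11, c12] at h'
        simp only [dif]
        rw [add_right_comm w (e (c + 1)) (e c), add_right_comm w (e (c + 2)) (e c)] at h'
        linarith
  intro c p q hp hq h2 h1
  exact key _ c p q hp hq h2 h1 rfl

theorem IsHive.rhombus {n : ℕ} {A : Pt → R} (h : IsHive n A) {w : Pt} (c : Fin 3)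
    (hw : wt w + 2 = n) : A (w + e c + e c) + A (w + e (c + 1) + e (c + 2)) ≤
      A (w + e c + e (c + 1)) + A (w + e c + e (c + 2)) := by
  have := h (c + 1) (w + e c) (w + e (c + 2)) (by simp; omega) (by simp; omega) (by simp)
    (by simp)
  simp only [dif, c11, c12] at this
  rw [add_right_comm w (e (c + 2)) (e c)] at this
  rw [add_right_comm w (e (c + 1)) (e (c + 2))]
  have h2 := h (c + 1) (w + e c) (w + e (c + 1)) (by simp; omega) (by simp; omega) (by simp)
    (by simp)
  simp only [dif, c11, c12] at h2
  rw [add_right_comm w (e (c + 1)) (e c), add_right_comm w (e (c + 1)) (e (c + 2))] at h2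
  linarith

/-- Exchange property. -/
theorem IsHive.exch {n : ℕ} {A : Pt → R} (h : IsHive n A) {p q : Pt} {i v : Fin 3}
    (hp : wt p + 1 = n) (hq : wt q + 1 = n) (hiv : i ≠ v) (hi : q i ≤ p i) (hv : p v ≤ q v) :
    A (p + e i) + A (q + e v) ≤ A (p + e v) + A (q + e i) := by
  rcases fin3_cases i v with rfl | rfl | rfl
  · exact absurd rfl hiv
  · have := h (i + 2) q p hq hp (by simpa) (by simpa)
    simp only [c21, c22, dif] at this
    linarith
  · have := h (i + 1) p q hp hq (by simpa) (by simpa)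
    simp only [c11, c12, dif] at this
    linarith

end Hive

section HiveOps

variable {R : Type*} [CommRing R] [LinearOrder R] [IsStrictOrderedRing R]

theorem LR.congr {n : ℕ} {x y : Fin 3 → ℕ → R} (h : LR n x) (hxy : ∀ c, ∀ i < n, x c i = y c i) :
    LR n y := by
  obtain ⟨A, hA, hb⟩ := h
  exact ⟨A, hA, fun c j l hj => by rw [hb c j l hj, hxy c l (by omega)]⟩

theorem LR.antitone {n : ℕ} {x : Fin 3 → ℕ → R} (h : LR n x) (c : Fin 3) {i k : ℕ} (hik : i ≤ k)
    (hk : k < n) : x c k ≤ x c i := by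
  obtain ⟨A, hA, hb⟩ := h
  obtain ⟨j, rfl⟩ := Nat.exists_eq_add_of_lt hk
  rw [← hb.dif (c := c) (j := j) (l := k) (by omega),
    ← hb.dif (c := c) (j := j + (k - i)) (l := i) (by omega)]
  exact hA c _ _ (by simp; omega) (by simp; omega) (by simpa) (by simp)

theorem LR.trace {n : ℕ} {x : Fin 3 → ℕ → R} (h : LR n x) :
    ∑ c, ∑ i ∈ range n, x c i = 0 := by
  obtain ⟨A, -, hb⟩ := h
  have key : ∀ c, ∑ i ∈ range n, x c i = A (sd c 0 n) - A (sd c n 0) := by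
    intro c
    have := sum_range_sub (fun l => A (sd c (n - l) l)) n
    simp only [Nat.sub_self, Nat.sub_zero] at this
    rw [← this]
    refine sum_congr rfl fun l hl => ?_
    have hl := mem_range.1 hl
    rw [← hb c (n - (l + 1)) l (by omega), show n - (l + 1) + 1 = n - l by omega]
  have hs : ∀ c, sd c 0 n = sd (c + 1) n 0 := fun c =>
    pt_ext c (by have := sd_2 (c + 1) n 0; simp at this; simp [this])
      (by simp) (by have := sd_1 (c + 1) n 0; simp at this; simp [this])
  simp only [key, hs, Fin.sum_univ_three]
  simp

theorem UpLR.of_LR {n : ℕ} {x : Fin 3 → ℕ → R} (h : LR n x) : UpLR n x :=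
  ⟨x, h, fun _ _ _ => le_rfl⟩

theorem UpLR.mono {n : ℕ} {x y : Fin 3 → ℕ → R} (h : UpLR n x)
    (hxy : ∀ c, ∀ i < n, x c i ≤ y c i) : UpLR n y := by
  obtain ⟨z, hz, hzx⟩ := h
  exact ⟨z, hz, fun c i hi => (hzx c i hi).trans (hxy c i hi)⟩

theorem UpLR.lr {n : ℕ} {x : Fin 3 → ℕ → R} (h : UpLR n x)
    (ht : ∑ c, ∑ i ∈ range n, x c i = 0) : LR n x := by
  obtain ⟨z, hz, hzx⟩ := h
  refine hz.congr fun c i hi => ?_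
  have h1 := (sum_eq_sum_iff_of_le (s := univ)
    (f := fun c => ∑ i ∈ range n, z c i) (g := fun c => ∑ i ∈ range n, x c i)
    (fun c _ => sum_le_sum fun i hi => hzx c i (mem_range.1 hi))).1
    (hz.trace.trans ht.symm) c (mem_univ _)
  exact (sum_eq_sum_iff_of_le fun i hi => hzx c i (mem_range.1 hi)).1 h1 i
    (mem_range.2 hi)

theorem UpLR.trace_nonneg {n : ℕ} {x : Fin 3 → ℕ → R} (h : UpLR n x) :
    0 ≤ ∑ c, ∑ i ∈ range n, x c i := by
  obtain ⟨z, hz, hzx⟩ := h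
  rw [← hz.trace]
  exact sum_le_sum fun c _ => sum_le_sum fun i hi =>
    hzx c i (mem_range.1 hi)

theorem LR.add {n : ℕ} {x y : Fin 3 → ℕ → R} (hx : LR n x) (hy : LR n y) :
    LR n (fun c i => x c i + y c i) := by
  obtain ⟨A, hA, ha⟩ := hx
  obtain ⟨B, hB, hb⟩ := hy
  refine ⟨fun p => A p + B p, fun c p q hp hq h2 h1 => ?_, fun c j l hj => ?_⟩
  · have := hA c p q hp hq h2 h1
    have := hB c p q hp hq h2 h1
    simp only [dif] at *
    linarith
  · simp only [← ha c j l hj, ← hb c j l hj]; ring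

theorem LR.smul {n : ℕ} {x : Fin 3 → ℕ → R} (hx : LR n x) {k : R} (hk : 0 ≤ k) :
    LR n (fun c i => k * x c i) := by
  obtain ⟨A, hA, ha⟩ := hx
  refine ⟨fun p => k * A p, fun c p q hp hq h2 h1 => ?_, fun c j l hj => ?_⟩
  · have := mul_le_mul_of_nonneg_left (hA c p q hp hq h2 h1) hk
    simp only [dif] at *
    linarith
  · simp only [← ha c j l hj]; ring

theorem UpLR.add {n : ℕ} {x y : Fin 3 → ℕ → R} (hx : UpLR n x) (hy : UpLR n y) :
    UpLR n (fun c i => x c i + y c i) := by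
  obtain ⟨u, hu, hux⟩ := hx
  obtain ⟨v, hv, hvy⟩ := hy
  exact ⟨_, hu.add hv, fun c i hi => add_le_add (hux c i hi) (hvy c i hi)⟩

theorem UpLR.smul {n : ℕ} {x : Fin 3 → ℕ → R} (hx : UpLR n x) {k : R} (hk : 0 ≤ k) :
    UpLR n (fun c i => k * x c i) := by
  obtain ⟨u, hu, hux⟩ := hx
  exact ⟨_, hu.smul hk, fun c i hi => mul_le_mul_of_nonneg_left (hux c i hi) hk⟩

theorem LR.const (n : ℕ) {s : Fin 3 → R} (hs : ∑ c, s c = 0) : LR n (fun c _ => s c) := by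
  refine ⟨fun p => s 2 * p 1 - s 1 * p 2, isHive_of_rhombus fun w c _ => ?_, fun c j l _ => ?_⟩
  · simp only [Pi.add_apply]; push_cast
    apply le_of_eq; ring
  · rw [Fin.sum_univ_three] at hs
    have : s 0 = - s 1 - s 2 := by linear_combination hs
    fin_cases c <;> simp [sd]
    · rw [this]; ring
    · ring
    · ring

theorem LR.shift {n : ℕ} {x : Fin 3 → ℕ → R} (hx : LR n x) {s : Fin 3 → R}
    (hs : ∑ c, s c = 0) : LR n (fun c i => x c i + s c) := hx.add (LR.const n hs)

theorem LR.zero (n : ℕ) : LR n (fun _ _ => (0 : R)) :=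
  LR.const n (s := fun _ => 0) (by simp)

theorem UpLR.const (n : ℕ) {s : Fin 3 → R} (hs : 0 ≤ ∑ c, s c) : UpLR n (fun c _ => s c) := by
  refine ⟨fun c i => if c = 0 then - s 1 - s 2 else s c,
    LR.const n (s := fun c => if c = 0 then - s 1 - s 2 else s c) ?_, ?_⟩
  · simp [Fin.sum_univ_three]; ring
  · intro c i _
    rw [Fin.sum_univ_three] at hs
    fin_cases c <;> simp
    linarith

/-- Reflection in the first axis. -/
def refl3 (p : Pt) : Pt := fun a => p (-a)

theorem refl3_sd (c : Fin 3) (j l : ℕ) : refl3 (sd c j l) = sd (-c) l j := by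
  funext a
  fin_cases c <;> fin_cases a <;> rfl

theorem refl3_add (p q : Pt) : refl3 (p + q) = refl3 p + refl3 q := rfl

theorem refl3_e (a : Fin 3) : refl3 (e a) = e (-a) := by
  funext b
  fin_cases a <;> fin_cases b <;> rfl

theorem refl3_refl3 (p : Pt) : refl3 (refl3 p) = p := by funext a; simp [refl3]

theorem wt_refl3 (p : Pt) : wt (refl3 p) = wt p := by
  simp only [wt, refl3]
  have h1 : (-1 : Fin 3) = 2 := rfl
  have h2 : (-2 : Fin 3) = 1 := rfl
  simp only [neg_zero, h1, h2]; omega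

theorem IsHive.refl {n : ℕ} {A : Pt → R} (h : IsHive n A) : IsHive n (fun p => A (refl3 p)) := by
  refine isHive_of_rhombus fun w c hw => ?_
  have := h.rhombus (w := refl3 w) (-c) (by rwa [wt_refl3])
  simp only [refl3_add, refl3_e]
  have h1 : -(c + 1) = -c + 2 := by fin_cases c <;> rfl
  have h2 : -(c + 2) = -c + 1 := by fin_cases c <;> rfl
  rw [h1, h2, add_right_comm (refl3 w) (e (-c + 2))]
  linarith

theorem HasBd.refl {n : ℕ} {A : Pt → R} {x : Fin 3 → ℕ → R} (h : HasBd n A x) :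
    HasBd n (fun p => A (refl3 p)) (fun c i => - x (-c) (n - 1 - i)) := by
  intro c j l hj
  simp only [refl3_sd]
  have := h (-c) l j (by omega)
  rw [show n - 1 - l = j by omega, ← this]
  ring

theorem LR.refl {n : ℕ} {x : Fin 3 → ℕ → R} (hx : LR n x) :
    LR n (fun c i => - x (-c) (n - 1 - i)) := by
  obtain ⟨A, hA, ha⟩ := hx
  exact ⟨_, hA.refl, ha.refl⟩

theorem LR.pair {n : ℕ} (a : Fin 3) {u : ℕ → R} (hu : ∀ i, i + 1 < n → u (i + 1) ≤ u i) :
    LR n (fun c i => if c = a + 1 then u i else if c = a + 2 then - u (n - 1 - i) else 0) := by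
  refine ⟨fun p => ∑ i ∈ range (p a), u i, isHive_of_rhombus fun w c hw => ?_,
    fun c j l hj => ?_⟩
  · rcases fin3_cases a c with rfl | rfl | rfl
    · have := hu (w c) (by rw [wt_cyc _ c] at hw; omega)
      simp [sum_range_succ]
      linarith
    · simp [sum_range_succ]
    · simp [sum_range_succ]; linarith
  · rcases fin3_cases a c with rfl | rfl | rfl
    · have : c ≠ c + 1 ∧ c ≠ c + 2 := by fin_cases c <;> simp
      simp [this]
    · have h1 := sd_2 (a + 1) j (l + 1)
      have h2 := sd_2 (a + 1) (j + 1) l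
      simp only [c12] at h1 h2
      simp [h1, h2, sum_range_succ]
    · have h1 := sd_1 (a + 2) j (l + 1)
      have h2 := sd_1 (a + 2) (j + 1) l
      simp only [c21] at h1 h2
      have : a + 2 ≠ a + 1 := by fin_cases a <;> simp
      simp [h1, h2, sum_range_succ, show n - 1 - l = j by omega]

theorem IsHive.dif_le_bd {n : ℕ} {A : Pt → R} {x : Fin 3 → ℕ → R} (hA : IsHive n A)
    (hb : HasBd n A x) {p : Pt} (hp : wt p + 1 = n) (c : Fin 3) :
    dif A c p ≤ x c (p (c + 2)) := by
  rw [wt_cyc _ c] at hp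
  rw [← hb.dif (c := c) (j := n - 1 - p (c + 2)) (l := p (c + 2)) (by omega)]
  exact hA c _ _ (by rw [wt_cyc _ c]; omega) (by simp; omega) (by simp) (by simp; omega)

theorem IsHive.bd_le_dif {n : ℕ} {A : Pt → R} {x : Fin 3 → ℕ → R} (hA : IsHive n A)
    (hb : HasBd n A x) {p : Pt} (hp : wt p + 1 = n) (c : Fin 3) :
    x c (n - 1 - p (c + 1)) ≤ dif A c p := by
  rw [wt_cyc _ c] at hp
  rw [← hb.dif (c := c) (j := p (c + 1)) (l := n - 1 - p (c + 1)) (by omega)]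
  exact hA c _ _ (by simp; omega) (by rw [wt_cyc _ c]; omega) (by simp; omega) (by simp)

/-- The Weyl inequalities. -/
theorem LR.weyl {n : ℕ} {x : Fin 3 → ℕ → R} (hx : LR n x) {s : Fin 3 → ℕ} (hs : ∑ c, s c < n) :
    0 ≤ ∑ c, x c (s c) := by
  obtain ⟨s', hs', hle⟩ : ∃ s' : Fin 3 → ℕ, ∑ c, s' c + 1 = n ∧ ∀ c, s c ≤ s' c := by
    refine ⟨fun c => if c = 0 then n - 1 - s 1 - s 2 else s c, ?_, ?_⟩
    · simp [Fin.sum_univ_three] at *; omega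
    · intro c; fin_cases c <;> simp [Fin.sum_univ_three] at * <;> omega
  have hlt : ∀ c, s' c < n := fun c => by
    have := single_le_sum (f := s') (fun i _ => Nat.zero_le _) (mem_univ c); omega
  have h1 : ∑ c, x c (s' c) ≤ ∑ c, x c (s c) :=
    sum_le_sum fun c _ => hx.antitone c (hle c) (hlt c)
  refine le_trans ?_ h1
  obtain ⟨A, hA, hb⟩ := hx
  have hw : wt (fun a => s' (a + 1)) + 1 = n := by
    simp [wt, Fin.sum_univ_three] at *; omega
  rw [← sum_dif A (fun a => s' (a + 1))]
  refine sum_le_sum fun c _ => ?_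
  have := hA.dif_le_bd hb hw c
  simpa using this

/-- The dual Weyl inequalities. -/
theorem LR.weyl_dual {n : ℕ} {x : Fin 3 → ℕ → R} (hx : LR n x) {s : Fin 3 → ℕ}
    (hs : 2 * n ≤ ∑ c, s c + 2) (hlt : ∀ c, s c < n) : ∑ c, x c (s c) ≤ 0 := by
  have := hx.refl.weyl (s := fun c => n - 1 - s (-c)) (by
    have h1 := hlt 0; have h2 := hlt 1; have h3 := hlt 2
    have e1 : (-1 : Fin 3) = 2 := rfl
    have e2 : (-2 : Fin 3) = 1 := rfl
    simp [Fin.sum_univ_three, e1, e2] at *; omega)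
  have e1 : (-1 : Fin 3) = 2 := rfl
  have e2 : (-2 : Fin 3) = 1 := rfl
  simp only [Fin.sum_univ_three, e1, e2, neg_zero] at this ⊢
  rw [show n - 1 - (n - 1 - s 0) = s 0 by have := hlt 0; omega,
    show n - 1 - (n - 1 - s 1) = s 1 by have := hlt 1; omega,
    show n - 1 - (n - 1 - s 2) = s 2 by have := hlt 2; omega] at this
  linarith

/-! ### Sup-convolution -/

/-- `H` is the sup-convolution of `A` and `B` in size `n₁ + n₂`. -/
def IsConv (n₁ n₂ : ℕ) (A B H : Pt → R) : Prop :=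
  ∀ x, wt x = n₁ + n₂ →
    (∃ q r, q + r = x ∧ wt q = n₁ ∧ wt r = n₂ ∧ H x = A q + B r) ∧
    ∀ q r, q + r = x → wt q = n₁ → wt r = n₂ → A q + B r ≤ H x

theorem exists_le_wt {x : Pt} {n : ℕ} (h : n ≤ wt x) : ∃ q r, q + r = x ∧ wt q = n := by
  induction n with
  | zero => exact ⟨0, x, by simp, by simp [wt]⟩
  | succ n ih =>
    obtain ⟨q, r, rfl, hq⟩ := ih (by omega)
    have : ∃ a, 0 < r a := by
      by_contra hc; push Not at hc
      simp only [wt_add] at h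
      have h0 := hc 0; have h1 := hc 1; have h2 := hc 2
      simp only [wt] at h hq; omega
    obtain ⟨a, ha⟩ := this
    obtain ⟨w, rfl⟩ := pt_pred ha
    exact ⟨q + e a, w, by abel, by simp [hq]⟩

theorem exists_isConv (n₁ n₂ : ℕ) (A B : Pt → R) : ∃ H, IsConv n₁ n₂ A B H := by
  have : ∀ x : Pt, ∃ m, wt x = n₁ + n₂ →
      (∃ q r, q + r = x ∧ wt q = n₁ ∧ wt r = n₂ ∧ m = A q + B r) ∧
      ∀ q r, q + r = x → wt q = n₁ → wt r = n₂ → A q + B r ≤ m := by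
    intro x
    by_cases hx : wt x = n₁ + n₂
    · have hfin : {q : Pt × Pt | q.1 + q.2 = x ∧ wt q.1 = n₁ ∧ wt q.2 = n₂}.Finite := by
        refine ((finite_le_wt n₁).prod (finite_le_wt n₂)).subset ?_
        rintro ⟨q, r⟩ ⟨-, h1, h2⟩
        exact ⟨h1, h2⟩
      obtain ⟨q, r, hqr, hq⟩ := exists_le_wt (x := x) (n := n₁) (by omega)
      have hne : {q : Pt × Pt | q.1 + q.2 = x ∧ wt q.1 = n₁ ∧ wt q.2 = n₂}.Nonempty :=
        ⟨(q, r), hqr, hq, by have := wt_add q r; rw [hqr] at this; show wt r = n₂; omega⟩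
      obtain ⟨⟨q, r⟩, ⟨h1, h2, h3⟩, hm⟩ :=
        hfin.exists_maximalFor (fun q : Pt × Pt => A q.1 + B q.2) _ hne
      refine ⟨A q + B r, fun _ => ⟨⟨q, r, h1, h2, h3, rfl⟩, fun q' r' h1' h2' h3' => ?_⟩⟩
      by_contra hlt
      exact hlt (hm (j := (q', r')) ⟨h1', h2', h3'⟩ (le_of_lt (not_le.1 hlt)))
    · exact ⟨0, fun h => absurd h hx⟩
  choose H hH using this
  exact ⟨H, hH⟩

theorem IsConv.symm {n₁ n₂ : ℕ} {A B H : Pt → R} (h : IsConv n₁ n₂ A B H) :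
    IsConv n₂ n₁ B A H := by
  intro x hx
  obtain ⟨⟨q, r, h1, h2, h3, h4⟩, h5⟩ := h x (by omega)
  exact ⟨⟨r, q, by rw [add_comm, h1], h3, h2, by rw [h4, add_comm]⟩, fun q' r' h1' h2' h3' => by
    rw [add_comm]; exact h5 r' q' (by rw [add_comm, h1']) h3' h2'⟩

theorem IsConv.rhombus_aux {n₁ n₂ : ℕ} {A B H : Pt → R} (h : IsConv n₁ n₂ A B H)
    (hA : IsHive n₁ A) {w : Pt} {c : Fin 3} {q r q' r' : Pt}
    (h1 : q + r = w + e c + e c) (h1' : q' + r' = w + e (c + 1) + e (c + 2))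
    (hq : wt q = n₁) (hr : wt r = n₂) (hq' : wt q' = n₁) (hr' : wt r' = n₂)
    (hlt : q' c < q c) : A q + B r + (A q' + B r') ≤
      H (w + e c + e (c + 1)) + H (w + e c + e (c + 2)) := by
  have hv : (q (c + 1) < q' (c + 1)) ∨ (q (c + 2) < q' (c + 2)) := by
    rw [wt_cyc _ c] at hq hq'; omega
  have hw : wt w + 2 = n₁ + n₂ := by
    have := congrArg wt h1; simp at this; omega
  obtain ⟨p, rfl⟩ := pt_pred (p := q) (a := c) (by omega)
  have h2 : p + r = w + e c := by
    rw [add_right_comm] at h1; exact add_right_cancel h1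
  simp only [wt_add, wt_e] at hq
  rcases hv with hv | hv
  · obtain ⟨p', rfl⟩ := pt_pred (p := q') (a := c + 1) (by omega)
    simp only [wt_add, wt_e] at hq'
    have h3 : p' + r' = w + e (c + 2) := by
      rw [add_right_comm, add_right_comm w] at h1'; exact add_right_cancel h1'
    have hex := hA.exch (p := p) (q := p') (i := c) (v := c + 1) (by omega) (by omega)
      (by fin_cases c <;> simp) (by simp at hlt; omega) (by simp at hv; omega)
    have g1 := (h (w + e c + e (c + 1)) (by simp; omega)).2 (p + e (c + 1)) r
      (by rw [add_right_comm, h2]) (by simpa) hr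
    have g2 := (h (w + e c + e (c + 2)) (by simp; omega)).2 (p' + e c) r'
      (by rw [add_right_comm, h3, add_right_comm]) (by simpa) hr'
    linarith
  · obtain ⟨p', rfl⟩ := pt_pred (p := q') (a := c + 2) (by omega)
    simp only [wt_add, wt_e] at hq'
    have h3 : p' + r' = w + e (c + 1) := by
      rw [add_right_comm] at h1'; exact add_right_cancel h1'
    have hex := hA.exch (p := p) (q := p') (i := c) (v := c + 2) (by omega) (by omega)
      (by fin_cases c <;> simp) (by simp at hlt; omega) (by simp at hv; omega)
    have g1 := (h (w + e c + e (c + 2)) (by simp; omega)).2 (p + e (c + 2)) r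
      (by rw [add_right_comm, h2]) (by simpa) hr
    have g2 := (h (w + e c + e (c + 1)) (by simp; omega)).2 (p' + e c) r'
      (by rw [add_right_comm, h3, add_right_comm]) (by simpa) hr'
    linarith

theorem IsConv.isHive {n₁ n₂ : ℕ} {A B H : Pt → R} (h : IsConv n₁ n₂ A B H)
    (hA : IsHive n₁ A) (hB : IsHive n₂ B) : IsHive (n₁ + n₂) H := by
  refine isHive_of_rhombus fun w c hw => ?_
  obtain ⟨q, r, h1, hq, hr, e1⟩ := (h (w + e c + e c) (by simp; omega)).1
  obtain ⟨q', r', h1', hq', hr', e2⟩ := (h (w + e (c + 1) + e (c + 2)) (by simp; omega)).1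
  rw [e1, e2]
  have f1 := congrFun h1 c
  have f2 := congrFun h1' c
  simp at f1 f2
  by_cases hlt : q' c < q c
  · exact h.rhombus_aux hA h1 h1' hq hr hq' hr' hlt
  · have := h.symm.rhombus_aux hB (by rwa [add_comm]) (by rwa [add_comm]) hr hq hr' hq'
      (w := w) (c := c) (by omega)
    linarith

theorem UpLR.merge {n₁ n₂ : ℕ} {u v x : Fin 3 → ℕ → R} (hu : UpLR n₁ u) (hv : UpLR n₂ v)
    (h : ∀ c θ l₁ l₂, l₁ ≤ n₁ → l₂ ≤ n₂ → (∀ i < l₁, θ ≤ u c i) → (∀ i < l₂, θ ≤ v c i) →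
      ∀ k < l₁ + l₂, θ ≤ x c k) : UpLR (n₁ + n₂) x := by
  obtain ⟨u', ⟨A, hA, ha⟩, hu'⟩ := hu
  obtain ⟨v', ⟨B, hB, hb⟩, hv'⟩ := hv
  obtain ⟨H, hH⟩ := exists_isConv n₁ n₂ A B
  have lu : LR n₁ u' := ⟨A, hA, ha⟩
  have lv : LR n₂ v' := ⟨B, hB, hb⟩
  refine ⟨fun c l => H (sd c (n₁ + n₂ - 1 - l) (l + 1)) - H (sd c (n₁ + n₂ - l) l),
    ⟨H, hH.isHive hA hB, fun c j l hj => ?_⟩, fun c l hl => ?_⟩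
  · simp only [show n₁ + n₂ - 1 - l = j by omega, show n₁ + n₂ - l = j + 1 by omega]
  obtain ⟨q, r, h1, hq, hr, e1⟩ := (hH (sd c (n₁ + n₂ - 1 - l) (l + 1)) (by simp; omega)).1
  have f0 := congrFun h1 c
  have f1 := congrFun h1 (c + 1)
  have f2 := congrFun h1 (c + 2)
  simp at f0 f1 f2
  have sq := eq_sd (p := q) (c := c) (by omega)
  have sr := eq_sd (p := r) (c := c) (by omega)
  rw [wt_cyc _ c] at hq hr
  set θ := H (sd c (n₁ + n₂ - 1 - l) (l + 1)) - H (sd c (n₁ + n₂ - l) l) with hθ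
  have hle := (hH (sd c (n₁ + n₂ - l) l) (by simp; omega)).2
  refine h c θ (q (c + 2)) (r (c + 2)) (by omega) (by omega) (fun i hi => ?_) (fun i hi => ?_) l
    (by omega)
  · refine le_trans ?_ ((lu.antitone c (i := i) (k := q (c + 2) - 1) (by omega) (by omega)).trans
      (hu' c i (by omega)))
    have := hle (sd c (q (c + 1) + 1) (q (c + 2) - 1)) r
      (pt_ext c (by simp; omega) (by simp; omega) (by simp; omega)) (by simp; omega)
      (by rw [wt_cyc _ c]; omega)
    have ha' := ha c (q (c + 1)) (q (c + 2) - 1) (by omega)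
    rw [show q (c + 2) - 1 + 1 = q (c + 2) by omega, ← sq] at ha'
    linarith
  · refine le_trans ?_ ((lv.antitone c (i := i) (k := r (c + 2) - 1) (by omega) (by omega)).trans
      (hv' c i (by omega)))
    have := hle q (sd c (r (c + 1) + 1) (r (c + 2) - 1))
      (pt_ext c (by simp; omega) (by simp; omega) (by simp; omega)) 
      (by rw [wt_cyc _ c]; omega) (by simp; omega)
    have hb' := hb c (r (c + 1)) (r (c + 2) - 1) (by omega)
    rw [show r (c + 2) - 1 + 1 = r (c + 2) by omega, ← sr] at hb'
    linarith

theorem UpLR.empty (x : Fin 3 → ℕ → R) : UpLR 0 x :=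
  ⟨_, LR.zero 0, fun _ i hi => absurd hi (by omega)⟩

theorem UpLR.dilate {n : ℕ} {x : Fin 3 → ℕ → R} (h : UpLR n x) (Q : ℕ) :
    UpLR (Q * n) (fun c i => x c (i / Q)) := by
  induction Q with
  | zero => simpa using UpLR.empty _
  | succ Q ih =>
    rw [add_mul, one_mul]
    refine ih.merge h fun c θ l₁ l₂ h1 h2 hu hv k hk => ?_
    set m := k / (Q + 1) with hm
    have h3 : (Q + 1) * m ≤ k := Nat.mul_div_le k (Q + 1)
    by_cases hml : m < l₂
    · exact hv m hml
    · have h4 : Q * m < l₁ := by nlinarith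
      have := hu _ h4
      rcases Nat.eq_zero_or_pos Q with rfl | hQ
      · omega
      · rwa [Nat.mul_div_cancel_left _ hQ] at this

end HiveOps

/-! ### Elements of finite sets in increasing order -/

theorem nthSmall_eq {s : Finset ℕ} {k : ℕ} (hk : k < s.card) :
    nthSmall s k = s.orderEmbOfFin rfl ⟨k, hk⟩ := by
  rw [nthSmall, orderEmbOfFin_apply, List.getD_eq_getElem]
  · rfl

theorem nthSmall_mem {s : Finset ℕ} {k : ℕ} (hk : k < s.card) : nthSmall s k ∈ s := by
  rw [nthSmall_eq hk]; exact orderEmbOfFin_mem _ _ _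

theorem nthSmall_lt {s : Finset ℕ} {i k : ℕ} (hik : i < k) (hk : k < s.card) :
    nthSmall s i < nthSmall s k := by
  rw [nthSmall_eq hk, nthSmall_eq (hik.trans hk)]
  exact (s.orderEmbOfFin rfl).strictMono hik

theorem nthSmall_le {s : Finset ℕ} {i k : ℕ} (hik : i ≤ k) (hk : k < s.card) :
    nthSmall s i ≤ nthSmall s k := by
  rcases hik.eq_or_lt with rfl | h
  · exact le_rfl
  · exact (nthSmall_lt h hk).le

theorem nthSmall_lt_iff {s : Finset ℕ} {i k : ℕ} (hi : i < s.card) (hk : k < s.card) :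
    nthSmall s i < nthSmall s k ↔ i < k :=
  ⟨fun h => by by_contra hc; exact absurd (nthSmall_le (not_lt.1 hc) hi) (not_le.2 h),
    fun h => nthSmall_lt h hk⟩

theorem exists_nthSmall {s : Finset ℕ} {x : ℕ} (hx : x ∈ s) : ∃ k < s.card, nthSmall s k = x := by
  have : x ∈ Set.range (s.orderEmbOfFin rfl) := by rw [range_orderEmbOfFin]; exact hx
  obtain ⟨⟨k, hk⟩, rfl⟩ := this
  exact ⟨k, hk, nthSmall_eq hk⟩

theorem image_nthSmall (s : Finset ℕ) : (range s.card).image (nthSmall s) = s := by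
  ext x
  simp only [mem_image, mem_range]
  exact ⟨fun ⟨k, hk, h⟩ => h ▸ nthSmall_mem hk, fun h => exists_nthSmall h⟩

theorem nthSmall_injOn (s : Finset ℕ) : Set.InjOn (nthSmall s) (range s.card) := by
  intro i hi k hk h
  simp only [coe_range, Set.mem_Iio] at hi hk
  rcases lt_trichotomy i k with h' | h' | h'
  · exact absurd h (nthSmall_lt h' hk).ne
  · exact h'
  · exact absurd h (nthSmall_lt h' hi).ne'

theorem sum_nthSmall {M : Type*} [AddCommMonoid M] (s : Finset ℕ) (f : ℕ → M) :
    ∑ k ∈ range s.card, f (nthSmall s k) = ∑ i ∈ s, f i := by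
  conv_rhs => rw [← image_nthSmall s]
  rw [sum_image (nthSmall_injOn s)]

theorem card_lt_nthSmall {s : Finset ℕ} {k : ℕ} (hk : k < s.card) :
    (s.filter (· < nthSmall s k)).card = k := by
  have : s.filter (· < nthSmall s k) = (range k).image (nthSmall s) := by
    ext x
    simp only [mem_filter, mem_image, mem_range]
    constructor
    · rintro ⟨hx, hlt⟩
      obtain ⟨i, hi, rfl⟩ := exists_nthSmall hx
      exact ⟨i, (nthSmall_lt_iff hi hk).1 hlt, rfl⟩
    · rintro ⟨i, hi, rfl⟩
      exact ⟨nthSmall_mem (hi.trans hk), nthSmall_lt hi hk⟩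
  rw [this, card_image_of_injOn, card_range]
  exact (nthSmall_injOn s).mono (by simpa using hk.le)

theorem nthSmall_of_card {s : Finset ℕ} {k x : ℕ} (hx : x ∈ s)
    (hk : (s.filter (· < x)).card = k) : nthSmall s k = x := by
  obtain ⟨j, hj, rfl⟩ := exists_nthSmall hx
  rw [card_lt_nthSmall hj] at hk
  rw [hk]

theorem nthSmall_sub_le {s : Finset ℕ} {i k : ℕ} (hik : i ≤ k) (hk : k < s.card) :
    nthSmall s i + k ≤ nthSmall s k + i := by
  obtain ⟨d, rfl⟩ := Nat.exists_eq_add_of_le hik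
  clear hik
  induction d with
  | zero => simp
  | succ d ih =>
    have h1 := ih (by omega)
    have h2 : nthSmall s (i + d) < nthSmall s (i + (d + 1)) := nthSmall_lt (by omega) hk
    omega

/-! ### Triangles -/

/-- The points `p` with `wt p + k = n`. -/
noncomputable def tri (k n : ℕ) : Finset Pt :=
  (Set.Finite.subset (finite_le_wt (n - k)) (t := {p | wt p + k = n}) fun p hp => by
    simp only [Set.mem_ofPred_eq] at *; omega).toFinset

@[simp] theorem mem_tri {k n : ℕ} {p : Pt} : p ∈ tri k n ↔ wt p + k = n := by simp [tri]

theorem sum_tri_split {M : Type*} [AddCommMonoid M] (n : ℕ) (c : Fin 3) (F : Pt → M) :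
    ∑ y ∈ tri 1 n, F y =
      ∑ l ∈ range n, F (sd c (n - 1 - l) l) + ∑ w ∈ tri 2 n, F (w + e c) := by
  rw [← sum_filter_add_sum_filter_not (tri 1 n) (fun y => y c = 0)]
  congr 1
  · symm
    refine sum_bij (fun l _ => sd c (n - 1 - l) l) ?_ ?_ ?_ ?_
    · intro l hl
      simp at hl ⊢; omega
    · intro l _ l' _ h
      simpa using congrFun h (c + 2)
    · intro y hy
      simp only [mem_filter, mem_tri] at hy
      have h2 := hy.1
      rw [wt_cyc _ c] at h2
      refine ⟨y (c + 2), by simp; omega, ?_⟩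
      exact pt_ext c (by simp [hy.2]) (by simp; omega) (by simp)
    · intros; rfl
  · symm
    refine sum_bij (fun w _ => w + e c) ?_ ?_ ?_ ?_
    · intro w hw
      simp at hw ⊢; omega
    · intro w _ w' _ h
      exact add_right_cancel h
    · intro y hy
      simp only [mem_filter, mem_tri] at hy
      obtain ⟨w, rfl⟩ := pt_pred (p := y) (a := c) (by omega)
      exact ⟨w, by simp at hy ⊢; omega, rfl⟩
    · intros; rfl

theorem card_tri (n : ℕ) : (tri 1 n).card = n + (tri 2 n).card := by
  have := sum_tri_split n 0 (fun _ => 1)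
  simpa using this

theorem card_tri_add (n : ℕ) : (tri 1 n).card + (tri 2 n).card = n ^ 2 := by
  induction n with
  | zero =>
    have h1 : tri 1 0 = ∅ := by ext; simp
    have h2 : tri 2 0 = ∅ := by ext; simp
    simp [h1, h2]
  | succ n ih =>
    have h1 := card_tri (n + 1)
    have h2 := card_tri n
    have h3 : tri 2 (n + 1) = tri 1 n := by ext; simp
    rw [h3] at h1 ⊢
    nlinarith

section Validity

variable {R : Type*} [CommRing R] [LinearOrder R] [IsStrictOrderedRing R]

/-- Increments over steps of length `Q`. -/
def difQ (Q : ℕ) (H : Pt → R) (c : Fin 3) (z : Pt) : R :=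
  H (z + Q • e (c + 2)) - H (z + Q • e (c + 1))

theorem sum_difQ (Q : ℕ) (A : Pt → R) (z : Pt) : ∑ c, difQ Q A c z = 0 := by
  simp only [Fin.sum_univ_three, difQ]
  simp

theorem sum_difQ_down (Q : ℕ) (A : Pt → R) (w : Pt) : ∑ c, difQ Q A c (w + Q • e c) = 0 := by
  simp only [Fin.sum_univ_three, difQ]
  have h1 : w + Q • e 0 + Q • e 2 = w + Q • e 2 + Q • e 0 := by abel
  have h2 : w + Q • e 0 + Q • e 1 = w + Q • e 1 + Q • e 0 := by abel
  have h3 : w + Q • e 2 + Q • e 1 = w + Q • e 1 + Q • e 2 := by abel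
  simp only [zero_add, Fin.reduceAdd, h1, h2, h3]
  ring

theorem difQ_eq_sum (Q : ℕ) (H : Pt → R) (c : Fin 3) (z : Pt) :
    difQ Q H c z =
      ∑ t ∈ range Q, dif H c (z + (t • e (c + 2) + (Q - 1 - t) • e (c + 1))) := by
  have := sum_range_sub (fun t => H (z + (t • e (c + 2) + (Q - t) • e (c + 1)))) Q
  simp only [Nat.sub_self, Nat.sub_zero, zero_smul, add_zero, zero_add] at this
  rw [difQ, ← this]
  refine sum_congr rfl fun t ht => ?_
  have ht := mem_range.1 ht
  rw [dif]
  congr 2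
  · exact pt_ext c (by simp) (by simp; omega) (by simp; omega)
  · exact pt_ext c (by simp) (by simp; omega) (by simp)

theorem IsHive.difQ_mono {n Q : ℕ} {H : Pt → R} (h : IsHive n H) (c : Fin 3) {p q : Pt}
    (hp : wt p + Q = n) (hq : wt q + Q = n) (h2 : q (c + 2) ≤ p (c + 2))
    (h1 : p (c + 1) ≤ q (c + 1)) : difQ Q H c p ≤ difQ Q H c q := by
  rw [difQ_eq_sum, difQ_eq_sum]
  refine sum_le_sum fun t ht => ?_
  have ht := mem_range.1 ht
  exact h c _ _ (by simp only [wt_add, wt_smul, wt_e]; omega)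
    (by simp only [wt_add, wt_smul, wt_e]; omega) (by simpa) (by simpa)

theorem HasBd.difQ {n Q : ℕ} {H : Pt → R} {x : Fin 3 → ℕ → R} (h : HasBd n H x) {c : Fin 3}
    {j l : ℕ} (hj : j + l + Q = n) :
    difQ Q H c (sd c j l) = ∑ t ∈ range Q, x c (l + t) := by
  rw [difQ_eq_sum]
  refine sum_congr rfl fun t ht => ?_
  have ht := mem_range.1 ht
  rw [← h.dif (c := c) (j := j + (Q - 1 - t)) (l := l + t) (by omega)]
  congr 1
  exact pt_ext c (by simp) (by simp) (by simp)

/-- The position of the up triangle `y` of a small hive `G` inside the large hive. -/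
def upPos (Q : ℕ) (G : Pt → ℤ) (s : Fin 3 → ℤ) (y : Pt) : Pt :=
  fun a => (Q * y a + s (a + 1) - dif G (a + 1) y).toNat

/-- The position of the down triangle `w` of a small hive `G` inside the large hive. -/
def downPos (Q : ℕ) (G : Pt → ℤ) (s : Fin 3 → ℤ) (w : Pt) : Pt :=
  fun a => (Q * w a + s (a + 1) - dif G (a + 1) (w + e (a + 1))).toNat

variable {N r Q : ℕ} {G : Pt → ℤ} {Z : Fin 3 → ℕ → ℤ} {s : Fin 3 → ℤ}

theorem dif_le_shift (hG : IsHive r G) (hZ : HasBd r G Z) (h0 : 0 < r → ∀ c, Z c 0 ≤ s c)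
    {y : Pt} (hy : wt y + 1 = r) (c : Fin 3) : dif G c y ≤ s c := by
  have h1 := hG.dif_le_bd hZ hy c
  have h2 := LR.antitone ⟨G, hG, hZ⟩ c (i := 0) (k := y (c + 2)) (by omega)
    (by rw [wt_cyc _ c] at hy; omega)
  have := h0 (by omega) c
  linarith

theorem upPos_eq (hG : IsHive r G) (hZ : HasBd r G Z) (h0 : 0 < r → ∀ c, Z c 0 ≤ s c)
    {y : Pt} (hy : wt y + 1 = r) (c : Fin 3) :
    (upPos Q G s y (c + 2) : ℤ) = Q * y (c + 2) + s c - dif G c y := by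
  have := dif_le_shift hG hZ h0 hy c
  rw [upPos, c21, Int.toNat_of_nonneg]
  have : (0 : ℤ) ≤ Q * y (c + 2) := by positivity
  linarith

theorem downPos_eq (hG : IsHive r G) (hZ : HasBd r G Z) (h0 : 0 < r → ∀ c, Z c 0 ≤ s c)
    {w : Pt} (hw : wt w + 2 = r) (c : Fin 3) :
    (downPos Q G s w (c + 2) : ℤ) = Q * w (c + 2) + s c - dif G c (w + e c) := by
  have := dif_le_shift hG hZ h0 (y := w + e c) (by simp; omega) c
  rw [downPos, c21, Int.toNat_of_nonneg]
  have : (0 : ℤ) ≤ Q * w (c + 2) := by positivity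
  linarith

theorem wt_upPos (hG : IsHive r G) (hZ : HasBd r G Z) (h0 : 0 < r → ∀ c, Z c 0 ≤ s c)
    (hs : ∑ c, s c = Q * ((N : ℤ) - r))
    {y : Pt} (hy : wt y + 1 = r) : wt (upPos Q G s y) + Q = Q * N := by
  have h := fun c => upPos_eq (Q := Q) hG hZ h0 hy c
  have h0' := h 0; have h1 := h 1; have h2 := h 2
  have hd := sum_dif G y
  rw [Fin.sum_univ_three] at hd hs
  simp only [zero_add, Fin.reduceAdd] at h0' h1 h2
  have hy' : ((y 0 : ℤ) + y 1 + y 2) + 1 = r := by rw [wt] at hy; exact_mod_cast hy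
  zify
  simp only [wt]
  push_cast
  rw [h0', h1, h2]
  linear_combination hs - hd + Q * hy'

theorem wt_downPos (hG : IsHive r G) (hZ : HasBd r G Z) (h0 : 0 < r → ∀ c, Z c 0 ≤ s c)
    (hs : ∑ c, s c = Q * ((N : ℤ) - r))
    {w : Pt} (hw : wt w + 2 = r) : wt (downPos Q G s w) + 2 * Q = Q * N := by
  have h := fun c => downPos_eq (Q := Q) hG hZ h0 hw c
  have h0' := h 0; have h1 := h 1; have h2 := h 2
  have hd := sum_dif_down G w
  rw [Fin.sum_univ_three] at hd hs
  simp only [zero_add, Fin.reduceAdd] at h0' h1 h2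
  have hy' : ((w 0 : ℤ) + w 1 + w 2) + 2 = r := by rw [wt] at hw; exact_mod_cast hw
  zify
  simp only [wt]
  push_cast
  rw [h0', h1, h2]
  linear_combination hs - hd + Q * hy'

theorem upPos_two_eq (hG : IsHive r G) (hZ : HasBd r G Z) (h0 : 0 < r → ∀ c, Z c 0 ≤ s c)
    {w : Pt} (hw : wt w + 2 = r) (c : Fin 3) :
    upPos Q G s (w + e c) (c + 2) = downPos Q G s w (c + 2) := by
  zify
  rw [upPos_eq hG hZ h0 (by simp; omega), downPos_eq hG hZ h0 hw]
  simp

theorem upPos_one_le (hG : IsHive r G) (hZ : HasBd r G Z) (h0 : 0 < r → ∀ c, Z c 0 ≤ s c)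
    {w : Pt} (hw : wt w + 2 = r) (c : Fin 3) :
    upPos Q G s (w + e c) (c + 1) ≤ downPos Q G s w (c + 1) := by
  zify
  have h1 := upPos_eq (Q := Q) hG hZ h0 (y := w + e c) (by simp; omega) (c + 2)
  have h2 := downPos_eq (Q := Q) hG hZ h0 hw (c + 2)
  simp only [c22] at h1 h2
  rw [h1, h2]
  have := hG (c + 2) (w + e (c + 2)) (w + e c) (by simp; omega) (by simp; omega) (by simp)
    (by simp)
  simp
  linarith

variable {H : Pt → R} {x : Fin 3 → ℕ → R}

theorem difQ_up_le_down (hH : IsHive (Q * N) H) (hG : IsHive r G)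
    (hZ : HasBd r G Z) (h0 : 0 < r → ∀ c, Z c 0 ≤ s c) (hs : ∑ c, s c = Q * ((N : ℤ) - r))
    {w : Pt} (hw : wt w + 2 = r) (c : Fin 3) :
    difQ Q H c (upPos Q G s (w + e c)) ≤ difQ Q H c (downPos Q G s w + Q • e c) := by
  have h1 := wt_downPos hG hZ h0 hs hw
  refine hH.difQ_mono c (wt_upPos hG hZ h0 hs (by simp; omega))
    (by simp only [wt_add, wt_smul, wt_e]; omega) ?_ ?_
  · simpa using (upPos_two_eq hG hZ h0 hw c).ge
  · simpa using upPos_one_le hG hZ h0 hw c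

theorem upPos_bd (hG : IsHive r G) (hZ : HasBd r G Z) (h0 : 0 < r → ∀ c, Z c 0 ≤ s c)
    {c : Fin 3} {j l : ℕ} (hj : j + l + 1 = r) :
    upPos Q G s (sd c j l) (c + 2) = (Q * l + s c - Z c l).toNat := by
  zify
  have h1 := upPos_eq (Q := Q) hG hZ h0 (y := sd c j l) (by simp; omega) c
  rw [hZ.dif hj] at h1
  simp only [sd_2] at h1
  rw [← h1]
  simp

theorem difQ_up_le_bd (hH : IsHive (Q * N) H) (hx : HasBd (Q * N) H x) (hG : IsHive r G)
    (hZ : HasBd r G Z) (h0 : 0 < r → ∀ c, Z c 0 ≤ s c) (hs : ∑ c, s c = Q * ((N : ℤ) - r))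
    {c : Fin 3} {j l : ℕ} (hj : j + l + 1 = r) :
    difQ Q H c (upPos Q G s (sd c j l)) ≤
      ∑ t ∈ range Q, x c ((Q * l + s c - Z c l).toNat + t) := by
  have h1 := wt_upPos hG hZ h0 hs (y := sd c j l) (by simp; omega)
  have h2 := upPos_bd (Q := Q) hG hZ h0 (c := c) hj
  rw [wt_cyc _ c] at h1
  rw [← hx.difQ (c := c) (j := Q * N - Q - (Q * l + s c - Z c l).toNat)
    (l := (Q * l + s c - Z c l).toNat) (by omega)]
  exact hH.difQ_mono c (by rw [wt_cyc _ c]; omega) (by simp; omega) (by simp [h2])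
    (by simp; omega)

theorem sum_difQ_split (H : Pt → R) (f : Pt → Pt) (r : ℕ) :
    ∑ c, ∑ l ∈ range r, difQ Q H c (f (sd c (r - 1 - l) l)) +
      ∑ c, ∑ w ∈ tri 2 r, difQ Q H c (f (w + e c)) = 0 := by
  rw [← sum_add_distrib]
  have := fun c => sum_tri_split r c (fun y => difQ Q H c (f y))
  simp only [← this]
  rw [sum_comm]
  simp [sum_difQ]

/-- A small integral hive gives an inequality for the boundary of the large hive. -/
theorem validity (hH : IsHive (Q * N) H) (hx : HasBd (Q * N) H x) (hG : IsHive r G)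
    (hZ : HasBd r G Z) (h0 : 0 < r → ∀ c, Z c 0 ≤ s c) (hs : ∑ c, s c = Q * ((N : ℤ) - r)) :
    0 ≤ ∑ c, ∑ l ∈ range r,
      ∑ t ∈ range Q, x c ((Q * l + s c - Z c l).toNat + t) := by
  rw [← sum_difQ_split H (upPos Q G s) r (Q := Q)]
  have h1 : ∑ c, ∑ w ∈ tri 2 r, difQ Q H c (upPos Q G s (w + e c)) ≤ 0 := by
    have : ∑ c, ∑ w ∈ tri 2 r, difQ Q H c (downPos Q G s w + Q • e c) = 0 := by
      rw [sum_comm]; simp [sum_difQ_down, -nsmul_eq_mul]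
    rw [← this]
    exact sum_le_sum fun c _ => sum_le_sum fun w hw =>
      difQ_up_le_down hH hG hZ h0 hs (mem_tri.1 hw) c
  have h2 : ∑ c, ∑ l ∈ range r, difQ Q H c (upPos Q G s (sd c (r - 1 - l) l)) ≤
      ∑ c, ∑ l ∈ range r,
        ∑ t ∈ range Q, x c ((Q * l + s c - Z c l).toNat + t) :=
    sum_le_sum fun c _ => sum_le_sum fun l hl =>
      difQ_up_le_bd hH hx hG hZ h0 hs (by have := mem_range.1 hl; omega)
  linarith

/-- In the case of equality all the estimates are sharp. -/
theorem validity_tight (hH : IsHive (Q * N) H) (hx : HasBd (Q * N) H x) (hG : IsHive r G)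
    (hZ : HasBd r G Z) (h0 : 0 < r → ∀ c, Z c 0 ≤ s c) (hs : ∑ c, s c = Q * ((N : ℤ) - r))
    (heq : ∑ c, ∑ l ∈ range r,
      ∑ t ∈ range Q, x c ((Q * l + s c - Z c l).toNat + t) = 0) :
    (∀ w c, wt w + 2 = r →
      difQ Q H c (upPos Q G s (w + e c)) = difQ Q H c (downPos Q G s w + Q • e c)) ∧
    ∀ c j l, j + l + 1 = r → difQ Q H c (upPos Q G s (sd c j l)) =
      ∑ t ∈ range Q, x c ((Q * l + s c - Z c l).toNat + t) := by
  have h0' := sum_difQ_split H (upPos Q G s) r (Q := Q)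
  have hd : ∑ c, ∑ w ∈ tri 2 r, difQ Q H c (downPos Q G s w + Q • e c) = 0 := by
    rw [sum_comm]; simp [sum_difQ_down, -nsmul_eq_mul]
  have h1 : ∑ c, ∑ w ∈ tri 2 r, difQ Q H c (upPos Q G s (w + e c)) ≤
      ∑ c, ∑ w ∈ tri 2 r, difQ Q H c (downPos Q G s w + Q • e c) :=
    sum_le_sum fun c _ => sum_le_sum fun w hw =>
      difQ_up_le_down hH hG hZ h0 hs (mem_tri.1 hw) c
  have h2 : ∑ c, ∑ l ∈ range r, difQ Q H c (upPos Q G s (sd c (r - 1 - l) l)) ≤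
      ∑ c, ∑ l ∈ range r,
        ∑ t ∈ range Q, x c ((Q * l + s c - Z c l).toNat + t) :=
    sum_le_sum fun c _ => sum_le_sum fun l hl =>
      difQ_up_le_bd hH hx hG hZ h0 hs (by have := mem_range.1 hl; omega)
  constructor
  · intro w c hw
    have e1 : ∑ c, ∑ w ∈ tri 2 r, difQ Q H c (upPos Q G s (w + e c)) =
      ∑ c, ∑ w ∈ tri 2 r, difQ Q H c (downPos Q G s w + Q • e c) := by linarith
    have e2 := (sum_eq_sum_iff_of_le (fun c _ => sum_le_sum fun w hw =>
      difQ_up_le_down hH hG hZ h0 hs (mem_tri.1 hw) c)).1 e1 c (mem_univ _)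
    exact (sum_eq_sum_iff_of_le (fun w hw =>
      difQ_up_le_down hH hG hZ h0 hs (mem_tri.1 hw) c)).1 e2 w (mem_tri.2 hw)
  · intro c j l hj
    have e1 : ∑ c, ∑ l ∈ range r, difQ Q H c (upPos Q G s (sd c (r - 1 - l) l)) =
      ∑ c, ∑ l ∈ range r,
        ∑ t ∈ range Q, x c ((Q * l + s c - Z c l).toNat + t) := by linarith
    have e2 := (sum_eq_sum_iff_of_le (fun c _ => sum_le_sum fun l hl =>
      difQ_up_le_bd hH hx hG hZ h0 hs
        (by have := mem_range.1 hl; omega))).1 e1 c (mem_univ _)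
    have e3 := (sum_eq_sum_iff_of_le (fun l hl =>
      difQ_up_le_bd hH hx hG hZ h0 hs (by have := mem_range.1 hl; omega))).1 e2 l
      (mem_range.2 (by omega))
    rwa [show r - 1 - l = j by omega] at e3

end Validity

/-! ### Clearing denominators and averaged validity -/

theorem exists_common_den {ι : Type*} (t : Finset ι) (f : ι → ℚ) :
    ∃ Q : ℕ, 0 < Q ∧ ∀ i ∈ t, ∃ z : ℤ, (z : ℚ) = Q * f i := by
  classical
  induction t using Finset.induction_on with
  | empty => exact ⟨1, one_pos, by simp⟩
  | insert a t ha ih =>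
    obtain ⟨Q, hQ, h⟩ := ih
    refine ⟨Q * (f a).den, Nat.mul_pos hQ (f a).den_pos, fun i hi => ?_⟩
    rcases mem_insert.1 hi with rfl | hi
    · refine ⟨Q * (f i).num, ?_⟩
      have := Rat.den_mul_eq_num (f i)
      push_cast
      rw [mul_assoc, this]
    · obtain ⟨z, hz⟩ := h i hi
      refine ⟨z * (f a).den, ?_⟩
      push_cast
      rw [hz]; ring

/-- A rational hive becomes integral after multiplication by some `Q`, which also
clears the denominators of a given vector. -/
theorem exists_int_hive {r : ℕ} {z : Bdry} (hz : LR r z) (s : Fin 3 → ℚ) :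
    ∃ Q : ℕ, 0 < Q ∧ ∃ (G : Pt → ℤ) (Z : Fin 3 → ℕ → ℤ) (S : Fin 3 → ℤ), IsHive r G ∧
      HasBd r G Z ∧ (∀ c, (S c : ℚ) = Q * s c) ∧ ∀ c, ∀ i < r, (Z c i : ℚ) = Q * z c i := by
  obtain ⟨A, hA, ha⟩ := hz
  obtain ⟨Q₁, hQ₁, h₁⟩ := exists_common_den (tri 0 r) A
  obtain ⟨Q₂, hQ₂, h₂⟩ := exists_common_den univ s
  have h₁' : ∀ p, ∃ g : ℤ, wt p = r → (g : ℚ) = (Q₁ * Q₂ : ℕ) * A p := by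
    intro p
    by_cases hp : wt p = r
    · obtain ⟨g, hg⟩ := h₁ p (by simpa)
      exact ⟨g * Q₂, fun _ => by push_cast; rw [hg]; ring⟩
    · exact ⟨0, fun h => absurd h hp⟩
  choose G hG using h₁'
  choose S hS using fun c => h₂ c (mem_univ c)
  refine ⟨Q₁ * Q₂, Nat.mul_pos hQ₁ hQ₂, G,
    fun c l => G (sd c (r - 1 - l) (l + 1)) - G (sd c (r - l) l), fun c => Q₁ * S c, ?_, ?_, ?_, ?_⟩
  · intro c p q hp hq h2 h1
    have := mul_le_mul_of_nonneg_left (hA c p q hp hq h2 h1) (Nat.cast_nonneg (α := ℚ) (Q₁ * Q₂))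
    simp only [dif, mul_sub] at *
    rw [← hG _ (by simpa), ← hG _ (by simpa), ← hG _ (by simpa), ← hG _ (by simpa)] at this
    exact_mod_cast this
  · intro c j l hj
    simp only [show r - 1 - l = j by omega, show r - l = j + 1 by omega]
  · intro c
    push_cast
    rw [hS]; ring
  · intro c i hi
    push_cast
    rw [hG _ (by simp; omega), hG _ (by simp; omega), ← ha c (r - 1 - i) i (by omega),
      show r - 1 - i + 1 = r - i by omega]
    push_cast; ring

/-- Piecewise linear interpolation of a sequence. -/
def av (f : ℕ → ℚ) (u : ℚ) : ℚ :=
  ((⌊u⌋₊ : ℚ) + 1 - u) * f ⌊u⌋₊ + (u - ⌊u⌋₊) * f (⌊u⌋₊ + 1)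

theorem sum_div_eq_av (f : ℕ → ℚ) {Q : ℕ} (hQ : 0 < Q) (p : ℕ) :
    ∑ t ∈ range Q, f ((p + t) / Q) = Q * av f ((p : ℚ) / Q) := by
  have hfl : ⌊(p : ℚ) / Q⌋₊ = p / Q := Nat.floor_div_eq_div p Q
  have hQ' : (Q : ℚ) ≠ 0 := by positivity
  set m := p / Q with hm
  set ρ := p % Q with hρ
  have hp : Q * m + ρ = p := Nat.div_add_mod p Q
  have hρQ : ρ < Q := Nat.mod_lt _ hQ
  rw [av, hfl]
  have h1 : ∀ t ∈ range (Q - ρ), f ((p + t) / Q) = f m := fun t ht => by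
    have ht := mem_range.1 ht
    rw [show (p + t) / Q = m by
      rw [← hp, add_assoc, Nat.mul_add_div hQ, Nat.div_eq_of_lt (by omega), add_zero]]
  have h2 : ∀ t ∈ range ρ, f ((p + (Q - ρ + t)) / Q) = f (m + 1) := fun t ht => by
    have ht := mem_range.1 ht
    rw [show (p + (Q - ρ + t)) / Q = m + 1 by
      rw [show p + (Q - ρ + t) = Q * (m + 1) + t by rw [mul_add]; omega, Nat.mul_add_div hQ,
        Nat.div_eq_of_lt (by omega), add_zero]]
  have h3 : Q = (Q - ρ) + ρ := by omega
  have h4 : ∑ t ∈ range Q, f ((p + t) / Q) =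
      ∑ t ∈ range ((Q - ρ) + ρ), f ((p + t) / Q) := by rw [← h3]
  rw [h4, sum_range_add, sum_congr rfl h1, sum_congr rfl h2]
  simp only [sum_const, card_range, nsmul_eq_mul]
  rw [Nat.cast_sub hρQ.le]
  have hp' : (p : ℚ) = Q * m + ρ := by exact_mod_cast hp.symm
  rw [hp']
  field_simp
  ring

theorem av_natCast (f : ℕ → ℚ) (m : ℕ) : av f m = f m := by simp [av]

theorem av_le {f : ℕ → ℚ} {N m : ℕ} {u : ℚ} (hf : ∀ i j, i ≤ j → j < N → f j ≤ f i)
    (hm : (m : ℚ) ≤ u) (hu : u + 1 ≤ N) : av f u ≤ f m := by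
  have h1 : m ≤ ⌊u⌋₊ := Nat.le_floor hm
  have hu0 : 0 ≤ u := (Nat.cast_nonneg m).trans hm
  have h2 := Nat.floor_le hu0
  have h3 := (Nat.lt_floor_add_one u).le
  have h4 : ⌊u⌋₊ < N := by
    have : ((⌊u⌋₊ : ℕ) : ℚ) < N := by linarith
    exact_mod_cast this
  have h5 := hf m ⌊u⌋₊ h1 h4
  rcases Nat.lt_or_ge (⌊u⌋₊ + 1) N with h6 | h6
  · have h7 := hf m _ (h1.trans (Nat.le_succ _)) h6
    rw [av]
    nlinarith
  · have h8 : u - ⌊u⌋₊ = 0 := by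
      have : (N : ℚ) ≤ ⌊u⌋₊ + 1 := by exact_mod_cast h6
      linarith
    rw [av, show ((⌊u⌋₊ : ℕ) : ℚ) + 1 - u = 1 by linarith, h8]
    linarith

theorem LR.bd_bounds {N r : ℕ} {z : Bdry} (hz : LR r z) {s : Fin 3 → ℚ}
    (hs : ∑ c, s c = (N : ℚ) - r) (h0 : 0 < r → ∀ c, z c 0 ≤ s c) (c : Fin 3) {k : ℕ}
    (hk : k < r) : z c k ≤ s c ∧ (k : ℚ) + s c - z c k + 1 ≤ N := by
  have h1 := fun c => (hz.antitone c (Nat.zero_le k) hk).trans (h0 (by omega) c)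
  refine ⟨h1 c, ?_⟩
  have h2 := hz.weyl (s := fun a => if a = c then k else 0) (by simpa)
  rw [sum_cyc _ c] at h2 hs
  have e1 : c + 1 ≠ c := by fin_cases c <;> simp
  have e2 : c + 2 ≠ c := by fin_cases c <;> simp
  simp only [if_true, e1, e2, if_false] at h2
  have h3 := h0 (by omega) (c + 1)
  have h4 := h0 (by omega) (c + 2)
  have : (k : ℚ) + 1 ≤ r := by exact_mod_cast hk
  linarith

theorem validity_av {N r : ℕ} {x z : Bdry} (hx : UpLR N x) (hz : LR r z) {s : Fin 3 → ℚ}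
    (hs : ∑ c, s c = (N : ℚ) - r) (h0 : 0 < r → ∀ c, z c 0 ≤ s c) :
    0 ≤ ∑ c, ∑ k ∈ range r, av (x c) (k + s c - z c k) := by
  obtain ⟨Q, hQ, G, Z, S, hG, hGZ, hS, hZ⟩ := exists_int_hive hz s
  obtain ⟨y, ⟨H, hH, hy⟩, hyx⟩ := hx.dilate Q
  have hQ' : (0 : ℚ) < Q := by exact_mod_cast hQ
  have h0' : 0 < r → ∀ c, Z c 0 ≤ S c := fun hr c => by
    have := mul_le_mul_of_nonneg_left (h0 hr c) hQ'.le
    rw [← hS, ← hZ c 0 hr] at this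
    exact_mod_cast this
  have hs' : ∑ c, S c = Q * ((N : ℤ) - r) := by
    have : ((∑ c, S c : ℤ) : ℚ) = Q * ((N : ℚ) - r) := by
      push_cast
      simp only [hS]
      rw [← mul_sum, hs]
    exact_mod_cast this
  have hv := validity hH hy hG hGZ h0' hs'
  have hle : ∑ c, ∑ l ∈ range r,
      ∑ t ∈ range Q, y c ((Q * l + S c - Z c l).toNat + t) ≤
      Q * ∑ c, ∑ k ∈ range r, av (x c) (k + s c - z c k) := by
    rw [mul_sum]
    refine sum_le_sum fun c _ => ?_
    rw [mul_sum]
    refine sum_le_sum fun l hl => ?_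
    have hl := mem_range.1 hl
    have hpos := upPos_bd (Q := Q) hG hGZ h0' (c := c) (j := r - 1 - l) (l := l) (by omega)
    have hwt := wt_upPos hG hGZ h0' hs' (y := sd c (r - 1 - l) l) (by simp; omega)
    have heq := upPos_eq (Q := Q) hG hGZ h0' (y := sd c (r - 1 - l) l) (by simp; omega) c
    rw [hpos, hGZ.dif (by omega)] at heq
    rw [wt_cyc _ c] at hwt
    have hu : ((((Q * l + S c - Z c l).toNat : ℕ) : ℚ)) / Q = l + s c - z c l := by
      have : ((((Q * l + S c - Z c l).toNat : ℕ) : ℤ) : ℚ) = Q * l + Q * s c - Q * z c l := by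
        rw [heq]; push_cast; rw [hS, hZ c l hl]; simp
      rw [Int.cast_natCast] at this
      rw [this]
      field_simp
    rw [← hu, ← sum_div_eq_av _ hQ]
    refine sum_le_sum fun t ht => hyx c _ ?_
    have ht := mem_range.1 ht
    omega
  have := hv.trans hle
  exact nonneg_of_mul_nonneg_right this hQ'

/-! ### The inequalities attached to triples of index sets -/

/-- The normalized partition of a triple of `r`-element subsets of `range N`. -/
def setBd (N r : ℕ) (s : Triple) (c : Fin 3) (k : ℕ) : ℚ :=
  ((N : ℚ) - r) / 3 - ((nthSmall (s c) k : ℚ) - k)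

/-- The triples of subsets of `range N` that give inequalities for hives. -/
structure IsE (N r : ℕ) (s : Triple) : Prop where
  sub : ∀ c, s c ⊆ range N
  card : ∀ c, (s c).card = r
  up : UpLR r (setBd N r s)

theorem IsE.valid {N r : ℕ} {s : Triple} (h : IsE N r s) {x : Bdry}
    (hx : UpLR N x) : 0 ≤ ∑ c, ∑ i ∈ s c, x c i := by
  obtain ⟨y, hy, hyx⟩ := hx
  obtain ⟨z, hz, hzs⟩ := h.up
  have hs : ∑ _c : Fin 3, ((N : ℚ) - r) / 3 = (N : ℚ) - r := by simp; ring
  have h0 : 0 < r → ∀ c, z c 0 ≤ ((N : ℚ) - r) / 3 := fun hr c => by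
    refine (hzs c 0 hr).trans ?_
    simp [setBd]
  refine (validity_av (UpLR.of_LR hy) hz hs h0).trans (sum_le_sum fun c _ => ?_)
  rw [← sum_nthSmall (s c), h.card c]
  refine sum_le_sum fun k hk => ?_
  have hk := mem_range.1 hk
  have hmem := mem_range.1 (h.sub c (nthSmall_mem (s := s c) (k := k) (by rw [h.card c]; omega)))
  refine le_trans (av_le (N := N) (fun i j hij hj => hy.antitone c hij hj) ?_
    (LR.bd_bounds hz hs h0 c hk).2) (hyx c _ hmem)
  have := hzs c k hk
  rw [setBd] at this
  linarith

/-! ### Potentials and scaling down -/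

theorem exists_potential {R : Type*} [CommRing R] [LinearOrder R] [IsStrictOrderedRing R] {M : ℕ} {z : Fin 3 → Pt → R}
    (hup : ∀ y, wt y + 1 = M → ∑ c, z c y = 0)
    (hdown : ∀ w, wt w + 2 = M → ∑ c, z c (w + e c) = 0) :
    ∃ G : Pt → R, ∀ y c, wt y + 1 = M → dif G c y = z c y := by
  have e0 : ∀ a b d : ℕ, (![a, b, d] : Pt) + e 0 = ![a + 1, b, d] := fun a b d =>
    pt_ext 0 (by simp [e]) (by simp [e]) (by simp [e])
  have e1 : ∀ a b d : ℕ, (![a, b, d] : Pt) + e 1 = ![a, b + 1, d] := fun a b d =>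
    pt_ext 0 (by simp [e]) (by simp [e]) (by simp [e])
  have e2 : ∀ a b d : ℕ, (![a, b, d] : Pt) + e 2 = ![a, b, d + 1] := fun a b d =>
    pt_ext 0 (by simp [e]) (by simp [e]) (by simp [e])
  have w3 : ∀ a b d : ℕ, wt ![a, b, d] = a + b + d := fun a b d => by simp [wt]
  let G : Pt → R := fun p => ∑ t ∈ range (p 1 + p 2), z 2 ![M - 1 - t, t, 0] +
    ∑ t ∈ range (p 2), z 0 ![p 0, p 1 + p 2 - 1 - t, t]
  have h0 : ∀ y, wt y + 1 = M → dif G 0 y = z 0 y := by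
    intro y hy
    have hy3 : y = ![y 0, y 1, y 2] := pt_ext 0 (by simp) (by simp) (by simp)
    simp only [dif, G]
    simp only [zero_add, Pi.add_apply, e]
    simp
    rw [show y 1 + 1 + y 2 = y 1 + (y 2 + 1) by omega, sum_range_succ _ (y 2)]
    rw [show y 1 + y 2 - y 2 = y 1 by omega, ← hy3]
    ring
  have h2 : ∀ y, wt y + 1 = M → dif G 2 y = z 2 y := by
    intro y hy
    have hy3 : y = ![y 0, y 1, y 2] := pt_ext 0 (by simp) (by simp) (by simp)
    simp only [dif, G]
    simp only [Fin.reduceAdd, Pi.add_apply, e]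
    simp
    rw [show y 1 + 1 + y 2 = y 1 + y 2 + 1 by omega, sum_range_succ _ (y 1 + y 2)]
    have tel := sum_range_sub (fun t => z 2 ![y 0, y 1 + y 2 - t, t]) (y 2)
    simp only [Nat.add_sub_cancel, Nat.sub_zero] at tel
    rw [← hy3] at tel
    have hM : M - 1 - (y 1 + y 2) = y 0 := by rw [wt] at hy; omega
    rw [hM]
    have key : ∑ t ∈ range (y 2), (z 2 ![y 0, y 1 + y 2 - (t + 1), t + 1] -
        z 2 ![y 0, y 1 + y 2 - t, t]) = ∑ t ∈ range (y 2),
        (z 0 ![y 0, y 1 + y 2 - t, t] - z 0 ![y 0 + 1, y 1 + y 2 - 1 - t, t]) := by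
      refine sum_congr rfl fun t ht => ?_
      have ht := mem_range.1 ht
      have hu := hup ![y 0, y 1 + y 2 - t, t] (by rw [w3]; rw [wt] at hy; omega)
      have hd := hdown ![y 0, y 1 + y 2 - 1 - t, t] (by rw [w3]; rw [wt] at hy; omega)
      rw [Fin.sum_univ_three] at hu hd
      rw [e0, e1, e2, show y 1 + y 2 - 1 - t + 1 = y 1 + y 2 - t by omega] at hd
      rw [show y 1 + y 2 - (t + 1) = y 1 + y 2 - 1 - t by omega]
      linear_combination hd - hu
    rw [key, sum_sub_distrib] at tel
    linear_combination tel
  refine ⟨G, fun y c hy => ?_⟩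
  have hs := sum_dif G y
  have hz := hup y hy
  rw [Fin.sum_univ_three] at hs hz
  have g0 := h0 y hy
  have g2 := h2 y hy
  fin_cases c
  · exact g0
  · show dif G 1 y = z 1 y
    linear_combination hs - hz - g0 - g2
  · exact g2

theorem LR.scale_down {Q n : ℕ} {x : Bdry} (hx : LR (Q * n) x) :
    LR n (fun c l => (∑ t ∈ range Q, x c (Q * l + t)) / Q) := by
  obtain ⟨G, hG, hb⟩ := hx
  refine ⟨fun p => G (Q • p) / Q, fun c p q hp hq h2 h1 => ?_, fun c j l hj => ?_⟩
  · have := hG.difQ_mono (Q := Q) c (p := Q • p) (q := Q • q)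
      (by rw [wt_smul, ← hp]; ring) (by rw [wt_smul, ← hq]; ring)
      (Nat.mul_le_mul_left _ h2) (Nat.mul_le_mul_left _ h1)
    simp only [dif, difQ, smul_add] at *
    rw [← sub_div, ← sub_div]
    exact div_le_div_of_nonneg_right this (Nat.cast_nonneg _)
  · have h := hb.difQ (Q := Q) (c := c) (j := Q * j) (l := Q * l) (by rw [← hj]; ring)
    rw [difQ] at h
    simp only
    rw [← h, ← sub_div]
    have g1 : Q • sd c j (l + 1) = sd c (Q * j) (Q * l) + Q • e (c + 2) :=
      pt_ext c (by simp) (by simp) (by simp; ring)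
    have g2 : Q • sd c (j + 1) l = sd c (Q * j) (Q * l) + Q • e (c + 1) :=
      pt_ext c (by simp) (by simp; ring) (by simp)
    rw [g1, g2]

/-! ### Duality -/

theorem exists_strict_argmax {r : ℕ} (G : Pt → ℤ) {t : Fin 3 → ℤ} (ht : ∑ c, t c = 0)
    (hmod : ∀ c, ¬ (3 : ℤ) ∣ t c) : ∃ q, wt q = r ∧ ∀ p c, wt p + 1 = r →
      (q = p + e (c + 2) → -(3 * dif G c p) < t c) ∧ (q = p + e (c + 1) → 3 * dif G c p < -t c) := by
  let F : Pt → ℤ := fun q => 3 * G q - (t 1 * q 2 - t 2 * q 1)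
  have hne : {p : Pt | wt p = r}.Nonempty := ⟨sd 0 r 0, by simp⟩
  obtain ⟨q, hq, hm⟩ := (finite_le_wt r).exists_maximalFor F _ hne
  have hmax : ∀ p, wt p = r → F p ≤ F q := fun p hp => by
    by_contra hlt
    exact hlt (hm (j := p) hp (le_of_lt (not_le.1 hlt)))
  have hF : ∀ p c, F (p + e (c + 2)) - F (p + e (c + 1)) = 3 * dif G c p + t c := by
    intro p c
    rw [Fin.sum_univ_three] at ht
    have h0 : t 0 = - t 1 - t 2 := by linarith
    simp only [F, dif, Pi.add_apply]
    fin_cases c <;> simp [e]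
    · rw [h0]; ring
    · ring
    · ring
  refine ⟨q, hq, fun p c hp => ⟨?_, ?_⟩⟩
  · rintro rfl
    have h1 := hmax (p + e (c + 1)) (by simpa)
    have h2 := hF p c
    have h3 := hmod c
    omega
  · rintro rfl
    have h1 := hmax (p + e (c + 2)) (by simpa)
    have h2 := hF p c
    have h3 := hmod c
    omega

theorem argmax_compare {r : ℕ} {G : Pt → ℤ} (hG : IsHive r G) {T : Fin 3 → ℤ} {c : Fin 3}
    {q q' : Pt} (hq : wt q = r) (hq' : wt q' = r)
    (h : ∀ p b, wt p + 1 = r →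
      (q = p + e (b + 2) → -(3 * dif G b p) < 3 * (T b + e c (b + 2)) + 1) ∧
      (q = p + e (b + 1) → 3 * dif G b p < -(3 * (T b + e c (b + 2)) + 1)))
    (h' : ∀ p b, wt p + 1 = r →
      (q' = p + e (b + 2) → -(3 * dif G b p) < 3 * T b + 2) ∧
      (q' = p + e (b + 1) → 3 * dif G b p < -(3 * T b + 2))) :
    q (c + 1) = q' (c + 1) ∧ q (c + 2) ≤ q' (c + 2) := by
  have k1 : ∀ b, ¬ (q' (b + 1) < q (b + 1) ∧ q (b + 2) < q' (b + 2)) := by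
    rintro b ⟨hi, hv⟩
    obtain ⟨p, rfl⟩ := pt_pred (p := q) (a := b + 1) (by omega)
    obtain ⟨p', rfl⟩ := pt_pred (p := q') (a := b + 2) (by omega)
    simp only [wt_add, wt_e] at hq hq'
    have h1 := (h p b hq).2 rfl
    have h2 := (h' p' b hq').1 rfl
    simp at hi hv
    have h3 := hG b p' p hq' hq (by omega) (by omega)
    have : (0 : ℤ) ≤ e c (b + 2) := by positivity
    omega
  have k2 : ∀ b, b + 2 ≠ c → ¬ (q' (b + 2) < q (b + 2) ∧ q (b + 1) < q' (b + 1)) := by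
    rintro b hb ⟨hi, hv⟩
    obtain ⟨p, rfl⟩ := pt_pred (p := q) (a := b + 2) (by omega)
    obtain ⟨p', rfl⟩ := pt_pred (p := q') (a := b + 1) (by omega)
    simp only [wt_add, wt_e] at hq hq'
    have h1 := (h p b hq).1 rfl
    have h2 := (h' p' b hq').2 rfl
    simp at hi hv
    have h3 := hG b p p' hq hq' (by omega) (by omega)
    have : e c (b + 2) = 0 := by simp [e, hb]
    rw [this] at h1
    push_cast at h1
    omega
  have a1 := k1 c; have a2 := k1 (c + 1); have a3 := k1 (c + 2)
  have b1 := k2 c (by fin_cases c <;> simp)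
  have b3 := k2 (c + 2) (by fin_cases c <;> simp)
  simp only [c11, c12, c21, c22] at a1 a2 a3 b1 b3
  rw [wt_cyc _ c] at hq hq'
  omega

theorem sum_card_lt {r M : ℕ} {v : ℕ → ℤ} (h0 : ∀ i < r, 0 ≤ v i) (hM : ∀ i < r, v i ≤ M) :
    ∑ l ∈ range M, (((range r).filter fun i => (l : ℤ) < v i).card : ℤ) =
      ∑ i ∈ range r, v i := by
  simp only [card_filter]
  push_cast
  rw [sum_comm]
  refine sum_congr rfl fun i hi => ?_
  have hi := mem_range.1 hi
  rw [← sum_filter, sum_const]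
  have : (range M).filter (fun l : ℕ => (l : ℤ) < v i) = range (v i).toNat := by
    ext l; simp; have := h0 i hi; have := hM i hi; omega
  rw [this]
  simp [h0 i hi]

theorem dual_hive {r M : ℕ} {G : Pt → ℤ} {Z : Fin 3 → ℕ → ℤ} {S : Fin 3 → ℤ} (hG : IsHive r G)
    (hZ : HasBd r G Z) (hS : ∑ c, S c = M) (h0 : 0 < r → ∀ c, Z c 0 ≤ S c) :
    LR M (fun c l =>
      (((range r).filter fun i => (l : ℤ) < S c - Z c i).card : ℚ) - r / 3) := by
  have hup : ∀ y : Pt, ∃ q, wt y + 1 = M → wt q = r ∧ ∀ p c, wt p + 1 = r →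
      (q = p + e (c + 2) → -(3 * dif G c p) < 3 * (y (c + 2) - S c) + 1) ∧
      (q = p + e (c + 1) → 3 * dif G c p < -(3 * (y (c + 2) - S c) + 1)) := by
    intro y
    by_cases hy : wt y + 1 = M
    · obtain ⟨q, h1, h2⟩ := exists_strict_argmax (r := r) G
        (t := fun c => 3 * (y (c + 2) - S c) + 1) (by
          rw [Fin.sum_univ_three] at *
          rw [wt] at hy
          simp only [zero_add, Fin.reduceAdd]
          have : (y 0 : ℤ) + y 1 + y 2 + 1 = M := by exact_mod_cast hy
          linarith) (fun c => by omega)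
      exact ⟨q, fun _ => ⟨h1, h2⟩⟩
    · exact ⟨0, fun h => absurd h hy⟩
  have hdown : ∀ w : Pt, wt w + 2 = M → ∃ q, wt q = r ∧ ∀ p c, wt p + 1 = r →
      (q = p + e (c + 2) → -(3 * dif G c p) < 3 * (w (c + 2) - S c) + 2) ∧
      (q = p + e (c + 1) → 3 * dif G c p < -(3 * (w (c + 2) - S c) + 2)) := by
    intro w hw
    obtain ⟨q, h1, h2⟩ := exists_strict_argmax (r := r) G
      (t := fun c => 3 * (w (c + 2) - S c) + 2) (by
        rw [Fin.sum_univ_three] at *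
        rw [wt] at hw
        simp only [zero_add, Fin.reduceAdd]
        have : (w 0 : ℤ) + w 1 + w 2 + 2 = M := by exact_mod_cast hw
        linarith) (fun c => by omega)
    exact ⟨q, h1, h2⟩
  choose α hα using hup
  have hcmp : ∀ w, wt w + 2 = M → ∃ q', wt q' = r ∧ ∀ c,
      α (w + e c) (c + 1) = q' (c + 1) ∧ α (w + e c) (c + 2) ≤ q' (c + 2) := by
    intro w hw
    obtain ⟨q', hq', h'⟩ := hdown w hw
    refine ⟨q', hq', fun c => ?_⟩
    obtain ⟨hq, h⟩ := hα (w + e c) (by simp; omega)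
    refine argmax_compare hG (T := fun b => w (b + 2) - S b) hq hq' (fun p b hp => ?_) h'
    have := h p b hp
    simp only [Pi.add_apply] at this
    push_cast at this
    rw [show ((w (b + 2) : ℤ) - S b + e c (b + 2)) = w (b + 2) + e c (b + 2) - S b by ring]
    exact this
  obtain ⟨G', hG'⟩ := exists_potential (R := ℚ) (M := M)
    (z := fun c y => (α y (c + 1) : ℚ) - r / 3) (fun y hy => by
      have := (hα y hy).1
      rw [wt] at this
      rw [Fin.sum_univ_three]
      simp only [zero_add, Fin.reduceAdd]
      have : (α y 0 : ℚ) + α y 1 + α y 2 = r := by exact_mod_cast this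
      linarith) (fun w hw => by
      obtain ⟨q', hq', h⟩ := hcmp w hw
      rw [wt] at hq'
      simp only [(h _).1]
      rw [Fin.sum_univ_three]
      simp only [zero_add, Fin.reduceAdd]
      have : (q' 0 : ℚ) + q' 1 + q' 2 = r := by exact_mod_cast hq'
      linarith)
  have hive : IsHive M G' := by
    refine isHive_of_rhombus fun w c hw => ?_
    obtain ⟨q', hq', h⟩ := hcmp w hw
    have h1 := (h (c + 1)).1
    have h2 := (h c).2
    simp only [c11] at h1
    have g1 := hG' (w + e (c + 1)) (c + 1) (by simp; omega)
    have g2 := hG' (w + e c) (c + 1) (by simp; omega)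
    simp only [dif, c11, c12] at g1 g2
    have h3 : (α (w + e c) (c + 2) : ℚ) ≤ α (w + e (c + 1)) (c + 2) := by
      rw [h1]; exact_mod_cast h2
    rw [add_right_comm w (e (c + 1)) (e c)] at g1
    linarith
  have bd : HasBd M G' (fun c l => (α (sd c (M - 1 - l) l) (c + 1) : ℚ) - r / 3) := by
    intro c j l hj
    have := hG' (sd c j l) c (by simp; omega)
    rw [dif, sd_add_e1, sd_add_e2] at this
    simp only [this, show M - 1 - l = j by omega]
  refine UpLR.lr ⟨_, ⟨G', hive, bd⟩, fun c l hl => ?_⟩ ?_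
  · obtain ⟨hq, h⟩ := hα (sd c (M - 1 - l) l) (by simp; omega)
    set q := α (sd c (M - 1 - l) l) with hqdef
    have hle : q (c + 1) ≤ ((range r).filter fun i => (l : ℤ) < S c - Z c i).card := by
      rcases Nat.eq_zero_or_pos (q (c + 1)) with h1 | h1
      · omega
      obtain ⟨p, hp⟩ := pt_pred h1
      rw [hp] at hq
      simp only [wt_add, wt_e] at hq
      have h2 := (h p c hq).2 hp
      simp only [sd_2] at h2
      have h3 := hG.bd_le_dif hZ hq c
      have hp1 : q (c + 1) = p (c + 1) + 1 := by rw [hp]; simp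
      have hpr : p (c + 1) < r := by rw [wt_cyc _ c] at hq; omega
      have : (range r).filter (fun i => r - 1 - p (c + 1) ≤ i) ⊆
          (range r).filter fun i => (l : ℤ) < S c - Z c i := by
        intro i hi
        simp only [mem_filter, mem_range] at hi ⊢
        have h4 := LR.antitone ⟨G, hG, hZ⟩ c hi.2 hi.1
        exact ⟨hi.1, by omega⟩
      refine le_trans (le_of_eq ?_) (card_le_card this)
      have : (range r).filter (fun i => r - 1 - p (c + 1) ≤ i) =
          Ico (r - 1 - p (c + 1)) r := by
        ext i; simp; omega
      rw [this, Nat.card_Ico]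
      omega
    have : (q (c + 1) : ℚ) ≤ ((range r).filter fun i => (l : ℤ) < S c - Z c i).card := by
      exact_mod_cast hle
    linarith
  · have hb : ∀ c, ∀ i < r, 0 ≤ S c - Z c i ∧ S c - Z c i ≤ M := by
      intro c i hi
      have l1 : LR r Z := ⟨G, hG, hZ⟩
      have h1 := (l1.antitone c (Nat.zero_le i) hi).trans (h0 (by omega) c)
      have h2 := l1.weyl (s := fun a => if a = c then i else 0) (by simpa)
      rw [sum_cyc _ c] at h2 hS
      have e1 : c + 1 ≠ c := by fin_cases c <;> simp
      have e2 : c + 2 ≠ c := by fin_cases c <;> simp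
      simp only [if_true, e1, e2, if_false] at h2
      have h3 := h0 (by omega) (c + 1)
      have h4 := h0 (by omega) (c + 2)
      omega
    have hsum := fun c => sum_card_lt (r := r) (M := M) (v := fun i => S c - Z c i)
      (fun i hi => (hb c i hi).1) (fun i hi => (hb c i hi).2)
    have htr : ∑ c, ∑ i ∈ range r, Z c i = 0 := LR.trace ⟨G, hG, hZ⟩
    have h1 : ∑ c, ∑ l ∈ range M,
        (((range r).filter fun i => (l : ℤ) < S c - Z c i).card : ℤ) = r * M := by
      simp only [hsum, sum_sub_distrib, htr]
      simp only [sum_const, card_range, nsmul_eq_mul, sub_zero]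
      rw [← mul_sum, hS]
    simp only [sum_sub_distrib]
    have h2 : ∑ c, ∑ l ∈ range M,
        (((range r).filter fun i => (l : ℤ) < S c - Z c i).card : ℚ) = r * M := by
      exact_mod_cast h1
    rw [h2]
    simp only [sum_const, card_range, nsmul_eq_mul, card_univ,
      Fintype.card_fin]
    push_cast
    ring

/-! ### Reversal and complements of index sets -/

/-- Reversal of a subset of `range n`. -/
def revS (n : ℕ) (s : Finset ℕ) : Finset ℕ := s.image (fun i => n - 1 - i)

/-- Complement in `range n`. -/
def cpl (n : ℕ) (s : Finset ℕ) : Finset ℕ := range n \ s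

theorem mem_revS {n : ℕ} {s : Finset ℕ} (hs : s ⊆ range n) {i : ℕ} :
    i ∈ revS n s ↔ i < n ∧ n - 1 - i ∈ s := by
  simp only [revS, mem_image]
  constructor
  · rintro ⟨j, hj, rfl⟩
    have := mem_range.1 (hs hj)
    exact ⟨by omega, by rwa [show n - 1 - (n - 1 - j) = j by omega]⟩
  · rintro ⟨h1, h2⟩
    exact ⟨_, h2, by omega⟩

theorem revS_sub (n : ℕ) {s : Finset ℕ} (hs : s ⊆ range n) :
    revS n s ⊆ range n := fun i hi => by
  simpa using ((mem_revS hs).1 hi).1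

theorem cpl_sub (n : ℕ) (s : Finset ℕ) : cpl n s ⊆ range n := sdiff_subset

theorem mem_cpl {n i : ℕ} {s : Finset ℕ} : i ∈ cpl n s ↔ i < n ∧ i ∉ s := by simp [cpl]

theorem card_cpl {n : ℕ} {s : Finset ℕ} (hs : s ⊆ range n) :
    (cpl n s).card = n - s.card := by
  rw [cpl, card_sdiff_of_subset hs, card_range]

theorem card_revS {n : ℕ} {s : Finset ℕ} (hs : s ⊆ range n) :
    (revS n s).card = s.card := by
  refine card_image_of_injOn fun i hi j hj h => ?_
  have h1 := mem_range.1 (hs hi)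
  have h2 := mem_range.1 (hs hj)
  omega

theorem cpl_cpl {n : ℕ} {s : Finset ℕ} (hs : s ⊆ range n) : cpl n (cpl n s) = s := by
  ext i
  simp only [mem_cpl]
  constructor
  · rintro ⟨h1, h2⟩; by_contra h; exact h2 ⟨h1, h⟩
  · intro h; exact ⟨mem_range.1 (hs h), fun h' => h'.2 h⟩

theorem revS_cpl {n : ℕ} {s : Finset ℕ} (hs : s ⊆ range n) :
    revS n (cpl n s) = cpl n (revS n s) := by
  ext i
  rw [mem_revS (cpl_sub n s), mem_cpl, mem_cpl, mem_revS hs]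
  constructor
  · rintro ⟨h1, h2, h3⟩; exact ⟨h1, fun h => h3 h.2⟩
  · rintro ⟨h1, h2⟩; exact ⟨h1, by omega, fun h => h2 ⟨h1, h⟩⟩

theorem nthSmall_revS {n k : ℕ} {s : Finset ℕ} (hs : s ⊆ range n) (hk : k < s.card) :
    nthSmall (revS n s) k = n - 1 - nthSmall s (s.card - 1 - k) := by
  have hmem := nthSmall_mem (s := s) (k := s.card - 1 - k) (by omega)
  have hlt := mem_range.1 (hs hmem)
  apply nthSmall_of_card
  · rw [mem_revS hs]
    exact ⟨by omega, by rwa [show n - 1 - (n - 1 - nthSmall s (s.card - 1 - k)) =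
      nthSmall s (s.card - 1 - k) by omega]⟩
  · have : (revS n s).filter (· < n - 1 - nthSmall s (s.card - 1 - k)) =
        (range k).image (fun i => n - 1 - nthSmall s (s.card - 1 - i)) := by
      ext x
      simp only [mem_filter, mem_revS hs, mem_image, mem_range]
      constructor
      · rintro ⟨⟨h1, h2⟩, h3⟩
        obtain ⟨j, hj, hjx⟩ := exists_nthSmall h2
        have : nthSmall s (s.card - 1 - k) < nthSmall s j := by omega
        rw [nthSmall_lt_iff (by omega) hj] at this
        refine ⟨s.card - 1 - j, by omega, ?_⟩
        rw [show s.card - 1 - (s.card - 1 - j) = j by omega, hjx]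
        omega
      · rintro ⟨i, hi, rfl⟩
        have h1 := nthSmall_mem (s := s) (k := s.card - 1 - i) (by omega)
        have h2 := mem_range.1 (hs h1)
        have h3 := nthSmall_lt (s := s) (i := s.card - 1 - k) (k := s.card - 1 - i) (by omega)
          (by omega)
        exact ⟨⟨by omega, by rwa [show n - 1 - (n - 1 - nthSmall s (s.card - 1 - i)) =
          nthSmall s (s.card - 1 - i) by omega]⟩, by omega⟩
    rw [this, card_image_of_injOn, card_range]
    intro i hi j hj h
    simp only [coe_range, Set.mem_Iio] at hi hj
    have h1 := mem_range.1 (hs (nthSmall_mem (s := s) (k := s.card - 1 - i) (by omega)))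
    have h2 := mem_range.1 (hs (nthSmall_mem (s := s) (k := s.card - 1 - j) (by omega)))
    have h3 := nthSmall_injOn s (x₁ := s.card - 1 - i) (x₂ := s.card - 1 - j)
      (by simp; omega) (by simp; omega) (by simp only at h; omega)
    omega

theorem card_filter_lt_add {n x : ℕ} {s : Finset ℕ} (hx : x ≤ n) :
    (s.filter (· < x)).card + ((cpl n s).filter (· < x)).card = x := by
  have : range x = s.filter (· < x) ∪ (cpl n s).filter (· < x) := by
    ext i
    simp only [mem_range, mem_union, mem_filter, mem_cpl]
    constructor
    · intro h
      by_cases hi : i ∈ s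
      · exact Or.inl ⟨hi, h⟩
      · exact Or.inr ⟨⟨by omega, hi⟩, h⟩
    · rintro (h | h) <;> exact h.2
  conv_rhs => rw [← card_range x, this]
  rw [card_union_of_disjoint]
  rw [disjoint_left]
  intro i h1 h2
  simp only [mem_filter, mem_cpl] at h1 h2
  exact h2.1.2 h1.1

theorem card_conj {n m : ℕ} {s : Finset ℕ} (hs : s ⊆ range n) (hm : m < n - s.card) :
    ((range s.card).filter fun k => m + k < nthSmall s k).card + nthSmall (cpl n s) m =
      s.card + m := by
  have hmc : m < (cpl n s).card := by rwa [card_cpl hs]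
  set x := nthSmall (cpl n s) m with hx
  have hxm := mem_cpl.1 (nthSmall_mem hmc)
  have h1 := card_filter_lt_add (n := n) (s := s) (x := x) hxm.1.le
  rw [card_lt_nthSmall hmc] at h1
  have h2 : (range s.card).filter (fun k => m + k < nthSmall s k) =
      Ico (s.filter (· < x)).card s.card := by
    ext k
    simp only [mem_filter, mem_range, mem_Ico, and_comm (a := k < s.card)]
    refine and_congr_left fun hk => ?_
    have hkm := nthSmall_mem hk
    have hkn := mem_range.1 (hs hkm)
    have h3 := card_filter_lt_add (n := n) (s := s) (x := nthSmall s k) hkn.le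
    rw [card_lt_nthSmall hk] at h3
    have hne : nthSmall s k ≠ x := fun h => hxm.2 (by rw [← hx, ← h]; exact hkm)
    rcases lt_or_gt_of_ne hne with hlt | hgt
    · have a1 : (cpl n s).filter (· < nthSmall s k) ⊆ (cpl n s).filter (· < x) := fun i hi => by
        simp only [mem_filter] at hi ⊢; exact ⟨hi.1, by omega⟩
      have a1 := card_le_card a1
      rw [card_lt_nthSmall hmc] at a1
      have a2 : insert (nthSmall s k) (s.filter (· < nthSmall s k)) ⊆ s.filter (· < x) :=
        fun i hi => by
          simp only [mem_insert, mem_filter] at hi ⊢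
          rcases hi with rfl | hi
          · exact ⟨hkm, hlt⟩
          · exact ⟨hi.1, by omega⟩
      have a2 := card_le_card a2
      rw [card_insert_of_notMem (by simp), card_lt_nthSmall hk] at a2
      omega
    · have a1 : s.filter (· < x) ⊆ s.filter (· < nthSmall s k) := fun i hi => by
        simp only [mem_filter] at hi ⊢; exact ⟨hi.1, by omega⟩
      have a1 := card_le_card a1
      rw [card_lt_nthSmall hk] at a1
      have a2 : insert x ((cpl n s).filter (· < x)) ⊆ (cpl n s).filter (· < nthSmall s k) :=
        fun i hi => by
          simp only [mem_insert, mem_filter] at hi ⊢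
          rcases hi with rfl | hi
          · exact ⟨nthSmall_mem hmc, hgt⟩
          · exact ⟨hi.1, by omega⟩
      have a2 := card_le_card a2
      rw [card_insert_of_notMem (by simp), card_lt_nthSmall hmc] at a2
      omega
  rw [h2, Nat.card_Ico]
  have := card_le_card (filter_subset (· < x) s)
  omega

/-- The dual triple. -/
def dualS (n : ℕ) (s : Triple) : Triple := fun c => revS n (cpl n (s (-c)))

theorem IsE.le {n r : ℕ} {s : Triple} (h : IsE n r s) : r ≤ n := by
  have := card_le_card (h.sub 0)
  rwa [h.card, card_range] at this

theorem IsE.dual {n r : ℕ} {s : Triple} (h : IsE n r s) : IsE n (n - r) (dualS n s) := by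
  refine ⟨fun c => revS_sub n (cpl_sub n _), fun c => ?_, ?_⟩
  · rw [dualS, card_revS (cpl_sub n _), card_cpl (h.sub _), h.card]
  obtain ⟨z, hz, hzs⟩ := h.up
  obtain ⟨Q, hQ, G, Z, S, hG, hGZ, hS, hZ⟩ := exists_int_hive hz (fun _ => ((n : ℚ) - r) / 3)
  have hQ' : (0 : ℚ) < Q := by exact_mod_cast hQ
  have hsum : ∑ c, S c = ((Q * (n - r) : ℕ) : ℤ) := by
    have : ((∑ c, S c : ℤ) : ℚ) = ((Q * (n - r) : ℕ) : ℚ) := by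
      push_cast [Nat.cast_sub h.le]
      simp only [hS]
      simp; ring
    exact_mod_cast this
  have h0 : 0 < r → ∀ c, Z c 0 ≤ S c := fun hr c => by
    have h1 : z c 0 ≤ ((n : ℚ) - r) / 3 := (hzs c 0 hr).trans (by simp [setBd])
    have := mul_le_mul_of_nonneg_left h1 hQ'.le
    rw [← hS c, ← hZ c 0 hr] at this
    exact_mod_cast this
  have hd := (dual_hive hG hGZ hsum h0).scale_down.refl
  refine ⟨_, hd, fun c l hl => ?_⟩
  simp only [setBd]
  have hcard : (cpl n (s (-c))).card = n - r := by rw [card_cpl (h.sub _), h.card]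
  have hnt : nthSmall (dualS n s c) l = n - 1 - nthSmall (cpl n (s (-c))) (n - r - 1 - l) := by
    rw [dualS, nthSmall_revS (cpl_sub n _) (by rw [hcard]; omega), hcard]
  have hcj := card_conj (n := n) (m := n - r - 1 - l) (h.sub (-c)) (by rw [h.card]; omega)
  rw [h.card] at hcj
  have hmem := (mem_cpl.1 (nthSmall_mem (s := cpl n (s (-c))) (k := n - r - 1 - l)
    (by rw [hcard]; omega))).1
  set x := nthSmall (cpl n (s (-c))) (n - r - 1 - l)
  set K := ((range r).filter fun k => n - r - 1 - l + k < nthSmall (s (-c)) k).card with hK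
  have hnt' : (nthSmall (dualS n s c) l : ℚ) - l = K := by
    have hle := h.le
    have : nthSmall (dualS n s c) l = K + l := by omega
    rw [this]; push_cast; ring
  rw [hnt', Nat.cast_sub h.le]
  have hsumle : (Q : ℚ) * (K - r / 3) ≤ ∑ t ∈ range Q,
      ((((range r).filter fun i => ((Q * (n - r - 1 - l) + t : ℕ) : ℤ) <
        S (-c) - Z (-c) i).card : ℚ) - r / 3) := by
    rw [show (Q : ℚ) * (K - r / 3) = ∑ t ∈ range Q, ((K : ℚ) - r / 3) by
      simp [mul_sub]]
    refine sum_le_sum fun t ht => ?_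
    have ht := mem_range.1 ht
    have : K ≤ ((range r).filter fun i => ((Q * (n - r - 1 - l) + t : ℕ) : ℤ) <
        S (-c) - Z (-c) i).card := by
      refine card_le_card fun i hi => ?_
      simp only [mem_filter, mem_range] at hi ⊢
      refine ⟨hi.1, ?_⟩
      have g1 := hzs (-c) i hi.1
      rw [setBd] at g1
      have g2 : (Q : ℚ) * ((nthSmall (s (-c)) i : ℚ) - i) ≤ ((S (-c) - Z (-c) i : ℤ) : ℚ) := by
        push_cast
        rw [hS, hZ _ i hi.1]
        nlinarith
      have g3 : (Q : ℤ) * ((nthSmall (s (-c)) i : ℤ) - i) ≤ S (-c) - Z (-c) i := by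
        exact_mod_cast g2
      have g4 : ((n - r - 1 - l : ℕ) : ℤ) + 1 ≤ (nthSmall (s (-c)) i : ℤ) - i := by omega
      push_cast
      nlinarith
    have : (K : ℚ) ≤ ((range r).filter fun i => ((Q * (n - r - 1 - l) + t : ℕ) : ℤ) <
        S (-c) - Z (-c) i).card := by exact_mod_cast this
    linarith
  rw [mul_comm, ← le_div_iff₀ hQ'] at hsumle
  linarith

/-! ### Reduction of supports -/

theorem exists_hit {J : Type*} [Finite J] (f g : J → ℚ) (hf : ∀ j, 0 ≤ f j) (hg : ∃ j, g j < 0) :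
    ∃ s, 0 ≤ s ∧ (∀ j, 0 ≤ f j + s * g j) ∧ ∃ j, g j < 0 ∧ f j + s * g j = 0 := by
  obtain ⟨j, hj, hm⟩ := (Set.toFinite {j | g j < 0}).exists_minimalFor (fun j => f j / (- g j)) _ hg
  have hmin : ∀ i, g i < 0 → f j / (- g j) ≤ f i / (- g i) := fun i hi => by
    by_contra hlt
    exact hlt (hm (j := i) hi (le_of_lt (not_le.1 hlt)))
  have hj : g j < 0 := hj
  have hs : 0 ≤ f j / (- g j) := div_nonneg (hf j) (by linarith)
  refine ⟨f j / (- g j), hs, fun i => ?_, j, hj, ?_⟩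
  · rcases lt_or_ge (g i) 0 with hi | hi
    · have := hmin i hi
      rw [le_div_iff₀ (by linarith)] at this
      linarith
    · have := hf i
      positivity
  · have : g j ≠ 0 := by linarith
    field_simp
    ring

theorem support_reduction {ι J : Type*} [Fintype ι] [Finite J] (w : ι → ℚ)
    (L : J → (ι → ℚ) →ₗ[ℚ] ℚ) (P : (ι → ℚ) → Prop)
    (hP : ∀ u v, ∀ a b : ℚ, 0 ≤ a → 0 ≤ b → P u → P v → P (a • u + b • v))
    (htight : ∀ k : ι → ℚ, (∀ i, 0 ≤ k i) → ∑ i, w i * k i = 0 → (∀ j, 0 ≤ L j k) →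
      (∃ j, L j k = 0) → P k)
    (hbase : ∀ k : ι → ℚ, (∀ i, 0 ≤ k i) → ∑ i, w i * k i = 0 → (∀ j, 0 ≤ L j k) →
      (∀ i j, 0 < k i → 0 < k j → (w i = 0 ∧ w j = 0 ∨ 0 < w i * w j) → i = j) → P k)
    (k : ι → ℚ) (h0 : ∀ i, 0 ≤ k i) (hw : ∑ i, w i * k i = 0) (hL : ∀ j, 0 ≤ L j k) : P k := by
  classical
  obtain ⟨m, hm⟩ : ∃ m, (univ.filter fun i => 0 < k i).card = m := ⟨_, rfl⟩
  induction m using Nat.strong_induction_on generalizing k with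
  | _ m ih =>
  by_cases hc : ∀ i j, 0 < k i → 0 < k j → (w i = 0 ∧ w j = 0 ∨ 0 < w i * w j) → i = j
  · exact hbase k h0 hw hL hc
  push Not at hc
  obtain ⟨i₀, j₀, hi₀, hj₀, hcomp, hne₀⟩ := hc
  have step : ∀ i j : ι, 0 < k i → 0 < k j → i ≠ j → ∀ a b : ℚ, 0 < a → 0 < b →
      w i * a = w j * b → ∃ s : ℚ, 0 ≤ s ∧ P (k + s • (a • Pi.single i 1 - b • Pi.single j 1)) := by
    intro i j hi hj hne a b ha hb hab
    set d : ι → ℚ := a • Pi.single i 1 - b • Pi.single j 1 with hd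
    have dj : d j = - b := by simp [hd, Ne.symm hne]
    have di : d i = a := by simp [hd, hne]
    have do_ : ∀ l, l ≠ i → l ≠ j → d l = 0 := fun l h1 h2 => by
      simp [hd, h1, h2]
    obtain ⟨s, hs, hpos, j', hg', hz⟩ := exists_hit (J := Option J)
      (fun o => o.elim (k j) (fun o => L o k)) (fun o => o.elim (d j) (fun o => L o d))
      (by rintro (_ | o); exacts [hj.le, hL o]) ⟨none, by simp [dj, hb]⟩
    have kpos : ∀ l, 0 ≤ (k + s • d) l := by
      intro l
      simp only [Pi.add_apply, Pi.smul_apply, smul_eq_mul]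
      by_cases h1 : l = j
      · subst h1; simpa using hpos none
      by_cases h2 : l = i
      · subst h2; rw [di]; have := h0 l; positivity
      · rw [do_ l h2 h1]; simpa using h0 l
    have kw : ∑ l, w l * (k + s • d) l = 0 := by
      have : ∑ l, w l * d l = 0 := by
        simp only [hd, Pi.sub_apply, Pi.smul_apply, smul_eq_mul, mul_sub]
        rw [sum_sub_distrib]
        simp [Pi.single_apply]
        linarith
      simp only [Pi.add_apply, Pi.smul_apply, smul_eq_mul, mul_add, sum_add_distrib, hw,
        zero_add]
      rw [← mul_zero s, ← this, mul_sum]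
      exact sum_congr rfl fun l _ => by ring
    have kL : ∀ o, 0 ≤ L o (k + s • d) := fun o => by
      simpa using hpos (some o)
    refine ⟨s, hs, ?_⟩
    rcases j' with _ | o
    · have hz : k j + s * d j = 0 := hz
      refine ih _ ?_ _ kpos kw kL rfl
      rw [← hm]
      refine card_lt_card ⟨fun l hl => ?_, fun h => ?_⟩
      · simp only [mem_filter, mem_univ, true_and] at hl ⊢
        by_contra hkl
        by_cases h1 : l = j
        · exact hkl (h1 ▸ hj)
        by_cases h2 : l = i
        · exact hkl (h2 ▸ hi)
        · simp only [Pi.add_apply, Pi.smul_apply, smul_eq_mul, do_ l h2 h1] at hl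
          exact hkl (by simpa using hl)
      · have := h (show j ∈ _ by simpa using hj)
        simp only [mem_filter, mem_univ, true_and, Pi.add_apply, Pi.smul_apply,
          smul_eq_mul] at this
        linarith
    · refine htight _ kpos kw kL ⟨o, ?_⟩
      simpa using hz
  obtain ⟨a, b, ha, hb, hab⟩ : ∃ a b : ℚ, 0 < a ∧ 0 < b ∧ w i₀ * a = w j₀ * b := by
    rcases hcomp with h | h
    · exact ⟨1, 1, one_pos, one_pos, by rw [h.1, h.2]⟩
    · have h1 : w i₀ ≠ 0 := fun h' => by rw [h'] at h; simp at h
      have h2 : w j₀ ≠ 0 := fun h' => by rw [h'] at h; simp at h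
      refine ⟨|w j₀|, |w i₀|, abs_pos.2 h2, abs_pos.2 h1, ?_⟩
      rcases lt_or_gt_of_ne h1 with h3 | h3
      · have h4 : w j₀ < 0 := by nlinarith
        rw [abs_of_neg h3, abs_of_neg h4]; ring
      · have h4 : 0 < w j₀ := by nlinarith
        rw [abs_of_pos h3, abs_of_pos h4]; ring
  obtain ⟨s, hs, hPs⟩ := step i₀ j₀ hi₀ hj₀ hne₀ a b ha hb hab
  obtain ⟨t, ht, hPt⟩ := step j₀ i₀ hj₀ hi₀ hne₀.symm b a hb ha hab.symm
  rcases hs.eq_or_lt with h | h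
  · rw [← h] at hPs; simpa using hPs
  have hst : 0 < s + t := by linarith
  have := hP _ _ (t / (s + t)) (s / (s + t)) (by positivity) (by positivity) hPs hPt
  convert this using 1
  funext l
  simp only [Pi.add_apply, Pi.smul_apply, Pi.sub_apply, smul_eq_mul]
  field_simp
  ring

/-! ### Restriction to index sets -/

/-- The value of the inequality attached to `s`. -/
def evS (s : Triple) (x : Bdry) : ℚ := ∑ c, ∑ i ∈ s c, x c i

/-- Restriction of sequences to index sets. -/
def res (s : Triple) (x : Bdry) : Bdry :=
  fun c k => x c (nthSmall (s c) k)

/-- The subset of `s` given by the indices in `P`. -/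
def pick (s P : Finset ℕ) : Finset ℕ := P.image (nthSmall s)

theorem pick_injOn {s P : Finset ℕ} (hP : P ⊆ range s.card) :
    Set.InjOn (nthSmall s) P :=
  (nthSmall_injOn s).mono (by exact_mod_cast hP)

theorem card_pick {s P : Finset ℕ} (hP : P ⊆ range s.card) : (pick s P).card = P.card :=
  card_image_of_injOn (pick_injOn hP)

theorem pick_sub {s P : Finset ℕ} (hP : P ⊆ range s.card) : pick s P ⊆ s := fun i hi => by
  obtain ⟨k, hk, rfl⟩ := mem_image.1 hi
  exact nthSmall_mem (mem_range.1 (hP hk))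

theorem sum_pick {M : Type*} [AddCommMonoid M] {s P : Finset ℕ} (hP : P ⊆ range s.card)
    (f : ℕ → M) : ∑ i ∈ pick s P, f i = ∑ k ∈ P, f (nthSmall s k) :=
  sum_image (pick_injOn hP)

theorem nthSmall_pick {s P : Finset ℕ} (hP : P ⊆ range s.card) {k : ℕ} (hk : k < P.card) :
    nthSmall (pick s P) k = nthSmall s (nthSmall P k) := by
  have hPm := fun {j} (hj : j ∈ P) => mem_range.1 (hP hj)
  apply nthSmall_of_card
  · exact mem_image_of_mem _ (nthSmall_mem hk)
  · have : (pick s P).filter (· < nthSmall s (nthSmall P k)) =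
        pick s (P.filter (· < nthSmall P k)) := by
      ext i
      simp only [pick, mem_filter, mem_image]
      constructor
      · rintro ⟨⟨j, hj, rfl⟩, h⟩
        exact ⟨j, ⟨hj, (nthSmall_lt_iff (hPm hj) (hPm (nthSmall_mem hk))).1 h⟩, rfl⟩
      · rintro ⟨j, ⟨hj, h⟩, rfl⟩
        exact ⟨⟨j, hj, rfl⟩, nthSmall_lt h (hPm (nthSmall_mem hk))⟩
    rw [this, card_pick ((filter_subset _ _).trans hP), card_lt_nthSmall hk]

theorem nthSmall_range {n k : ℕ} (hk : k < n) : nthSmall (range n) k = k := by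
  apply nthSmall_of_card (mem_range.2 hk)
  have : (range n).filter (· < k) = range k := by ext; simp; omega
  rw [this, card_range]

theorem sum_cpl {M : Type*} [AddCommGroup M] {n : ℕ} {s : Finset ℕ} (hs : s ⊆ range n)
    (f : ℕ → M) : ∑ i ∈ cpl n s, f i = ∑ i ∈ range n, f i - ∑ i ∈ s, f i := by
  rw [cpl, ← sum_sdiff hs]; abel

theorem sum_revS {M : Type*} [AddCommMonoid M] {n : ℕ} {s : Finset ℕ} (hs : s ⊆ range n)
    (f : ℕ → M) : ∑ i ∈ revS n s, f i = ∑ i ∈ s, f (n - 1 - i) := by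
  refine sum_image fun i hi j hj h => ?_
  have h1 := mem_range.1 (hs hi)
  have h2 := mem_range.1 (hs hj)
  omega

/-- Weakly decreasing sequences of length `n`. -/
def Dec (n : ℕ) (x : Bdry) : Prop := ∀ c i j, i ≤ j → j < n → x c j ≤ x c i

theorem Dec.res {n : ℕ} {x : Bdry} (h : Dec n x) {r : ℕ} {s : Triple}
    (hs : ∀ c, s c ⊆ range n) (hr : ∀ c, (s c).card = r) : Dec r (res s x) :=
  fun c i j hij hj => h c _ _ (nthSmall_le hij (by rw [hr]; exact hj))
    (mem_range.1 (hs c (nthSmall_mem (by rw [hr]; exact hj))))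

theorem dec_setBd {n r : ℕ} {s : Triple} (hr : ∀ c, (s c).card = r) :
    Dec r (setBd n r s) := fun c i j hij hj => by
  have h1 := nthSmall_sub_le (s := s c) hij (by rw [hr]; exact hj)
  have h2 : (nthSmall (s c) i : ℚ) + j ≤ nthSmall (s c) j + i := by exact_mod_cast h1
  simp only [setBd]
  linarith

theorem evS_res {r : ℕ} {s P : Triple} (hr : ∀ c, (s c).card = r)
    (hP : ∀ c, P c ⊆ range r) (x : Bdry) :
    evS P (res s x) = evS (fun c => pick (s c) (P c)) x := by
  unfold evS
  refine sum_congr rfl fun c _ => ?_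
  rw [sum_pick (by rw [hr]; exact hP c)]
  rfl

theorem UpLR.split {n r : ℕ} {s : Triple} (hs : ∀ c, s c ⊆ range n)
    (hr : ∀ c, (s c).card = r) {x : Bdry} (hx : Dec n x) (h1 : UpLR r (res s x))
    (h2 : UpLR (n - r) (res (fun c => cpl n (s c)) x)) : UpLR n x := by
  have hrn : r ≤ n := by
    have := card_le_card (hs 0)
    rwa [hr, card_range] at this
  have := h1.merge h2 (x := fun c k => x c k) ?_
  · rwa [Nat.add_sub_cancel' hrn] at this
  intro c θ l₁ l₂ hl₁ hl₂ hu hv k hk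
  have hcc : (cpl n (s c)).card = n - r := by rw [card_cpl (hs c), hr]
  set U := (range l₁).image (nthSmall (s c)) ∪ (range l₂).image (nthSmall (cpl n (s c)))
    with hU
  have hcard : U.card = l₁ + l₂ := by
    rw [hU, card_union_of_disjoint]
    · rw [card_image_of_injOn, card_image_of_injOn, card_range,
        card_range]
      · exact (nthSmall_injOn _).mono (by rw [hcc]; simpa using hl₂)
      · exact (nthSmall_injOn _).mono (by rw [hr]; simpa using hl₁)
    · rw [disjoint_left]
      intro i hi hi'
      obtain ⟨a, ha, rfl⟩ := mem_image.1 hi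
      obtain ⟨b, hb, hab⟩ := mem_image.1 hi'
      have g1 := nthSmall_mem (s := s c) (k := a) (by rw [hr]; have := mem_range.1 ha; omega)
      have g2 := nthSmall_mem (s := cpl n (s c)) (k := b)
        (by rw [hcc]; have := mem_range.1 hb; omega)
      rw [hab] at g2
      exact (mem_cpl.1 g2).2 g1
  obtain ⟨i, hi, hik⟩ : ∃ i ∈ U, k ≤ i := by
    by_contra hcon
    push Not at hcon
    have := card_le_card (show U ⊆ range k from fun i hi => by simpa using hcon i hi)
    rw [card_range, hcard] at this
    omega
  have key : θ ≤ x c i ∧ i < n := by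
    rcases mem_union.1 hi with hi | hi
    · obtain ⟨a, ha, rfl⟩ := mem_image.1 hi
      have ha := mem_range.1 ha
      exact ⟨hu a ha, mem_range.1 (hs c (nthSmall_mem (by rw [hr]; omega)))⟩
    · obtain ⟨a, ha, rfl⟩ := mem_image.1 hi
      have ha := mem_range.1 ha
      exact ⟨hv a ha, (mem_cpl.1 (nthSmall_mem (by rw [hcc]; omega))).1⟩
  exact key.1.trans (hx c k i hik key.2)

/-! ### The main theorem on hives -/

/-- The cone defined by all the inequalities. -/
def InK (n : ℕ) (x : Bdry) : Prop :=
  Dec n x ∧ ∀ r s, IsE n r s → 0 ≤ evS s x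

theorem UpLR.inK {n : ℕ} {x : Bdry} (hx : Dec n x) (h : UpLR n x) : InK n x :=
  ⟨hx, fun _ _ hs => hs.valid h⟩

theorem LR.dec {n : ℕ} {x : Bdry} (h : LR n x) : Dec n x :=
  fun c _ _ hij hj => h.antitone c hij hj

theorem isE_full (n : ℕ) : IsE n n (fun _ => range n) :=
  ⟨fun _ => subset_rfl, fun _ => card_range n, ⟨_, LR.zero n, fun c i hi => by
    simp [setBd, nthSmall_range hi]⟩⟩

theorem IsE.eq_full {n : ℕ} {s : Triple} (h : IsE n n s) (c : Fin 3) :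
    s c = range n :=
  eq_of_subset_of_card_le (h.sub c) (by rw [h.card, card_range])

theorem isE_one {n : ℕ} {p : Fin 3 → ℕ} (hp : ∑ c, p c < n) : IsE n 1 (fun c => {p c}) := by
  refine ⟨fun c => ?_, fun c => by simp, ?_⟩
  · have := single_le_sum (f := p) (fun i _ => Nat.zero_le _) (mem_univ c)
    simp; omega
  · refine (UpLR.const 1 (s := fun c => ((n : ℚ) - 1) / 3 - p c) ?_).mono fun c i hi => ?_
    · rw [sum_sub_distrib]
      have : ((∑ c, p c : ℕ) : ℚ) + 1 ≤ n := by exact_mod_cast hp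
      push_cast at this
      simp; linarith
    · obtain rfl : i = 0 := by omega
      have : nthSmall {p c} 0 = p c := by simp [nthSmall]
      simp [setBd, this]

/-- Transitivity of the index sets, in size `m`. -/
def TransAt (m : ℕ) : Prop := ∀ n r I P, IsE n r I → IsE r m P → IsE n m (fun c => pick (I c) (P c))

/-- Sufficiency of the inequalities, in size `n`. -/
def MainAt (n : ℕ) : Prop := ∀ x, InK n x → UpLR n x

theorem setBd_pick {n r m : ℕ} {I P : Triple} (hI : ∀ c, (I c).card = r)
    (hP : ∀ c, P c ⊆ range r) (hPc : ∀ c, (P c).card = m) (c : Fin 3) {k : ℕ} (hk : k < m) :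
    setBd n m (fun c => pick (I c) (P c)) c k = res P (setBd n r I) c k + setBd r m P c k := by
  simp only [setBd, res]
  rw [nthSmall_pick (by rw [hI]; exact hP c) (by rw [hPc]; exact hk)]
  ring

theorem transAt_of {m : ℕ} (hmain : MainAt m) (ih : ∀ t < m, TransAt t) : TransAt m := by
  intro n r I P hI hP
  have hsub : ∀ c, P c ⊆ range (I c).card := fun c => by rw [hI.card]; exact hP.sub c
  have hcard : ∀ c, (pick (I c) (P c)).card = m := fun c => by rw [card_pick (hsub c), hP.card]
  refine ⟨fun c => (pick_sub (hsub c)).trans (hI.sub c), hcard, hmain _ ⟨dec_setBd hcard, ?_⟩⟩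
  intro t R hR
  have h1 : evS R (setBd n m fun c => pick (I c) (P c)) =
      evS (fun c => pick (P c) (R c)) (setBd n r I) + evS R (setBd r m P) := by
    rw [← evS_res hP.card hR.sub]
    simp only [evS, ← sum_add_distrib]
    refine sum_congr rfl fun c _ => sum_congr rfl fun k hk => ?_
    exact setBd_pick hI.card hP.sub hP.card c (mem_range.1 (hR.sub c hk))
  rw [h1]
  refine add_nonneg ?_ (hR.valid hP.up)
  rcases hR.le.eq_or_lt with rfl | hlt
  · have : (fun c => pick (P c) (R c)) = P := by
      funext c
      rw [hR.eq_full c]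
      conv_rhs => rw [← image_nthSmall (P c), hP.card]
      rfl
    rw [this]
    exact hP.valid hI.up
  · exact (ih t hlt r m P R hP hR).valid hI.up

theorem inK_res {n r : ℕ} (ih : ∀ t < n, TransAt t) {I : Triple} (hI : IsE n r I)
    (hr : r < n) {x : Bdry} (hx : InK n x) : InK r (res I x) := by
  refine ⟨hx.1.res hI.sub hI.card, fun t P hP => ?_⟩
  rw [evS_res hI.card hP.sub]
  exact hx.2 t _ (ih t (hP.le.trans_lt hr) n r I P hI hP)

theorem evS_dual {n : ℕ} {s : Triple} (hs : ∀ c, s c ⊆ range n)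
    (x : Bdry) : evS (dualS n s) x = ∑ c, (∑ i ∈ range n, x c i -
      ∑ i ∈ s (-c), x c (n - 1 - i)) := by
  unfold evS
  refine sum_congr rfl fun c _ => ?_
  rw [dualS, sum_revS (cpl_sub n _), sum_cpl (hs _), sum_range_reflect]

/-- Quotients: a triple in the complement of `I` can be added to `I`. -/
theorem exists_quot {n r t : ℕ} (ih : ∀ t < n, TransAt t) {I P : Triple}
    (hI : IsE n r I) (hr : 0 < r) (hP : IsE (n - r) t P) : ∃ J, IsE n (r + t) J ∧
      ∀ x, evS J x = evS I x + evS P (res (fun c => cpl n (I c)) x) := by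
  have hle := hI.le
  have htle := hP.le
  have h1 := ih (n - r - t) (by omega) n (n - r) _ _ hI.dual hP.dual
  have hsub : ∀ c, dualS (n - r) P c ⊆ range (dualS n I c).card := fun c => by
    rw [hI.dual.card]; exact hP.dual.sub c
  refine ⟨_, by have := h1.dual; rwa [show n - (n - r - t) = r + t by omega] at this,
    fun x => ?_⟩
  rw [evS_dual h1.sub]
  unfold evS
  rw [← sum_add_distrib]
  refine sum_congr rfl fun c _ => ?_
  have hcc : (cpl n (I c)).card = n - r := by rw [card_cpl (hI.sub c), hI.card]
  rw [sum_pick (hsub _)]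
  have e1 : ∑ k ∈ dualS (n - r) P (-c), x c (n - 1 - nthSmall (dualS n I (-c)) k) =
      ∑ k ∈ dualS (n - r) P (-c), res (fun c => cpl n (I c)) x c (n - r - 1 - k) := by
    refine sum_congr rfl fun k hk => ?_
    have hk := mem_range.1 (hP.dual.sub _ hk)
    simp only [dualS, res, neg_neg]
    rw [nthSmall_revS (cpl_sub n _) (by rw [hcc]; exact hk), hcc]
    have := (mem_cpl.1 (nthSmall_mem (s := cpl n (I c)) (k := n - r - 1 - k)
      (by rw [hcc]; omega))).1
    congr 1
    omega
  rw [e1, dualS, neg_neg, sum_revS (cpl_sub _ _)]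
  have e2 : ∑ i ∈ cpl (n - r) (P c), res (fun c => cpl n (I c)) x c (n - r - 1 - (n - r - 1 - i)) =
      ∑ i ∈ cpl (n - r) (P c), res (fun c => cpl n (I c)) x c i := by
    refine sum_congr rfl fun i hi => ?_
    have := (mem_cpl.1 hi).1
    rw [show n - r - 1 - (n - r - 1 - i) = i by omega]
  rw [e2, sum_cpl (hP.sub c)]
  have e3 : ∑ i ∈ range (n - r), res (fun c => cpl n (I c)) x c i =
      ∑ i ∈ range n, x c i - ∑ i ∈ I c, x c i := by
    rw [← sum_cpl (hI.sub c), ← sum_nthSmall (cpl n (I c)), hcc]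
    rfl
  rw [e3]
  ring

theorem inK_res_cpl {n r : ℕ} (ih : ∀ t < n, TransAt t) {I : Triple} (hI : IsE n r I)
    (hr : 0 < r) {x : Bdry} (hx : InK n x) (h0 : evS I x = 0) :
    InK (n - r) (res (fun c => cpl n (I c)) x) := by
  refine ⟨hx.1.res (fun c => cpl_sub n _) (fun c => by rw [card_cpl (hI.sub c), hI.card]),
    fun t P hP => ?_⟩
  obtain ⟨J, hJ, hev⟩ := exists_quot ih hI hr hP
  have := hx.2 _ J hJ
  rw [hev, h0] at this
  linarith

theorem upLR_of_tight {n r : ℕ} (ihM : ∀ m < n, MainAt m) (ihT : ∀ m < n, TransAt m)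
    {I : Triple} (hI : IsE n r I) (hr : 0 < r) (hrn : r < n) {x : Bdry}
    (hx : InK n x) (h0 : evS I x = 0) : UpLR n x :=
  UpLR.split hI.sub hI.card hx.1 (ihM r hrn _ (inK_res ihT hI hrn hx))
    (ihM (n - r) (by omega) _ (inK_res_cpl ihT hI hr hx h0))

/-- The index sets of proper inequalities. -/
def properE (n : ℕ) : Set (Triple) := {s | ∃ r, 0 < r ∧ r < n ∧ IsE n r s}

theorem finite_sub_range (n : ℕ) : {s : Triple | ∀ c, s c ⊆ range n}.Finite := by
  have := Set.Finite.pi' (ι := Fin 3) (t := fun _ => {s : Finset ℕ | s ⊆ range n})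
    (fun _ => by
      have h := (range n).powerset.finite_toSet
      exact h.subset fun s hs => mem_coe.2 (mem_powerset.2 hs))
  exact this

instance (n : ℕ) : Finite (properE n) := by
  refine Set.Finite.to_subtype ((finite_sub_range n).subset ?_)
  rintro s ⟨r, -, -, h⟩
  exact h.sub

/-- Sequences with zero sums and given differences. -/
def genX (m : ℕ) (k : Fin 3 × Fin m → ℚ) (c : Fin 3) (l : ℕ) : ℚ :=
  ∑ i : Fin m, k (c, i) * ((if l ≤ i then 1 else 0) - ((i : ℚ) + 1) / (m + 1))

theorem sum_genX (m : ℕ) (k : Fin 3 × Fin m → ℚ) (c : Fin 3) :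
    ∑ l ∈ range (m + 1), genX m k c l = 0 := by
  simp only [genX]
  rw [sum_comm]
  refine sum_eq_zero fun i _ => ?_
  rw [← mul_sum, sum_sub_distrib, sum_boole]
  have : (range (m + 1)).filter (fun l => l ≤ (i : ℕ)) = range (i + 1) := by
    ext l; simp; have := i.2; omega
  rw [this]
  simp
  have : (m : ℚ) + 1 ≠ 0 := by positivity
  field_simp
  simp

theorem genX_sub_last (m : ℕ) (x : ℕ → ℚ) {l : ℕ} (hl : l ≤ m) :
    ∑ i : Fin m, (x i - x (i + 1)) * (if l ≤ (i : ℕ) then 1 else 0) = x l - x m := by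
  rw [Fin.sum_univ_eq_sum_range (fun i => (x i - x (i + 1)) * (if l ≤ i then 1 else 0)) m]
  induction m with
  | zero => obtain rfl : l = 0 := by omega
            simp
  | succ m ih =>
    rw [sum_range_succ]
    rcases hl.eq_or_lt with rfl | h
    · rw [sum_eq_zero fun i hi => by
        have := mem_range.1 hi; rw [if_neg (by omega), mul_zero]]
      rw [if_neg (by omega)]; simp
    · rw [ih (by omega), if_pos (by omega)]; ring

theorem exists_genX {m : ℕ} {x : Bdry} (hx : Dec (m + 1) x)
    (ht : ∑ c, ∑ l ∈ range (m + 1), x c l = 0) :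
    ∃ k : Fin 3 × Fin m → ℚ, (∀ i, 0 ≤ k i) ∧ ∃ s : Fin 3 → ℚ, ∑ c, s c = 0 ∧
      ∀ c, ∀ l < m + 1, x c l = genX m k c l + s c := by
  refine ⟨fun i => x i.1 i.2 - x i.1 (i.2 + 1), fun i => ?_, fun c => x c m + ∑ i : Fin m,
    (x c i - x c (i + 1)) * (((i : ℚ) + 1) / (m + 1)), ?_⟩
  · have := hx i.1 i.2 (i.2 + 1) (by omega) (by have := i.2.2; omega)
    linarith
  have key : ∀ c, ∀ l < m + 1, x c l = genX m (fun i => x i.1 i.2 - x i.1 (i.2 + 1)) c l +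
      (x c m + ∑ i : Fin m, (x c i - x c (i + 1)) * (((i : ℚ) + 1) / (m + 1))) := by
    intro c l hl
    have := genX_sub_last m (x c) (l := l) (by omega)
    simp only [genX, mul_sub, sum_sub_distrib]
    rw [this]; ring
  refine ⟨?_, key⟩
  have h1 : ∑ c, ∑ l ∈ range (m + 1), x c l = ∑ c, ∑ l ∈ range (m + 1),
      (genX m (fun i => x i.1 i.2 - x i.1 (i.2 + 1)) c l +
      (x c m + ∑ i : Fin m, (x c i - x c (i + 1)) * (((i : ℚ) + 1) / (m + 1)))) :=
    sum_congr rfl fun c _ => sum_congr rfl fun l hl =>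
      key c l (mem_range.1 hl)
  rw [ht] at h1
  simp only [sum_add_distrib, sum_genX] at h1
  simp only [sum_const, card_range, nsmul_eq_mul, ← mul_add, ← mul_sum,
    mul_zero, zero_add, ← sum_add_distrib] at h1
  have h2 : ((m + 1 : ℕ) : ℚ) ≠ 0 := by positivity
  exact (mul_eq_zero.1 h1.symm).resolve_left h2

theorem evS_add (s : Triple) (x y : Bdry) :
    evS s (fun c i => x c i + y c i) = evS s x + evS s y := by
  simp [evS, sum_add_distrib]

theorem evS_const {r : ℕ} {s : Triple} (hr : ∀ c, (s c).card = r) (a : Fin 3 → ℚ) :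
    evS s (fun c _ => a c) = r * ∑ c, a c := by
  simp [evS, hr, mul_sum]

theorem evS_congr {n : ℕ} {s : Triple} (hs : ∀ c, s c ⊆ range n)
    {x y : Bdry} (h : ∀ c, ∀ i < n, x c i = y c i) : evS s x = evS s y :=
  sum_congr rfl fun c _ => sum_congr rfl fun i hi =>
    h c i (mem_range.1 (hs c hi))

theorem dec_genX {m : ℕ} {k : Fin 3 × Fin m → ℚ} (hk : ∀ i, 0 ≤ k i) : Dec (m + 1) (genX m k) := by
  intro c i j hij _
  refine sum_le_sum fun l _ => mul_le_mul_of_nonneg_left ?_ (hk _)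
  split_ifs <;> first | omega | linarith

/-- `evS s` as a linear functional of the differences. -/
def evGen (m : ℕ) (s : Triple) : (Fin 3 × Fin m → ℚ) →ₗ[ℚ] ℚ where
  toFun k := evS s (genX m k)
  map_add' k k' := by
    simp only [evS, genX, Pi.add_apply, add_mul, sum_add_distrib]
  map_smul' a k := by
    simp only [evS, genX, Pi.smul_apply, smul_eq_mul, RingHom.id_apply, mul_sum, mul_assoc]

theorem genX_comb (m : ℕ) (k k' : Fin 3 × Fin m → ℚ) (a b : ℚ) (c : Fin 3) (l : ℕ) :
    genX m (a • k + b • k') c l = a * genX m k c l + b * genX m k' c l := by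
  simp only [genX, Pi.add_apply, Pi.smul_apply, smul_eq_mul, add_mul, sum_add_distrib,
    mul_sum, mul_assoc]

theorem upLR_of_trace_zero {n : ℕ} (ihM : ∀ m < n, MainAt m) (ihT : ∀ m < n, TransAt m)
    {x : Bdry} (hx : InK n x) (ht : ∑ c, ∑ l ∈ range n, x c l = 0) :
    UpLR n x := by
  rcases n with _ | m
  · exact UpLR.empty x
  have hfull : ∀ k, evS (fun _ => range (m + 1)) (genX m k) = 0 := fun k => by
    simp [evS, sum_genX]
  have hinK : ∀ k : Fin 3 × Fin m → ℚ, (∀ i, 0 ≤ k i) →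
      (∀ j : properE (m + 1), 0 ≤ evGen m j.1 k) → InK (m + 1) (genX m k) := by
    intro k hk hL
    refine ⟨dec_genX hk, fun r s hs => ?_⟩
    rcases Nat.eq_zero_or_pos r with rfl | hr
    · have : ∀ c, s c = ∅ := fun c => card_eq_zero.1 (hs.card c)
      simp [evS, this]
    rcases hs.le.eq_or_lt with rfl | hlt
    · rw [show s = fun _ => range (m + 1) from funext hs.eq_full, hfull]
    · exact hL ⟨s, r, hr, hlt, hs⟩
  have key := support_reduction (ι := Fin 3 × Fin m) (J := properE (m + 1)) (fun _ => 0)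
    (fun j => evGen m j.1) (fun k => UpLR (m + 1) (genX m k)) ?_ ?_ ?_
  · obtain ⟨k, hk, s, hs, hxs⟩ := exists_genX hx.1 ht
    have h1 := key k hk (by simp) (fun j => by
      obtain ⟨r, h1, h2, h3⟩ := j.2
      have h4 := hx.2 r j.1 h3
      rw [evS_congr h3.sub hxs, evS_add, evS_const h3.card, hs, mul_zero, add_zero] at h4
      exact h4)
    refine (h1.add (UpLR.of_LR (LR.const (m + 1) hs))).mono fun c i hi => ?_
    rw [hxs c i hi]
  · intro u v a b ha hb hu hv
    refine ((hu.smul ha).add (hv.smul hb)).mono fun c i _ => ?_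
    rw [genX_comb]
  · rintro k hk - hL ⟨j, hj⟩
    obtain ⟨r, h1, h2, h3⟩ := j.2
    exact upLR_of_tight ihM ihT h3 h1 h2 (hinK k hk hL) hj
  · intro k hk _ hL hsupp
    by_cases hz : ∀ i, k i = 0
    · refine (UpLR.of_LR (LR.zero (m + 1))).mono fun c i _ => ?_
      simp [genX, hz]
    push Not at hz
    obtain ⟨⟨c, i⟩, hi⟩ := hz
    have hpos : 0 < k (c, i) := lt_of_le_of_ne (hk _) (Ne.symm hi)
    have hzero : ∀ j, j ≠ (c, i) → k j = 0 := fun j hj => by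
      by_contra h
      exact hj (hsupp j (c, i) (lt_of_le_of_ne (hk _) (Ne.symm h)) hpos (Or.inl ⟨rfl, rfl⟩))
    have hm : 0 < m := lt_of_le_of_lt (Nat.zero_le _) i.2
    have hE := isE_one (n := m + 1) (p := fun a => if a = c then m else 0) (by simp)
    have h1 := (hinK k hk hL).2 1 _ hE
    exfalso
    simp only [evS, sum_singleton] at h1
    rw [sum_cyc _ c] at h1
    have e1 : c + 1 ≠ c := by fin_cases c <;> simp
    have e2 : c + 2 ≠ c := by fin_cases c <;> simp
    have g1 : ∀ a, a ≠ c → ∀ l, genX m k a l = 0 := fun a ha l => by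
      simp only [genX]
      refine sum_eq_zero fun i' _ => ?_
      rw [hzero (a, i') (by simp [ha]), zero_mul]
    rw [g1 _ e1, g1 _ e2, if_pos rfl, add_zero, add_zero, genX,
      sum_eq_single i] at h1
    · rw [if_neg (by have := i.2; omega)] at h1
      have : 0 < ((i : ℚ) + 1) / (m + 1) := by positivity
      nlinarith
    · intro b _ hb
      rw [hzero (c, b) (by simp [hb]), zero_mul]
    · simp

theorem mainAt_of {n : ℕ} (ihM : ∀ m < n, MainAt m) (ihT : ∀ m < n, TransAt m) : MainAt n := by
  intro x hx
  rcases Nat.eq_zero_or_pos n with rfl | hn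
  · exact UpLR.empty x
  let J := {s : Triple // ∃ r, 0 < r ∧ IsE n r s}
  have : Finite J := Set.Finite.to_subtype
    ((finite_sub_range n).subset fun s ⟨r, _, h⟩ => h.sub)
  have hev : ∀ (s : Triple) (t : ℚ), evS s (fun c i => x c i + if c = 0 then -t else 0) =
      evS s x + t * (-((s 0).card : ℚ)) := by
    intro s t
    rw [evS_add]
    simp only [evS, sum_const, nsmul_eq_mul, Fin.sum_univ_three]
    simp; ring
  obtain ⟨t, ht, hpos, ⟨s, r, hr, hs⟩, -, hz⟩ := exists_hit (J := J) (fun j => evS j.1 x)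
    (fun j => -((j.1 0).card : ℚ)) (fun j => by obtain ⟨r, _, h⟩ := j.2; exact hx.2 r _ h)
    ⟨⟨_, n, hn, isE_full n⟩, by simpa⟩
  have hK : InK n (fun c i => x c i + if c = 0 then -t else 0) := by
    refine ⟨fun c i j hij hj => by have := hx.1 c i j hij hj; simpa, fun r s hs => ?_⟩
    rw [hev]
    rcases Nat.eq_zero_or_pos r with rfl | hr
    · rw [hs.card]; simpa using hx.2 0 s hs
    · exact hpos ⟨s, r, hr, hs⟩
  replace hz : evS s (fun c i => x c i + if c = 0 then -t else 0) = 0 := by rw [hev]; exact hz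
  have hup : UpLR n (fun c i => x c i + if c = 0 then -t else 0) := by
    rcases hs.le.eq_or_lt with rfl | hlt
    · refine upLR_of_trace_zero ihM ihT hK ?_
      rw [show s = fun _ => range r from funext hs.eq_full] at hz
      exact hz
    · exact upLR_of_tight ihM ihT hs hr hlt hK hz
  exact hup.mono fun c i _ => by split_ifs <;> linarith

theorem main_and_trans (n : ℕ) : MainAt n ∧ TransAt n := by
  induction n using Nat.strong_induction_on with
  | _ n ih =>
    have h := mainAt_of (fun m hm => (ih m hm).1) (fun m hm => (ih m hm).2)
    exact ⟨h, transAt_of h fun m hm => (ih m hm).2⟩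

/-- The boundaries of hives are described by the inequalities. -/
theorem InK.upLR {n : ℕ} {x : Bdry} (h : InK n x) : UpLR n x := (main_and_trans n).1 x h

theorem IsE.trans {n r m : ℕ} {I P : Triple} (hI : IsE n r I) (hP : IsE r m P) :
    IsE n m (fun c => pick (I c) (P c)) := (main_and_trans m).2 n r I P hI hP

/-! ### Symmetry -/

theorem sum_neg3 {M : Type*} [AddCommMonoid M] (f : Fin 3 → M) : ∑ c, f (-c) = ∑ c, f c :=
  Equiv.sum_comp (Equiv.neg (Fin 3)) f

theorem LR.swap {n : ℕ} {x : Bdry} (hx : LR n x) : LR n (fun c => x (-c)) := by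
  induction n using Nat.strong_induction_on generalizing x with
  | _ n ih =>
  have ht : ∑ c, ∑ i ∈ range n, x (-c) i = 0 := by
    rw [sum_neg3 fun c => ∑ i ∈ range n, x c i]; exact hx.trace
  refine (InK.upLR ⟨fun c => hx.dec (-c), fun r s hs => ?_⟩).lr ht
  rcases hs.le.eq_or_lt with rfl | hlt
  · rw [show s = fun _ => range r from funext hs.eq_full]
    exact ht.ge
  · obtain ⟨z, hz, hzs⟩ := hs.up
    have h1 : IsE n r (fun c => s (-c)) :=
      ⟨fun c => hs.sub _, fun c => hs.card _, ⟨_, ih r hlt hz, fun c i hi => hzs (-c) i hi⟩⟩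
    have := h1.valid (UpLR.of_LR hx)
    rw [← sum_neg3] at this
    simpa [evS] using this

theorem LR.neg_rev {n : ℕ} {x : Bdry} (hx : LR n x) :
    LR n (fun c i => - x c (n - 1 - i)) := by
  have := hx.refl.swap
  simpa using this

/-- The orthogonal triple. -/
def perpS (n : ℕ) (s : Triple) : Triple := fun c => cpl n (revS n (s c))

theorem IsE.perp {n r : ℕ} {s : Triple} (h : IsE n r s) : IsE n (n - r) (perpS n s) := by
  have h1 := h.dual
  obtain ⟨z, hz, hzs⟩ := h1.up
  have h2 : IsE n (n - r) (fun c => dualS n s (-c)) :=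
    ⟨fun c => h1.sub _, fun c => h1.card _, ⟨_, hz.swap, fun c i hi => hzs (-c) i hi⟩⟩
  have : (fun c => dualS n s (-c)) = perpS n s := by
    funext c
    simp only [dualS, perpS, neg_neg]
    exact revS_cpl (h.sub c)
  rwa [this] at h2

/-! ### Merging and splitting along index sets -/

/-- The restriction of `x` to `s` is the boundary of a hive of size `t`. -/
def LRon (s : Triple) (t : ℕ) (x : Bdry) : Prop :=
  (∀ c, (s c).card = t) ∧ LR t (res s x)

theorem trace_res {s : Triple} {t : ℕ} (hs : ∀ c, (s c).card = t) (x : Bdry) :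
    ∑ c, ∑ i ∈ range t, res s x c i = evS s x := by
  refine sum_congr rfl fun c _ => ?_
  rw [← sum_nthSmall (s c), hs]
  rfl

theorem LRon.ev {s : Triple} {t : ℕ} {x : Bdry} (h : LRon s t x) :
    evS s x = 0 := by rw [← trace_res h.1, h.2.trace]

theorem LRon.union {n t t' : ℕ} {s s' : Triple} {x : Bdry} (hx : Dec n x)
    (hs : ∀ c, s c ⊆ range n) (hs' : ∀ c, s' c ⊆ range n)
    (hd : ∀ c, Disjoint (s c) (s' c)) (h : LRon s t x) (h' : LRon s' t' x) :
    LRon (fun c => s c ∪ s' c) (t + t') x := by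
  have hc : ∀ c, (s c ∪ s' c).card = t + t' := fun c => by
    rw [card_union_of_disjoint (hd c), h.1, h'.1]
  refine ⟨hc, UpLR.lr ?_ ?_⟩
  · refine (UpLR.of_LR h.2).merge (UpLR.of_LR h'.2) fun c θ l₁ l₂ hl₁ hl₂ hu hv k hk => ?_
    set U := (range l₁).image (nthSmall (s c)) ∪ (range l₂).image (nthSmall (s' c))
      with hU
    have m1 : ∀ a ∈ range l₁, nthSmall (s c) a ∈ s c := fun a ha =>
      nthSmall_mem (by rw [h.1]; exact (mem_range.1 ha).trans_le hl₁)
    have m2 : ∀ a ∈ range l₂, nthSmall (s' c) a ∈ s' c := fun a ha =>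
      nthSmall_mem (by rw [h'.1]; exact (mem_range.1 ha).trans_le hl₂)
    have hUs : U ⊆ s c ∪ s' c := union_subset_union
      (image_subset_iff.2 m1) (image_subset_iff.2 m2)
    have hcard : U.card = l₁ + l₂ := by
      rw [hU, card_union_of_disjoint]
      · rw [card_image_of_injOn, card_image_of_injOn, card_range,
          card_range]
        · exact (nthSmall_injOn _).mono (by rw [h'.1]; simpa using hl₂)
        · exact (nthSmall_injOn _).mono (by rw [h.1]; simpa using hl₁)
      · exact (hd c).mono (image_subset_iff.2 m1) (image_subset_iff.2 m2)
    have hkc : k < (s c ∪ s' c).card := by rw [hc]; omega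
    obtain ⟨i, hi, hik⟩ : ∃ i ∈ U, nthSmall (s c ∪ s' c) k ≤ i := by
      by_contra hcon
      push Not at hcon
      have := card_le_card (show U ⊆ (s c ∪ s' c).filter (· < nthSmall (s c ∪ s' c) k) from
        fun i hi => mem_filter.2 ⟨hUs hi, hcon i hi⟩)
      rw [card_lt_nthSmall hkc, hcard] at this
      omega
    have key : θ ≤ x c i := by
      rcases mem_union.1 hi with hi | hi
      · obtain ⟨a, ha, rfl⟩ := mem_image.1 hi
        exact hu a (mem_range.1 ha)
      · obtain ⟨a, ha, rfl⟩ := mem_image.1 hi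
        exact hv a (mem_range.1 ha)
    exact key.trans (hx c _ i hik (mem_range.1
      (union_subset (hs c) (hs' c) (hUs hi))))
  · rw [trace_res hc]
    have : evS (fun c => s c ∪ s' c) x = evS s x + evS s' x := by
      simp only [evS, ← sum_add_distrib]
      exact sum_congr rfl fun c _ => sum_union (hd c)
    rw [this, h.ev, h'.ev, add_zero]

theorem LRon.full {n : ℕ} {x : Bdry} :
    LRon (fun _ => range n) n x ↔ LR n x := by
  refine ⟨fun h => h.2.congr fun c i hi => by simp [res, nthSmall_range hi],
    fun h => ⟨fun _ => card_range n, h.congr fun c i hi => by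
      simp [res, nthSmall_range hi]⟩⟩

theorem LRon.empty (x : Bdry) : LRon (fun _ => ∅) 0 x :=
  ⟨fun _ => rfl, (LR.zero 0).congr fun _ i hi => absurd hi (by omega)⟩

theorem LRon.pick {r t : ℕ} {I P : Triple} {x : Bdry}
    (hI : ∀ c, (I c).card = r) (hP : ∀ c, P c ⊆ range r) (h : LRon P t (res I x)) :
    LRon (fun c => pick (I c) (P c)) t x := by
  have hs : ∀ c, P c ⊆ range (I c).card := fun c => by rw [hI]; exact hP c
  refine ⟨fun c => by rw [card_pick (hs c), h.1], h.2.congr fun c i hi => ?_⟩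
  simp only [res]
  rw [nthSmall_pick (hs c) (by rw [h.1]; exact hi)]

theorem LR.split {n r : ℕ} {s : Triple} (hs : ∀ c, s c ⊆ range n)
    {x : Bdry} (hx : Dec n x) (h1 : LRon s r x)
    (h2 : LRon (fun c => cpl n (s c)) (n - r) x) : LR n x := by
  have hrn : r ≤ n := by
    have := card_le_card (hs 0)
    rwa [h1.1, card_range] at this
  have := LRon.union hx hs (fun c => cpl_sub n _) (fun c => disjoint_sdiff) h1 h2
  rw [Nat.add_sub_cancel' hrn] at this
  have e1 : (fun c => s c ∪ cpl n (s c)) = fun _ => range n := by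
    funext c; exact union_sdiff_of_subset (hs c)
  rw [e1] at this
  exact LRon.full.1 this

theorem LR.inK {n : ℕ} {x : Bdry} (h : LR n x) : InK n x := UpLR.inK h.dec (UpLR.of_LR h)

theorem InK.lr {n : ℕ} {x : Bdry} (h : InK n x)
    (ht : ∑ c, ∑ i ∈ range n, x c i = 0) : LR n x := h.upLR.lr ht

theorem evS_cpl {n : ℕ} {s : Triple} (hs : ∀ c, s c ⊆ range n)
    (x : Bdry) : evS (fun c => cpl n (s c)) x =
      ∑ c, ∑ i ∈ range n, x c i - evS s x := by
  simp only [evS, sum_cpl (hs _), sum_sub_distrib]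

/-- A tight inequality splits the boundary. -/
theorem IsE.split_of_tight {n r : ℕ} {I : Triple} (hI : IsE n r I) {x : Bdry}
    (hx : LR n x) (h0 : evS I x = 0) :
    LRon I r x ∧ LRon (fun c => cpl n (I c)) (n - r) x := by
  have hcc : ∀ c, (cpl n (I c)).card = n - r := fun c => by rw [card_cpl (hI.sub c), hI.card]
  have h0' : evS (fun c => cpl n (I c)) x = 0 := by rw [evS_cpl hI.sub, hx.trace, h0, sub_zero]
  rcases Nat.eq_zero_or_pos r with rfl | hr
  · have e1 : I = fun _ => ∅ := funext fun c => card_eq_zero.1 (hI.card c)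
    subst e1
    refine ⟨LRon.empty x, ?_⟩
    have : (fun _ : Fin 3 => cpl n ∅) = fun _ => range n := by simp [cpl]
    rw [this]
    exact LRon.full.2 hx
  rcases hI.le.eq_or_lt with rfl | hlt
  · rw [show I = fun _ => range r from funext hI.eq_full]
    refine ⟨LRon.full.2 hx, ?_⟩
    have : (fun _ : Fin 3 => cpl r (range r)) = fun _ => ∅ := by simp [cpl]
    rw [this, Nat.sub_self]
    exact LRon.empty x
  · refine ⟨⟨hI.card, (inK_res (fun t _ => (main_and_trans t).2) hI hlt hx.inK).lr ?_⟩,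
      ⟨hcc, (inK_res_cpl (fun t _ => (main_and_trans t).2) hI hr hx.inK h0).lr ?_⟩⟩
    · rw [trace_res hI.card, h0]
    · rw [trace_res hcc, h0']

/-! ### Interior points and perturbations -/

theorem exists_small {J : Type*} [Finite J] (f g : J → ℚ) (hf : ∀ j, 0 < f j) :
    ∃ ε, 0 < ε ∧ ∀ δ, |δ| ≤ ε → ∀ j, 0 < f j + δ * g j := by
  have : ∀ j, ∃ ε, 0 < ε ∧ ∀ δ, |δ| ≤ ε → 0 < f j + δ * g j := by
    intro j
    refine ⟨f j / (|g j| + 1), div_pos (hf j) (by positivity), fun δ hδ => ?_⟩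
    rw [le_div_iff₀ (by positivity)] at hδ
    have h1 := abs_mul δ (g j)
    have h2 := neg_abs_le (δ * g j)
    have h3 := hf j
    rcases eq_or_ne δ 0 with rfl | h
    · simpa
    · have := abs_pos.2 h
      nlinarith
  choose ε hε h using this
  rcases isEmpty_or_nonempty J with hJ | hJ
  · exact ⟨1, one_pos, fun _ _ j => (IsEmpty.false j).elim⟩
  · obtain ⟨j, hj⟩ := Finite.exists_min ε
    exact ⟨ε j, hε j, fun δ hδ i => h i δ (hδ.trans (hj i))⟩

/-- Strictly decreasing sequences of length `n`. -/
def SDec (n : ℕ) (x : Bdry) : Prop := ∀ c i j, i < j → j < n → x c j < x c i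

theorem SDec.dec {n : ℕ} {x : Bdry} (h : SDec n x) : Dec n x := fun c i j hij hj => by
  rcases hij.eq_or_lt with rfl | hlt
  · exact le_rfl
  · exact (h c i j hlt hj).le

theorem SDec.res {n : ℕ} {x : Bdry} (h : SDec n x) {r : ℕ} {s : Triple}
    (hs : ∀ c, s c ⊆ range n) (hr : ∀ c, (s c).card = r) : SDec r (res s x) :=
  fun c i j hij hj => h c _ _ (nthSmall_lt hij (by rw [hr]; exact hj))
    (mem_range.1 (hs c (nthSmall_mem (by rw [hr]; exact hj))))

theorem SDec.perturb {n : ℕ} {x : Bdry} (h : SDec n x) (z : Bdry) :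
    ∃ ε, 0 < ε ∧ ∀ δ, |δ| ≤ ε → SDec n (fun c i => x c i + δ * z c i) := by
  obtain ⟨ε, hε, hs⟩ := exists_small (J := {p : Fin 3 × Fin n × Fin n // p.2.1 < p.2.2})
    (fun p => x p.1.1 p.1.2.1 - x p.1.1 p.1.2.2) (fun p => z p.1.1 p.1.2.1 - z p.1.1 p.1.2.2)
    (fun p => by have := h p.1.1 p.1.2.1 p.1.2.2 p.2 p.1.2.2.2; linarith)
  refine ⟨ε, hε, fun δ hδ c i j hij hj => ?_⟩
  have := hs δ hδ ⟨(c, ⟨i, by omega⟩, ⟨j, hj⟩), hij⟩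
  simp only at this
  linarith

/-- All proper inequalities are strict. -/
def Interior (n : ℕ) (x : Bdry) : Prop :=
  LR n x ∧ SDec n x ∧ ∀ s ∈ properE n, 0 < evS s x

theorem evS_smul_add (s : Triple) (x z : Bdry) (δ : ℚ) :
    evS s (fun c i => x c i + δ * z c i) = evS s x + δ * evS s z := by
  simp [evS, sum_add_distrib, mul_sum]

theorem Interior.perturb {n : ℕ} {x z : Bdry} (h : Interior n x)
    (hz : ∑ c, ∑ i ∈ range n, z c i = 0) :
    ∃ ε, 0 < ε ∧ ∀ δ, |δ| ≤ ε → LR n (fun c i => x c i + δ * z c i) := by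
  obtain ⟨ε₁, hε₁, h₁⟩ := h.2.1.perturb z
  obtain ⟨ε₂, hε₂, h₂⟩ := exists_small (J := properE n) (fun s => evS s.1 x) (fun s => evS s.1 z)
    (fun s => h.2.2 s.1 s.2)
  refine ⟨min ε₁ ε₂, lt_min hε₁ hε₂, fun δ hδ => ?_⟩
  have htr : ∑ c, ∑ i ∈ range n, (x c i + δ * z c i) = 0 := by
    have := evS_smul_add (fun _ => range n) x z δ
    simp only [evS] at this
    rw [this, h.1.trace, hz]; ring
  refine InK.lr ⟨(h₁ δ (hδ.trans (min_le_left _ _))).dec, fun r s hs => ?_⟩ htr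
  rcases Nat.eq_zero_or_pos r with rfl | hr
  · have : ∀ c, s c = ∅ := fun c => card_eq_zero.1 (hs.card c)
    simp [evS, this]
  rcases hs.le.eq_or_lt with rfl | hlt
  · rw [show s = fun _ => range r from funext hs.eq_full]
    exact htr.ge
  · rw [evS_smul_add]
    exact (h₂ δ (hδ.trans (min_le_right _ _)) ⟨s, r, hr, hlt, hs⟩).le

/-- The inequality of `s` holds for all boundaries of hives. -/
def ValidS (n : ℕ) (s : Triple) : Prop :=
  (∀ c, s c ⊆ range n) ∧ ∀ y, LR n y → 0 ≤ evS s y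

theorem IsE.validS {n r : ℕ} {s : Triple} (h : IsE n r s) : ValidS n s :=
  ⟨h.sub, fun _ hy => h.valid (UpLR.of_LR hy)⟩

theorem ValidS.const_of_interior {n : ℕ} {s : Triple} {x : Bdry}
    (hs : ValidS n s) (hx : Interior n x) (h0 : evS s x = 0) :
    (∀ c, s c = ∅) ∨ ∀ c, s c = range n := by
  by_contra hcon
  push Not at hcon
  obtain ⟨⟨a, ha⟩, b, hb⟩ := hcon
  obtain ⟨i, hi⟩ := ha
  obtain ⟨j, hj, hjs⟩ : ∃ j ∈ range n, j ∉ s b := by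
    by_contra h; push Not at h
    exact hb (Subset.antisymm (hs.1 b) h)
  have hin := hs.1 a hi
  let z : Bdry := fun c l =>
    (if c = a ∧ l = i then -1 else 0) + (if c = b ∧ l = j then 1 else 0)
  have hev : ∀ t : Triple, evS t z =
      (if i ∈ t a then -1 else 0) + if j ∈ t b then 1 else 0 := by
    intro t
    simp only [evS, z, sum_add_distrib, ite_and]
    congr 1
    · rw [sum_eq_single a]
      · simp
      · intro c _ hc; simp [hc]
      · simp
    · rw [sum_eq_single b]
      · simp
      · intro c _ hc; simp [hc]
      · simp
  obtain ⟨ε, hε, h⟩ := hx.perturb (z := z) (by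
    have := hev (fun _ => range n)
    simp only [evS] at this
    rw [this, if_pos hin, if_pos hj]; ring)
  have h1 := hs.2 _ (h ε (by rw [abs_of_pos hε]))
  rw [evS_smul_add, h0, hev, if_pos hi, if_neg hjs] at h1
  linarith

/-- Extension by zero from an index set. -/
def ext0 (I : Triple) (y : Bdry) (c : Fin 3) (i : ℕ) : ℚ :=
  if i ∈ I c then y c ((I c).filter (· < i)).card else 0

theorem ext0_nthSmall {I : Triple} {c : Fin 3} {k : ℕ} (hk : k < (I c).card)
    (y : Bdry) : ext0 I y c (nthSmall (I c) k) = y c k := by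
  rw [ext0, if_pos (nthSmall_mem hk), card_lt_nthSmall hk]

/-- The positions in `I` of the elements of `s`. -/
def posn (I s : Finset ℕ) : Finset ℕ := (range I.card).filter fun k => nthSmall I k ∈ s

theorem posn_sub (I s : Finset ℕ) : posn I s ⊆ range I.card := filter_subset _ _

theorem pick_posn (I s : Finset ℕ) : pick I (posn I s) = I ∩ s := by
  ext i
  simp only [pick, posn, mem_image, mem_filter, mem_range, mem_inter]
  constructor
  · rintro ⟨k, ⟨hk, hks⟩, rfl⟩
    exact ⟨nthSmall_mem hk, hks⟩
  · rintro ⟨hi, his⟩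
    obtain ⟨k, hk, rfl⟩ := exists_nthSmall hi
    exact ⟨k, ⟨hk, his⟩, rfl⟩

theorem cpl_posn (I s : Finset ℕ) : pick I (cpl I.card (posn I s)) = I \ s := by
  ext i
  simp only [pick, posn, mem_image, mem_cpl, mem_filter, mem_range,
    mem_sdiff]
  constructor
  · rintro ⟨k, ⟨hk, hks⟩, rfl⟩
    exact ⟨nthSmall_mem hk, fun h => hks ⟨hk, h⟩⟩
  · rintro ⟨hi, his⟩
    obtain ⟨k, hk, rfl⟩ := exists_nthSmall hi
    exact ⟨k, ⟨hk, fun h => his h.2⟩, rfl⟩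

theorem evS_ext0 (I s : Triple) (y : Bdry) :
    evS s (ext0 I y) = evS (fun c => posn (I c) (s c)) y := by
  refine sum_congr rfl fun c _ => ?_
  have h1 : ∑ i ∈ s c, ext0 I y c i = ∑ i ∈ pick (I c) (posn (I c) (s c)), ext0 I y c i := by
    rw [pick_posn]
    symm
    refine sum_subset inter_subset_right fun i hi hi' => ?_
    rw [ext0, if_neg fun h => hi' (mem_inter.2 ⟨h, hi⟩)]
  rw [h1, sum_pick (posn_sub _ _)]
  exact sum_congr rfl fun k hk => ext0_nthSmall (mem_range.1 (posn_sub _ _ hk)) y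

theorem ValidS.posn {n r : ℕ} {I s : Triple} {x : Bdry} (hs : ValidS n s)
    (hx : SDec n x) (hI : ∀ c, I c ⊆ range n) (h1 : LRon I r x)
    (h2 : LRon (fun c => cpl n (I c)) (n - r) x) (h0 : evS s x = 0) :
    ValidS r (fun c => posn (I c) (s c)) ∧ evS (fun c => _root_.posn (I c) (s c)) (res I x) = 0 := by
  have key : ∀ y, LR r y → evS (fun c => _root_.posn (I c) (s c)) (res I x) ≤
      evS (fun c => _root_.posn (I c) (s c)) y := by
    intro y hy
    set z := ext0 I (fun c i => y c i + (-1) * res I x c i) with hz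
    obtain ⟨ε₁, hε₁, hp⟩ := hx.perturb z
    set ε := min ε₁ 1 with hε
    have hε0 : 0 < ε := lt_min hε₁ one_pos
    have hd := hp ε (by rw [abs_of_pos hε0]; exact min_le_left _ _)
    have hzI : ∀ c, ∀ k < r, z c (nthSmall (I c) k) = y c k + (-1) * res I x c k := fun c k hk =>
      ext0_nthSmall (by rw [h1.1]; exact hk) _
    have hzc : ∀ c, ∀ k < n - r, z c (nthSmall (cpl n (I c)) k) = 0 := fun c k hk => by
      rw [hz, ext0, if_neg (mem_cpl.1 (nthSmall_mem (by rw [h2.1 c]; exact hk))).2]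
    have hl : LR n (fun c i => x c i + ε * z c i) := by
      refine LR.split hI hd.dec ⟨h1.1, ?_⟩ ⟨h2.1, ?_⟩
      · have hle : 0 ≤ 1 - ε := by have := min_le_right ε₁ 1; linarith
        refine ((h1.2.smul hle).add (hy.smul hε0.le)).congr fun c i hi => ?_
        simp only [res] at *
        rw [hzI c i hi]; ring
      · refine h2.2.congr fun c i hi => ?_
        simp only [res] at *
        rw [hzc c i hi]; ring
    have h3 := hs.2 _ hl
    rw [evS_smul_add, h0, hz, evS_ext0, evS_smul_add, zero_add] at h3
    have := nonneg_of_mul_nonneg_right h3 hε0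
    linarith
  have hz0 : evS (fun c => _root_.posn (I c) (s c)) (res I x) = 0 := by
    have a1 := key _ (LR.zero r)
    have a2 := key _ (h1.2.smul (k := 2) (by norm_num))
    have e1 : evS (fun c => _root_.posn (I c) (s c)) (fun _ _ => 0) = 0 := by simp [evS]
    have e2 : evS (fun c => _root_.posn (I c) (s c)) (fun c i => 2 * res I x c i) =
        2 * evS (fun c => _root_.posn (I c) (s c)) (res I x) := by
      simp [evS, mul_sum]
    rw [e1] at a1; rw [e2] at a2
    linarith
  refine ⟨⟨fun c => ?_, fun y hy => hz0 ▸ key y hy⟩, hz0⟩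
  have := posn_sub (I c) (s c)
  rwa [h1.1] at this

/-- A valid inequality that is tight at a strictly decreasing boundary splits it. -/
theorem ValidS.split_of_tight {n : ℕ} {s : Triple} {x : Bdry}
    (hs : ValidS n s) (hx : SDec n x) (hl : LR n x) (h0 : evS s x = 0) :
    ∃ t, LRon s t x ∧ LRon (fun c => cpl n (s c)) (n - t) x := by
  induction n using Nat.strong_induction_on generalizing s x with
  | _ n ih =>
  by_cases hint : ∀ I ∈ properE n, 0 < evS I x
  · rcases hs.const_of_interior ⟨hl, hx, hint⟩ h0 with h | h
    · rw [show s = fun _ => ∅ from funext h]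
      refine ⟨0, LRon.empty x, ?_⟩
      have : (fun _ : Fin 3 => cpl n ∅) = fun _ => range n := by simp [cpl]
      rw [this]
      exact LRon.full.2 hl
    · rw [show s = fun _ => range n from funext h]
      refine ⟨n, LRon.full.2 hl, ?_⟩
      have : (fun _ : Fin 3 => cpl n (range n)) = fun _ => ∅ := by simp [cpl]
      rw [this, Nat.sub_self]
      exact LRon.empty x
  · push Not at hint
    obtain ⟨I, ⟨r, hr, hrn, hI⟩, hle⟩ := hint
    have hIt : evS I x = 0 := le_antisymm hle (hI.valid (UpLR.of_LR hl))
    obtain ⟨h1, h2⟩ := hI.split_of_tight hl hIt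
    have hcc : ∀ c, cpl n (cpl n (I c)) = I c := fun c => cpl_cpl (hI.sub c)
    obtain ⟨v1, z1⟩ := hs.posn hx hI.sub h1 h2 h0
    obtain ⟨v2, z2⟩ := hs.posn (I := fun c => cpl n (I c)) (r := n - r) hx (fun c => cpl_sub n _) h2
      (by simp only [hcc]; rwa [show n - (n - r) = r by omega]) h0
    obtain ⟨t1, a1, b1⟩ := ih r hrn v1 (hx.res hI.sub hI.card) h1.2 z1
    obtain ⟨t2, a2, b2⟩ := ih (n - r) (by omega) v2 (hx.res (fun c => cpl_sub n _) h2.1) h2.2 z2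
    have a1' := a1.pick hI.card v1.1
    have a2' := a2.pick h2.1 v2.1
    have b1' := b1.pick hI.card (fun c => cpl_sub r _)
    have b2' := b2.pick h2.1 (fun c => cpl_sub (n - r) _)
    simp only [pick_posn] at a1' a2'
    have c1 : (fun c => _root_.pick (I c) (cpl r (_root_.posn (I c) (s c)))) = fun c => I c \ s c := by
      funext c; rw [← hI.card c]; exact cpl_posn _ _
    have c2 : (fun c => _root_.pick (cpl n (I c)) (cpl (n - r) (_root_.posn (cpl n (I c)) (s c)))) =
        fun c => cpl n (I c) \ s c := by
      funext c; rw [← h2.1 c]; exact cpl_posn _ _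
    rw [c1] at b1'
    rw [c2] at b2'
    have A := LRon.union hx.dec (fun c => inter_subset_left.trans (hI.sub c))
      (fun c => inter_subset_left.trans (cpl_sub n _)) (fun c =>
        (disjoint_sdiff).mono inter_subset_left inter_subset_left) a1' a2'
    have B := LRon.union hx.dec (fun c => sdiff_subset.trans (hI.sub c))
      (fun c => sdiff_subset.trans (cpl_sub n _)) (fun c =>
        (disjoint_sdiff).mono sdiff_subset sdiff_subset) b1' b2'
    have d1 : (fun c => I c ∩ s c ∪ cpl n (I c) ∩ s c) = s := by
      funext c; ext i
      have := fun h : i ∈ s c => mem_range.1 (hs.1 c h)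
      simp only [mem_union, mem_inter, mem_cpl]
      tauto
    have d2 : (fun c => I c \ s c ∪ cpl n (I c) \ s c) = fun c => cpl n (s c) := by
      funext c; ext i
      have := fun h : i ∈ I c => mem_range.1 (hI.sub c h)
      simp only [mem_union, mem_sdiff, mem_cpl]
      tauto
    rw [d1] at A
    rw [d2] at B
    have ht1 : t1 ≤ r := by
      have := card_le_card (v1.1 0); rwa [a1.1 0, card_range] at this
    have ht2 : t2 ≤ n - r := by
      have := card_le_card (v2.1 0); rwa [a2.1 0, card_range] at this
    refine ⟨t1 + t2, A, ?_⟩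
    rwa [show r - t1 + (n - r - t2) = n - (t1 + t2) by omega] at B

/-! ### Counting inversions between two boundaries -/

theorem exists_argmax {m : ℕ} (B : Pt → ℚ) {T : Fin 3 → ℚ} (hT : ∑ c, T c = 0) :
    ∃ q, wt q = m ∧ ∀ p c, wt p + 1 = m →
      (q = p + e (c + 2) → T c ≤ dif B c p) ∧ (q = p + e (c + 1) → dif B c p ≤ T c) := by
  let F : Pt → ℚ := fun q => B q + (T 1 * q 2 - T 2 * q 1)
  have hne : {p : Pt | wt p = m}.Nonempty := ⟨sd 0 m 0, by simp⟩
  obtain ⟨q, hq, hm⟩ := (finite_le_wt m).exists_maximalFor F _ hne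
  have hmax : ∀ p, wt p = m → F p ≤ F q := fun p hp => by
    by_contra hlt
    exact hlt (hm (j := p) hp (le_of_lt (not_le.1 hlt)))
  have hF : ∀ p c, F (p + e (c + 2)) - F (p + e (c + 1)) = dif B c p - T c := by
    intro p c
    rw [Fin.sum_univ_three] at hT
    have h0 : T 0 = - T 1 - T 2 := by linarith
    simp only [F, dif, Pi.add_apply]
    fin_cases c <;> simp [e]
    · rw [h0]; ring
    · ring
    · ring
  refine ⟨q, hq, fun p c hp => ⟨?_, ?_⟩⟩
  · rintro rfl
    have h1 := hmax (p + e (c + 1)) (by simpa)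
    have h2 := hF p c
    linarith
  · rintro rfl
    have h1 := hmax (p + e (c + 2)) (by simpa)
    have h2 := hF p c
    linarith

theorem argmax_le {m : ℕ} {B : Pt → ℚ} (hB : IsHive m B) {T T' : Fin 3 → ℚ} {c : Fin 3}
    (h0 : T c = T' c) (h1 : T (c + 1) ≤ T' (c + 1)) (h2 : T' (c + 2) ≤ T (c + 2))
    {q q' : Pt} (hq : wt q = m) (hq' : wt q' = m)
    (h : ∀ p b, wt p + 1 = m →
      (q = p + e (b + 2) → T b < dif B b p) ∧ (q = p + e (b + 1) → dif B b p < T b))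
    (h' : ∀ p b, wt p + 1 = m →
      (q' = p + e (b + 2) → T' b ≤ dif B b p) ∧ (q' = p + e (b + 1) → dif B b p ≤ T' b)) :
    q (c + 1) ≤ q' (c + 1) ∧ q (c + 2) ≤ q' (c + 2) := by
  have k1 : ∀ b, T b ≤ T' b → ¬ (q' (b + 1) < q (b + 1) ∧ q (b + 2) < q' (b + 2)) := by
    rintro b hb ⟨hi, hv⟩
    obtain ⟨p, rfl⟩ := pt_pred (p := q) (a := b + 1) (by omega)
    obtain ⟨p', rfl⟩ := pt_pred (p := q') (a := b + 2) (by omega)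
    simp only [wt_add, wt_e] at hq hq'
    have h1 := (h p b hq).2 rfl
    have h2 := (h' p' b hq').1 rfl
    simp at hi hv
    have h3 := hB b p' p hq' hq (by omega) (by omega)
    linarith
  have k2 : ∀ b, T' b ≤ T b → ¬ (q' (b + 2) < q (b + 2) ∧ q (b + 1) < q' (b + 1)) := by
    rintro b hb ⟨hi, hv⟩
    obtain ⟨p, rfl⟩ := pt_pred (p := q) (a := b + 2) (by omega)
    obtain ⟨p', rfl⟩ := pt_pred (p := q') (a := b + 1) (by omega)
    simp only [wt_add, wt_e] at hq hq'
    have h1 := (h p b hq).1 rfl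
    have h2 := (h' p' b hq').2 rfl
    simp at hi hv
    have h3 := hB b p p' hq hq' (by omega) (by omega)
    linarith
  have a1 := k1 c h0.le
  have a2 := k2 c h0.ge
  have a3 := k1 (c + 1) h1
  have a4 := k2 (c + 2) h2
  simp only [c11, c12, c21, c22] at a1 a2 a3 a4
  rw [wt_cyc _ c] at hq hq'
  omega

/-- The number of entries of `b` on side `c` that exceed the entry `l` of `a`. -/
def cnt (m : ℕ) (a b : Bdry) (c : Fin 3) (l : ℕ) : ℕ :=
  ((range m).filter fun j => a c l < b c j).card

/-- Two hives in general position. -/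
def Generic (r m : ℕ) (A B : Pt → ℚ) : Prop :=
  ∀ c y p, wt y + 1 = r → wt p + 1 = m → dif A c y ≠ dif B c p

theorem count_aux {r m : ℕ} {A B : Pt → ℚ} {a b : Bdry} (hA : IsHive r A)
    (ha : HasBd r A a) (hB : IsHive m B) (hb : HasBd m B b) (gen : Generic r m A B) :
    ∃ β δ : Pt → Pt, (∀ y, wt y + 1 = r → wt (β y) = m) ∧ (∀ w, wt w + 2 = r → wt (δ w) = m) ∧
      (∀ w c, wt w + 2 = r → β (w + e c) (c + 1) ≤ δ w (c + 1) ∧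
        β (w + e c) (c + 2) ≤ δ w (c + 2)) ∧
      ∀ c j l, j + l + 1 = r → β (sd c j l) (c + 2) ≤ cnt m a b c l := by
  have hup : ∀ y : Pt, ∃ q, wt y + 1 = r → wt q = m ∧ ∀ p c, wt p + 1 = m →
      (q = p + e (c + 2) → dif A c y < dif B c p) ∧
      (q = p + e (c + 1) → dif B c p < dif A c y) := by
    intro y
    obtain ⟨q, hq, h⟩ := exists_argmax (m := m) B (T := fun c => dif A c y) (sum_dif A y)
    exact ⟨q, fun hy => ⟨hq, fun p c hp =>
      ⟨fun h' => lt_of_le_of_ne ((h p c hp).1 h') (gen c y p hy hp),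
        fun h' => lt_of_le_of_ne ((h p c hp).2 h') (gen c y p hy hp).symm⟩⟩⟩
  have hdown : ∀ w : Pt, ∃ q, wt q = m ∧ ∀ p c, wt p + 1 = m →
      (q = p + e (c + 2) → dif A c (w + e c) ≤ dif B c p) ∧
      (q = p + e (c + 1) → dif B c p ≤ dif A c (w + e c)) := fun w =>
    exists_argmax (m := m) B (T := fun c => dif A c (w + e c)) (sum_dif_down A w)
  choose β hβ using hup
  choose δ hδ using hdown
  refine ⟨β, δ, fun y hy => (hβ y hy).1, fun w _ => (hδ w).1, fun w c hw => ?_,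
    fun c j l hj => ?_⟩
  · have hy : wt (w + e c) + 1 = r := by simp; omega
    refine argmax_le hB (T := fun b => dif A b (w + e c)) (T' := fun b => dif A b (w + e b)) rfl ?_ ?_
      (hβ _ hy).1 (hδ w).1 (hβ _ hy).2 (hδ w).2
    · exact hA (c + 1) _ _ (by simp; omega) (by simp; omega) (by simp) (by simp)
    · exact hA (c + 2) _ _ (by simp; omega) (by simp; omega) (by simp) (by simp)
  · have hy : wt (sd c j l) + 1 = r := by simp; omega
    obtain ⟨hq, h⟩ := hβ _ hy
    rcases Nat.eq_zero_or_pos (β (sd c j l) (c + 2)) with h1 | h1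
    · omega
    obtain ⟨p, hp⟩ := pt_pred h1
    rw [hp] at hq
    simp only [wt_add, wt_e] at hq
    have h2 := (h p c hq).1 hp
    rw [ha.dif hj] at h2
    have h3 := hB.dif_le_bd hb hq c
    have hp1 : β (sd c j l) (c + 2) = p (c + 2) + 1 := by rw [hp]; simp
    have hpm : p (c + 2) < m := by rw [wt_cyc _ c] at hq; omega
    rw [hp1, ← card_range (p (c + 2) + 1)]
    refine card_le_card fun i hi => ?_
    have hi := mem_range.1 hi
    refine mem_filter.2 ⟨mem_range.2 (by omega), ?_⟩
    have := LR.antitone ⟨B, hB, hb⟩ c (i := i) (k := p (c + 2)) (by omega) hpm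
    linarith

theorem sum_up_down {r m : ℕ} {β δ : Pt → Pt} (h1 : ∀ y, wt y + 1 = r → wt (β y) = m)
    (h2 : ∀ w, wt w + 2 = r → wt (δ w) = m) :
    ∑ c, ∑ l ∈ range r, β (sd c (r - 1 - l) l) (c + 2) +
      ∑ c, ∑ w ∈ tri 2 r, β (w + e c) (c + 2) =
    r * m + ∑ c, ∑ w ∈ tri 2 r, δ w (c + 2) := by
  have hw : ∀ p : Pt, ∑ c : Fin 3, p (c + 2) = wt p := fun p => by
    rw [Fin.sum_univ_three]; simp [wt]; omega
  rw [← sum_add_distrib]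
  have := fun c : Fin 3 => sum_tri_split r c (fun y => β y (c + 2))
  simp only [← this]
  rw [sum_comm, sum_comm (s := univ) (t := tri 2 r)]
  simp only [hw]
  rw [sum_congr rfl fun y hy => h1 y (mem_tri.1 hy),
    sum_congr rfl fun w hw' => h2 w (mem_tri.1 hw')]
  simp [card_tri r]
  ring

theorem count_le {r m : ℕ} {A B : Pt → ℚ} {a b : Bdry} (hA : IsHive r A)
    (ha : HasBd r A a) (hB : IsHive m B) (hb : HasBd m B b) (gen : Generic r m A B) :
    r * m ≤ ∑ c, ∑ l ∈ range r, cnt m a b c l := by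
  obtain ⟨β, δ, h1, h2, h3, h4⟩ := count_aux hA ha hB hb gen
  have hs := sum_up_down h1 h2
  have g1 : ∑ c, ∑ l ∈ range r, β (sd c (r - 1 - l) l) (c + 2) ≤
      ∑ c, ∑ l ∈ range r, cnt m a b c l :=
    sum_le_sum fun c _ => sum_le_sum fun l hl =>
      h4 c _ l (by have := mem_range.1 hl; omega)
  have g2 : ∑ c, ∑ w ∈ tri 2 r, β (w + e c) (c + 2) ≤ ∑ c, ∑ w ∈ tri 2 r, δ w (c + 2) :=
    sum_le_sum fun c _ => sum_le_sum fun w hw => (h3 w c (mem_tri.1 hw)).2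
  omega

theorem count_eq {r m : ℕ} {A B : Pt → ℚ} {a b : Bdry} (hA : IsHive r A)
    (ha : HasBd r A a) (hB : IsHive m B) (hb : HasBd m B b) (gen : Generic r m A B)
    (heq : ∑ c, ∑ l ∈ range r, cnt m a b c l = r * m) {s : Fin 3 → ℤ}
    (hsm : ∑ c, s c = m) : LR r (fun c l => s c - cnt m a b c l) := by
  obtain ⟨β, δ, h1, h2, h3, h4⟩ := count_aux hA ha hB hb gen
  have hs := sum_up_down h1 h2
  have f1 : ∀ c : Fin 3, ∀ l ∈ range r, β (sd c (r - 1 - l) l) (c + 2) ≤ cnt m a b c l :=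
    fun c l hl => h4 c _ l (by have := mem_range.1 hl; omega)
  have f2 : ∀ c : Fin 3, ∀ w ∈ tri 2 r, β (w + e c) (c + 2) ≤ δ w (c + 2) :=
    fun c w hw => (h3 w c (mem_tri.1 hw)).2
  have g1 := sum_le_sum fun c (_ : c ∈ univ) => sum_le_sum (f1 c)
  have g2 := sum_le_sum fun c (_ : c ∈ univ) => sum_le_sum (f2 c)
  have e1 : ∀ c j l, j + l + 1 = r → β (sd c j l) (c + 2) = cnt m a b c l := by
    intro c j l hj
    have k1 := (sum_eq_sum_iff_of_le fun c _ => sum_le_sum (f1 c)).1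
      (by omega) c (mem_univ _)
    have k2 := (sum_eq_sum_iff_of_le (f1 c)).1 k1 l (mem_range.2 (by omega))
    rwa [show r - 1 - l = j by omega] at k2
  have e2 : ∀ c w, wt w + 2 = r → β (w + e c) (c + 2) = δ w (c + 2) := by
    intro c w hw
    have k1 := (sum_eq_sum_iff_of_le fun c _ => sum_le_sum (f2 c)).1
      (by omega) c (mem_univ _)
    exact (sum_eq_sum_iff_of_le (f2 c)).1 k1 w (mem_tri.2 hw)
  have hw : ∀ p : Pt, ∑ c : Fin 3, (p (c + 2) : ℤ) = wt p := fun p => by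
    rw [Fin.sum_univ_three]; simp [wt]; omega
  obtain ⟨G, hG⟩ := exists_potential (R := ℤ) (M := r) (z := fun c y => s c - β y (c + 2))
    (fun y hy => by rw [sum_sub_distrib, hw, h1 y hy, hsm, sub_self])
    (fun w hw' => by
      simp only [e2 _ w hw']
      rw [sum_sub_distrib, hw, h2 w hw', hsm, sub_self])
  refine ⟨G, isHive_of_rhombus fun w c hw' => ?_, fun c j l hj => ?_⟩
  · have g1 := hG (w + e (c + 1)) (c + 1) (by simp; omega)
    have g2 := hG (w + e c) (c + 1) (by simp; omega)
    have g3 := e2 (c + 1) w hw'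
    simp only [dif, c11, c12] at g1 g2 g3
    have k1 := (h3 w c hw').1
    have k2 := (h3 w c hw').2
    have k3 := h2 w hw'
    have k4 := h1 (w + e c) (by simp; omega)
    rw [wt_cyc _ c] at k3 k4
    have h3' : (β (w + e (c + 1)) c : ℤ) ≤ β (w + e c) c := by
      rw [g3]; omega
    rw [add_right_comm w (e (c + 1)) (e c)] at g1
    linarith
  · have := hG (sd c j l) c (by simp; omega)
    rw [dif, sd_add_e1, sd_add_e2, e1 c j l hj] at this
    exact this

/-! ### General position -/

theorem finite_generic_bad (r m : ℕ) (A B : Pt → ℚ) {t : Fin 3 → ℚ} (ht : ∀ c, t c ≠ 0) :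
    {ε : ℚ | ∃ c y p, wt y + 1 = r ∧ wt p + 1 = m ∧ dif A c y + ε * t c = dif B c p}.Finite := by
  have hfin : (Set.univ ×ˢ ((tri 1 r : Set Pt) ×ˢ (tri 1 m : Set Pt)) :
      Set (Fin 3 × Pt × Pt)).Finite :=
    Set.finite_univ.prod ((tri 1 r).finite_toSet.prod (tri 1 m).finite_toSet)
  refine (hfin.image fun q => (dif B q.1 q.2.2 - dif A q.1 q.2.1) / t q.1).subset ?_
  rintro ε ⟨c, y, p, hy, hp, h⟩
  refine ⟨(c, y, p), ⟨Set.mem_univ _, by simpa using hy, by simpa using hp⟩, ?_⟩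
  simp only
  rw [← h]
  field_simp [ht c]
  ring

theorem exists_notMem_small {S : Set ℚ} (hS : S.Finite) {ε : ℚ} (hε : 0 < ε) :
    ∃ δ, 0 < δ ∧ δ ≤ ε ∧ δ ∉ S := by
  have hinf : (Set.Ioc 0 ε).Infinite := Set.Ioc_infinite hε
  obtain ⟨δ, hδ, hn⟩ := (hinf.sdiff hS).nonempty
  exact ⟨δ, hδ.1, hδ.2, hn⟩

/-- A linear function with given slopes along the sides. -/
def linF (t : Fin 3 → ℚ) (p : Pt) : ℚ := t 2 * p 1 - t 1 * p 2

theorem dif_linF {t : Fin 3 → ℚ} (ht : ∑ c, t c = 0) (c : Fin 3) (z : Pt) : dif (linF t) c z = t c := by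
  rw [Fin.sum_univ_three] at ht
  have : t 0 = - t 1 - t 2 := by linear_combination ht
  simp only [dif, linF, Pi.add_apply]
  fin_cases c <;> simp [e]
  · rw [this]; ring
  · ring
  · ring

theorem dif_add_linF {t : Fin 3 → ℚ} (ht : ∑ c, t c = 0) (A : Pt → ℚ) (ε : ℚ) (c : Fin 3) (z : Pt) :
    dif (fun p => A p + ε * linF t p) c z = dif A c z + ε * t c := by
  rw [← dif_linF ht c z]; simp only [dif]; ring

theorem IsHive.add_linF {r : ℕ} {A : Pt → ℚ} (hA : IsHive r A) {t : Fin 3 → ℚ} (ht : ∑ c, t c = 0)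
    (ε : ℚ) : IsHive r (fun p => A p + ε * linF t p) := by
  intro c p q hp hq h2 h1
  rw [dif_add_linF ht, dif_add_linF ht]
  have := hA c p q hp hq h2 h1
  linarith

theorem HasBd.add_linF {r : ℕ} {A : Pt → ℚ} {a : Bdry} (ha : HasBd r A a) {t : Fin 3 → ℚ}
    (ht : ∑ c, t c = 0) (ε : ℚ) :
    HasBd r (fun p => A p + ε * linF t p) (fun c i => a c i + ε * t c) := by
  intro c j l hj
  have := dif_add_linF ht A ε c (sd c j l)
  rw [ha.dif hj, _root_.dif, sd_add_e1, sd_add_e2] at this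
  exact this

/-- Entries of two boundaries are distinct. -/
def Distinct (r m : ℕ) (a b : Bdry) : Prop := ∀ c, ∀ i < r, ∀ j < m, a c i ≠ b c j

theorem exists_generic {r m : ℕ} {A B : Pt → ℚ} {a b : Bdry} (hd : Distinct r m a b) :
    ∃ t : Fin 3 → ℚ, ∑ c, t c = 0 ∧ ∃ ε, 0 < ε ∧
      Generic r m (fun p => A p + ε * linF t p) B ∧
      ∀ c, ∀ l < r, cnt m (fun c i => a c i + ε * t c) b c l = cnt m a b c l := by
  let t : Fin 3 → ℚ := ![1, 1, -2]
  have ht : ∑ c, t c = 0 := by simp [t, Fin.sum_univ_three]; norm_num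
  have ht0 : ∀ c, t c ≠ 0 := fun c => by fin_cases c <;> simp [t]
  obtain ⟨ε₀, hε₀, hs⟩ := exists_small (J := Fin 3 × Fin r × Fin m)
    (fun q => |a q.1 q.2.1 - b q.1 q.2.2|)
    (fun q => if b q.1 q.2.2 < a q.1 q.2.1 then t q.1 else - t q.1)
    (fun q => abs_pos.2 (sub_ne_zero.2 (hd _ _ q.2.1.2 _ q.2.2.2)))
  obtain ⟨ε, hε, hle, hbad⟩ := exists_notMem_small (finite_generic_bad r m A B ht0) hε₀
  refine ⟨t, ht, ε, hε, fun c y p hy hp h => ?_, fun c l hl => ?_⟩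
  · rw [dif_add_linF ht] at h
    exact hbad ⟨c, y, p, hy, hp, h⟩
  · refine congrArg card (filter_congr fun j hj => ?_)
    have hj := mem_range.1 hj
    have h1 := hs ε (by rw [abs_of_pos hε]; exact hle) (c, ⟨l, hl⟩, ⟨j, hj⟩)
    have h2 := hd c l hl j hj
    simp only at h1
    rcases lt_or_gt_of_ne h2 with h3 | h3
    · rw [abs_of_neg (by linarith), if_neg (by linarith)] at h1
      exact ⟨fun _ => h3, fun _ => by linarith⟩
    · rw [abs_of_pos (by linarith), if_pos h3] at h1
      exact ⟨fun h => by linarith, fun h => by linarith⟩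

theorem LR.count_le {r m : ℕ} {a b : Bdry} (ha : LR r a) (hb : LR m b)
    (hd : Distinct r m a b) : r * m ≤ ∑ c, ∑ l ∈ range r, cnt m a b c l := by
  obtain ⟨A, hA, hA'⟩ := ha
  obtain ⟨B, hB, hB'⟩ := hb
  obtain ⟨t, ht, ε, -, hg, hc⟩ := exists_generic (A := A) (B := B) hd
  refine (_root_.count_le (hA.add_linF ht ε) (hA'.add_linF ht ε) hB hB' hg).trans (le_of_eq ?_)
  exact sum_congr rfl fun c _ => sum_congr rfl fun l hl => hc c l (mem_range.1 hl)

theorem LR.count_eq {r m : ℕ} {a b : Bdry} (ha : LR r a) (hb : LR m b)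
    (hd : Distinct r m a b) (heq : ∑ c, ∑ l ∈ range r, cnt m a b c l = r * m)
    {s : Fin 3 → ℤ} (hsm : ∑ c, s c = m) : LR r (fun c l => s c - (cnt m a b c l : ℤ)) := by
  obtain ⟨A, hA, hA'⟩ := ha
  obtain ⟨B, hB, hB'⟩ := hb
  obtain ⟨t, ht, ε, -, hg, hc⟩ := exists_generic (A := A) (B := B) hd
  refine (_root_.count_eq (hA.add_linF ht ε) (hA'.add_linF ht ε) hB hB' hg ?_ hsm).congr
    fun c i hi => by rw [hc c i hi]
  rw [← heq]
  exact sum_congr rfl fun c _ => sum_congr rfl fun l hl => hc c l (mem_range.1 hl)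

/-! ### Unique decompositions and uniqueness of hives -/

/-- Strict hives. -/
def SHive (n : ℕ) (A : Pt → ℚ) : Prop :=
  ∀ c p q, wt p + 1 = n → wt q + 1 = n → q (c + 2) ≤ p (c + 2) → p (c + 1) ≤ q (c + 1) → p ≠ q →
    dif A c p < dif A c q

theorem SHive.isHive {n : ℕ} {A : Pt → ℚ} (h : SHive n A) : IsHive n A := by
  intro c p q hp hq h2 h1
  rcases eq_or_ne p q with rfl | hne
  · exact le_rfl
  · exact (h c p q hp hq h2 h1 hne).le

theorem SHive.exch {n : ℕ} {A : Pt → ℚ} (h : SHive n A) {p q : Pt} {i v : Fin 3}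
    (hp : wt p + 1 = n) (hq : wt q + 1 = n) (hiv : i ≠ v) (hi : q i ≤ p i) (hv : p v ≤ q v)
    (hne : p ≠ q) : A (p + e i) + A (q + e v) < A (p + e v) + A (q + e i) := by
  rcases fin3_cases i v with rfl | rfl | rfl
  · exact absurd rfl hiv
  · have := h (i + 2) q p hq hp (by simpa) (by simpa) hne.symm
    simp only [c21, c22, dif] at this
    linarith
  · have := h (i + 1) p q hp hq (by simpa) (by simpa) hne
    simp only [c11, c12, dif] at this
    linarith

theorem Generic.ne {r m : ℕ} {A B : Pt → ℚ} (h : Generic r m A B) {p o : Pt} {i v : Fin 3}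
    (hp : wt p + 1 = r) (ho : wt o + 1 = m) (hiv : i ≠ v) :
    A (p + e i) + B (o + e v) ≠ A (p + e v) + B (o + e i) := by
  intro heq
  rcases fin3_cases i v with rfl | rfl | rfl
  · exact hiv rfl
  · refine h (i + 2) p o hp ho ?_
    simp only [c21, c22, dif]
    linarith
  · refine h (i + 1) p o hp ho ?_
    simp only [c11, c12, dif]
    linarith

theorem wt_of_ne {a b k : Fin 3} (hab : a ≠ b) (hak : a ≠ k) (hbk : b ≠ k) (p : Pt) :
    wt p = p a + p b + p k := by
  rcases fin3_cases a b with rfl | rfl | rfl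
  · exact absurd rfl hab
  · rcases fin3_cases a k with rfl | rfl | rfl
    · exact absurd rfl hak
    · exact absurd rfl hbk
    · exact wt_cyc p a
  · rcases fin3_cases a k with rfl | rfl | rfl
    · exact absurd rfl hak
    · rw [wt_cyc p a]; omega
    · exact absurd rfl hbk

/-- `α` gives the unique optimal decompositions for the sup-convolution `H` of `A` and `B`. -/
structure UDec (r m : ℕ) (A B H : Pt → ℚ) (α : Pt → Pt) : Prop where
  strict : SHive r A
  hive : IsHive m B
  conv : IsConv r m A B H
  opt : ∀ x, wt x = r + m → ∃ o, α x + o = x ∧ wt (α x) = r ∧ wt o = m ∧ H x = A (α x) + B o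
  uniq : ∀ x q o, wt x = r + m → q + o = x → wt q = r → wt o = m → H x ≤ A q + B o → q = α x

theorem exists_uDec {r m : ℕ} {A B : Pt → ℚ} (hA : SHive r A) (hB : IsHive m B)
    (hg : Generic r m A B) : ∃ H α, UDec r m A B H α := by
  obtain ⟨H, hH⟩ := exists_isConv r m A B
  have hopt : ∀ x, ∃ q, wt x = r + m →
      ∃ o, q + o = x ∧ wt q = r ∧ wt o = m ∧ H x = A q + B o := by
    intro x
    by_cases hx : wt x = r + m
    · obtain ⟨q, o, h1, h2, h3, h4⟩ := (hH x hx).1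
      exact ⟨q, fun _ => ⟨o, h1, h2, h3, h4⟩⟩
    · exact ⟨0, fun h => absurd h hx⟩
  choose α hα using hopt
  refine ⟨H, α, hA, hB, hH, hα, fun x q o hx hqo hq ho hle => ?_⟩
  obtain ⟨o', hqo', hq', ho', he'⟩ := hα x hx
  set q' := α x
  by_contra hne
  obtain ⟨i, hi⟩ : ∃ i, q' i < q i := by
    by_contra hcon; push Not at hcon
    refine hne (pt_ext 0 ?_ ?_ ?_) <;>
      (have h0 := hcon 0; have h1 := hcon 1; have h2 := hcon 2
       simp only [wt] at hq hq'; try simp only [zero_add]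
       omega)
  obtain ⟨v, hv⟩ : ∃ v, q v < q' v := by
    by_contra hcon; push Not at hcon
    have h0 := hcon 0; have h1 := hcon 1; have h2 := hcon 2
    simp only [wt] at hq hq'
    fin_cases i <;> simp at hi <;> omega
  have hiv : i ≠ v := by rintro rfl; omega
  have hoi : o i < o' i := by
    have a := congrFun hqo i; have b := congrFun hqo' i; simp at a b; omega
  have hov : o' v < o v := by
    have a := congrFun hqo v; have b := congrFun hqo' v; simp at a b; omega
  obtain ⟨p, rfl⟩ := pt_pred (p := q) (a := i) (by omega)
  obtain ⟨p', hp'⟩ := pt_pred (p := q') (a := v) (by omega)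
  obtain ⟨u, rfl⟩ := pt_pred (p := o) (a := v) (by omega)
  obtain ⟨u', rfl⟩ := pt_pred (p := o') (a := i) (by omega)
  rw [hp'] at hi hv hq' he' hqo'
  have eiv : e i v = 0 := by simp [e, hiv.symm]
  have evi : e v i = 0 := by simp [e, hiv]
  simp only [wt_add, wt_e, Pi.add_apply, e_self, eiv, evi, add_zero] at *
  have b1 := (hH x hx).2 (p + e v) (u + e i) (by rw [← hqo]; abel) (by simpa) (by simpa)
  have b2 := (hH x hx).2 (p' + e i) (u' + e v) (by rw [← hqo']; abel) (by simpa) (by simpa)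
  have x1 := hA.isHive.exch (p := p) (q := p') hq hq' hiv (by omega) (by omega)
  have x2 := hB.exch (p := u') (q := u) ho' ho hiv (by omega) (by omega)
  by_cases hpp : p = p'
  · have := hg.ne hq ho hiv
    subst hpp
    exact this (by linarith)
  · have := hA.exch hq hq' hiv (by omega) (by omega) hpp
    linarith

namespace UDec

variable {r m : ℕ} {A B H : Pt → ℚ} {α : Pt → Pt}

theorem two (h : UDec r m A B H α) {x x' q o q' o' : Pt} (hx : wt x = r + m) (hx' : wt x' = r + m)
    (h1 : q + o = x) (h1' : q' + o' = x') (hq : wt q = r) (ho : wt o = m) (hq' : wt q' = r)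
    (ho' : wt o' = m) (hle : H x + H x' ≤ A q + B o + (A q' + B o')) : q = α x ∧ q' = α x' := by
  have b1 := (h.conv x hx).2 q o h1 hq ho
  have b2 := (h.conv x' hx').2 q' o' h1' hq' ho'
  exact ⟨h.uniq x q o hx h1 hq ho (by linarith), h.uniq x' q' o' hx' h1' hq' ho' (by linarith)⟩

/-- The possible differences of decompositions along an edge. -/
theorem edge (h : UDec r m A B H α) {z : Pt} (hz : wt z + 1 = r + m) {a b k : Fin 3}
    (hab : a ≠ b) (hak : a ≠ k) (hbk : b ≠ k) :
    α (z + e b) = α (z + e a) ∨ α (z + e b) + e a = α (z + e a) + e b ∨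
      α (z + e b) + e k = α (z + e a) + e b ∨ α (z + e b) + e a = α (z + e a) + e k := by
  have hxb : wt (z + e b) = r + m := by simpa
  have hxa : wt (z + e a) = r + m := by simpa
  obtain ⟨o, hqo, hq, ho, he⟩ := h.opt (z + e b) hxb
  obtain ⟨o', hqo', hq', ho', he'⟩ := h.opt (z + e a) hxa
  have hu := h.uniq (z + e b)
  have hu' := h.uniq (z + e a)
  set q := α (z + e b)
  set q' := α (z + e a)
  have eab : ∀ i j : Fin 3, i ≠ j → e i j = 0 := fun i j hij => by simp [e, hij.symm]
  have m0 : ∀ i v, i ≠ v → ¬ (q' i < q i ∧ q v < q' v ∧ o i < o' i ∧ o' v < o v) := by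
    rintro i v hiv ⟨h1, h2, h3, h4⟩
    obtain ⟨p, hp⟩ := pt_pred (p := q) (a := i) (by omega)
    obtain ⟨p', hp'⟩ := pt_pred (p := q') (a := v) (by omega)
    obtain ⟨u, rfl⟩ := pt_pred (p := o) (a := v) (by omega)
    obtain ⟨u', rfl⟩ := pt_pred (p := o') (a := i) (by omega)
    rw [hp] at h1 h2 hq hqo he; rw [hp'] at h1 h2 hq' hqo' he'
    simp only [wt_add, wt_e, Pi.add_apply, e_self, eab _ _ hiv, eab _ _ hiv.symm, add_zero] at *
    have x1 := h.strict.isHive.exch (p := p) (q := p') hq hq' hiv (by omega) (by omega)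
    have x2 := h.hive.exch (p := u') (q := u) ho' ho hiv (by omega) (by omega)
    have := (h.two (x := z + e b) (x' := z + e a) (by simpa) (by simpa) (q := p + e v) (o := u + e i) (q' := p' + e i) (o' := u' + e v)
      (by rw [← hqo]; abel) (by rw [← hqo']; abel) (by simpa) (by simpa) (by simpa) (by simpa)
      (by linarith)).1
    have h5 : p + e v = p + e i := by rw [this, ← hp]
    have h6 := congrFun (add_left_cancel h5) v
    simp [eab _ _ hiv] at h6
  have m1 : q' b < q b → q a < q' a → q + e a = q' + e b := by
    intro h1 h2
    obtain ⟨p, hp⟩ := pt_pred (p := q) (a := b) (by omega)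
    obtain ⟨p', hp'⟩ := pt_pred (p := q') (a := a) (by omega)
    rw [hp] at h1 h2 hq hqo he; rw [hp'] at h1 h2 hq' hqo' he'
    simp only [wt_add, wt_e, Pi.add_apply, e_self, eab _ _ hab, eab _ _ hab.symm, add_zero] at *
    have x1 := h.strict.isHive.exch (p := p) (q := p') hq hq' hab.symm (by omega) (by omega)
    have e1 : p + o = z := by
      rw [add_right_comm] at hqo; exact add_right_cancel hqo
    have e2 : p' + o' = z := by
      rw [add_right_comm] at hqo'; exact add_right_cancel hqo'
    have := (h.two (x := z + e a) (x' := z + e b) (by simpa) (by simpa) (q := p + e a) (o := o) (q' := p' + e b) (o' := o')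
      (by rw [← e1]; abel) (by rw [← e2]; abel) (by simpa) (by simpa) (by simpa) (by simpa)
      (by linarith)).1
    rw [hp, add_right_comm, this]
  have m2 : o' b < o b → o a < o' a → q = q' := by
    intro h1 h2
    obtain ⟨u, rfl⟩ := pt_pred (p := o) (a := b) (by omega)
    obtain ⟨u', rfl⟩ := pt_pred (p := o') (a := a) (by omega)
    simp only [wt_add, wt_e, Pi.add_apply, e_self, eab _ _ hab, eab _ _ hab.symm, add_zero] at *
    have x1 := h.hive.exch (p := u) (q := u') ho ho' hab.symm (by omega) (by omega)
    have e1 : q + u = z := by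
      rw [← add_assoc] at hqo; exact add_right_cancel hqo
    have e2 : q' + u' = z := by
      rw [← add_assoc] at hqo'; exact add_right_cancel hqo'
    exact (h.two (x := z + e a) (x' := z + e b) (by simpa) (by simpa) (q := q) (o := u + e a) (q' := q') (o' := u' + e b)
      (by rw [← e1]; abel) (by rw [← e2]; abel) (by simpa) (by simpa) (by simpa) (by simpa)
      (by linarith)).1
  have m3 : q' b < q b → q k < q' k → o' k < o k → o a < o' a → q + e k = q' + e b := by
    intro h1 h2 h3 h4
    obtain ⟨p, hp⟩ := pt_pred (p := q) (a := b) (by omega)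
    obtain ⟨p', hp'⟩ := pt_pred (p := q') (a := k) (by omega)
    obtain ⟨u, rfl⟩ := pt_pred (p := o) (a := k) (by omega)
    obtain ⟨u', rfl⟩ := pt_pred (p := o') (a := a) (by omega)
    rw [hp] at h1 h2 hq hqo he; rw [hp'] at h1 h2 hq' hqo' he'
    simp only [wt_add, wt_e, Pi.add_apply, e_self, eab _ _ hbk, eab _ _ hbk.symm, eab _ _ hak,
      eab _ _ hak.symm, add_zero] at *
    have x1 := h.strict.isHive.exch (p := p) (q := p') hq hq' hbk (by omega) (by omega)
    have x2 := h.hive.exch (p := u) (q := u') ho ho' hak.symm (by omega) (by omega)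
    have e1 : p + u + e k = z := by
      have : p + u + e k + e b = z + e b := by rw [← hqo]; abel
      exact add_right_cancel this
    have e2 : p' + u' + e k = z := by
      have : p' + u' + e k + e a = z + e a := by rw [← hqo']; abel
      exact add_right_cancel this
    have := (h.two (x := z + e a) (x' := z + e b) (by simpa) (by simpa) (q := p + e k) (o := u + e a) (q' := p' + e b) (o' := u' + e k)
      (by rw [← e1]; abel) (by rw [← e2]; abel) (by simpa) (by simpa) (by simpa) (by simpa)
      (by linarith)).1
    rw [hp, add_right_comm, this]
  have m4 : q' k < q k → q a < q' a → o' b < o b → o k < o' k → q + e a = q' + e k := by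
    intro h1 h2 h3 h4
    obtain ⟨p, hp⟩ := pt_pred (p := q) (a := k) (by omega)
    obtain ⟨p', hp'⟩ := pt_pred (p := q') (a := a) (by omega)
    obtain ⟨u, rfl⟩ := pt_pred (p := o) (a := b) (by omega)
    obtain ⟨u', rfl⟩ := pt_pred (p := o') (a := k) (by omega)
    rw [hp] at h1 h2 hq hqo he; rw [hp'] at h1 h2 hq' hqo' he'
    simp only [wt_add, wt_e, Pi.add_apply, e_self, eab _ _ hbk, eab _ _ hbk.symm, eab _ _ hak,
      eab _ _ hak.symm, add_zero] at *
    have x1 := h.strict.isHive.exch (p := p) (q := p') hq hq' hak.symm (by omega) (by omega)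
    have x2 := h.hive.exch (p := u) (q := u') ho ho' hbk (by omega) (by omega)
    have e1 : p + u + e k = z := by
      have : p + u + e k + e b = z + e b := by rw [← hqo]; abel
      exact add_right_cancel this
    have e2 : p' + u' + e k = z := by
      have : p' + u' + e k + e a = z + e a := by rw [← hqo']; abel
      exact add_right_cancel this
    have := (h.two (x := z + e a) (x' := z + e b) (by simpa) (by simpa) (q := p + e a) (o := u + e k) (q' := p' + e k) (o' := u' + e b)
      (by rw [← e1]; abel) (by rw [← e2]; abel) (by simpa) (by simpa) (by simpa) (by simpa)
      (by linarith)).1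
    rw [hp, add_right_comm, this]
  have sum3 := wt_of_ne hab hak hbk
  have fb := congrFun hqo b; have fb' := congrFun hqo' b
  have fa := congrFun hqo a; have fa' := congrFun hqo' a
  have fk := congrFun hqo k; have fk' := congrFun hqo' k
  simp only [Pi.add_apply, e_self, eab _ _ hab, eab _ _ hab.symm, eab _ _ hak, eab _ _ hbk,
    add_zero] at fa fa' fb fb' fk fk'
  rw [sum3] at hq hq' ho ho'
  have n1 := m0 k a hak.symm
  have n2 := m0 k b hbk.symm
  have n3 := m0 b k hbk
  have n4 := m0 a k hak
  rcases lt_trichotomy (q k) (q' k) with hk | hk | hk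
  · refine Or.inr (Or.inr (Or.inl (m3 ?_ ?_ ?_ ?_))) <;> omega
  · by_cases hb : q' b < q b
    · exact Or.inr (Or.inl (m1 hb (by omega)))
    · exact Or.inl (m2 (by omega) (by omega))
  · refine Or.inr (Or.inr (Or.inr (m4 ?_ ?_ ?_ ?_))) <;> omega

/-- Decompositions around a tight rhombus. -/
theorem rhombus (h : UDec r m A B H α) {u : Pt} (hu : wt u + 2 = r + m) (i : Fin 3)
    (ht : H (u + e i + e (i + 1)) + H (u + e i + e (i + 2)) ≤
      H (u + e i + e i) + H (u + e (i + 1) + e (i + 2))) :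
    (α (u + e i + e (i + 1)) = α (u + e i + e i) ∧
      α (u + e i + e (i + 2)) = α (u + e (i + 1) + e (i + 2))) ∨
    (α (u + e i + e (i + 2)) = α (u + e i + e i) ∧
      α (u + e i + e (i + 1)) = α (u + e (i + 1) + e (i + 2))) := by
  obtain ⟨o, hqo, hq, ho, he⟩ := h.opt (u + e i + e i) (by simp; omega)
  obtain ⟨o', hqo', hq', ho', he'⟩ := h.opt (u + e (i + 1) + e (i + 2)) (by simp; omega)
  set q := α (u + e i + e i)
  set q' := α (u + e (i + 1) + e (i + 2))
  have n1 : i ≠ i + 1 := by fin_cases i <;> simp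
  have n2 : i ≠ i + 2 := by fin_cases i <;> simp
  have fi := congrFun hqo i; have fi' := congrFun hqo' i
  simp at fi fi'
  by_cases hqi : q' i < q i
  · obtain ⟨p, hp⟩ := pt_pred (p := q) (a := i) (by omega)
    have hqw := hq
    rw [hp] at hq hqo he
    have e1 : p + o = u + e i := by
      rw [add_right_comm] at hqo; exact add_right_cancel hqo
    rw [wt_cyc _ i] at hqw
    have hqw' := hq'
    rw [wt_cyc _ i] at hqw'
    rcases (by omega : q (i + 1) < q' (i + 1) ∨ q (i + 2) < q' (i + 2)) with hv | hv
    · obtain ⟨p', hp'⟩ := pt_pred (p := q') (a := i + 1) (by omega)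
      rw [hp'] at hqi hv hq' hqo' he'; rw [hp] at hqi hv
      simp only [wt_add, wt_e, Pi.add_apply, e_self, e_01, e_10, add_zero] at *
      have e2 : p' + o' = u + e (i + 2) := by
        rw [add_right_comm, add_right_comm u] at hqo'; exact add_right_cancel hqo'
      have w1 : wt (u + e i + e (i + 1)) = r + m := by simp; omega
      have w2 : wt (u + e i + e (i + 2)) = r + m := by simp; omega
      have x1 := h.strict.isHive.exch (p := p) (q := p') hq hq' n1 (by omega) (by omega)
      have g := h.two (x := u + e i + e (i + 1)) (x' := u + e i + e (i + 2)) w1 w2 (q := p + e (i + 1)) (o := o) (q' := p' + e i) (o' := o')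
        (by rw [← e1]; abel) (by rw [add_right_comm u, ← e2]; abel) (by simpa) ho (by simpa) ho'
        (by linarith)
      have hpp : p = p' := by
        by_contra hne
        have x2 := h.strict.exch hq hq' n1 (by omega) (by omega) hne
        have b1 := (h.conv (u + e i + e (i + 1)) w1).2 (p + e (i + 1)) o (by rw [← e1]; abel) (by simpa) ho
        have b2 := (h.conv (u + e i + e (i + 2)) w2).2 (p' + e i) o' (by rw [add_right_comm u, ← e2]; abel) (by simpa)
          ho'
        linarith
      right
      rw [← g.1, ← g.2, hp, hp', hpp]
      exact ⟨rfl, rfl⟩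
    · obtain ⟨p', hp'⟩ := pt_pred (p := q') (a := i + 2) (by omega)
      rw [hp'] at hqi hv hq' hqo' he'; rw [hp] at hqi hv
      simp only [wt_add, wt_e, Pi.add_apply, e_self, e_02, e_20, add_zero] at *
      have e2 : p' + o' = u + e (i + 1) := by
        rw [add_right_comm] at hqo'; exact add_right_cancel hqo'
      have w1 : wt (u + e i + e (i + 1)) = r + m := by simp; omega
      have w2 : wt (u + e i + e (i + 2)) = r + m := by simp; omega
      have x1 := h.strict.isHive.exch (p := p) (q := p') hq hq' n2 (by omega) (by omega)
      have g := h.two (x := u + e i + e (i + 2)) (x' := u + e i + e (i + 1)) w2 w1 (q := p + e (i + 2)) (o := o) (q' := p' + e i) (o' := o')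
        (by rw [← e1]; abel) (by rw [add_right_comm u, ← e2]; abel) (by simpa) ho (by simpa) ho'
        (by linarith)
      have hpp : p = p' := by
        by_contra hne
        have x2 := h.strict.exch hq hq' n2 (by omega) (by omega) hne
        have b1 := (h.conv (u + e i + e (i + 2)) w2).2 (p + e (i + 2)) o (by rw [← e1]; abel) (by simpa) ho
        have b2 := (h.conv (u + e i + e (i + 1)) w1).2 (p' + e i) o' (by rw [add_right_comm u, ← e2]; abel) (by simpa)
          ho'
        linarith
      left
      rw [← g.1, ← g.2, hp, hp', hpp]
      exact ⟨rfl, rfl⟩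
  · have how := ho; have how' := ho'
    rw [wt_cyc _ i] at how how'
    obtain ⟨t, rfl⟩ := pt_pred (p := o) (a := i) (by omega)
    have e1 : q + t = u + e i := by
      rw [← add_assoc] at hqo; exact add_right_cancel hqo
    simp only [wt_add, wt_e, Pi.add_apply, e_self, e_01, e_02, e_10, e_20, add_zero] at *
    rcases (by omega : t (i + 1) < o' (i + 1) ∨ t (i + 2) < o' (i + 2)) with hv | hv
    · obtain ⟨t', rfl⟩ := pt_pred (p := o') (a := i + 1) (by omega)
      simp only [wt_add, wt_e, Pi.add_apply, e_self, e_01, e_02, e_10, e_20, add_zero] at *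
      have e2 : q' + t' = u + e (i + 2) := by
        rw [← add_assoc, add_right_comm u] at hqo'; exact add_right_cancel hqo'
      have w1 : wt (u + e i + e (i + 1)) = r + m := by simp; omega
      have w2 : wt (u + e i + e (i + 2)) = r + m := by simp; omega
      have x1 := h.hive.exch (p := t) (q := t') ho ho' n1 (by omega) (by omega)
      have g := h.two (x := u + e i + e (i + 1)) (x' := u + e i + e (i + 2)) w1 w2 (q := q) (o := t + e (i + 1)) (q' := q') (o' := t' + e i)
        (by rw [← e1]; abel) (by rw [add_right_comm u, ← e2]; abel) hq (by simpa) hq' (by simpa)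
        (by linarith)
      exact Or.inl ⟨g.1.symm, g.2.symm⟩
    · obtain ⟨t', rfl⟩ := pt_pred (p := o') (a := i + 2) (by omega)
      simp only [wt_add, wt_e, Pi.add_apply, e_self, e_01, e_02, e_10, e_20, add_zero] at *
      have e2 : q' + t' = u + e (i + 1) := by
        rw [← add_assoc] at hqo'; exact add_right_cancel hqo'
      have w1 : wt (u + e i + e (i + 1)) = r + m := by simp; omega
      have w2 : wt (u + e i + e (i + 2)) = r + m := by simp; omega
      have x1 := h.hive.exch (p := t) (q := t') ho ho' n2 (by omega) (by omega)
      have g := h.two (x := u + e i + e (i + 2)) (x' := u + e i + e (i + 1)) w2 w1 (q := q) (o := t + e (i + 2)) (q' := q') (o' := t' + e i)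
        (by rw [← e1]; abel) (by rw [add_right_comm u, ← e2]; abel) hq (by simpa) hq' (by simpa)
        (by linarith)
      exact Or.inr ⟨g.1.symm, g.2.symm⟩

/-- Decompositions along a tight strip. -/
theorem strip (h : UDec r m A B H α) (c : Fin 3) {z z' : Pt} (hz : wt z + 1 = r + m)
    (hz' : wt z' + 1 = r + m) (h2 : z (c + 2) = z' (c + 2)) (h1 : z (c + 1) ≤ z' (c + 1))
    (hd : dif H c z = dif H c z') :
    (α (z + e (c + 1)) = α (z' + e (c + 1)) ∧ α (z + e (c + 2)) = α (z' + e (c + 2))) ∨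
    (α (z + e (c + 1)) = α (z + e (c + 2)) ∧ α (z' + e (c + 1)) = α (z' + e (c + 2))) := by
  have hH : IsHive (r + m) H := h.conv.isHive h.strict.isHive h.hive
  obtain ⟨k, hk⟩ := Nat.exists_eq_add_of_le h1
  induction k generalizing z with
  | zero =>
    have : z = z' := by
      rw [wt_cyc _ c] at hz hz'; exact pt_ext c (by omega) (by omega) (by omega)
    subst this
    exact Or.inl ⟨rfl, rfl⟩
  | succ k ih =>
    obtain ⟨u, rfl⟩ := pt_pred (p := z) (a := c) (by rw [wt_cyc _ c] at hz hz'; omega)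
    simp only [wt_add, wt_e, Pi.add_apply, e_01, e_02, add_zero] at *
    have hz1 : wt (u + e (c + 1)) + 1 = r + m := by simp; omega
    have d1 := hH c (u + e c) (u + e (c + 1)) (by simp; omega) hz1 (by simp) (by simp)
    have d2 := hH c (u + e (c + 1)) z' hz1 hz' (by simp [h2]) (by simp; omega)
    have ih' := ih (z := u + e (c + 1)) (by simp; omega) (by simp [h2]) (by simp; omega)
      (by linarith) (by simp; omega)
    have rh := h.rhombus (u := u) hz (c + 1) (by
      simp only [c11, c12]
      have : dif H c (u + e c) = dif H c (u + e (c + 1)) := by linarith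
      simp only [dif] at this
      rw [add_right_comm u (e (c + 1)) (e c), add_right_comm u (e (c + 2)) (e c)]
      linarith)
    simp only [c11, c12] at rh
    rw [add_right_comm u (e (c + 1)) (e c), add_right_comm u (e (c + 2)) (e c)] at rh
    rcases rh with ⟨r1, r2⟩ | ⟨r1, r2⟩
    · rcases ih' with ⟨s1, s2⟩ | ⟨s1, s2⟩
      · right
        exact ⟨r2, by rw [← s1, ← s2, r1]⟩
      · exact Or.inr ⟨r2, s2⟩
    · rcases ih' with ⟨s1, s2⟩ | ⟨s1, s2⟩
      · exact Or.inl ⟨by rw [r1, s1], by rw [← r2, s2]⟩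
      · exact Or.inr ⟨by rw [r1, s1, r2], s2⟩

end UDec

/-! ### Signed areas and rigidity -/

/-- The planar cross product. -/
def cr (p q : Pt) : ℤ := p 0 * q 1 - p 1 * q 0

theorem cr_self (p : Pt) : cr p p = 0 := by simp only [cr]; ring

theorem area_le {x₀ y₀ x₁ y₁ : ℤ}
    (h₀ : (x₀ = 0 ∧ y₀ = 0) ∨ (x₀ = 0 ∧ y₀ = -1) ∨ (x₀ = -1 ∧ y₀ = 0) ∨ (x₀ = 1 ∧ y₀ = -1))
    (h₁ : (x₁ = 0 ∧ y₁ = 0) ∨ (x₁ = 1 ∧ y₁ = 0) ∨ (x₁ = 1 ∧ y₁ = -1) ∨ (x₁ = 0 ∧ y₁ = 1))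
    (h₂ : (x₀ + x₁ = 0 ∧ y₀ + y₁ = 0) ∨ (x₀ + x₁ = 1 ∧ y₀ + y₁ = -1) ∨
      (x₀ + x₁ = 0 ∧ y₀ + y₁ = -1) ∨ (x₀ + x₁ = 1 ∧ y₀ + y₁ = 0)) :
    x₀ * y₁ - y₀ * x₁ ≤ 1 ∧ (x₀ * y₁ - y₀ * x₁ = 1 →
      (x₀ = 0 ∧ y₀ = -1 ∧ x₁ = 1 ∧ y₁ = 0) ∨ (x₀ = -1 ∧ y₀ = 0 ∧ x₁ = 1 ∧ y₁ = -1) ∨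
      (x₀ = 1 ∧ y₀ = -1 ∧ x₁ = 0 ∧ y₁ = 1)) := by
  rcases h₀ with ⟨rfl, rfl⟩ | ⟨rfl, rfl⟩ | ⟨rfl, rfl⟩ | ⟨rfl, rfl⟩ <;>
  rcases h₁ with ⟨rfl, rfl⟩ | ⟨rfl, rfl⟩ | ⟨rfl, rfl⟩ | ⟨rfl, rfl⟩ <;> omega

/-- The possible differences along an edge parallel to side `c`. -/
def EdgeStep (c : Fin 3) (p q : Pt) : Prop :=
  q = p ∨ q + e (c + 1) = p + e (c + 2) ∨ q + e c = p + e (c + 2) ∨ q + e (c + 1) = p + e c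

theorem EdgeStep.coords {p q : Pt} :
    (EdgeStep 0 p q → ((q 0 - p 0 : ℤ) = 0 ∧ (q 1 - p 1 : ℤ) = 0) ∨
      ((q 0 - p 0 : ℤ) = 0 ∧ (q 1 - p 1 : ℤ) = -1) ∨ ((q 0 - p 0 : ℤ) = -1 ∧ (q 1 - p 1 : ℤ) = 0) ∨
      ((q 0 - p 0 : ℤ) = 1 ∧ (q 1 - p 1 : ℤ) = -1)) ∧
    (EdgeStep 1 p q → ((q 0 - p 0 : ℤ) = 0 ∧ (q 1 - p 1 : ℤ) = 0) ∨
      ((q 0 - p 0 : ℤ) = 1 ∧ (q 1 - p 1 : ℤ) = 0) ∨ ((q 0 - p 0 : ℤ) = 1 ∧ (q 1 - p 1 : ℤ) = -1) ∨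
      ((q 0 - p 0 : ℤ) = 0 ∧ (q 1 - p 1 : ℤ) = 1)) ∧
    (EdgeStep 2 p q → ((q 0 - p 0 : ℤ) = 0 ∧ (q 1 - p 1 : ℤ) = 0) ∨
      ((q 0 - p 0 : ℤ) = -1 ∧ (q 1 - p 1 : ℤ) = 1) ∨ ((q 0 - p 0 : ℤ) = 0 ∧ (q 1 - p 1 : ℤ) = 1) ∨
      ((q 0 - p 0 : ℤ) = -1 ∧ (q 1 - p 1 : ℤ) = 0)) := by
  refine ⟨?_, ?_, ?_⟩ <;> rintro (h | h | h | h) <;>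
    first | (subst h; simp) | (have h0 := congrFun h 0; have h1 := congrFun h 1
                               simp [e] at h0 h1; omega)

theorem up_area {q : Fin 3 → Pt} {r : ℕ} (hw : ∀ a, wt (q a) = r)
    (h : ∀ c, EdgeStep c (q (c + 1)) (q (c + 2))) :
    ∑ c, cr (q (c + 1)) (q (c + 2)) ≤ 1 ∧ (∑ c, cr (q (c + 1)) (q (c + 2)) = 1 →
      (∀ c, q c + e (c + 1) = q (c + 1) + e c) ∨ (∀ c, q c + e (c + 1) = q (c + 1) + e (c + 2)) ∨
      ∀ c, q c + e (c + 2) = q (c + 1) + e c) := by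
  have h0 := EdgeStep.coords.1 (h 0)
  have h1 := EdgeStep.coords.2.1 (h 1)
  have h2 := EdgeStep.coords.2.2 (h 2)
  simp only [zero_add, Fin.reduceAdd] at h0 h1 h2
  have key := area_le h0 h1 (by omega)
  have hsum : ∑ c, cr (q (c + 1)) (q (c + 2)) =
      ((q 2 0 - q 1 0 : ℤ)) * (q 0 1 - q 2 1) - (q 2 1 - q 1 1) * (q 0 0 - q 2 0) := by
    simp only [Fin.sum_univ_three, cr, zero_add, Fin.reduceAdd]
    ring
  rw [hsum]
  refine ⟨key.1, fun heq => ?_⟩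
  have w0 := hw 0; have w1 := hw 1; have w2 := hw 2
  simp only [wt] at w0 w1 w2
  rcases key.2 heq with k | k | k
  · left
    intro c
    refine pt_ext 0 ?_ ?_ ?_ <;> fin_cases c <;> simp [e] <;> omega
  · right; left
    intro c
    refine pt_ext 0 ?_ ?_ ?_ <;> fin_cases c <;> simp [e] <;> omega
  · right; right
    intro c
    refine pt_ext 0 ?_ ?_ ?_ <;> fin_cases c <;> simp [e] <;> omega

theorem down_area {p : Fin 3 → Pt}
    (h : ∀ c, EdgeStep c (p (c + 2)) (p (c + 1))) :
    ∑ c, cr (p (c + 1)) (p (c + 2)) ≤ 1 := by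
  have h0 := EdgeStep.coords.1 (h 0)
  have h1 := EdgeStep.coords.2.1 (h 1)
  have h2 := EdgeStep.coords.2.2 (h 2)
  simp only [zero_add, Fin.reduceAdd] at h0 h1 h2
  have key := area_le h0 h1 (by omega)
  have hsum : ∑ c, cr (p (c + 1)) (p (c + 2)) =
      ((p 1 0 - p 2 0 : ℤ)) * (p 2 1 - p 0 1) - (p 1 1 - p 2 1) * (p 2 0 - p 0 0) := by
    simp only [Fin.sum_univ_three, cr, zero_add, Fin.reduceAdd]
    ring
  rw [hsum]
  exact key.1

theorem cnt_lt_iff {m : ℕ} {a b : Bdry} (hb : LR m b) (c : Fin 3) (l : ℕ) {j : ℕ}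
    (hj : j < m) : j < cnt m a b c l ↔ a c l < b c j := by
  constructor
  · intro h
    by_contra hcon
    have : cnt m a b c l ≤ j := by
      rw [cnt, ← card_range j]
      refine card_le_card fun i hi => ?_
      obtain ⟨hi, hlt⟩ := mem_filter.1 hi
      rw [mem_range] at hi ⊢
      by_contra hji
      have := hb.antitone c (i := j) (k := i) (by omega) hi
      exact hcon (by linarith)
    omega
  · intro h
    rw [cnt, Nat.lt_iff_add_one_le, ← card_range (j + 1)]
    refine card_le_card fun i hi => ?_
    have hi := mem_range.1 hi
    have := hb.antitone c (i := i) (k := j) (by omega) hj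
    exact mem_filter.2 ⟨mem_range.2 (by omega), by linarith⟩

theorem cnt_le (m : ℕ) (a b : Bdry) (c : Fin 3) (l : ℕ) : cnt m a b c l ≤ m := by
  rw [cnt]
  exact (card_filter_le _ _).trans (by simp)

namespace UDec

variable {r m : ℕ} {A B H : Pt → ℚ} {α : Pt → Pt} {a b : Bdry}

theorem edgeStep (h : UDec r m A B H α) {z : Pt} (hz : wt z + 1 = r + m) (c : Fin 3) :
    EdgeStep c (α (z + e (c + 1))) (α (z + e (c + 2))) :=
  h.edge hz (by fin_cases c <;> simp) (by fin_cases c <;> simp) (by fin_cases c <;> simp)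

theorem three (h : UDec r m A B H α) {x q o : Fin 3 → Pt} (hx : ∀ c, wt (x c) = r + m)
    (h1 : ∀ c, q c + o c = x c) (hq : ∀ c, wt (q c) = r) (ho : ∀ c, wt (o c) = m)
    (hle : ∑ c, H (x c) ≤ ∑ c, (A (q c) + B (o c))) (c : Fin 3) : q c = α (x c) := by
  have b1 := fun c => (h.conv _ (hx c)).2 _ _ (h1 c) (hq c) (ho c)
  refine h.uniq _ _ _ (hx c) (h1 c) (hq c) (ho c) ?_
  rw [sum_cyc _ c, sum_cyc _ c] at hle
  have := b1 (c + 1); have := b1 (c + 2)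
  linarith

theorem up_std (h : UDec r m A B H α) {z : Pt} (hz : wt z + 1 = r + m)
    (harea : ∑ c, cr (α (z + e (c + 1))) (α (z + e (c + 2))) = 1) :
    ∃ S, ∀ a, α (z + e a) = S + e a := by
  have hx : ∀ a, wt (z + e a) = r + m := fun a => by simpa
  choose o ho using fun a => h.opt (z + e a) (hx a)
  have hsum : ∑ a, H (z + e a) = ∑ a, (A (α (z + e a)) + B (o a)) :=
    sum_congr rfl fun a _ => (ho a).2.2.2
  rcases (up_area (q := fun a => α (z + e a)) (fun a => (ho a).2.1)
    (fun c => h.edgeStep hz c)).2 harea with k | k | k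
  · have hpos : 0 < α (z + e 0) 0 := by
      have := congrFun (k 0) 0
      simp [e] at this; omega
    obtain ⟨S, hS⟩ := pt_pred hpos
    refine ⟨S, fun a => ?_⟩
    have k0 := k 0; have k2 := k 2
    simp only [zero_add, Fin.reduceAdd] at k0 k2
    fin_cases a
    · exact hS
    · refine add_right_cancel (b := e 0) ?_
      show α (z + e 1) + e 0 = S + e 1 + e 0
      rw [← k0, hS]; abel
    · refine add_right_cancel (b := e 0) ?_
      show α (z + e 2) + e 0 = S + e 2 + e 0
      rw [k2, hS]; abel
  · exfalso
    have := h.three (x := fun a => z + e a) (q := fun a => α (z + e (a + 1)))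
      (o := fun a => o (a + 2)) hx (fun a => ?_) (fun a => (ho _).2.1) (fun a => (ho _).2.2.1) ?_ 0
    · have k0 := k 0
      rw [← this] at k0
      simpa [e] using congrFun (add_left_cancel k0) 1
    · have h2 := (ho (a + 2)).1
      have k1 := k (a + 1)
      simp only [c11, c12] at k1
      refine add_right_cancel (b := e (a + 2)) ?_
      rw [add_right_comm, k1, add_right_comm, h2]; abel
    · rw [hsum]
      apply le_of_eq
      rw [sum_cyc _ 0, sum_cyc _ 0]
      simp only [zero_add, Fin.reduceAdd]
      ring
  · exfalso
    have := h.three (x := fun a => z + e a) (q := fun a => α (z + e (a + 2)))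
      (o := fun a => o (a + 1)) hx (fun a => ?_) (fun a => (ho _).2.1) (fun a => (ho _).2.2.1) ?_ 0
    · have k0 := k 2
      simp only [Fin.reduceAdd] at this k0
      rw [← this] at k0
      simpa [e] using congrFun (add_left_cancel k0) 1
    · have h2 := (ho (a + 1)).1
      have k1 := k (a + 1)
      simp only [c11, c12] at k1
      refine add_right_cancel (b := e (a + 1)) ?_
      rw [add_right_comm, ← k1, add_right_comm, h2]; abel
    · rw [hsum]
      apply le_of_eq
      rw [sum_cyc _ 0, sum_cyc _ 0]
      simp only [zero_add, Fin.reduceAdd]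
      ring

/-- The decomposition of a boundary point. -/
theorem bdry_opt (h : UDec r m A B H α) (ha : HasBd r A a) (hb : HasBd m B b) {c : Fin 3}
    {J X t' : ℕ} (hJ : J + X = r + m) (ht : t' ≤ r) (htX : t' ≤ X) (hX : X ≤ t' + m)
    (h1 : ∀ t j, t < t' → t < r → j < m → X ≤ j + t' → b c j < a c t)
    (h2 : ∀ t j, t' ≤ t → t < r → j < m → j + t' < X → a c t < b c j) :
    α (sd c J X) = sd c (r - t') t' := by
  have hx : wt (sd c J X) = r + m := by simpa
  obtain ⟨o, hqo, hq, ho, he⟩ := h.opt _ hx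
  set q := α (sd c J X)
  have f0 := congrFun hqo c; have f1 := congrFun hqo (c + 1); have f2 := congrFun hqo (c + 2)
  simp at f0 f1 f2
  rw [wt_cyc _ c] at hq ho
  have hqs := eq_sd (p := q) (c := c) f0.1
  have hos := eq_sd (p := o) (c := c) f0.2
  rcases lt_trichotomy (q (c + 2)) t' with hlt | heq | hgt
  · exfalso
    have g := h1 (q (c + 2)) (o (c + 2) - 1) hlt (by omega) (by omega) (by omega)
    have a1 := ha c (q (c + 1) - 1) (q (c + 2)) (by omega)
    have b1 := hb c (o (c + 1)) (o (c + 2) - 1) (by omega)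
    rw [show q (c + 1) - 1 + 1 = q (c + 1) by omega, ← hqs] at a1
    rw [show o (c + 2) - 1 + 1 = o (c + 2) by omega, ← hos] at b1
    have := (h.conv _ hx).2 (sd c (q (c + 1) - 1) (q (c + 2) + 1))
      (sd c (o (c + 1) + 1) (o (c + 2) - 1))
      (pt_ext c (by simp) (by simp; omega) (by simp; omega)) (by simp; omega) (by simp; omega)
    linarith
  · rw [hqs, heq]
    congr 1; omega
  · exfalso
    have g := h2 (q (c + 2) - 1) (o (c + 2)) (by omega) (by omega) (by omega) (by omega)
    have a1 := ha c (q (c + 1)) (q (c + 2) - 1) (by omega)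
    have b1 := hb c (o (c + 1) - 1) (o (c + 2)) (by omega)
    rw [show q (c + 2) - 1 + 1 = q (c + 2) by omega, ← hqs] at a1
    rw [show o (c + 1) - 1 + 1 = o (c + 1) by omega, ← hos] at b1
    have := (h.conv _ hx).2 (sd c (q (c + 1) + 1) (q (c + 2) - 1))
      (sd c (o (c + 1) - 1) (o (c + 2) + 1))
      (pt_ext c (by simp) (by simp; omega) (by simp; omega)) (by simp; omega) (by simp; omega)
    linarith

theorem bdry_cnt (h : UDec r m A B H α) (ha : HasBd r A a) (hb : HasBd m B b)
    (hg : Generic r m A B) {c : Fin 3} {J l : ℕ} (hl : l < r)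
    (hJ : J + (l + cnt m a b c l) + 1 = r + m) :
    α (sd c (J + 1) (l + cnt m a b c l)) = sd c (r - l) l ∧
    α (sd c J (l + cnt m a b c l + 1)) = sd c (r - (l + 1)) (l + 1) ∧
    dif H c (sd c J (l + cnt m a b c l)) = a c l := by
  have la : LR r a := ⟨A, h.strict.isHive, ha⟩
  have lb : LR m b := ⟨B, h.hive, hb⟩
  have hk := cnt_le m a b c l
  have hne : ∀ j < m, a c l ≠ b c j := fun j hj => by
    rw [← ha.dif (c := c) (j := r - 1 - l) (l := l) (by omega),
      ← hb.dif (c := c) (j := m - 1 - j) (l := j) (by omega)]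
    exact hg c _ _ (by simp; omega) (by simp; omega)
  have k1 : ∀ t j, t ≤ l → j < m → cnt m a b c l ≤ j → b c j < a c t := by
    intro t j ht hj hkj
    have g1 := la.antitone c ht hl
    have g2 : ¬ a c l < b c j := fun hlt => by
      have := (cnt_lt_iff lb c l hj).2 hlt; omega
    have := lt_of_le_of_ne (not_lt.1 g2) (hne j hj).symm
    linarith
  have k2 : ∀ t j, l ≤ t → t < r → j < m → j < cnt m a b c l → a c t < b c j := by
    intro t j ht htr hj hkj
    have g1 := la.antitone c ht htr
    have := (cnt_lt_iff lb c l hj).1 hkj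
    linarith
  have o1 : α (sd c (J + 1) (l + cnt m a b c l)) = sd c (r - l) l :=
    h.bdry_opt ha hb (by omega) hl.le (by omega) (by omega)
      (fun t j ht _ hj hX => k1 t j ht.le hj (by omega))
      (fun t j ht htr hj hX => k2 t j ht htr hj (by omega))
  have o2 : α (sd c J (l + cnt m a b c l + 1)) = sd c (r - (l + 1)) (l + 1) :=
    h.bdry_opt ha hb (by omega) hl (by omega) (by omega)
      (fun t j ht _ hj hX => k1 t j (by omega) hj (by omega))
      (fun t j ht htr hj hX => k2 t j (by omega) htr hj (by omega))
  refine ⟨o1, o2, ?_⟩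
  obtain ⟨o, p1, -, -, p2⟩ := h.opt (sd c (J + 1) (l + cnt m a b c l)) (by simp; omega)
  obtain ⟨o', p1', -, -, p2'⟩ := h.opt (sd c J (l + cnt m a b c l + 1)) (by simp; omega)
  rw [o1] at p1 p2; rw [o2] at p1' p2'
  have hoo : o = o' := by
    have f0 := congrFun p1 c; have f1 := congrFun p1 (c + 1); have f2 := congrFun p1 (c + 2)
    have f0' := congrFun p1' c; have f1' := congrFun p1' (c + 1); have f2' := congrFun p1' (c + 2)
    simp at f0 f1 f2 f0' f1' f2'
    exact pt_ext c (by omega) (by omega) (by omega)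
  rw [dif, sd_add_e1, sd_add_e2, p2, p2', hoo]
  have := ha c (r - (l + 1)) l (by omega)
  rw [show r - (l + 1) + 1 = r - l by omega] at this
  linarith

/-- The small triangles are mapped identically. -/
theorem rigid (h : UDec r m A B H α) (ha : HasBd r A a) (hb : HasBd m B b)
    (hg : Generic r m A B) {s : Fin 3 → ℤ} (hs : ∑ c, s c = m) {G : Pt → ℤ} (hG : IsHive r G)
    (hZ : HasBd r G (fun c l => s c - cnt m a b c l)) :
    ∀ y i, wt y + 1 = r → α (upPos 1 G s y + e i) = y + e i := by
  have la : LR r a := ⟨A, h.strict.isHive, ha⟩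
  have hH : IsHive (1 * (r + m)) H := by
    rw [one_mul]; exact h.conv.isHive h.strict.isHive h.hive
  have h0 : 0 < r → ∀ c, s c - (cnt m a b c 0 : ℤ) ≤ s c := fun _ c => by omega
  have hs' : ∑ c, s c = (1 : ℕ) * (((r + m : ℕ) : ℤ) - r) := by rw [hs]; push_cast; ring
  let x : Bdry := fun c i => H (sd c (r + m - 1 - i) (i + 1)) - H (sd c (r + m - i) i)
  have hx : HasBd (1 * (r + m)) H x := fun c j l hj => by
    simp only [x]
    rw [show r + m - 1 - l = j by omega, show r + m - l = j + 1 by omega]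
  have hpos : ∀ (c : Fin 3) (l : ℕ), ((1 : ℕ) * (l : ℤ) + s c - (s c - (cnt m a b c l : ℤ))).toNat =
      l + cnt m a b c l := fun c l => by
    have : ((1 : ℕ) * (l : ℤ) + s c - (s c - (cnt m a b c l : ℤ))) = ((l + cnt m a b c l : ℕ) : ℤ) := by
      push_cast; ring
    rw [this, Int.toNat_natCast]
  have hxa : ∀ c, ∀ l < r, x c (l + cnt m a b c l) = a c l := fun c l hl => by
    have hk := cnt_le m a b c l
    obtain ⟨-, -, h3⟩ := h.bdry_cnt ha hb hg (c := c) (J := r + m - 1 - (l + cnt m a b c l)) hl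
      (by omega)
    rw [← h3, ← hx.dif (c := c) (j := r + m - 1 - (l + cnt m a b c l)) (by omega)]
  have heq : ∑ c, ∑ l ∈ range r, ∑ t ∈ range 1,
      x c (((1 : ℕ) * (l : ℤ) + s c - (s c - (cnt m a b c l : ℤ))).toNat + t) = 0 := by
    rw [← la.trace]
    refine sum_congr rfl fun c _ => sum_congr rfl fun l hl => ?_
    rw [sum_range_one, hpos, add_zero, hxa c l (mem_range.1 hl)]
  obtain ⟨t1, t2⟩ := validity_tight hH hx hG hZ h0 hs' heq
  have dq : ∀ c z, difQ 1 H c z = dif H c z := fun c z => by simp [difQ, dif]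
  simp only [dq, one_smul, sum_range_one, hpos, add_zero] at t1 t2
  have wφ : ∀ y, wt y + 1 = r → wt (upPos 1 G s y) + 1 = r + m := fun y hy => by
    have := wt_upPos hG hZ h0 hs' hy; omega
  have wψ : ∀ w, wt w + 2 = r → wt (downPos 1 G s w) + 2 = r + m := fun w hw => by
    have := wt_downPos hG hZ h0 hs' hw; omega
  have s1 := fun w c (hw : wt w + 2 = r) => h.strip c (z := upPos 1 G s (w + e c))
    (z' := downPos 1 G s w + e c) (wφ _ (by simp; omega)) (by have := wψ w hw; simp; omega)
    (by simp [upPos_two_eq hG hZ h0 hw]) (by simpa using upPos_one_le hG hZ h0 hw c) (t1 w c hw)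
  have ub : ∀ c j l, j + l + 1 = r → upPos 1 G s (sd c j l) (c + 2) = l + cnt m a b c l :=
    fun c j l hj => by rw [upPos_bd hG hZ h0 hj, hpos]
  have s2 : ∀ c j l, j + l + 1 = r → ∃ J, J + (l + cnt m a b c l) + 1 = r + m ∧
      ((α (upPos 1 G s (sd c j l) + e (c + 1)) = sd c (r - l) l ∧
        α (upPos 1 G s (sd c j l) + e (c + 2)) = sd c (r - (l + 1)) (l + 1))) := by
    intro c j l hj
    have hk := cnt_le m a b c l
    obtain ⟨J, hJ⟩ : ∃ J, J + (l + cnt m a b c l) + 1 = r + m :=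
      ⟨r + m - 1 - (l + cnt m a b c l), by omega⟩
    obtain ⟨o1, o2, o3⟩ := h.bdry_cnt ha hb hg (c := c) (l := l) (by omega) hJ
    have hwy := wφ (sd c j l) (by simp; omega)
    have huy := ub c j l hj
    have st := h.strip c (z := upPos 1 G s (sd c j l)) (z' := sd c J (l + cnt m a b c l))
      hwy (by simp; omega) (by simp [huy])
      (by rw [wt_cyc _ c] at hwy; simp; omega)
      (by rw [t2 c j l hj, o3, hxa c l (by omega)])
    rw [sd_add_e1, sd_add_e2, o1, o2] at st
    refine ⟨J, hJ, st.resolve_right fun hh => ?_⟩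
    have := congrFun hh.2 (c + 2)
    simp at this
  -- the areas add up to the area of the large triangle
  let F : Fin 3 → Pt → ℤ := fun c z => cr (α (z + e (c + 1))) (α (z + e (c + 2)))
  let P : Pt → Fin 3 → Pt := fun w c => α (downPos 1 G s w + e (c + 1) + e (c + 2))
  have hF : ∀ w c, wt w + 2 = r → F c (upPos 1 G s (w + e c)) = - cr (P w (c + 1)) (P w (c + 2)) := by
    intro w c hw
    simp only [F, P, c11, c12, c21, c22]
    rw [add_right_comm (downPos 1 G s w) (e (c + 2)) (e c)]
    rcases s1 w c hw with ⟨g1, g2⟩ | ⟨g1, g2⟩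
    · rw [g1, g2]; simp only [cr]; ring
    · rw [g1, cr_self, g2, cr_self, neg_zero]
  have hup : ∀ y ∈ tri 1 r, ∑ c, F c (upPos 1 G s y) ≤ 1 := fun y hy =>
    (up_area (r := r) (q := fun a => α (upPos 1 G s y + e a))
      (fun a => (h.opt _ (by have := wφ y (mem_tri.1 hy); simpa)).choose_spec.2.1)
      (fun c => h.edgeStep (wφ y (mem_tri.1 hy)) c)).1
  have hdown : ∀ w ∈ tri 2 r, ∑ c, cr (P w (c + 1)) (P w (c + 2)) ≤ 1 := fun w hw => by
    refine down_area fun c => ?_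
    have := h.edgeStep (z := downPos 1 G s w + e c)
      (by have := wψ w (mem_tri.1 hw); simp; omega) c
    simp only [P, c11, c12, c21, c22]
    rwa [add_right_comm (downPos 1 G s w) (e (c + 2)) (e c)]
  have htot : ∑ y ∈ tri 1 r, ∑ c, F c (upPos 1 G s y) +
      ∑ w ∈ tri 2 r, ∑ c, cr (P w (c + 1)) (P w (c + 2)) = (r : ℤ) ^ 2 := by
    rw [sum_comm, sum_comm (s := tri 2 r)]
    have := fun c => sum_tri_split r c (fun y => F c (upPos 1 G s y))
    simp only [this]
    rw [sum_add_distrib, add_assoc, ← sum_add_distrib]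
    have hz : ∀ c : Fin 3, ∑ w ∈ tri 2 r, F c (upPos 1 G s (w + e c)) +
        ∑ w ∈ tri 2 r, cr (P w (c + 1)) (P w (c + 2)) = 0 := fun c => by
      rw [← sum_add_distrib]
      exact sum_eq_zero fun w hw => by rw [hF w c (mem_tri.1 hw)]; ring
    simp only [hz, sum_const_zero, add_zero]
    have hbd : ∀ c : Fin 3, ∀ l ∈ range r, F c (upPos 1 G s (sd c (r - 1 - l) l)) =
        if c = 2 then (r : ℤ) else 0 := by
      intro c l hl
      have hl := mem_range.1 hl
      obtain ⟨J, -, g1, g2⟩ := s2 c (r - 1 - l) l (by omega)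
      simp only [F]
      rw [g1, g2]
      fin_cases c
      · simp [cr, sd]
      · simp [cr, sd]
      · simp [cr, sd]
        rw [Nat.cast_sub hl.le, Nat.cast_sub (by omega : l + 1 ≤ r)]; push_cast; ring
    rw [sum_congr rfl fun c _ => sum_congr rfl (hbd c)]
    simp; ring
  have hall : ∀ y ∈ tri 1 r, ∑ c, F c (upPos 1 G s y) = 1 := by
    have hc := card_tri_add r
    have d1 := sum_le_sum hup
    have d2 := sum_le_sum hdown
    have hc' : ((tri 1 r).card : ℤ) + (tri 2 r).card = (r : ℤ) ^ 2 := by exact_mod_cast hc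
    simp only [sum_const, nsmul_eq_mul, mul_one] at d1 d2
    refine (sum_eq_sum_iff_of_le hup).1 ?_
    simp only [sum_const, nsmul_eq_mul, mul_one]
    linarith
  have hstd : ∀ y, ∃ S, wt y + 1 = r → ∀ i, α (upPos 1 G s y + e i) = S + e i := fun y => by
    by_cases hy : wt y + 1 = r
    · obtain ⟨S, hS⟩ := h.up_std (wφ y hy) (hall y (mem_tri.2 hy))
      exact ⟨S, fun _ => hS⟩
    · exact ⟨0, fun h => absurd h hy⟩
  choose S hS using hstd
  have hstep : ∀ w c, wt w + 2 = r → S (w + e c) + e (c + 1) = S (w + e (c + 1)) + e c := by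
    intro w c hw
    have key : ∀ c, α (downPos 1 G s w + e c + e (c + 1)) = S (w + e c) + e (c + 1) ∧
        α (downPos 1 G s w + e c + e (c + 2)) = S (w + e c) + e (c + 2) := by
      intro c
      have hS' := hS (w + e c) (by simp; omega)
      rcases s1 w c hw with ⟨g1, g2⟩ | ⟨g1, g2⟩
      · rw [← g1, ← g2]; exact ⟨hS' _, hS' _⟩
      · rw [hS', hS'] at g1
        have := congrFun (add_left_cancel g1) (c + 1)
        simp at this
    have k1 := (key c).1
    have k2 := (key (c + 1)).2
    rw [c12] at k2
    rw [← k1, ← k2, add_right_comm]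
  have hSy : ∀ k y, y 0 = k → wt y + 1 = r → S y = y := by
    intro k
    induction k with
    | zero =>
      intro y h0 hy
      obtain ⟨J, -, g1, g2⟩ := s2 0 (y 1) (y 2) (by rw [wt] at hy; omega)
      have hsd : sd 0 (y 1) (y 2) = y := (eq_sd (c := 0) h0).symm
      rw [hsd, hS y hy] at g1
      refine add_right_cancel (b := e (0 + 1)) (g1.trans ?_)
      rw [wt] at hy
      exact pt_ext 0 (by simp [h0, sd, e]) (by simp [sd, e]; omega) (by simp [sd, e])
    | succ k ih =>
      intro y h0 hy
      obtain ⟨w, rfl⟩ := pt_pred (p := y) (a := 0) (by omega)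
      have g := hstep w 0 (by simpa using hy)
      rw [zero_add, ih (w + e 1) (by simp [e] at h0 ⊢; omega) (by simpa using hy)] at g
      refine add_right_cancel (b := e 1) (g.trans ?_)
      abel
  intro y i hy
  rw [hS y hy, hSy _ y rfl hy]

/-- The integral hive with the counting boundary is unique. -/
theorem unique (h : UDec r m A B H α) (ha : HasBd r A a) (hb : HasBd m B b)
    (hg : Generic r m A B) {s : Fin 3 → ℤ} (hs : ∑ c, s c = m) {G G' : Pt → ℤ}
    (hG : IsHive r G) (hZ : HasBd r G (fun c l => s c - cnt m a b c l))
    (hG' : IsHive r G') (hZ' : HasBd r G' (fun c l => s c - cnt m a b c l)) :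
    ∀ y c, wt y + 1 = r → dif G c y = dif G' c y := by
  have h0 : 0 < r → ∀ c, s c - (cnt m a b c 0 : ℤ) ≤ s c := fun _ c => by omega
  have hs' : ∑ c, s c = (1 : ℕ) * (((r + m : ℕ) : ℤ) - r) := by rw [hs]; push_cast; ring
  have key : ∀ G : Pt → ℤ, IsHive r G → HasBd r G (fun c l => s c - cnt m a b c l) →
      ∀ y, wt y + 1 = r → ∃ β : Pt, upPos 1 G s y = y + β ∧ wt β = m ∧ ∀ p b, wt p + 1 = m →
        (β = p + e (b + 2) → dif A b y < dif B b p) ∧ (β = p + e (b + 1) → dif B b p < dif A b y) := by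
    intro G hG hZ y hy
    have hr := h.rigid ha hb hg hs hG hZ y
    have hw := wt_upPos hG hZ h0 hs' hy
    have hx : ∀ i, wt (upPos 1 G s y + e i) = r + m := fun i => by simp; omega
    obtain ⟨β, q1, -, q3, -⟩ := h.opt _ (hx 0)
    rw [hr 0 hy] at q1
    have hβ : upPos 1 G s y = y + β := by
      refine add_right_cancel (b := e 0) (q1.symm.trans ?_); abel
    refine ⟨β, hβ, q3, ?_⟩
    have hval : ∀ i, H (y + β + e i) = A (y + e i) + B β := fun i => by
      obtain ⟨o, p1, -, p3, p4⟩ := h.opt _ (hx i)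
      rw [hr i hy] at p1 p4
      rw [hβ] at p1 p4
      have : o = β := by
        refine add_left_cancel (a := y + e i) (p1.trans ?_); abel
      rw [p4, this]
    have main : ∀ i v p, wt p + 1 = m → β = p + e v → i ≠ v →
        A (y + e v) + B (p + e i) < A (y + e i) + B (p + e v) := by
      rintro i v p hp rfl hiv
      have h1 := (h.conv (y + (p + e v) + e i) (by rw [← hβ]; exact hx i)).2 (y + e v) (p + e i)
        (by abel) (by simpa) (by simpa)
      rw [hval i] at h1
      exact lt_of_le_of_ne h1 (hg.ne hy hp hiv.symm)
    intro p b hp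
    refine ⟨fun hb => ?_, fun hb => ?_⟩
    · have := main (b + 1) (b + 2) p hp hb (by fin_cases b <;> simp)
      simp only [dif]; linarith
    · have := main (b + 2) (b + 1) p hp hb (by fin_cases b <;> simp)
      simp only [dif]; linarith
  intro y c hy
  obtain ⟨β, e1, w1, m1⟩ := key G hG hZ y hy
  obtain ⟨β', e2, w2, m2⟩ := key G' hG' hZ' y hy
  have hle : ∀ c, β (c + 2) ≤ β' (c + 2) := fun c =>
    (argmax_le h.hive (T := fun b => dif A b y) (T' := fun b => dif A b y) (c := c) rfl le_rfl le_rfl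
      w1 w2 m1 fun p b hp => ⟨fun hq => ((m2 p b hp).1 hq).le, fun hq => ((m2 p b hp).2 hq).le⟩).2
  have hge : ∀ c, β' (c + 2) ≤ β (c + 2) := fun c =>
    (argmax_le h.hive (T := fun b => dif A b y) (T' := fun b => dif A b y) (c := c) rfl le_rfl le_rfl
      w2 w1 m2 fun p b hp => ⟨fun hq => ((m1 p b hp).1 hq).le, fun hq => ((m1 p b hp).2 hq).le⟩).2
  have u1 := upPos_eq (Q := 1) hG hZ h0 hy c
  have u2 := upPos_eq (Q := 1) hG' hZ' h0 hy c
  have hββ : β (c + 2) = β' (c + 2) := le_antisymm (hle c) (hge c)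
  rw [e1] at u1; rw [e2] at u2
  simp only [Pi.add_apply] at u1 u2
  push_cast at u1 u2
  rw [hββ] at u1
  linarith

end UDec

theorem shive_quad (n : ℕ) : SHive n (fun p => -(1 / 2) * ∑ a, (p a : ℚ) ^ 2) ∧
    HasBd n (fun p => -(1 / 2) * ∑ a, (p a : ℚ) ^ 2) (fun _ l => (n : ℚ) - 1 - 2 * l) := by
  have hd : ∀ c z, dif (fun p : Pt => -(1 / 2) * ∑ a, (p a : ℚ) ^ 2) c z = z (c + 1) - z (c + 2) := by
    intro c z
    simp only [dif, sum_cyc _ c, Pi.add_apply, e_self, e_12, e_21, e_10, e_20]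
    push_cast; ring
  refine ⟨fun c p q hp hq h2 h1 hne => ?_, fun c j l hj => ?_⟩
  · rw [hd, hd]
    have : p (c + 1) + q (c + 2) < q (c + 1) + p (c + 2) := by
      by_contra hcon
      rw [wt_cyc _ c] at hp hq
      exact hne (pt_ext c (by omega) (by omega) (by omega))
    have : (p (c + 1) : ℚ) + q (c + 2) < q (c + 1) + p (c + 2) := by exact_mod_cast this
    linarith
  · have := hd c (sd c j l)
    rw [dif, sd_add_e1, sd_add_e2] at this
    rw [this, ← hj]; simp; ring

theorem Interior.exists_shive {n : ℕ} {x : Bdry} (hx : Interior n x) :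
    ∃ A, SHive n A ∧ HasBd n A x := by
  obtain ⟨hs, hb⟩ := shive_quad n
  obtain ⟨ε, hε, h⟩ := hx.perturb (z := fun _ l => (n : ℚ) - 1 - 2 * l) (LR.trace ⟨_, hs.isHive, hb⟩)
  obtain ⟨A, hA, ha⟩ := h (-ε) (by rw [abs_neg, abs_of_pos hε])
  refine ⟨fun p => A p + ε * (-(1 / 2) * ∑ a, (p a : ℚ) ^ 2), fun c p q hp hq h2 h1 hne => ?_,
    fun c j l hj => ?_⟩
  · have g1 := hA c p q hp hq h2 h1
    have g2 := mul_lt_mul_of_pos_left (hs c p q hp hq h2 h1 hne) hε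
    simp only [dif] at *
    linarith
  · have g1 := ha c j l hj
    have g2 := hb c j l hj
    simp only at g1 g2 ⊢
    linear_combination g1 + ε * g2

theorem SHive.add_linF {r : ℕ} {A : Pt → ℚ} (hA : SHive r A) {t : Fin 3 → ℚ} (ht : ∑ c, t c = 0)
    (ε : ℚ) : SHive r (fun p => A p + ε * linF t p) := by
  intro c p q hp hq h2 h1 hne
  rw [dif_add_linF ht, dif_add_linF ht]
  have := hA c p q hp hq h2 h1 hne
  linarith

/-- There is exactly one integral hive with boundary `Z`, up to constants. -/
def RigidLR (r : ℕ) (Z : Fin 3 → ℕ → ℤ) : Prop :=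
  LR r Z ∧ ∀ G G', IsHive r G → HasBd r G Z → IsHive r G' → HasBd r G' Z →
    ∀ y c, wt y + 1 = r → dif G c y = dif G' c y

theorem RigidLR.congr {r : ℕ} {Z Z' : Fin 3 → ℕ → ℤ} (h : RigidLR r Z)
    (hZ : ∀ c, ∀ i < r, Z c i = Z' c i) : RigidLR r Z' := by
  have hb : ∀ G, HasBd r G Z' → HasBd r G Z := fun G hG c j l hj => by
    rw [hG c j l hj, hZ c l (by omega)]
  exact ⟨h.1.congr hZ, fun G G' h1 h2 h3 h4 => h.2 G G' h1 (hb G h2) h3 (hb G' h4)⟩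

theorem Interior.rigid {r m : ℕ} {a b : Bdry} (ha : Interior r a) (hb : LR m b)
    (hd : Distinct r m a b) (heq : ∑ c, ∑ l ∈ range r, cnt m a b c l = r * m)
    {s : Fin 3 → ℤ} (hsm : ∑ c, s c = m) : RigidLR r (fun c l => s c - (cnt m a b c l : ℤ)) := by
  refine ⟨ha.1.count_eq hb hd heq hsm, fun G G' hG hZ hG' hZ' => ?_⟩
  obtain ⟨A, hA, hA'⟩ := ha.exists_shive
  obtain ⟨B, hB, hB'⟩ := hb
  obtain ⟨t, ht, ε, -, hg, hc⟩ := exists_generic (A := A) (B := B) hd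
  obtain ⟨H, α, hu⟩ := exists_uDec (hA.add_linF ht ε) hB hg
  have hbd : ∀ G, HasBd r G (fun c l => s c - (cnt m a b c l : ℤ)) →
      HasBd r G (fun c l => s c - (cnt m (fun c i => a c i + ε * t c) b c l : ℤ)) :=
    fun G hG c j l hj => by simp only [hG c j l hj, hc c l (by omega : l < r)]
  exact hu.unique (hA'.add_linF ht ε) hB' hg hsm hG (hbd G hZ) hG' (hbd G' hZ')

/-! ### Boundaries as multisets -/

/-- The multiset of the first `n` entries of `u`. -/
def ms (n : ℕ) (u : ℕ → ℚ) : Multiset ℚ := (Multiset.range n).map u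

@[simp] theorem card_ms (n : ℕ) (u : ℕ → ℚ) : Multiset.card (ms n u) = n := by simp [ms]

theorem mem_ms {n : ℕ} {u : ℕ → ℚ} {v : ℚ} : v ∈ ms n u ↔ ∃ i < n, u i = v := by simp [ms]

theorem sum_ms (n : ℕ) (u : ℕ → ℚ) : (ms n u).sum = ∑ i ∈ range n, u i := rfl

theorem ms_congr {n : ℕ} {u v : ℕ → ℚ} (h : ∀ i < n, u i = v i) : ms n u = ms n v :=
  Multiset.map_congr rfl fun i hi => h i (Multiset.mem_range.1 hi)

theorem map_ms (n : ℕ) (u : ℕ → ℚ) (g : ℚ → ℚ) : (ms n u).map g = ms n (fun i => g (u i)) := by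
  simp [ms, Multiset.map_map]

theorem ms_add (n m : ℕ) (u : ℕ → ℚ) : ms (n + m) u = ms n u + ms m (fun i => u (n + i)) := by
  simp [ms, Multiset.range_add, Multiset.map_map]

theorem ms_const (n : ℕ) (v : ℚ) : ms n (fun _ => v) = Multiset.replicate n v := by
  simp [ms]

theorem ms_nthSmall {s : Finset ℕ} {r : ℕ} (hs : s.card = r) (u : ℕ → ℚ) :
    ms r (fun k => u (nthSmall s k)) = s.val.map u := by
  subst hs
  conv_rhs => rw [← image_nthSmall s, image_val_of_injOn (nthSmall_injOn s)]
  simp [ms, Multiset.map_map]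

theorem ms_rev (n : ℕ) (u : ℕ → ℚ) : ms n (fun i => u (n - 1 - i)) = ms n u := by
  have h : (range n).image (fun i => n - 1 - i) = range n := by
    ext i
    simp only [mem_image, mem_range]
    exact ⟨fun ⟨j, hj, h⟩ => by omega, fun hi => ⟨n - 1 - i, by omega, by omega⟩⟩
  have h2 : (range n).val = (range n).val.map (fun i => n - 1 - i) := by
    conv_lhs => rw [← h]
    refine image_val_of_injOn fun i hi j hj hij => ?_
    simp at hi hj hij; omega
  have h3 : Multiset.range n = (Multiset.range n).map (fun i => n - 1 - i) := h2
  conv_rhs => rw [ms, h3]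
  simp [ms, Multiset.map_map]

/-- Weakly decreasing sequences. -/
def Dec1 (n : ℕ) (u : ℕ → ℚ) : Prop := ∀ i j, i ≤ j → j < n → u j ≤ u i

theorem ms_inj {n : ℕ} {u v : ℕ → ℚ} (hu : Dec1 n u) (hv : Dec1 n v) (h : ms n u = ms n v) :
    ∀ i < n, u i = v i := by
  have key : ∀ w, Dec1 n w → List.Pairwise (· ≥ ·) ((List.range n).map w) := fun w hw => by
    rw [List.pairwise_map]
    refine List.pairwise_lt_range.imp_of_mem fun {a b} _ hb hab => ?_
    exact hw a b hab.le (List.mem_range.1 hb)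
  have hp : ((List.range n).map u).Perm ((List.range n).map v) := by
    rw [← Multiset.coe_eq_coe, ← Multiset.map_coe, ← Multiset.map_coe]; exact h
  have := hp.eq_of_pairwise (fun a b _ _ h1 h2 => le_antisymm h2 h1) (key u hu) (key v hv)
  intro i hi
  have h2 := congrArg (fun l => l[i]?) this
  simpa [hi] using h2

theorem exists_dec1 (M : Multiset ℚ) : ∃ u, Dec1 (Multiset.card M) u ∧ ms (Multiset.card M) u = M := by
  set l := M.sort (· ≥ ·) with hl
  have hlen : l.length = Multiset.card M := by rw [hl, Multiset.length_sort]
  have hp : List.Pairwise (· ≥ ·) l := Multiset.pairwise_sort M _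
  refine ⟨fun i => l.getD i 0, fun i j hij hj => ?_, ?_⟩
  · rcases hij.eq_or_lt with rfl | hlt
    · exact le_rfl
    rw [← hlen] at hj
    simp only [List.getD_eq_getElem _ _ hj, List.getD_eq_getElem _ _ (hlt.trans hj)]
    exact List.pairwise_iff_getElem.1 hp i j (hlt.trans hj) hj hlt
  · conv_rhs => rw [← Multiset.sort_eq M (· ≥ ·), ← hl]
    rw [ms, ← Multiset.coe_range, Multiset.map_coe, ← hlen]
    congr 1
    apply List.ext_getElem
    · simp
    · intro i h1 h2; simp [List.getElem?_eq_getElem h2]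

theorem countP_ms (n : ℕ) (u : ℕ → ℚ) (θ : ℚ) :
    (ms n u).countP (θ ≤ ·) = ((range n).filter fun i => θ ≤ u i).card := by
  rw [ms, Multiset.countP_map]; rfl

/-- `M` is the boundary of a hive, up to order. -/
def LRM (M : Fin 3 → Multiset ℚ) : Prop := ∃ n x, LR n x ∧ ∀ c, ms n (x c) = M c

theorem LR.lrm {n : ℕ} {x : Bdry} (h : LR n x) : LRM (fun c => ms n (x c)) :=
  ⟨n, x, h, fun _ => rfl⟩

theorem LRM.congr {M M' : Fin 3 → Multiset ℚ} (h : LRM M) (hM : ∀ c, M c = M' c) : LRM M' := by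
  rwa [← funext hM]

theorem LRM.lr {n : ℕ} {M : Fin 3 → Multiset ℚ} {x : Bdry} (h : LRM M)
    (hx : ∀ c, Dec1 n (x c)) (hM : ∀ c, ms n (x c) = M c) : LR n x := by
  obtain ⟨m, y, hy, hyM⟩ := h
  have hmn : m = n := by
    have := congrArg Multiset.card ((hyM 0).trans (hM 0).symm)
    simpa using this
  subst hmn
  exact hy.congr fun c i hi => ms_inj (hy.dec c) (hx c) ((hyM c).trans (hM c).symm) i hi

theorem LRM.add {M M' : Fin 3 → Multiset ℚ} (h : LRM M) (h' : LRM M') :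
    LRM (fun c => M c + M' c) := by
  obtain ⟨n, x, hx, hxM⟩ := h
  obtain ⟨n', x', hx', hxM'⟩ := h'
  have hcard : ∀ c, Multiset.card (M c + M' c) = n + n' := fun c => by
    rw [← hxM, ← hxM']; simp
  choose w hw hwM using fun c => exists_dec1 (M c + M' c)
  simp only [hcard] at hw hwM
  refine ⟨n + n', w, UpLR.lr ((UpLR.of_LR hx).merge (UpLR.of_LR hx') ?_) ?_, hwM⟩
  · intro c θ l₁ l₂ h1 h2 hu hv k hk
    by_contra hlt
    have e1 : (M c + M' c).countP (θ ≤ ·) ≤ k := by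
      rw [← hwM, countP_ms, ← card_range k]
      refine card_le_card fun i hi => ?_
      simp only [mem_filter, mem_range] at hi ⊢
      by_contra hki
      have := hw c k i (by omega) hi.1
      linarith
    have e2 : ∀ (m l : ℕ) (u : ℕ → ℚ), l ≤ m → (∀ i < l, θ ≤ u i) → l ≤ (ms m u).countP (θ ≤ ·) := by
      intro m l u hl hu
      rw [countP_ms, ← card_range l]
      refine card_le_card fun i hi => ?_
      simp only [mem_filter, mem_range] at hi ⊢
      exact ⟨by omega, hu i hi⟩
    rw [Multiset.countP_add, ← hxM, ← hxM'] at e1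
    have := e2 n l₁ (x c) h1 hu
    have := e2 n' l₂ (x' c) h2 hv
    omega
  · have : ∀ c, ∑ i ∈ range (n + n'), w c i =
        ∑ i ∈ range n, x c i + ∑ i ∈ range n', x' c i := fun c => by
      rw [← sum_ms, hwM, Multiset.sum_add, ← hxM, ← hxM', sum_ms, sum_ms]
    rw [sum_congr rfl fun c _ => this c, sum_add_distrib, hx.trace, hx'.trace, add_zero]

theorem LRM.neg {M : Fin 3 → Multiset ℚ} (h : LRM M) : LRM (fun c => (M c).map Neg.neg) := by
  obtain ⟨n, x, hx, hxM⟩ := h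
  refine ⟨n, _, hx.neg_rev, fun c => ?_⟩
  simp only [ms_rev n (fun i => - x c i), ← hxM, map_ms]

theorem LRM.const (n : ℕ) {s : Fin 3 → ℚ} (hs : ∑ c, s c = 0) :
    LRM (fun c => Multiset.replicate n (s c)) :=
  ⟨n, _, LR.const n hs, fun c => ms_const n (s c)⟩

theorem LRon.lrm {s : Triple} {t : ℕ} {x : Bdry} (h : LRon s t x) :
    LRM (fun c => (s c).val.map (x c)) :=
  ⟨t, _, h.2, fun c => ms_nthSmall (h.1 c) _⟩

theorem LRM.lrOn {s : Triple} {t n : ℕ} {x : Bdry} (hx : Dec n x)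
    (hs : ∀ c, s c ⊆ range n) (ht : ∀ c, (s c).card = t)
    (h : LRM (fun c => (s c).val.map (x c))) : LRon s t x :=
  ⟨ht, h.lr (fun c => hx.res hs ht c) fun c => ms_nthSmall (ht c) _⟩

/-- A hive made of constant blocks. -/
theorem LR.step {r : ℕ} {a a' : Fin 3 → ℕ} {v w : Fin 3 → ℚ} (ha : ∀ c, a c + a' c = r)
    (hr : ∑ c, a' c = r) (hvw : ∀ c, w c ≤ v c) (h : ∀ c, w c + v (c + 1) + v (c + 2) = 0) :
    LR r (fun c i => if i < a c then v c else w c) := by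
  have hb : ∀ k, LRM (fun c => Multiset.replicate (a' k) (if c = k then w c else v c)) := fun k =>
    LRM.const (a' k) (s := fun c => if c = k then w c else v c) (by
      rw [sum_cyc _ k, ← h k]
      have e1 : k + 1 ≠ k := by fin_cases k <;> simp
      have e2 : k + 2 ≠ k := by fin_cases k <;> simp
      simp [e1, e2])
  refine (((hb 0).add (hb 1)).add (hb 2)).lr (fun c i j hij _ => ?_) fun c => ?_
  · have := hvw c
    by_cases h1 : j < a c
    · simp only [h1, if_true, show i < a c by omega, le_refl]
    · simp only [h1, if_false]
      split_ifs <;> linarith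
  · have e1 : ms r (fun i => if i < a c then v c else w c) =
        Multiset.replicate (a c) (v c) + Multiset.replicate (a' c) (w c) := by
      rw [← ha c, ms_add, ← ms_const, ← ms_const]
      congr 1
      · exact ms_congr fun i hi => if_pos hi
      · exact ms_congr fun i hi => if_neg (by omega)
    rw [e1]
    have h3 := ha c
    rw [Fin.sum_univ_three] at hr
    fin_cases c <;> simp only [Fin.isValue, Fin.zero_eta, Fin.mk_one, Fin.reduceFinMk, if_true,
      zero_ne_one, one_ne_zero, if_false, Fin.reduceEq] at h3 ⊢
    · rw [show a 0 = a' 1 + a' 2 by omega, Multiset.replicate_add]; abel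
    · rw [show a 1 = a' 0 + a' 2 by omega, Multiset.replicate_add]; abel
    · rw [show a 2 = a' 0 + a' 1 by omega, Multiset.replicate_add]

/-! ### Symmetric boundaries -/

/-- The antisymmetric sequence of length `2 * n + 1` extending `x`. -/
def hat (n : ℕ) (x : Bdry) : Bdry := fun c i =>
  if i < n then x c i else if i = n then 0 else - x c (2 * n - i)

/-- The antisymmetric extension of `x` is the boundary of a hive. -/
def SymLR (n : ℕ) (x : Bdry) : Prop := LR (2 * n + 1) (hat n x)

/-- The variant of `SymLR` without the central zero. -/
def SymLR₀ (n : ℕ) (x : Bdry) : Prop :=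
  LRM (fun c => ms n (x c) + ms n (fun i => - x c i))

/-- Weakly decreasing and nonnegative sequences. -/
def DecPos (n : ℕ) (x : Bdry) : Prop := Dec n x ∧ ∀ c, ∀ i < n, 0 ≤ x c i

theorem hat_rev (n : ℕ) (x : Bdry) (c : Fin 3) {i : ℕ} (hi : i < 2 * n + 1) :
    hat n x c (2 * n + 1 - 1 - i) = - hat n x c i := by
  simp only [hat]
  rcases lt_trichotomy i n with h | h | h
  · rw [if_neg (by omega), if_neg (by omega), if_pos h, show 2 * n - (2 * n + 1 - 1 - i) = i by omega]
  · rw [if_neg (by omega), if_pos (by omega), if_neg (by omega), if_pos h, neg_zero]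
  · rw [if_pos (by omega), if_neg (by omega), if_neg (by omega), neg_neg,
      show 2 * n + 1 - 1 - i = 2 * n - i by omega]

theorem dec_hat {n : ℕ} {x : Bdry} (h : DecPos n x) : Dec (2 * n + 1) (hat n x) := by
  intro c i j hij hj
  have h0 := h.2 c
  simp only [hat]
  split_ifs with h1 h2 h3 h4 h5 h6 h7 h8 <;>
    first | omega | exact le_rfl | exact h.1 c i j hij h1 | exact h0 _ (by omega) | skip
  · have := h0 (2 * n - j) (by omega); have := h0 i (by omega); linarith
  · have := h0 (2 * n - j) (by omega); linarith
  · have := h.1 c (2 * n - j) (2 * n - i) (by omega) (by omega); linarith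

theorem sdec_hat {n : ℕ} {x : Bdry} (h : SDec n x) (h0 : ∀ c, ∀ i < n, 0 < x c i) :
    SDec (2 * n + 1) (hat n x) := by
  intro c i j hij hj
  have h0 := h0 c
  simp only [hat]
  split_ifs with h1 h2 h3 h4 h5 h6 h7 h8 <;>
    first | omega | exact h c i j hij h1 | exact h0 _ (by omega) | skip
  · have := h0 (2 * n - j) (by omega); have := h0 i (by omega); linarith
  · have := h0 (2 * n - j) (by omega); linarith
  · have := h c (2 * n - j) (2 * n - i) (by omega) (by omega); linarith

theorem evS_revS_hat {n : ℕ} {s : Triple} (hs : ∀ c, s c ⊆ range (2 * n + 1))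
    (x : Bdry) : evS (fun c => revS (2 * n + 1) (s c)) (hat n x) = - evS s (hat n x) := by
  simp only [evS, sum_revS (hs _), ← sum_neg_distrib]
  exact sum_congr rfl fun c _ => sum_congr rfl fun i hi =>
    hat_rev n x c (mem_range.1 (hs c hi))

theorem trace_hat (n : ℕ) (x : Bdry) :
    ∑ c, ∑ i ∈ range (2 * n + 1), hat n x c i = 0 := by
  refine sum_eq_zero fun c _ => ?_
  have := sum_range_reflect (hat n x c) (2 * n + 1)
  rw [sum_congr rfl fun i hi => hat_rev n x c (mem_range.1 hi),
    sum_neg_distrib] at this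
  linarith

theorem hat_comb (n : ℕ) (x y : Bdry) (s t : ℚ) (c : Fin 3) (i : ℕ) :
    hat n (fun c i => s * x c i + t * y c i) c i = s * hat n x c i + t * hat n y c i := by
  simp only [hat]
  split_ifs <;> ring

theorem evS_comb (A : Triple) (x y : Bdry) (s t : ℚ) :
    evS A (fun c i => s * x c i + t * y c i) = s * evS A x + t * evS A y := by
  simp [evS, sum_add_distrib, mul_sum]

theorem evS_hat_comb (n : ℕ) (A : Triple) (x y : Bdry) (s t : ℚ) :
    evS A (hat n (fun c i => s * x c i + t * y c i)) = s * evS A (hat n x) + t * evS A (hat n y) := by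
  rw [← evS_comb]
  exact sum_congr rfl fun c _ => sum_congr rfl fun i _ => hat_comb n x y s t c i

theorem LR.of_properE {n : ℕ} {x : Bdry} (hx : Dec n x)
    (ht : ∑ c, ∑ i ∈ range n, x c i = 0) (h : ∀ s ∈ properE n, 0 ≤ evS s x) : LR n x := by
  refine InK.lr ⟨hx, fun r s hs => ?_⟩ ht
  rcases Nat.eq_zero_or_pos r with rfl | hr
  · have : ∀ c, s c = ∅ := fun c => card_eq_zero.1 (hs.card c)
    simp [evS, this]
  rcases hs.le.eq_or_lt with rfl | hlt
  · rw [show s = fun _ => range r from funext hs.eq_full]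
    exact ht.ge
  · exact h s ⟨r, hr, hlt, hs⟩

/-- The number of elements of `V` below `i`. -/
def bef (V : Finset ℕ) (i : ℕ) : ℕ := (V.filter (· < i)).card

theorem bef_union {U V : Finset ℕ} (h : Disjoint U V) (i : ℕ) : bef (U ∪ V) i = bef U i + bef V i := by
  rw [bef, filter_union, card_union_of_disjoint]
  · rfl
  · exact disjoint_filter_filter h

theorem bef_nthSmall {s : Finset ℕ} {k : ℕ} (hk : k < s.card) : bef s (nthSmall s k) = k :=
  card_lt_nthSmall hk

theorem nthSmall_lt_iff_bef {s : Finset ℕ} {k x : ℕ} (hk : k < s.card) :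
    nthSmall s k < x ↔ k < bef s x := by
  constructor
  · intro h
    rw [← bef_nthSmall hk, bef, bef]
    refine card_lt_card ⟨fun i hi => ?_, fun hsub => ?_⟩
    · rw [mem_filter] at hi ⊢; exact ⟨hi.1, by omega⟩
    · have := hsub (mem_filter.2 ⟨nthSmall_mem hk, h⟩)
      simp at this
  · intro h
    by_contra hcon
    have : bef s x ≤ bef s (nthSmall s k) := card_le_card fun i hi => by
      rw [mem_filter] at hi ⊢; exact ⟨hi.1, by omega⟩
    rw [bef_nthSmall hk] at this
    omega

/-- The indices that are neither in `A` nor opposite to `A`, except the middle. -/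
def freeS (n : ℕ) (A : Finset ℕ) : Finset ℕ :=
  (range (2 * n + 1) \ (A ∪ revS (2 * n + 1) A)).erase n

/-- The count of opposite indices before those of `A`. -/
def bd2 (n r : ℕ) (A : Triple) : Fin 3 → ℕ → ℤ := fun c l =>
  (if c = 2 then (r : ℤ) else 0) - bef (revS (2 * n + 1) (A c)) (nthSmall (A c) l)

/-- The count of free indices before those of `A`. -/
def bd0 (n r : ℕ) (A : Triple) : Fin 3 → ℕ → ℤ := fun c l =>
  (if c = 2 then (2 * n - 2 * r : ℤ) else 0) - bef (freeS n (A c)) (nthSmall (A c) l)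

/-- The index triples of the inequalities for symmetric boundaries. -/
structure IsQ (n r : ℕ) (A : Triple) : Prop where
  sub : ∀ c, A c ⊆ range (2 * n + 1)
  card : ∀ c, (A c).card = r
  disj : ∀ c, Disjoint (A c) (revS (2 * n + 1) (A c))
  neg : ∑ c, ((A c).filter (n < ·)).card = r
  lr2 : LR r (bd2 n r A)
  lr0 : LR r (bd0 n r A)

section Disj

variable {n r : ℕ} {A : Finset ℕ}

theorem mid_notMem (hs : A ⊆ range (2 * n + 1)) (hd : Disjoint A (revS (2 * n + 1) A)) : n ∉ A := fun h => by
  refine disjoint_left.1 hd h ((mem_revS hs).2 ⟨by omega, ?_⟩)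
  rwa [show 2 * n + 1 - 1 - n = n by omega]

theorem mid_notMem_rev (hs : A ⊆ range (2 * n + 1)) (hd : Disjoint A (revS (2 * n + 1) A)) : n ∉ revS (2 * n + 1) A := fun h => by
  have := ((mem_revS hs).1 h).2
  rw [show 2 * n + 1 - 1 - n = n by omega] at this
  exact mid_notMem hs hd this

theorem perp_sdiff (hs : A ⊆ range (2 * n + 1)) (hd : Disjoint A (revS (2 * n + 1) A)) : cpl (2 * n + 1) (revS (2 * n + 1) A) \ A = freeS n A ∪ {n} := by
  have h1 := mid_notMem hs hd
  have h2 := mid_notMem_rev hs hd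
  ext i
  simp only [cpl, freeS, mem_sdiff, mem_union, mem_erase, mem_range,
    mem_singleton]
  constructor
  · intro h; by_cases hi : i = n <;> tauto
  · rintro (h | rfl)
    · tauto
    · exact ⟨⟨by omega, h2⟩, h1⟩

theorem perp_eq (hs : A ⊆ range (2 * n + 1)) (hd : Disjoint A (revS (2 * n + 1) A)) : cpl (2 * n + 1) (revS (2 * n + 1) A) = A ∪ (freeS n A ∪ {n}) := by
  rw [← perp_sdiff hs hd, union_sdiff_of_subset]
  intro i hi
  exact mem_cpl.2 ⟨mem_range.1 (hs hi), disjoint_left.1 hd hi⟩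

theorem disjoint_freeS : Disjoint A (freeS n A ∪ {n}) ↔ n ∉ A := by
  rw [disjoint_union_right, disjoint_singleton_right]
  refine ⟨fun h => h.2, fun h => ⟨disjoint_left.2 fun i hi hi' => ?_, h⟩⟩
  simp only [freeS, mem_erase, mem_sdiff, mem_union] at hi'
  tauto

theorem disjoint_free_mid : Disjoint (freeS n A) {n} := by
  simp [freeS]

theorem cpl_eq (hs : A ⊆ range (2 * n + 1)) (hd : Disjoint A (revS (2 * n + 1) A)) : cpl (2 * n + 1) A = revS (2 * n + 1) A ∪ (freeS n A ∪ {n}) := by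
  have h1 := mid_notMem hs hd
  have h2 := mid_notMem_rev hs hd
  ext i
  simp only [cpl, freeS, mem_sdiff, mem_union, mem_erase, mem_range,
    mem_singleton]
  constructor
  · intro h; by_cases hi : i = n <;> tauto
  · rintro (h | h | rfl)
    · exact ⟨mem_range.1 (revS_sub _ hs h), fun h' => disjoint_left.1 hd h' h⟩
    · tauto
    · exact ⟨by omega, h1⟩

theorem disjoint_rev_free : Disjoint (revS (2 * n + 1) A) (freeS n A) :=
  disjoint_left.2 fun i hi hi' => by
    simp only [freeS, mem_erase, mem_sdiff, mem_union] at hi'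
    tauto

theorem nthSmall_eq_bef (hs : A ⊆ range (2 * n + 1)) (hr : A.card = r) (hd : Disjoint A (revS (2 * n + 1) A)) {l : ℕ} (hl : l < r) : nthSmall A l =
    l + bef (revS (2 * n + 1) A) (nthSmall A l) + bef (freeS n A) (nthSmall A l) +
      bef {n} (nthSmall A l) := by
  have hlt := mem_range.1 (hs (nthSmall_mem (s := A) (k := l) (by omega)))
  have h1 := card_filter_lt_add (s := A) hlt.le
  rw [card_lt_nthSmall (by omega)] at h1
  have h2 : bef (cpl (2 * n + 1) A) (nthSmall A l) = bef (revS (2 * n + 1) A) (nthSmall A l) +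
      (bef (freeS n A) (nthSmall A l) + bef {n} (nthSmall A l)) := by
    rw [cpl_eq hs hd, bef_union, bef_union disjoint_free_mid]
    rw [disjoint_union_right]
    exact ⟨disjoint_rev_free, disjoint_singleton_right.2 (mid_notMem_rev hs hd)⟩
  rw [bef] at h2
  omega

theorem card_freeS (hs : A ⊆ range (2 * n + 1)) (hr : A.card = r) (hd : Disjoint A (revS (2 * n + 1) A)) : (freeS n A).card + 2 * r = 2 * n := by
  have h1 := cpl_eq hs hd
  have h2 := congrArg card h1
  rw [card_union_of_disjoint (disjoint_union_right.2
    ⟨disjoint_rev_free, disjoint_singleton_right.2 (mid_notMem_rev hs hd)⟩),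
    card_union_of_disjoint disjoint_free_mid, card_cpl hs, card_revS hs,
    card_singleton] at h2
  have h3 := card_le_card hs
  rw [card_range] at h3
  have h4 := card_union_of_disjoint hd
  have h5 := card_le_card (union_subset hs (revS_sub _ hs))
  rw [h4, card_revS hs, card_range] at h5
  omega

end Disj

theorem val_map (V : Finset ℕ) (g : ℕ → ℚ) : V.val.map g = ∑ i ∈ V, ({g i} : Multiset ℚ) := by
  have := Multiset.sum_map_singleton (V.val.map g)
  rw [Multiset.map_map] at this
  exact this.symm

theorem ms_eq_sum (n : ℕ) (u : ℕ → ℚ) : ms n u = ∑ i ∈ range n, ({u i} : Multiset ℚ) :=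
  val_map (range n) u

/-- The elements of `V` below the middle. -/
def lowS (n : ℕ) (V : Finset ℕ) : Finset ℕ := V.filter (· < n)

theorem map_hat {n : ℕ} {V : Finset ℕ} (hV : V ⊆ range (2 * n + 1)) (x : Bdry)
    (c : Fin 3) : V.val.map (hat n x c) = (lowS n V).val.map (x c) +
      (lowS n (revS (2 * n + 1) V)).val.map (fun i => - x c i) +
      if n ∈ V then {0} else 0 := by
  simp only [val_map, lowS]
  have h1 : (revS (2 * n + 1) V).filter (· < n) = revS (2 * n + 1) (V.filter (n < ·)) := by
    ext i
    rw [mem_revS ((filter_subset _ _).trans hV), mem_filter, mem_revS hV,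
      mem_filter]
    constructor
    · rintro ⟨⟨a, b⟩, d⟩; exact ⟨a, b, by omega⟩
    · rintro ⟨a, b, d⟩; exact ⟨⟨a, b⟩, by omega⟩
  rw [h1, sum_revS ((filter_subset _ _).trans hV),
    ← sum_filter_add_sum_filter_not V (· < n),
    ← sum_filter_add_sum_filter_not (V.filter fun i => ¬ i < n) (n < ·), filter_filter,
    filter_filter, add_assoc]
  congr 1
  · exact sum_congr rfl fun i hi => by rw [hat, if_pos (mem_filter.1 hi).2]
  congr 1
  · have : V.filter (fun i => ¬ i < n ∧ n < i) = V.filter (n < ·) :=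
      filter_congr fun i _ => by omega
    rw [this]
    refine sum_congr rfl fun i hi => ?_
    have := (mem_filter.1 hi).2
    rw [hat, if_neg (by omega), if_neg (by omega), show 2 * n + 1 - 1 - i = 2 * n - i by omega]
  · have : V.filter (fun i => ¬ i < n ∧ ¬ n < i) = if n ∈ V then {n} else ∅ := by
      ext i
      split_ifs with h <;> simp only [mem_filter, mem_singleton, notMem_empty,
        iff_false]
      · exact ⟨fun h' => by omega, by rintro rfl; exact ⟨h, by omega, by omega⟩⟩
      · rintro ⟨h', h''⟩
        obtain rfl : i = n := by omega
        exact h h'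
    rw [this]
    split_ifs <;> simp [hat]

theorem range_hat (n : ℕ) (x : Bdry) (c : Fin 3) :
    ms (2 * n + 1) (hat n x c) = ms n (x c) + ms n (fun i => - x c i) + {0} := by
  have h := map_hat (n := n) (V := range (2 * n + 1)) subset_rfl x c
  have h1 : revS (2 * n + 1) (range (2 * n + 1)) = range (2 * n + 1) := by
    ext i; rw [mem_revS subset_rfl]; simp
  have h2 : lowS n (range (2 * n + 1)) = range n := by
    ext i; simp [lowS]; omega
  rw [h1, h2, if_pos (by simp; omega)] at h
  exact h

theorem DecPos.res {n r : ℕ} {x : Bdry} (h : DecPos n x) {s : Triple}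
    (hs : ∀ c, s c ⊆ range n) (hr : ∀ c, (s c).card = r) : DecPos r (res s x) :=
  ⟨h.1.res hs hr, fun c i hi =>
    h.2 c _ (mem_range.1 (hs c (nthSmall_mem (by rw [hr]; exact hi))))⟩

/-- The free indices below the middle. -/
def freeLow (n : ℕ) (A : Finset ℕ) : Finset ℕ := lowS n (freeS n A)

theorem freeLow_sub (n : ℕ) (A : Finset ℕ) : freeLow n A ⊆ range n := fun i hi => by
  simpa using (mem_filter.1 hi).2

section Disj

variable {n r : ℕ} {A : Finset ℕ}

theorem freeS_sub : freeS n A ⊆ range (2 * n + 1) :=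
  (erase_subset _ _).trans sdiff_subset

theorem revS_freeS (hs : A ⊆ range (2 * n + 1)) : revS (2 * n + 1) (freeS n A) = freeS n A := by
  ext i
  rw [mem_revS freeS_sub]
  simp only [freeS, mem_erase, mem_sdiff, mem_union, mem_range,
    mem_revS hs]
  constructor
  · rintro ⟨h1, h2, h3, h4⟩
    rw [not_or] at h4 ⊢
    refine ⟨by omega, h1, fun h => h4.2 ⟨by omega, ?_⟩, fun h => h4.1 h.2⟩
    rwa [show 2 * n + 1 - 1 - (2 * n + 1 - 1 - i) = i by omega]
  · rintro ⟨h2, h1, h4⟩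
    rw [not_or] at h4 ⊢
    refine ⟨h1, by omega, by omega, fun h => h4.2 ⟨h1, h⟩, fun h => h4.1 ?_⟩
    have := h.2
    rwa [show 2 * n + 1 - 1 - (2 * n + 1 - 1 - i) = i by omega] at this

theorem map_hat_free (hs : A ⊆ range (2 * n + 1)) (x : Bdry) (c : Fin 3) : (freeS n A).val.map (hat n x c) =
    (freeLow n A).val.map (x c) + (freeLow n A).val.map (fun i => - x c i) := by
  rw [map_hat freeS_sub, revS_freeS hs, if_neg (by simp [freeS]), add_zero, freeLow]

theorem card_freeLow (hs : A ⊆ range (2 * n + 1)) (hr : A.card = r) (hd : Disjoint A (revS (2 * n + 1) A)) : (freeLow n A).card + r = n := by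
  have h1 := congrArg Multiset.card (map_hat_free (n := n) hs (fun _ _ => 0) 0)
  have h2 := card_freeS hs hr hd
  simp only [Multiset.card_map, Multiset.card_add, card_val] at h1
  omega

end Disj

theorem symLR_free {n r : ℕ} {A : Triple} (hs : ∀ c, A c ⊆ range (2 * n + 1))
    (hr : ∀ c, (A c).card = r) (hd : ∀ c, Disjoint (A c) (revS (2 * n + 1) (A c)))
    {x : Bdry} (hx : DecPos n x)
    (h : LRM (fun c => (freeS n (A c) ∪ {n}).val.map (hat n x c))) :
    SymLR (n - r) (res (fun c => freeLow n (A c)) x) := by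
  have hc : ∀ c, (freeLow n (A c)).card = n - r := fun c => by
    have := card_freeLow (hs c) (hr c) (hd c); omega
  refine h.lr (dec_hat (hx.res (fun c => freeLow_sub n _) hc)) fun c => ?_
  rw [range_hat]
  have h1 := ms_nthSmall (hc c) (x c)
  have h2 := ms_nthSmall (hc c) (fun i => - x c i)
  change ms (n - r) (fun k => x c (nthSmall (freeLow n (A c)) k)) +
    ms (n - r) (fun k => - x c (nthSmall (freeLow n (A c)) k)) + {0} = _
  rw [h1, h2, ← map_hat_free (hs c), val_map, val_map,
    sum_union disjoint_free_mid]
  simp [hat]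

/-! ### Facets for symmetric boundaries -/

theorem evS_stair {n r : ℕ} {I : Triple} (hI : IsE (2 * n + 1) r I) (hr : 0 < r)
    (hrn : r < 2 * n + 1) : 0 < evS I (hat n (fun _ i => (n : ℚ) - i)) := by
  have h1 := hI.up.trace_nonneg
  have h2 : evS I (hat n (fun _ i => (n : ℚ) - i)) =
      ∑ c, ∑ k ∈ range r, ((n : ℚ) - nthSmall (I c) k) := by
    refine sum_congr rfl fun c _ => ?_
    rw [← hI.card c, sum_nthSmall (I c) (fun i => (n : ℚ) - i)]
    refine sum_congr rfl fun i hi => ?_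
    have := mem_range.1 (hI.sub c hi)
    simp only [hat]
    split_ifs with h h'
    · rfl
    · rw [h']; simp
    · rw [Nat.cast_sub (by omega)]; push_cast; ring
  have h3 : ∀ c, ∑ k ∈ range r, ((n : ℚ) - nthSmall (I c) k) =
      ∑ k ∈ range r, setBd (2 * n + 1) r I c k +
        (r * n - (r * (r - 1) / 2) - r * ((2 * n + 1 : ℚ) - r) / 3) := by
    intro c
    have h4 : ∑ k ∈ range r, (k : ℚ) = r * (r - 1) / 2 := by
      have := sum_range_id_mul_two r
      have h5 : ((∑ k ∈ range r, k : ℕ) : ℚ) * 2 = r * ((r - 1 : ℕ) : ℚ) := by exact_mod_cast this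
      rw [Nat.cast_sub (by omega)] at h5
      push_cast at h5
      linarith
    rw [← h4]
    simp only [setBd, sum_sub_distrib, sum_const, card_range, nsmul_eq_mul]
    push_cast; ring
  rw [h2, sum_congr rfl fun c _ => h3 c, sum_add_distrib]
  have h6 : (0 : ℚ) < r := by exact_mod_cast hr
  have h7 : (r : ℚ) < 2 * n + 1 := by exact_mod_cast hrn
  have h8 : 0 < (r : ℚ) * ((2 * n + 1) - r) := mul_pos h6 (by linarith)
  simp only [sum_const, card_univ, Fintype.card_fin, nsmul_eq_mul]
  push_cast
  nlinarith

theorem bef_eq (V : Finset ℕ) (x : ℕ) :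
    bef V x = ((range V.card).filter fun j => nthSmall V j < x).card := by
  conv_lhs => rw [bef, ← image_nthSmall V, filter_image]
  refine card_image_of_injOn ((nthSmall_injOn V).mono ?_)
  simp only [coe_filter, coe_range]
  exact fun i hi => by simpa using hi.1

theorem cnt_res {N r m : ℕ} {b : Bdry} (hb : SDec N b) {s V : Triple}
    (hs : ∀ c, s c ⊆ range N) (hV : ∀ c, V c ⊆ range N) (hr : ∀ c, (s c).card = r)
    (hm : ∀ c, (V c).card = m) (c : Fin 3) {l : ℕ} (hl : l < r) :
    cnt m (res s b) (res V b) c l = bef (V c) (nthSmall (s c) l) := by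
  rw [bef_eq, hm, cnt]
  refine congrArg card (filter_congr fun j hj => ?_)
  have hj := mem_range.1 hj
  have m1 := mem_range.1 (hs c (nthSmall_mem (s := s c) (k := l) (by rw [hr]; exact hl)))
  have m2 := mem_range.1 (hV c (nthSmall_mem (s := V c) (k := j) (by rw [hm]; exact hj)))
  simp only [res]
  rcases lt_trichotomy (nthSmall (V c) j) (nthSmall (s c) l) with h | h | h
  · exact ⟨fun _ => h, fun _ => hb c _ _ h m1⟩
  · rw [h]; simp
  · have := hb c _ _ h m2
    exact ⟨fun h' => absurd h' (by linarith), fun h' => absurd h' (by omega)⟩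

theorem distinct_res {N r m : ℕ} {b : Bdry} (hb : SDec N b) {s V : Triple}
    (hs : ∀ c, s c ⊆ range N) (hV : ∀ c, V c ⊆ range N) (hr : ∀ c, (s c).card = r)
    (hm : ∀ c, (V c).card = m) (hd : ∀ c, Disjoint (s c) (V c)) :
    Distinct r m (res s b) (res V b) := by
  intro c i hi j hj
  have k1 := nthSmall_mem (s := s c) (k := i) (by rw [hr]; exact hi)
  have k2 := nthSmall_mem (s := V c) (k := j) (by rw [hm]; exact hj)
  have m1 := mem_range.1 (hs c k1)
  have m2 := mem_range.1 (hV c k2)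
  simp only [res]
  rcases lt_trichotomy (nthSmall (V c) j) (nthSmall (s c) i) with h | h | h
  · exact (hb c _ _ h m1).ne
  · rw [h] at k2; exact absurd k2 (disjoint_left.1 (hd c) k1)
  · exact (hb c _ _ h m2).ne'

theorem bef_singleton (n i : ℕ) : bef {n} i = if n < i then 1 else 0 := by
  rw [bef, filter_singleton]
  split_ifs <;> simp

theorem sum_bef_mid {A : Finset ℕ} {r : ℕ} (hr : A.card = r) (n : ℕ) :
    ∑ l ∈ range r, bef {n} (nthSmall A l) = (A.filter (n < ·)).card := by
  simp only [bef_singleton]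
  rw [← hr, sum_nthSmall A (fun i => if n < i then 1 else 0), card_filter]

theorem sum_const3 (m : ℤ) : ∑ c : Fin 3, (if c = 2 then m else 0) = m := by simp

/-- A minimal tight set at a regular point of the boundary gives rigid data. -/
theorem facet_of_tight {n r : ℕ}
    (ih : ∀ m < n, ∀ x, DecPos m x → SymLR m x → SymLR₀ m x)
    {x : Bdry} (hx : SDec n x) (h0 : ∀ c, ∀ i < n, 0 < x c i) (hS : SymLR n x)
    {A : Triple} (hA : IsE (2 * n + 1) r A) (hr : 0 < r) (hrN : r < 2 * n + 1)
    (ht : evS A (hat n x) = 0)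
    (hmin : ∀ t P, 0 < t → t < r → IsE (2 * n + 1) t P → evS P (hat n x) ≠ 0) :
    IsQ n r A ∧ RigidLR r (bd2 n r A) ∧ RigidLR r (bd0 n r A) := by
  set N := 2 * n + 1 with hN
  set b := hat n x with hb
  have hbs : SDec N b := sdec_hat hx h0
  have hdp : DecPos n x := ⟨hx.dec, fun c i hi => (h0 c i hi).le⟩
  have hS' : LR N b := hS
  obtain ⟨hA1, hA2⟩ := hA.split_of_tight hS' ht
  have hint : Interior r (res A b) := by
    refine ⟨hA1.2, hbs.res hA.sub hA.card, ?_⟩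
    rintro P ⟨t, ht0, htr, hP⟩
    have hE := hA.trans hP
    have h1 := hE.valid (UpLR.of_LR hS)
    rw [evS_res hA.card hP.sub]
    exact lt_of_le_of_ne h1 (hmin t _ ht0 htr hE).symm
  have hrevc : ∀ c, (revS N (A c)).card = r := fun c => by rw [card_revS (hA.sub c), hA.card]
  have hperpt : evS (perpS N A) b = 0 := by
    have h1 := evS_cpl (n := N) (s := fun c => revS N (A c)) (fun c => revS_sub _ (hA.sub c)) b
    have h2 := evS_revS_hat hA.sub x
    rw [h2, hS'.trace, ht] at h1
    exact h1.trans (by simp)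
  obtain ⟨hp1, hp2⟩ := hA.perp.split_of_tight hS' hperpt
  have hrevLR : LRon (fun c => revS N (A c)) r b := by
    have : (fun c => cpl N (perpS N A c)) = fun c => revS N (A c) :=
      funext fun c => cpl_cpl (revS_sub _ (hA.sub c))
    rw [this, show N - (N - r) = r by omega] at hp2
    exact hp2
  have hd : ∀ c, Disjoint (A c) (revS N (A c)) := by
    obtain ⟨hv, hv0⟩ := hA.perp.validS.posn hbs hA.sub hA1 hA2 hperpt
    rcases hv.const_of_interior hint hv0 with h | h
    · exfalso
      have heq : (fun c => revS N (A c)) = A := funext fun c => by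
        symm
        refine eq_of_subset_of_card_le (fun i hi => ?_) (by rw [hrevc, hA.card])
        by_contra hni
        have h1 : A c ∩ perpS N A c = ∅ := by rw [← pick_posn, h c]; rfl
        have h2 : i ∈ A c ∩ perpS N A c := mem_inter.2
          ⟨hi, mem_cpl.2 ⟨mem_range.1 (hA.sub c hi), hni⟩⟩
        rw [h1] at h2
        simp at h2
      have h1 := evS_revS_hat hA.sub (fun _ i => (n : ℚ) - i)
      rw [heq] at h1
      have := evS_stair hA hr hrN
      linarith
    · intro c
      rw [disjoint_left]
      intro i hi
      have h1 : A c ∩ perpS N A c = A c := by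
        rw [← pick_posn, h c]
        conv_rhs => rw [← image_nthSmall (A c), hA.card]
        rfl
      rw [← h1] at hi
      exact (mem_cpl.1 (mem_inter.1 hi).2).2
  have hr2n : ∀ c, (freeS n (A c)).card = 2 * n - 2 * r := fun c => by
    have := card_freeS (hA.sub c) (hA.card c) (hd c); omega
  have h2r : 2 * r ≤ 2 * n := by have := card_freeS (hA.sub 0) (hA.card 0) (hd 0); omega
  have hfree : LRon (fun c => freeS n (A c)) (2 * n - 2 * r) b := by
    obtain ⟨hv, hv0⟩ := hA.validS.posn hbs hA.perp.sub hp1 hp2 ht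
    obtain ⟨t, -, hl⟩ := hv.split_of_tight (hbs.res hA.perp.sub hA.perp.card) hp1.2 hv0
    have h1 := hl.pick hA.perp.card (fun c => cpl_sub _ _)
    have h2 : ∀ c, pick (perpS N A c) (cpl (N - r) (posn (perpS N A c) (A c))) = freeS n (A c) ∪ {n} :=
      fun c => by
        have := cpl_posn (perpS N A c) (A c)
        rw [hA.perp.card] at this
        rw [this]
        exact perp_sdiff (hA.sub c) (hd c)
    simp only [h2] at h1
    have h3 := ih (n - r) (by omega) _ (hdp.res (fun c => freeLow_sub n _) fun c => by
      have := card_freeLow (hA.sub c) (hA.card c) (hd c); omega)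
      (symLR_free hA.sub hA.card hd hdp h1.lrm)
    refine LRM.lrOn hbs.dec (fun c => freeS_sub) hr2n (h3.congr fun c => ?_)
    have hc : (freeLow n (A c)).card = n - r := by
      have := card_freeLow (hA.sub c) (hA.card c) (hd c); omega
    rw [map_hat_free (hA.sub c), ← ms_nthSmall hc (x c), ← ms_nthSmall hc (fun i => - x c i)]
    rfl
  have hmidc : ∀ _c : Fin 3, ({n} : Finset ℕ).card = 1 := fun _ => rfl
  have hmids : ∀ _c : Fin 3, ({n} : Finset ℕ) ⊆ range N := fun _ => by simp [hN]; omega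
  have hmid : LRon (fun _ => {n}) 1 b := by
    refine LRM.lrOn hbs.dec hmids hmidc
      ((LRM.const 1 (s := fun _ => 0) (by simp)).congr fun c => ?_)
    simp [hb, hat]
  have df : ∀ c, Disjoint (A c) (freeS n (A c)) := fun c =>
    (disjoint_union_right.1 (disjoint_freeS.2 (mid_notMem (hA.sub c) (hd c)))).1
  have dm : ∀ c, Disjoint (A c) {n} := fun c =>
    disjoint_singleton_right.2 (mid_notMem (hA.sub c) (hd c))
  have d1 := distinct_res hbs hA.sub (fun c => revS_sub _ (hA.sub c)) hA.card hrevc hd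
  have d2 := distinct_res hbs hA.sub (fun c => freeS_sub) hA.card hr2n df
  have d3 := distinct_res hbs hA.sub hmids hA.card hmidc dm
  have c1 := fun c l (hl : l ∈ range r) =>
    cnt_res hbs hA.sub (fun c => revS_sub _ (hA.sub c)) hA.card hrevc c (mem_range.1 hl)
  have c2 := fun c l (hl : l ∈ range r) =>
    cnt_res hbs hA.sub (fun c => freeS_sub) hA.card hr2n c (mem_range.1 hl)
  have c3 := fun c l (hl : l ∈ range r) =>
    cnt_res hbs hA.sub hmids hA.card hmidc c (mem_range.1 hl)
  have e1 := hA1.2.count_le hrevLR.2 d1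
  have e2 := hA1.2.count_le hfree.2 d2
  have e3 := hA1.2.count_le hmid.2 d3
  have e4 : ∑ c, ∑ l ∈ range r, (bef (revS N (A c)) (nthSmall (A c) l) +
      bef (freeS n (A c)) (nthSmall (A c) l) + bef {n} (nthSmall (A c) l)) ≤ r * (N - r) := by
    have h1 := hA.up.trace_nonneg
    have h2 : ∀ c, ∀ l ∈ range r, setBd N r A c l = ((N : ℚ) - r) / 3 -
        ((bef (revS N (A c)) (nthSmall (A c) l) +
      bef (freeS n (A c)) (nthSmall (A c) l) + bef {n} (nthSmall (A c) l) : ℕ) : ℚ) := by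
      intro c l hl
      have := nthSmall_eq_bef (hA.sub c) (hA.card c) (hd c) (mem_range.1 hl)
      have h3 : (nthSmall (A c) l : ℚ) = ((l + bef (revS N (A c)) (nthSmall (A c) l) +
        bef (freeS n (A c)) (nthSmall (A c) l) + bef {n} (nthSmall (A c) l) : ℕ) : ℚ) := by
        exact_mod_cast this
      rw [setBd, h3]; push_cast; ring
    rw [sum_congr rfl fun c _ => sum_congr rfl (h2 c)] at h1
    simp only [sum_sub_distrib, sum_const, card_range, card_univ,
      Fintype.card_fin, nsmul_eq_mul] at h1
    have h3 : ((∑ c, ∑ l ∈ range r, (bef (revS N (A c)) (nthSmall (A c) l) +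
      bef (freeS n (A c)) (nthSmall (A c) l) + bef {n} (nthSmall (A c) l)) : ℕ) : ℚ) ≤
      ((r * (N - r) : ℕ) : ℚ) := by
      push_cast [Nat.cast_sub hrN.le]
      push_cast at h1
      linarith
    exact_mod_cast h3
  simp only [sum_add_distrib] at e4
  have g1 : ∑ c, ∑ l ∈ range r, cnt r (res A b) (res (fun c => revS N (A c)) b) c l = _ :=
    sum_congr rfl fun c _ => sum_congr rfl (c1 c)
  have g2 : ∑ c, ∑ l ∈ range r, cnt (2 * n - 2 * r) (res A b) (res (fun c => freeS n (A c)) b) c l = _ :=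
    sum_congr rfl fun c _ => sum_congr rfl (c2 c)
  have g3 : ∑ c, ∑ l ∈ range r, cnt 1 (res A b) (res (fun _ => {n}) b) c l = _ :=
    sum_congr rfl fun c _ => sum_congr rfl (c3 c)
  have htot : r * (N - r) = r * r + r * (2 * n - 2 * r) + r * 1 := by
    rw [← mul_add, ← mul_add]; congr 1; omega
  have R1 : RigidLR r (bd2 n r A) := by
    refine (hint.rigid hrevLR.2 d1 (by omega) (s := fun c => if c = 2 then (r : ℤ) else 0)
      (sum_const3 _)).congr fun c l hl => ?_
    simp only [bd2]
    rw [c1 c l (mem_range.2 hl)]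
  have R2 : RigidLR r (bd0 n r A) := by
    refine (hint.rigid hfree.2 d2 (by omega) (s := fun c => if c = 2 then (2 * n - 2 * r : ℤ) else 0)
      ?_).congr fun c l hl => ?_
    · rw [sum_const3]; push_cast [Nat.cast_sub h2r]; rfl
    · simp only [bd0]
      rw [c2 c l (mem_range.2 hl)]
  refine ⟨⟨hA.sub, hA.card, hd, ?_, R1.1, R2.1⟩, R1, R2⟩
  rw [← sum_congr rfl fun c _ => sum_bef_mid (hA.card c) n]
  simp only [mul_one] at *
  omega

theorem facet {n : ℕ} (ih : ∀ m < n, ∀ x, DecPos m x → SymLR m x → SymLR₀ m x)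
    {x : Bdry} (hx : DecPos n x) (hS : ¬ SymLR n x) :
    ∃ r A, 0 < r ∧ IsQ n r A ∧ RigidLR r (bd2 n r A) ∧ RigidLR r (bd0 n r A) ∧
      evS A (hat n x) < 0 := by
  let x₁ : Bdry := fun _ i => (n : ℚ) - i
  have hpos : ∀ j : properE (2 * n + 1), 0 < evS j.1 (hat n x₁) := fun j => by
    obtain ⟨r, h1, h2, h3⟩ := j.2
    exact evS_stair h3 h1 h2
  obtain ⟨j₀, hj₀⟩ : ∃ j : properE (2 * n + 1), evS j.1 (hat n x) < 0 := by
    by_contra hcon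
    push Not at hcon
    exact hS (LR.of_properE (dec_hat hx) (trace_hat n x) fun s hs => hcon ⟨s, hs⟩)
  obtain ⟨s, hs, hge, j₁, hj₁, hz⟩ := exists_hit (J := properE (2 * n + 1))
    (fun j => evS j.1 (hat n x₁)) (fun j => evS j.1 (hat n x) - evS j.1 (hat n x₁))
    (fun j => (hpos j).le) ⟨j₀, by have := hpos j₀; linarith⟩
  have hs1 : s < 1 := by
    by_contra hcon
    have := hge j₀
    have := hpos j₀
    nlinarith
  let b : Bdry := fun c i => (1 - s) * x₁ c i + s * x c i
  have hev : ∀ A, evS A (hat n b) = evS A (hat n x₁) + s * (evS A (hat n x) - evS A (hat n x₁)) :=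
    fun A => by rw [evS_hat_comb]; ring
  have hbs : SDec n b := fun c i k hik hk => by
    have h1 := hx.1 c i k hik.le hk
    have h2 : (i : ℚ) < k := by exact_mod_cast hik
    simp only [b, x₁]
    nlinarith
  have hb0 : ∀ c, ∀ i < n, 0 < b c i := fun c i hi => by
    have h1 := hx.2 c i hi
    have h2 : (i : ℚ) < n := by exact_mod_cast hi
    simp only [b, x₁]
    have : 0 < (1 - s) * ((n : ℚ) - i) := mul_pos (by linarith) (by linarith)
    have := mul_nonneg hs h1
    linarith
  have hbS : SymLR n b := LR.of_properE (sdec_hat hbs hb0).dec (trace_hat n b) fun A hA => by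
    rw [hev]; exact hge ⟨A, hA⟩
  have hex : ∃ r, ∃ A, 0 < r ∧ r < 2 * n + 1 ∧ IsE (2 * n + 1) r A ∧ evS A (hat n b) = 0 := by
    obtain ⟨r, h1, h2, h3⟩ := j₁.2
    exact ⟨r, j₁.1, h1, h2, h3, by rw [hev]; exact hz⟩
  classical
  obtain ⟨A, hr, hrN, hA, ht⟩ := Nat.find_spec hex
  have hmin : ∀ t P, 0 < t → t < Nat.find hex → IsE (2 * n + 1) t P → evS P (hat n b) ≠ 0 :=
    fun t P h1 h2 h3 h4 => Nat.find_min hex h2 ⟨P, h1, by omega, h3, h4⟩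
  obtain ⟨q1, q2, q3⟩ := facet_of_tight ih hbs hb0 hbS hA hr hrN ht hmin
  refine ⟨_, A, hr, q1, q2, q3, ?_⟩
  have hp := hpos ⟨A, _, hr, hrN, hA⟩
  rw [hev] at ht
  simp only at hp
  by_contra hcon
  push Not at hcon
  nlinarith

/-! ### Tight inequalities for symmetric boundaries -/

theorem LR.cast {r : ℕ} {Z : Fin 3 → ℕ → ℤ} (h : LR r Z) : LR r (fun c i => (Z c i : ℚ)) := by
  obtain ⟨G, hG, hb⟩ := h
  refine ⟨fun p => (G p : ℚ), fun c p q h1 h2 h3 h4 => ?_, fun c j l hj => ?_⟩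
  · have := hG c p q h1 h2 h3 h4
    simp only [dif] at this ⊢
    exact_mod_cast this
  · have := hb c j l hj
    simp only [← this]; push_cast; rfl

theorem card_low_add {n r : ℕ} {A : Finset ℕ} (hr : A.card = r) (hn : n ∉ A) :
    bef A n + (A.filter (n < ·)).card = r := by
  rw [bef, ← hr, ← card_filter_add_card_filter_not (s := A) (· < n)]
  congr 2
  refine filter_congr fun i hi => ?_
  have : i ≠ n := fun h => hn (h ▸ hi)
  omega

namespace IsQ

variable {n r : ℕ} {A : Triple}

theorem mid (h : IsQ n r A) (c : Fin 3) : n ∉ A c := mid_notMem (h.sub c) (h.disj c)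

theorem low_add (h : IsQ n r A) (c : Fin 3) : bef (A c) n + ((A c).filter (n < ·)).card = r :=
  card_low_add (h.card c) (h.mid c)

theorem le (h : IsQ n r A) : r ≤ n := by
  have := card_freeS (h.sub 0) (h.card 0) (h.disj 0); omega

theorem lr_rev (h : IsQ n r A) :
    LR r (fun c l => (r : ℚ) / 3 - bef (revS (2 * n + 1) (A c)) (nthSmall (A c) l)) := by
  refine (h.lr2.cast.shift (s := fun c => (r : ℚ) / 3 - if c = 2 then (r : ℚ) else 0) ?_).congr
    fun c l _ => ?_
  · simp; ring
  · simp only [bd2]; push_cast; split_ifs <;> ring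

theorem lr_free (h : IsQ n r A) : LR r (fun c l => (2 * (n : ℚ) - 2 * r) / 3 -
    bef (freeS n (A c)) (nthSmall (A c) l)) := by
  refine (h.lr0.cast.shift (s := fun c => (2 * (n : ℚ) - 2 * r) / 3 -
    if c = 2 then (2 * (n : ℚ) - 2 * r) else 0) ?_).congr fun c l _ => ?_
  · simp; ring
  · simp only [bd0]; push_cast; split_ifs <;> ring

theorem lt_low (h : IsQ n r A) (c : Fin 3) {l : ℕ} (hl : l < r) :
    l < bef (A c) n ↔ ¬ n < nthSmall (A c) l := by
  have hl' : l < (A c).card := by rw [h.card]; exact hl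
  rw [← nthSmall_lt_iff_bef hl']
  have : nthSmall (A c) l ≠ n := fun h' => h.mid c (h' ▸ nthSmall_mem hl')
  omega

theorem lr_mid (h : IsQ n r A) : LR r (fun c l => (1 : ℚ) / 3 - bef {n} (nthSmall (A c) l)) := by
  refine (LR.step (v := fun _ => 1 / 3) (w := fun _ => - 2 / 3) h.low_add h.neg (fun _ => by norm_num)
    fun _ => by norm_num).congr fun c l hl => ?_
  rw [bef_singleton]
  simp only [h.lt_low c hl]
  split_ifs <;> norm_num

theorem lr_setBd (h : IsQ n r A) : LR r (setBd (2 * n + 1) r A) := by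
  refine ((h.lr_rev.add h.lr_free).add h.lr_mid).congr fun c l hl => ?_
  have := nthSmall_eq_bef (h.sub c) (h.card c) (h.disj c) hl
  rw [setBd]
  conv_rhs => rw [this]
  push_cast
  ring

theorem isE (h : IsQ n r A) : IsE (2 * n + 1) r A := ⟨h.sub, h.card, UpLR.of_LR h.lr_setBd⟩

theorem isE_perp (h : IsQ n r A) : IsE (2 * n + 1 - r) r
    (fun c => posn (perpS (2 * n + 1) A c) (A c)) := by
  have hcard := h.isE.perp.card
  have hsub : ∀ c, A c ⊆ perpS (2 * n + 1) A c := fun c i hi =>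
    mem_cpl.2 ⟨mem_range.1 (h.sub c hi), disjoint_left.1 (h.disj c) hi⟩
  have hp : ∀ c, pick (perpS (2 * n + 1) A c) (posn (perpS (2 * n + 1) A c) (A c)) = A c := fun c => by
    rw [pick_posn, inter_eq_right.2 (hsub c)]
  have hc : ∀ c, (posn (perpS (2 * n + 1) A c) (A c)).card = r := fun c => by
    rw [← card_pick (posn_sub _ _), hp, h.card]
  refine ⟨fun c => ?_, hc,
    UpLR.of_LR ((h.lr_free.add h.lr_mid).congr fun c l hl => ?_)⟩
  · rw [← hcard c]; exact posn_sub _ _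
  · have h1 := nthSmall_pick (posn_sub (perpS (2 * n + 1) A c) (A c)) (k := l) (by rw [hc]; exact hl)
    rw [hp] at h1
    have hm : nthSmall (posn (perpS (2 * n + 1) A c) (A c)) l < (perpS (2 * n + 1) A c).card :=
      mem_range.1 (posn_sub _ _ (nthSmall_mem (by rw [hc]; exact hl)))
    have h2 := bef_nthSmall hm
    rw [← h1, perpS, perp_eq (h.sub c) (h.disj c), bef_union (disjoint_freeS.2 (h.mid c)),
      bef_union disjoint_free_mid, bef_nthSmall (by rw [h.card]; exact hl),
      ← perp_eq (h.sub c) (h.disj c)] at h2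
    change _ = nthSmall (posn (perpS (2 * n + 1) A c) (A c)) l at h2
    rw [setBd, ← h2]
    have := h.le
    push_cast [Nat.cast_sub (show r ≤ 2 * n + 1 by omega)]
    ring

theorem card_low (h : IsQ n r A) (c : Fin 3) : (freeLow n (A c)).card = n - r := by
  have := card_freeLow (h.sub c) (h.card c) (h.disj c); omega

theorem tight (h : IsQ n r A) {x : Bdry} (hx : DecPos n x) (hS : SymLR n x)
    (ht : evS A (hat n x) = 0) :
    LRon A r (hat n x) ∧ SymLR (n - r) (res (fun c => freeLow n (A c)) x) := by
  have hA := h.isE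
  obtain ⟨h1, -⟩ := hA.split_of_tight hS ht
  refine ⟨h1, ?_⟩
  have hperpt : evS (perpS (2 * n + 1) A) (hat n x) = 0 := by
    have h2 := evS_cpl (fun c => revS_sub _ (hA.sub c)) (hat n x)
    rw [evS_revS_hat hA.sub x, trace_hat, ht] at h2
    exact h2.trans (by simp)
  obtain ⟨hp1, -⟩ := hA.perp.split_of_tight hS hperpt
  have hsub : ∀ c, perpS (2 * n + 1) A c ∩ A c = A c := fun c =>
    inter_eq_right.2 fun i hi =>
      mem_cpl.2 ⟨mem_range.1 (h.sub c hi), disjoint_left.1 (h.disj c) hi⟩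
  have ht' : evS (fun c => posn (perpS (2 * n + 1) A c) (A c)) (res (perpS (2 * n + 1) A) (hat n x)) = 0 := by
    rw [evS_res hA.perp.card h.isE_perp.sub]
    simp only [pick_posn, hsub]
    exact ht
  have h3 := (h.isE_perp.split_of_tight hp1.2 ht').2.pick hA.perp.card fun c => cpl_sub _ _
  have h4 : ∀ c, pick (perpS (2 * n + 1) A c)
      (cpl (2 * n + 1 - r) (posn (perpS (2 * n + 1) A c) (A c))) = freeS n (A c) ∪ {n} := fun c => by
    have := cpl_posn (perpS (2 * n + 1) A c) (A c)
    rw [hA.perp.card] at this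
    rw [this]
    exact perp_sdiff (h.sub c) (h.disj c)
  simp only [h4] at h3
  exact symLR_free h.sub h.card h.disj hx h3.lrm

theorem ms_split (h : IsQ n r A) (c : Fin 3) (g : ℕ → ℚ) : ms n g = (lowS n (A c)).val.map g +
    (lowS n (revS (2 * n + 1) (A c))).val.map g + (freeLow n (A c)).val.map g := by
  rw [ms_eq_sum, val_map, val_map, val_map,
    ← sum_union (s₁ := lowS n (A c)) (s₂ := lowS n (revS (2 * n + 1) (A c)))
      (disjoint_filter_filter (h.disj c)), ← sum_union]
  · refine sum_congr ?_ fun _ _ => rfl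
    ext i
    simp only [freeLow, lowS, mem_union, mem_filter, mem_range, freeS,
      mem_erase, mem_sdiff]
    constructor
    · intro hi
      have h1 : i ≠ n := by omega
      have h2 : i < 2 * n + 1 := by omega
      tauto
    · tauto
  · rw [disjoint_left]
    simp only [freeLow, lowS, mem_union, mem_filter, freeS, mem_erase,
      mem_sdiff]
    tauto

theorem symLR₀_of_tight (h : IsQ n r A) {x : Bdry} (h1 : LRon A r (hat n x))
    (h2 : SymLR₀ (n - r) (res (fun c => freeLow n (A c)) x)) : SymLR₀ n x := by
  refine ((h1.lrm.add h1.lrm.neg).add h2).congr fun c => ?_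
  have e1 := ms_nthSmall (h.card_low c) (x c)
  have e2 := ms_nthSmall (h.card_low c) (fun i => - x c i)
  change _ + (ms (n - r) (fun k => x c (nthSmall (freeLow n (A c)) k)) +
    ms (n - r) (fun k => - x c (nthSmall (freeLow n (A c)) k))) = _
  rw [e1, e2, map_hat (h.sub c), if_neg (h.mid c), h.ms_split c (x c), h.ms_split c (fun i => - x c i)]
  simp only [Multiset.map_add, Multiset.map_map, Function.comp_def, neg_neg, add_zero]
  abel

end IsQ

/-- The nonnegative decreasing sequences with coordinates `k` in the fundamental weights. -/
def fundX (n : ℕ) (k : Fin 3 × Fin n → ℚ) (c : Fin 3) (l : ℕ) : ℚ :=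
  ∑ i : Fin n, k (c, i) * if l ≤ i then 1 else 0

theorem fundX_comb (n : ℕ) (k k' : Fin 3 × Fin n → ℚ) (a b : ℚ) :
    fundX n (a • k + b • k') = fun c l => a * fundX n k c l + b * fundX n k' c l := by
  funext c l
  simp only [fundX, mul_sum, ← sum_add_distrib]
  exact sum_congr rfl fun i _ => by
    simp only [Pi.add_apply, Pi.smul_apply, smul_eq_mul]; ring

theorem decPos_fundX {n : ℕ} {k : Fin 3 × Fin n → ℚ} (hk : ∀ i, 0 ≤ k i) : DecPos n (fundX n k) := by
  refine ⟨fun c i j hij _ => sum_le_sum fun l _ => mul_le_mul_of_nonneg_left ?_ (hk _),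
    fun c i _ => sum_nonneg fun l _ => mul_nonneg (hk _) (by split_ifs <;> simp)⟩
  split_ifs <;> first | omega | simp

theorem exists_fundX {n : ℕ} {x : Bdry} (hx : DecPos n x) :
    ∃ k : Fin 3 × Fin n → ℚ, (∀ i, 0 ≤ k i) ∧ ∀ c, ∀ l < n, fundX n k c l = x c l := by
  let y : Bdry := fun c i => if i < n then x c i else 0
  refine ⟨fun i => y i.1 i.2 - y i.1 (i.2 + 1), fun ⟨c, i⟩ => ?_, fun c l hl => ?_⟩
  · have := i.2
    simp only [y, if_pos this]
    split_ifs with h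
    · linarith [hx.1 c i (i + 1) (by omega) h]
    · linarith [hx.2 c i i.2]
  · rw [fundX, genX_sub_last n (y c) hl.le]
    simp [y, hl]

/-- Reduction to tight inequalities for statements about symmetric boundaries. -/
theorem symLR_induction {n : ℕ} (ih : ∀ m < n, ∀ x, DecPos m x → SymLR m x → SymLR₀ m x)
    {P : (Bdry) → Prop} (hP : ∀ x y, (∀ c, ∀ i < n, x c i = y c i) → P x → P y)
    (hcomb : ∀ x y, ∀ a b : ℚ, 0 ≤ a → 0 ≤ b → P x → P y → P (fun c i => a * x c i + b * y c i))
    (hzero : P fun _ _ => 0)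
    (htight : ∀ x r A, DecPos n x → SymLR n x → 0 < r → IsQ n r A → evS A (hat n x) = 0 → P x)
    {x : Bdry} (hx : DecPos n x) (hS : SymLR n x) : P x := by
  let J : Set (Triple) := {A | ∃ r, 0 < r ∧ IsQ n r A}
  have hJ : Finite J := by
    refine Set.Finite.to_subtype ((finite_sub_range (2 * n + 1)).subset ?_)
    rintro s ⟨r, -, h⟩
    exact h.sub
  let L : J → (Fin 3 × Fin n → ℚ) →ₗ[ℚ] ℚ := fun A =>
    { toFun := fun k => evS A.1 (hat n (fundX n k))
      map_add' := fun k k' => by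
        have := fundX_comb n k k' 1 1
        rw [one_smul, one_smul] at this
        rw [this, evS_hat_comb, one_mul, one_mul]
      map_smul' := fun a k => by
        have := fundX_comb n k 0 a 0
        rw [zero_smul, add_zero] at this
        rw [this, evS_hat_comb, zero_mul, add_zero]; rfl }
  have hfac : ∀ k : Fin 3 × Fin n → ℚ, (∀ i, 0 ≤ k i) → (∀ j, 0 ≤ L j k) → SymLR n (fundX n k) := by
    intro k hk hL
    by_contra hcon
    obtain ⟨r, A, hr, hQ, -, -, hlt⟩ := facet ih (decPos_fundX hk) hcon
    exact absurd (hL ⟨A, r, hr, hQ⟩) (not_le.2 hlt)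
  obtain ⟨k, hk, hkx⟩ := exists_fundX hx
  refine hP _ _ hkx (support_reduction (fun _ => 0) L (fun k => P (fundX n k)) ?_ ?_ ?_ k hk
    (by simp) fun A => ?_)
  · intro u v a b ha hb hu hv
    rw [fundX_comb]
    exact hcomb _ _ a b ha hb hu hv
  · rintro k hk - hL ⟨⟨A, r, hr, hQ⟩, hj⟩
    exact htight _ r A (decPos_fundX hk) (hfac k hk hL) hr hQ hj
  · rintro k hk - hL hsup
    have h1 := hfac k hk hL
    suffices h : ∀ i, k i = 0 by
      refine hP _ _ (fun c l _ => ?_) hzero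
      simp [fundX, h]
    rintro ⟨c, i⟩
    by_contra hne
    have hpos : 0 < k (c, i) := lt_of_le_of_ne (hk _) (Ne.symm hne)
    have huniq : ∀ j, j ≠ (c, i) → k j = 0 := fun j hj => by
      by_contra h
      exact hj (hsup _ _ (lt_of_le_of_ne (hk j) (Ne.symm h)) hpos (Or.inl ⟨rfl, rfl⟩))
    have hn : 0 < n := i.pos
    have hv : ∀ d, fundX n k d 0 = if d = c then k (c, i) else 0 := fun d => by
      rw [fundX, sum_eq_single i]
      · rw [if_pos (Nat.zero_le _), mul_one]
        split_ifs with h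
        · rw [h]
        · exact huniq _ (by simp [h])
      · intro j _ hj
        rw [huniq _ (by simp [hj]), zero_mul]
      · simp
    have h2 := LR.weyl h1 (s := fun d => if d = c then 2 * n else 0) (by simp)
    rw [sum_cyc _ c] at h2
    have hc1 : c + 1 ≠ c := by fin_cases c <;> decide
    have hc2 : c + 2 ≠ c := by fin_cases c <;> decide
    simp only [if_true, hc1, hc2, if_false, hat, if_pos hn, if_neg (show ¬ 2 * n < n by omega),
      if_neg (show ¬ 2 * n = n by omega), Nat.sub_self, hv] at h2
    linarith
  · have h1 : SymLR n (fundX n k) := by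
      refine LR.congr hS fun c i hi => ?_
      simp only [hat]
      split_ifs with h1 h2
      · exact (hkx c i h1).symm
      · rfl
      · rw [hkx c _ (by omega)]
    obtain ⟨r, hr, hQ⟩ := A.2
    exact hQ.isE.valid (UpLR.of_LR h1)

/-! ### Cutting boundaries along their sign change -/

theorem third_ne {k c : Fin 3} (h : c ≠ k) : -k - c ≠ k ∧ -k - c ≠ c := by
  revert h; fin_cases k <;> fin_cases c <;> decide

theorem sum_third {k c : Fin 3} (h : c ≠ k) (f : Fin 3 → ℕ) : ∑ j, f j = f k + f c + f (-k - c) := by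
  have h1 : k = c + 1 ∧ -k - c = c + 2 ∨ k = c + 2 ∧ -k - c = c + 1 := by
    revert h; fin_cases k <;> fin_cases c <;> decide
  rw [sum_cyc _ c]
  rcases h1 with ⟨h1, h2⟩ | ⟨h1, h2⟩ <;> rw [h2, h1] <;> ring

theorem LR.pair_ne {n : ℕ} {c c' : Fin 3} (hc : c' ≠ c) {u : ℕ → ℚ}
    (hu : ∀ i, i + 1 < n → u (i + 1) ≤ u i) :
    LR n (fun j i => if j = c then u i else if j = c' then - u (n - 1 - i) else 0) := by
  have h1 : c' = c + 1 ∨ c' = c + 2 := by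
    revert hc; fin_cases c' <;> fin_cases c <;> decide
  have e1 : c + 2 + 1 = c := (fin3_add_assoc c).2.2.1
  have e2 : c + 2 + 2 = c + 1 := (fin3_add_assoc c).2.2.2
  have e3 : c + 1 + 1 = c + 2 := (fin3_add_assoc c).1
  have e4 : c + 1 + 2 = c := (fin3_add_assoc c).2.1
  rcases h1 with rfl | rfl
  · have := LR.pair (n := n) (c + 2) hu
    rwa [e1, e2] at this
  · have := LR.pair (n := n) (c + 1) (u := fun i => - u (n - 1 - i)) fun i hi => by
      have := hu (n - 1 - (i + 1)) (by omega)
      rw [show n - 1 - (i + 1) + 1 = n - 1 - i by omega] at this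
      linarith
    rw [e3, e4] at this
    refine this.congr fun j i hi => ?_
    by_cases h1 : j = c
    · rw [if_neg (by rw [h1]; exact hc.symm), if_pos h1, if_pos h1,
        show n - 1 - (n - 1 - i) = i by omega, neg_neg]
    · simp only [if_neg h1]

/-- The two sides of the sign change of `p` are filled by hives that fit together. -/
def Ann (r : ℕ) (a : Fin 3 → ℕ) (p : Bdry) : Prop :=
  ∃ σ : Fin 3 → Bdry, (∀ j k i, j ≠ k → i < r - a k → 0 ≤ σ j k i) ∧
    (∀ k, LR (r - a k) (fun c i => if c = k then p k (a k + i) else σ c k i)) ∧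
    ∀ k, LR (a k) (fun c i => if c = k then p k i else if i < r - a (-k - c) then 0
      else - σ k c (a k - 1 - i))

/-- The form of `Ann` in terms of multisets. -/
def AnnM (a' : Fin 3 → ℕ) (P N : Fin 3 → Multiset ℚ) : Prop :=
  ∃ S : Fin 3 → Fin 3 → Multiset ℚ,
    (∀ j k, j ≠ k → Multiset.card (S j k) = a' k ∧ ∀ v ∈ S j k, 0 ≤ v) ∧
    (∀ k, LRM (fun c => if c = k then N k else S c k)) ∧
    ∀ k, LRM (fun c => if c = k then P k else
      Multiset.replicate (a' (-k - c)) 0 + (S k c).map Neg.neg)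

theorem AnnM.congr {a' b' : Fin 3 → ℕ} {P N P' N' : Fin 3 → Multiset ℚ} (h : AnnM a' P N)
    (ha : ∀ c, a' c = b' c) (hP : ∀ c, P c = P' c) (hN : ∀ c, N c = N' c) : AnnM b' P' N' := by
  rwa [← funext ha, ← funext hP, ← funext hN]

theorem AnnM.add {a' b' : Fin 3 → ℕ} {P N P' N' : Fin 3 → Multiset ℚ} (h : AnnM a' P N)
    (h' : AnnM b' P' N') : AnnM (fun c => a' c + b' c) (fun c => P c + P' c) (fun c => N c + N' c) := by
  obtain ⟨S, h0, h1, h2⟩ := h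
  obtain ⟨S', h0', h1', h2'⟩ := h'
  refine ⟨fun j k => S j k + S' j k, fun j k hjk => ⟨?_, fun v hv => ?_⟩, fun k => ?_, fun k => ?_⟩
  · rw [Multiset.card_add, (h0 j k hjk).1, (h0' j k hjk).1]
  · rcases Multiset.mem_add.1 hv with hv | hv
    · exact (h0 j k hjk).2 v hv
    · exact (h0' j k hjk).2 v hv
  · refine ((h1 k).add (h1' k)).congr fun c => ?_
    split_ifs <;> rfl
  · refine ((h2 k).add (h2' k)).congr fun c => ?_
    split_ifs
    · rfl
    · rw [Multiset.replicate_add, Multiset.map_add]; abel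

/-- The positions and signs compatible with cutting. -/
structure Signed (r : ℕ) (a : Fin 3 → ℕ) (p : Bdry) : Prop where
  le : ∀ c, a c ≤ r
  sum : ∑ c, a c = 2 * r
  pos : ∀ c, ∀ i < a c, 0 ≤ p c i
  neg : ∀ c i, a c ≤ i → i < r → p c i ≤ 0

theorem Signed.split {r : ℕ} {a : Fin 3 → ℕ} {p : Bdry} (h : Signed r a p) {k c : Fin 3}
    (hc : c ≠ k) : a k = (r - a (-k - c)) + (r - a c) := by
  have h1 := sum_third hc a
  have h2 := h.sum
  have h3 := h.le (-k - c)
  have h4 := h.le c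
  omega

theorem ms_outer {r b m : ℕ} (σ : ℕ → ℚ) (hm : m = b + r) :
    ms m (fun i => if i < b then 0 else - σ (m - 1 - i)) =
      Multiset.replicate b 0 + (ms r σ).map Neg.neg := by
  subst hm
  rw [ms_add, map_ms]
  congr 1
  · rw [ms_congr (v := fun _ => 0) fun i hi => if_pos hi, ms_const]
  · rw [← ms_rev r (fun i => - σ i)]
    refine ms_congr fun i hi => ?_
    rw [if_neg (by omega), show b + r - 1 - (b + i) = r - 1 - i by omega]

theorem Ann.annM {r : ℕ} {a : Fin 3 → ℕ} {p : Bdry} (hs : Signed r a p) (h : Ann r a p) :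
    AnnM (fun c => r - a c) (fun k => ms (a k) (p k)) (fun k => ms (r - a k) fun i => p k (a k + i)) := by
  obtain ⟨σ, h0, h1, h2⟩ := h
  refine ⟨fun j k => ms (r - a k) (σ j k), fun j k hjk => ⟨card_ms _ _, fun v hv => ?_⟩,
    fun k => (h1 k).lrm.congr fun c => ?_, fun k => (h2 k).lrm.congr fun c => ?_⟩
  · obtain ⟨i, hi, rfl⟩ := mem_ms.1 hv
    exact h0 j k i hjk hi
  · split_ifs <;> rfl
  · split_ifs with hc
    · rfl
    · exact ms_outer _ (hs.split hc)

theorem AnnM.ann {r : ℕ} {a : Fin 3 → ℕ} {p : Bdry} (hs : Signed r a p) (hp : Dec r p)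
    (h : AnnM (fun c => r - a c) (fun k => ms (a k) (p k))
      (fun k => ms (r - a k) fun i => p k (a k + i))) : Ann r a p := by
  obtain ⟨S, h0, h1, h2⟩ := h
  choose σ hσ hσ' using fun j k => exists_dec1 (S j k)
  have d : ∀ {j k}, j ≠ k → Dec1 (r - a k) (σ j k) ∧ ms (r - a k) (σ j k) = S j k := fun {j k} hjk => by
    rw [← show Multiset.card (S j k) = r - a k from (h0 j k hjk).1]; exact ⟨hσ j k, hσ' j k⟩
  have pos : ∀ j k i, j ≠ k → i < r - a k → 0 ≤ σ j k i := fun j k i hjk hi =>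
    (h0 j k hjk).2 _ (by rw [← (d hjk).2]; exact mem_ms.2 ⟨i, hi, rfl⟩)
  refine ⟨σ, pos, fun k => (h1 k).lr (fun c => ?_) fun c => ?_, fun k => (h2 k).lr (fun c => ?_) fun c => ?_⟩
  · split_ifs with hc
    · exact fun i j hij hj => hp k _ _ (by omega) (by omega)
    · exact (d hc).1
  · split_ifs with hc
    · rfl
    · exact (d hc).2
  · split_ifs with hc
    · exact fun i j hij hj => hp k _ _ hij (by have := hs.le k; omega)
    · have := hs.split hc
      intro i j hij hj
      simp only
      split_ifs
      · rfl
      · omega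
      · exact neg_nonpos.2 (pos _ _ _ (Ne.symm hc) (by omega))
      · exact neg_le_neg ((d (Ne.symm hc)).1 _ _ (by omega) (by omega))
  · split_ifs with hc
    · rfl
    · rw [← (d (Ne.symm hc)).2]; exact ms_outer _ (hs.split hc)

theorem Ann.comb {r : ℕ} {a : Fin 3 → ℕ} {p q : Bdry} {s t : ℚ} (hs : 0 ≤ s) (ht : 0 ≤ t)
    (hp : Ann r a p) (hq : Ann r a q) : Ann r a (fun c i => s * p c i + t * q c i) := by
  obtain ⟨σ, h0, h1, h2⟩ := hp
  obtain ⟨τ, g0, g1, g2⟩ := hq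
  refine ⟨fun j k i => s * σ j k i + t * τ j k i, fun j k i hjk hi => ?_, fun k => ?_, fun k => ?_⟩
  · exact add_nonneg (mul_nonneg hs (h0 j k i hjk hi)) (mul_nonneg ht (g0 j k i hjk hi))
  · refine (((h1 k).smul hs).add ((g1 k).smul ht)).congr fun c i _ => ?_
    split_ifs <;> rfl
  · refine (((h2 k).smul hs).add ((g2 k).smul ht)).congr fun c i _ => ?_
    split_ifs <;> ring

theorem Ann.congr {r : ℕ} {a : Fin 3 → ℕ} {p q : Bdry} (ha : ∀ c, a c ≤ r) (hp : Ann r a p)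
    (h : ∀ c, ∀ i < r, p c i = q c i) : Ann r a q := by
  obtain ⟨σ, h0, h1, h2⟩ := hp
  refine ⟨σ, h0, fun k => (h1 k).congr fun c i hi => ?_, fun k => (h2 k).congr fun c i hi => ?_⟩
  · split_ifs
    · exact h k _ (by omega)
    · rfl
  · split_ifs
    · exact h k _ (by have := ha k; omega)
    · rfl
    · rfl

theorem nthSmall_filter {s : Finset ℕ} {b l : ℕ} (hl : l < bef s b) :
    nthSmall (s.filter (· < b)) l = nthSmall s l := by
  have hl' : l < s.card := hl.trans_le (card_le_card (filter_subset _ _))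
  have h1 := (nthSmall_lt_iff_bef hl').2 hl
  refine nthSmall_of_card (mem_filter.2 ⟨nthSmall_mem hl', h1⟩) ?_
  rw [filter_filter]
  refine Eq.trans (congrArg _ ?_) (card_lt_nthSmall hl')
  exact filter_congr fun i _ => by omega

theorem ms_low {s : Finset ℕ} {b : ℕ} (u : ℕ → ℚ) :
    ms (bef s b) (fun l => u (nthSmall s l)) = (s.filter (· < b)).val.map u := by
  rw [← ms_nthSmall (s := s.filter (· < b)) (r := bef s b) rfl]
  exact ms_congr fun i hi => by rw [nthSmall_filter hi]

theorem ms_high {s : Finset ℕ} {r b : ℕ} (hr : s.card = r) (u : ℕ → ℚ) :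
    ms (r - bef s b) (fun l => u (nthSmall s (bef s b + l))) =
      (s.filter (fun i => ¬ i < b)).val.map u := by
  have h1 := ms_nthSmall hr u
  have hle : bef s b ≤ r := hr ▸ card_le_card (filter_subset _ _)
  conv_lhs at h1 => rw [show r = bef s b + (r - bef s b) by omega]
  rw [ms_add, ms_low, val_map s, ← sum_filter_add_sum_filter_not s (· < b), ← val_map,
    ← val_map] at h1
  exact add_left_cancel h1

theorem bef_range {r b : ℕ} (h : b ≤ r) : bef (range r) b = b := by
  have : (range r).filter (· < b) = range b := by ext i; simp; omega
  rw [bef, this, card_range]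

theorem bef_cpl {r b : ℕ} {s : Finset ℕ} (h : b ≤ r) : bef s b + bef (cpl r s) b = b :=
  card_filter_lt_add h

theorem evS_signs {t : ℕ} {a : Fin 3 → ℕ} {I : Triple}
    (hI : ∀ c, (I c).card = t) : evS I (fun c i => if i < a c then (1 : ℚ) else -2) =
      3 * (∑ c, bef (I c) (a c) : ℕ) - 6 * t := by
  have : ∀ c, ∑ i ∈ I c, (if i < a c then (1 : ℚ) else -2) = 3 * bef (I c) (a c) - 2 * t := fun c => by
    have h : ∀ i ∈ I c, (if i < a c then (1 : ℚ) else -2) = 3 * (if i < a c then 1 else 0) - 2 :=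
      fun i _ => by split_ifs <;> norm_num
    rw [sum_congr rfl h, sum_sub_distrib, ← mul_sum, sum_boole,
      sum_const, hI, nsmul_eq_mul, bef]
    ring
  rw [evS, sum_congr rfl fun c _ => this c, sum_sub_distrib, ← mul_sum]
  simp; ring

/-- Restricting a signed sequence to index sets with the right number of positive entries. -/
theorem Signed.res {r t : ℕ} {a : Fin 3 → ℕ} {p : Bdry} (h : Signed r a p)
    {I : Triple} (hs : ∀ c, I c ⊆ range r) (hI : ∀ c, (I c).card = t)
    (hb : ∑ c, bef (I c) (a c) = 2 * t) : Signed t (fun c => bef (I c) (a c)) (res I p) := by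
  refine ⟨fun c => hI c ▸ card_le_card (filter_subset _ _), hb, fun c i hi => ?_,
    fun c i hi hit => ?_⟩
  · have hle : bef (I c) (a c) ≤ (I c).card := card_le_card (filter_subset _ _)
    exact h.pos c _ ((nthSmall_lt_iff_bef (by omega)).2 hi)
  · have hi' : i < (I c).card := by rw [hI]; exact hit
    refine h.neg c _ ?_ (mem_range.1 (hs c (nthSmall_mem hi')))
    by_contra hcon
    exact absurd ((nthSmall_lt_iff_bef hi').1 (not_le.1 hcon)) (by omega)

theorem Signed.lr_step {r : ℕ} {a : Fin 3 → ℕ} {p : Bdry} (h : Signed r a p) :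
    LR r (fun c i => if i < a c then (1 : ℚ) else -2) := by
  refine LR.step (a' := fun c => r - a c) (fun c => Nat.add_sub_cancel' (h.le c)) ?_ (by norm_num)
    (by norm_num)
  have h1 := h.sum
  have h2 := h.le 0; have h3 := h.le 1; have h4 := h.le 2
  rw [Fin.sum_univ_three] at h1 ⊢
  omega

/-- For signed sequences the inequalities that respect the signs suffice. -/
theorem Signed.lr {r : ℕ} {a : Fin 3 → ℕ} {p : Bdry} (h : Signed r a p) (hp : Dec r p)
    (ht : ∑ c, ∑ i ∈ range r, p c i = 0)
    (hI : ∀ t I, 0 < t → t < r → IsE r t I → ∑ c, bef (I c) (a c) = 2 * t → 0 ≤ evS I p) :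
    LR r p := by
  by_contra hcon
  let q : Bdry := fun c i => if i < a c then 1 else -2
  have hq : LR r q := h.lr_step
  have hq0 : ∀ j : properE r, 0 ≤ evS j.1 q := fun j => by
    obtain ⟨t, -, -, hE⟩ := j.2
    exact hE.valid (UpLR.of_LR hq)
  obtain ⟨j₀, hj₀⟩ : ∃ j : properE r, evS j.1 p < 0 := by
    by_contra h'
    push Not at h'
    exact hcon (LR.of_properE hp ht fun s hs => h' ⟨s, hs⟩)
  obtain ⟨s, hs, hge, j₁, hj₁, hz⟩ := exists_hit (fun j : properE r => evS j.1 q)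
    (fun j => evS j.1 p - evS j.1 q) hq0 ⟨j₀, by have := hq0 j₀; linarith⟩
  have hs1 : s < 1 := by
    by_contra hc
    have := hge j₀
    have := hq0 j₀
    nlinarith
  let b : Bdry := fun c i => (1 - s) * q c i + s * p c i
  have hev : ∀ A, evS A b = evS A q + s * (evS A p - evS A q) := fun A => by
    rw [evS_comb]; ring
  have hbd : Dec r b := fun c i k hik hk => by
    have h1 := hp c i k hik hk
    have h2 := hq.dec c i k hik hk
    have := mul_le_mul_of_nonneg_left h1 hs
    have := mul_le_mul_of_nonneg_left h2 (show 0 ≤ 1 - s by linarith)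
    simp only [b]; linarith
  have hbl : LR r b := by
    refine LR.of_properE hbd ?_ fun A hA => by rw [hev]; exact hge ⟨A, hA⟩
    simp only [b, sum_add_distrib, ← mul_sum, hq.trace, ht]; ring
  obtain ⟨t, h0, htr, hE⟩ := j₁.2
  have htight : evS j₁.1 b = 0 := by rw [hev]; exact hz
  have hle := hq0 j₁
  have hstep : evS j₁.1 q = _ := evS_signs hE.card
  rw [hstep] at hle
  have hle' : 2 * t ≤ ∑ c, bef (j₁.1 c) (a c) := by
    have : (2 * (t : ℚ)) ≤ (∑ c, bef (j₁.1 c) (a c) : ℕ) := by linarith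
    exact_mod_cast this
  rcases hle'.eq_or_lt with heq | hlt
  · have h1 := hI t _ h0 htr hE heq.symm
    rw [← heq] at hstep
    push_cast at hstep
    linarith
  · have h1 := (hE.split_of_tight hbl htight).1.2
    have hbt : ∀ c, bef (j₁.1 c) (a c) ≤ t := fun c =>
      hE.card c ▸ card_le_card (filter_subset _ _)
    have b0 := hbt 0; have b1 := hbt 1; have b2 := hbt 2
    rw [Fin.sum_univ_three] at hlt
    have hpos : ∀ c, 0 < bef (j₁.1 c) (a c) := fun c => by fin_cases c <;> simp <;> omega
    have h2 := h1.weyl_dual (s := fun c => bef (j₁.1 c) (a c) - 1)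
      (by rw [Fin.sum_univ_three]; have := hpos 0; have := hpos 1; have := hpos 2; omega)
      fun c => by have := hpos c; have := hbt c; omega
    refine absurd h2 (not_le.2 (Finset.sum_pos (fun c _ => ?_) ⟨0, mem_univ _⟩))
    have hlt' : nthSmall (j₁.1 c) (bef (j₁.1 c) (a c) - 1) < a c :=
      (nthSmall_lt_iff_bef (by rw [hE.card]; have := hpos c; have := hbt c; omega)).2
        (by have := hpos c; omega)
    have h3 := mul_nonneg hs (h.pos c _ hlt')
    simp only [_root_.res, b, q, if_pos hlt']
    linarith

/-! ### Existence of the cut -/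

/-- The generators of the cone of signed decreasing sequences. -/
def signGen (b : ℕ) (i l : ℕ) : ℚ :=
  if i < b then (if l ≤ i then 1 else 0) else (if l < i then 0 else -1)

/-- The signed decreasing sequences with coordinates `k`. -/
def signX (r : ℕ) (a : Fin 3 → ℕ) (k : Fin 3 × Fin r → ℚ) (c : Fin 3) (l : ℕ) : ℚ :=
  ∑ i : Fin r, k (c, i) * signGen (a c) i l

/-- The trace of a generator. -/
def signW (r : ℕ) (a : Fin 3 → ℕ) (i : Fin 3 × Fin r) : ℚ :=
  if (i.2 : ℕ) < a i.1 then (i.2 : ℚ) + 1 else -((r : ℚ) - i.2)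

theorem sum_signGen {r b i : ℕ} (hi : i < r) : ∑ l ∈ range r, signGen b i l =
    if i < b then (i : ℚ) + 1 else -((r : ℚ) - i) := by
  unfold signGen
  split_ifs with h
  · rw [sum_boole, show (range r).filter (· ≤ i) = range (i + 1) by
      ext l; simp; omega]
    simp
  · have : ∀ l ∈ range r, (if l < i then (0 : ℚ) else -1) = (if l < i then 1 else 0) - 1 :=
      fun l _ => by split_ifs <;> norm_num
    rw [sum_congr rfl this, sum_sub_distrib, sum_boole,
      show (range r).filter (· < i) = range i by ext l; simp; omega]
    simp

theorem signX_comb (r : ℕ) (a : Fin 3 → ℕ) (k k' : Fin 3 × Fin r → ℚ) (s t : ℚ) :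
    signX r a (s • k + t • k') = fun c l => s * signX r a k c l + t * signX r a k' c l := by
  funext c l
  simp only [signX, mul_sum, ← sum_add_distrib]
  exact sum_congr rfl fun i _ => by
    simp only [Pi.add_apply, Pi.smul_apply, smul_eq_mul]; ring

theorem signX_single (r : ℕ) (a : Fin 3 → ℕ) (c j : Fin 3) (i : Fin r) (l : ℕ) :
    signX r a (Pi.single (c, i) 1) j l = if j = c then signGen (a c) i l else 0 := by
  rw [signX, sum_eq_single i]
  · by_cases h : j = c <;> simp [h]
  · intro m _ hm
    simp [hm]
  · simp

theorem trace_signX (r : ℕ) (a : Fin 3 → ℕ) (k : Fin 3 × Fin r → ℚ) :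
    ∑ c, ∑ l ∈ range r, signX r a k c l = ∑ i, signW r a i * k i := by
  rw [Fintype.sum_prod_type]
  refine sum_congr rfl fun c _ => ?_
  simp only [signX]
  rw [sum_comm]
  refine sum_congr rfl fun i _ => ?_
  rw [← mul_sum, sum_signGen i.2, mul_comm]
  rfl

theorem dec_signX {r : ℕ} {a : Fin 3 → ℕ} {k : Fin 3 × Fin r → ℚ} (hk : ∀ i, 0 ≤ k i) :
    Dec r (signX r a k) := fun c i j hij _ =>
  sum_le_sum fun l _ => mul_le_mul_of_nonneg_left (by
    unfold signGen; split_ifs <;> first | omega | norm_num) (hk _)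

theorem signed_signX {r : ℕ} {a : Fin 3 → ℕ} (ha : ∀ c, a c ≤ r) (hs : ∑ c, a c = 2 * r)
    {k : Fin 3 × Fin r → ℚ} (hk : ∀ i, 0 ≤ k i) : Signed r a (signX r a k) := by
  refine ⟨ha, hs, fun c i hi => sum_nonneg fun l _ => mul_nonneg (hk _) ?_,
    fun c i hi _ => sum_nonpos fun l _ => mul_nonpos_of_nonneg_of_nonpos (hk _) ?_⟩
  all_goals unfold signGen; split_ifs <;> first | omega | norm_num

theorem exists_signX {r : ℕ} {a : Fin 3 → ℕ} {p : Bdry} (h : Signed r a p) (hp : Dec r p) :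
    ∃ k : Fin 3 × Fin r → ℚ, (∀ i, 0 ≤ k i) ∧ ∀ c, ∀ l < r, signX r a k c l = p c l := by
  let y : Bdry := fun c i => if i < a c then p c i else 0
  let z : Bdry := fun c i => if i ≤ a c then 0 else p c (i - 1)
  refine ⟨fun i => (y i.1 i.2 - y i.1 (i.2 + 1)) + (z i.1 i.2 - z i.1 (i.2 + 1)),
    fun ⟨c, i⟩ => ?_, fun c l hl => ?_⟩
  · have hi := i.2
    have h0 := h.le c
    have h1 := h.pos c i
    have h2 := h.neg c i
    simp only [y, z]
    split_ifs <;> first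
      | omega
      | (have := hp c i (i + 1) (by omega) (by omega); linarith)
      | (have := hp c (i - 1) i (by omega) (by omega); simp only [Nat.add_sub_cancel]; linarith)
      | (have := h1 (by omega); linarith)
      | (have := h2 (by omega) hi; simp only [Nat.add_sub_cancel]; linarith)
  · have e1 := genX_sub_last r (y c) hl.le
    have e2 := genX_sub_last r (z c) (show l + 1 ≤ r by omega)
    have e3 := genX_sub_last r (z c) (Nat.zero_le r)
    have h0 := h.le c
    have : signX r a (fun i => (y i.1 i.2 - y i.1 (i.2 + 1)) + (z i.1 i.2 - z i.1 (i.2 + 1))) c l =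
        (y c l - y c r) + (z c (l + 1) - z c r) - (z c 0 - z c r) := by
      rw [← e1, ← e2, ← e3, signX, ← sum_add_distrib, ← sum_sub_distrib]
      refine sum_congr rfl fun i _ => ?_
      have hi := i.2
      simp only [signGen]
      by_cases hia : (i : ℕ) < a c
      · have hz : z c i - z c (i + 1) = 0 := by
          simp only [z]; rw [if_pos (by omega), if_pos (by omega), sub_zero]
        rw [hz, if_pos hia]; ring
      · have hy : y c i - y c (i + 1) = 0 := by
          simp only [y]; rw [if_neg (by omega), if_neg (by omega), sub_zero]
        rw [hy, if_neg hia]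
        split_ifs <;> first | omega | ring
    rw [this]
    simp only [y, z, if_neg (show ¬ r < a c by omega)]
    split_ifs <;> first | omega | (try simp only [Nat.add_sub_cancel]) <;> ring

theorem Ann.zero {r : ℕ} (a : Fin 3 → ℕ) : Ann r a fun _ _ => 0 :=
  ⟨fun _ _ _ => 0, fun _ _ _ _ _ => le_rfl, fun _ => (LR.zero _).congr fun _ _ _ => by simp,
    fun _ => (LR.zero _).congr fun _ _ _ => by simp⟩

/-- The cut of a pair of opposite fundamental weights. -/
theorem Ann.pair {r d : ℕ} {a : Fin 3 → ℕ} (ha : ∀ c, a c ≤ r) (hs : ∑ c, a c = 2 * r)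
    {c c' : Fin 3} (hc : c' ≠ c) (hd : d ≤ a c) (hd' : a c' + d ≤ r) {v : ℚ} (hv : 0 ≤ v) :
    Ann r a (fun j i => if j = c then (if i < d then v else 0) else
      if j = c' then (if i + d < r then 0 else -v) else 0) := by
  have hu : ∀ m i, i + 1 < m → (if i + 1 < d then v else 0) ≤ (if i < d then v else 0) := fun m i _ => by
    split_ifs <;> first | omega | exact hv | exact le_rfl
  refine ⟨fun j k i => if j = c then if k = c' then (if i < d then v else 0) else 0 else 0,
    fun j k i _ _ => by dsimp only; split_ifs <;> first | exact hv | exact le_rfl, fun k => ?_, fun k => ?_⟩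
  · by_cases hk : k = c'
    · subst hk
      refine (LR.pair_ne hc (hu (r - a k))).congr fun j i hi => ?_
      by_cases hj : j = c
      · simp [hj, hc.symm]
      · by_cases hj' : j = k
        · simp only [hj', hc, if_true, if_false]
          split_ifs <;> first | omega | simp
        · simp [hj, hj']
    · refine (LR.zero _).congr fun j i hi => ?_
      dsimp only
      split_ifs <;> first | rfl | contradiction | (subst_vars; omega)
  · by_cases hk : k = c
    · subst hk
      refine (LR.pair_ne hc (hu (a k))).congr fun j i hi => ?_
      by_cases hj : j = k
      · simp [hj]
      · by_cases hj' : j = c'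
        · subst hj'
          have := sum_third hc a
          have := ha j
          have := ha (-k - j)
          simp only [hj, if_true, if_false]
          split_ifs <;> first | omega | simp
        · simp [hj, hj']
    · refine (LR.zero _).congr fun j i hi => ?_
      dsimp only
      split_ifs <;> first | rfl | simp only [neg_zero] | contradiction | (subst_vars; omega)

theorem ann_of_generators {r : ℕ} {a : Fin 3 → ℕ} (ha : ∀ c, a c ≤ r) (hs : ∑ c, a c = 2 * r)
    {k : Fin 3 × Fin r → ℚ} (hk : ∀ i, 0 ≤ k i) (hw : ∑ i, signW r a i * k i = 0)
    (hl : LR r (signX r a k)) (hsup : ∀ i j, 0 < k i → 0 < k j →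
      (signW r a i = 0 ∧ signW r a j = 0 ∨ 0 < signW r a i * signW r a j) → i = j) :
    Ann r a (signX r a k) := by
  have hwp : ∀ i, (i.2 : ℕ) < a i.1 → 0 < signW r a i := fun i hi => by
    rw [signW, if_pos hi]; positivity
  have hwn : ∀ i, ¬ (i.2 : ℕ) < a i.1 → signW r a i < 0 := fun i hi => by
    rw [signW, if_neg hi]
    have : ((i.2 : ℕ) : ℚ) < r := by exact_mod_cast i.2.2
    linarith
  by_cases h0 : ∀ i, k i = 0
  · refine (Ann.zero a).congr ha fun c l _ => ?_
    simp [signX, h0]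
  push Not at h0
  have hpn : ∀ i, k i ≠ 0 → 0 < k i := fun i hi => lt_of_le_of_ne (hk i) (Ne.symm hi)
  have hex : ∀ s : ℚ, s ≠ 0 → ∃ i, k i ≠ 0 ∧ 0 < s * signW r a i := by
    intro s hs
    by_contra hcon
    push Not at hcon
    obtain ⟨i₀, hi₀⟩ := h0
    have h1 : ∑ i, s * (signW r a i * k i) < 0 := by
      refine sum_neg' (fun i _ => ?_) ⟨i₀, mem_univ _, ?_⟩
      · by_cases hi : k i = 0
        · simp [hi]
        · have := mul_nonpos_of_nonpos_of_nonneg (hcon i hi) (hk i); linarith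
      · have h2 : s * signW r a i₀ ≠ 0 := mul_ne_zero hs (by
          by_cases h : (i₀.2 : ℕ) < a i₀.1
          · exact (hwp _ h).ne'
          · exact (hwn _ h).ne)
        have := mul_neg_of_neg_of_pos (lt_of_le_of_ne (hcon i₀ hi₀) h2) (hpn _ hi₀)
        linarith
    rw [← mul_sum, hw, mul_zero] at h1
    exact lt_irrefl _ h1
  obtain ⟨⟨c, i⟩, hi0, hi⟩ := hex 1 one_ne_zero
  obtain ⟨⟨c', i'⟩, hi0', hi'⟩ := hex (-1) (by norm_num)
  have hia : (i : ℕ) < a c := by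
    by_contra h; have := hwn (c, i) h; linarith
  have hia' : ¬ (i' : ℕ) < a c' := fun h => by
    have := hwp (c', i') h; linarith
  have hne : (c, i) ≠ (c', i') := by
    intro h
    rw [Prod.mk.injEq] at h
    rw [h.1, h.2] at hia
    exact hia' hia
  have hzero : ∀ j, j ≠ (c, i) → j ≠ (c', i') → k j = 0 := fun j h1 h2 => by
    by_contra hj
    by_cases h : (j.2 : ℕ) < a j.1
    · exact h1 (hsup _ _ (hpn _ hj) (hpn _ hi0) (Or.inr (mul_pos (hwp _ h) (hwp _ hia))))
    · exact h2 (hsup _ _ (hpn _ hj) (hpn _ hi0') (Or.inr (mul_pos_of_neg_of_neg (hwn _ h) (hwn _ hia'))))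
  have hir := i.2
  have hir' := i'.2
  have hX : ∀ j l, signX r a k j l = (if j = c then k (c, i) * (if l ≤ i then 1 else 0) else 0) +
      if j = c' then k (c', i') * (if l < i' then 0 else -1) else 0 := by
    intro j l
    have h1 : k = k (c, i) • Pi.single (c, i) 1 + k (c', i') • Pi.single (c', i') 1 := by
      funext m
      by_cases hm : m = (c, i)
      · simp [hm, hne]
      · by_cases hm' : m = (c', i')
        · simp [hm', hne.symm]
        · simp [hm, hm', hzero m hm hm']
    conv_lhs => rw [h1, signX_comb]
    simp only [signX_single, signGen, if_pos hia, if_neg hia']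
    split_ifs <;> simp
  have hκ := hpn _ hi0
  have hκ' := hpn _ hi0'
  have hcc : c' ≠ c := by
    rintro rfl
    have := hl.weyl (s := fun j => if j = c' then r - 1 else 0) (by simp; omega)
    rw [sum_cyc _ c'] at this
    have hc1 : c' + 1 ≠ c' := by fin_cases c' <;> decide
    have hc2 : c' + 2 ≠ c' := by fin_cases c' <;> decide
    simp only [hX, if_true, hc1, hc2, if_false] at this
    have hii : (i : ℕ) ≠ r - 1 := by omega
    rw [if_neg (by omega), if_neg (by omega)] at this
    linarith
  have hwey := hl.weyl (s := fun j => if j = c then r - 1 - i' else if j = c' then i' else 0) (by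
    have := sum_third hcc (fun j => if j = c then r - 1 - (i' : ℕ) else if j = c' then (i' : ℕ) else 0)
    rw [this]; simp [(third_ne hcc).1, (third_ne hcc).2, hcc]; omega)
  have hwey' : k (c', i') ≤ k (c, i) * (if r - 1 - (i' : ℕ) ≤ i then 1 else 0) := by
    have h1 : ∀ j, signX r a k j (if j = c then r - 1 - i' else if j = c' then i' else 0) =
      (if j = c then k (c, i) * (if r - 1 - (i' : ℕ) ≤ i then 1 else 0) else 0) +
        if j = c' then - k (c', i') else 0 := fun j => by
      rw [hX]
      by_cases h1 : j = c
      · simp [h1, hcc.symm]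
      · by_cases h2 : j = c' <;> simp [h1, h2, hcc]
    rw [sum_congr rfl fun j _ => h1 j, sum_add_distrib, sum_ite_eq',
      sum_ite_eq'] at hwey
    simp only [mem_univ, if_true] at hwey
    linarith
  have hri : r - 1 - (i' : ℕ) ≤ i := by
    by_contra h
    rw [if_neg h] at hwey'
    linarith
  rw [if_pos hri, mul_one] at hwey'
  have htr := hw
  rw [← sum_subset (subset_univ {(c, i), (c', i')}) (fun j _ hj => by
    simp only [mem_insert, mem_singleton, not_or] at hj
    rw [hzero j hj.1 hj.2, mul_zero]), sum_pair hne] at htr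
  simp only [signW, if_pos hia, if_neg hia'] at htr
  have hdd : (r : ℚ) ≤ i + 1 + i' := by exact_mod_cast (show r ≤ i + 1 + i' by omega)
  have hpos : (0 : ℚ) < r - (i' : ℕ) := by
    have : ((i' : ℕ) : ℚ) < r := by exact_mod_cast hir'
    linarith
  have heq : k (c', i') = k (c, i) := by
    rcases hwey'.eq_or_lt with h | h
    · exact h
    · nlinarith
  rw [heq] at htr
  have hd : (r : ℚ) = i + 1 + i' := by
    have : k (c, i) * ((i : ℚ) + 1 - (r - i')) = 0 := by linarith
    rcases mul_eq_zero.1 this with h | h <;> linarith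
  have hd' : r = i + 1 + i' := by exact_mod_cast hd
  refine (Ann.pair ha hs hcc (d := i + 1) (by omega) (by omega) hκ.le).congr ha fun j l hl => ?_
  rw [hX, heq]
  by_cases h1 : j = c
  · simp only [h1, if_true, hcc.symm, if_false, add_zero]
    split_ifs <;> first | omega | simp
  · by_cases h2 : j = c'
    · simp only [h2, if_true, hcc, if_false, zero_add]
      split_ifs <;> first | omega | simp
    · simp [h1, h2]

theorem Signed.ann {r : ℕ} {a : Fin 3 → ℕ} {p : Bdry} (h : Signed r a p) (hp : LR r p) :
    Ann r a p := by
  induction r using Nat.strong_induction_on generalizing a p with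
  | _ r ih =>
  let J : Set (Triple) := {I | ∃ t, 0 < t ∧ t < r ∧ IsE r t I ∧ ∑ c, bef (I c) (a c) = 2 * t}
  have hJ : Finite J := by
    refine Set.Finite.to_subtype ((finite_sub_range r).subset ?_)
    rintro s ⟨t, -, -, hE, -⟩
    exact hE.sub
  let L : J → (Fin 3 × Fin r → ℚ) →ₗ[ℚ] ℚ := fun A =>
    { toFun := fun k => evS A.1 (signX r a k)
      map_add' := fun k k' => by
        have := signX_comb r a k k' 1 1
        rw [one_smul, one_smul] at this
        rw [this, evS_comb, one_mul, one_mul]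
      map_smul' := fun s k => by
        have := signX_comb r a k 0 s 0
        rw [zero_smul, add_zero] at this
        rw [this, evS_comb, zero_mul, add_zero]; rfl }
  have hfac : ∀ k : Fin 3 × Fin r → ℚ, (∀ i, 0 ≤ k i) → ∑ i, signW r a i * k i = 0 →
      (∀ j, 0 ≤ L j k) → LR r (signX r a k) := fun k hk hw hL =>
    (signed_signX h.le h.sum hk).lr (dec_signX hk) ((trace_signX r a k).trans hw)
      fun t I h0 ht hE hb => hL ⟨I, t, h0, ht, hE, hb⟩
  obtain ⟨k, hk, hkp⟩ := exists_signX h hp.dec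
  have hlk : LR r (signX r a k) := hp.congr fun c i hi => (hkp c i hi).symm
  refine (support_reduction (signW r a) L (fun k => Ann r a (signX r a k)) ?_ ?_ ?_ k hk
    (by rw [← trace_signX]; exact hlk.trace) fun A => ?_).congr h.le hkp
  · intro u v s t hs ht hu hv
    rw [signX_comb]
    exact hu.comb hs ht hv
  · rintro k hk hw hL ⟨⟨I, t, h0, ht, hE, hb⟩, hj⟩
    have hl := hfac k hk hw hL
    have hsg := signed_signX h.le h.sum hk
    obtain ⟨h1, h2⟩ := hE.split_of_tight hl hj
    have hb' : ∑ c, bef (cpl r (I c)) (a c) = 2 * (r - t) := by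
      have h3 : ∑ c, bef (I c) (a c) + ∑ c, bef (cpl r (I c)) (a c) = ∑ c, a c := by
        rw [← sum_add_distrib]
        exact sum_congr rfl fun c _ => bef_cpl (h.le c)
      have := h.sum
      omega
    have s1 := hsg.res hE.sub hE.card hb
    have s2 := hsg.res (fun c => cpl_sub r (I c)) h2.1 hb'
    refine AnnM.ann hsg (dec_signX hk) (((ih t ht s1 h1.2).annM s1 |>.add
      ((ih (r - t) (by omega) s2 h2.2).annM s2)).congr (fun c => ?_) (fun c => ?_) fun c => ?_)
    · have h3 := bef_cpl (s := I c) (h.le c)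
      have h4 := s1.le c
      have h5 := s2.le c
      omega
    · change ms _ (fun l => signX r a k c (nthSmall (I c) l)) +
        ms _ (fun l => signX r a k c (nthSmall (cpl r (I c)) l)) = _
      rw [ms_low, ms_low, ms_eq_sum, val_map, val_map]
      have h3 : (range (a c)) = (I c).filter (· < a c) ∪ (cpl r (I c)).filter (· < a c) := by
        ext i
        have := h.le c
        simp only [mem_range, mem_union, mem_filter, mem_cpl]
        constructor
        · intro hi
          have : i < r := by omega
          tauto
        · tauto
      rw [h3, sum_union]
      rw [disjoint_left]
      simp only [mem_filter, mem_cpl]; tauto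
    · change ms _ (fun l => signX r a k c (nthSmall (I c) (bef (I c) (a c) + l))) +
        ms _ (fun l => signX r a k c (nthSmall (cpl r (I c)) (bef (cpl r (I c)) (a c) + l))) = _
      have h4 := ms_high (s := range r) (b := a c) (card_range r) (signX r a k c)
      rw [bef_range (h.le c)] at h4
      rw [ms_high (hE.card c), ms_high (h2.1 c), val_map, val_map,
        ms_congr (v := fun l => signX r a k c (nthSmall (range r) (a c + l))) fun i hi => by
          rw [nthSmall_range (by omega)], h4, val_map, ← sum_union]
      · refine sum_congr ?_ fun _ _ => rfl
        ext i
        have := fun h' => mem_range.1 (hE.sub c h' : i ∈ range r)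
        simp only [mem_range, mem_union, mem_filter, mem_cpl]
        tauto
      · rw [disjoint_left]
        simp only [mem_filter, mem_cpl]; tauto
  · intro k hk hw hL hsup
    exact ann_of_generators h.le h.sum hk hw (hfac k hk hw hL) hsup
  · obtain ⟨t, -, -, hE, -⟩ := A.2
    exact hE.valid (UpLR.of_LR hlk)

/-! ### Symmetric boundaries decompose -/

/-- The three boundaries `x k` are sums of pairs of common nonnegative boundaries. -/
def NLQ (n : ℕ) (x : Bdry) : Prop :=
  ∃ y : Bdry, (∀ c, ∀ i < n, 0 ≤ y c i) ∧
    ∀ k, LR n (fun c i => if c = k then - x k (n - 1 - i) else y (-k - c) i)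

theorem nlq_of_lrm {n : ℕ} {x : Bdry} (hx : Dec n x) {Y : Fin 3 → Multiset ℚ}
    (hc : ∀ c, Multiset.card (Y c) = n) (h0 : ∀ c, ∀ v ∈ Y c, 0 ≤ v)
    (h : ∀ k, LRM (fun c => if c = k then ms n (fun i => - x k i) else Y (-k - c))) : NLQ n x := by
  choose y hy hy' using fun c => exists_dec1 (Y c)
  simp only [hc] at hy hy'
  refine ⟨y, fun c i hi => h0 c _ (by rw [← hy' c]; exact mem_ms.2 ⟨i, hi, rfl⟩), fun k =>
    (h k).lr (fun c => ?_) fun c => ?_⟩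
  · split_ifs with hck
    · exact fun i j hij hj => neg_le_neg (hx k _ _ (by omega) (by omega))
    · exact hy _
  · split_ifs with hck
    · exact ms_rev n (fun i => - x k i)
    · exact hy' _

theorem NLQ.comb {n : ℕ} {x z : Bdry} {s t : ℚ} (hs : 0 ≤ s) (ht : 0 ≤ t) (hx : NLQ n x)
    (hz : NLQ n z) : NLQ n (fun c i => s * x c i + t * z c i) := by
  obtain ⟨y, h0, h1⟩ := hx
  obtain ⟨y', g0, g1⟩ := hz
  refine ⟨fun c i => s * y c i + t * y' c i, fun c i hi =>
    add_nonneg (mul_nonneg hs (h0 c i hi)) (mul_nonneg ht (g0 c i hi)), fun k =>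
    (((h1 k).smul hs).add ((g1 k).smul ht)).congr fun c i _ => ?_⟩
  split_ifs
  · ring
  · rfl

theorem NLQ.congr {n : ℕ} {x z : Bdry} (hx : NLQ n x) (h : ∀ c, ∀ i < n, x c i = z c i) :
    NLQ n z := by
  obtain ⟨y, h0, h1⟩ := hx
  refine ⟨y, h0, fun k => (h1 k).congr fun c i hi => ?_⟩
  rw [h k _ (by omega)]

theorem IsQ.signed {n r : ℕ} {A : Triple} (h : IsQ n r A) {x : Bdry}
    (hx : DecPos n x) : Signed r (fun c => bef (A c) n) (res A (hat n x)) := by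
  have hle : ∀ c, bef (A c) n ≤ r := fun c => by have := h.low_add c; omega
  refine ⟨hle, ?_, fun c i hi => ?_, fun c i hi hir => ?_⟩
  · have h1 := h.neg
    have h2 : ∑ c, bef (A c) n + ∑ c, ((A c).filter (n < ·)).card = 3 * r := by
      rw [← sum_add_distrib, sum_congr rfl fun c _ => h.low_add c]; simp
    omega
  · have := (nthSmall_lt_iff_bef (s := A c) (x := n) (k := i) (by
      rw [h.card]; exact lt_of_lt_of_le hi (hle c))).2 hi
    simp only [res, hat, if_pos this]
    exact hx.2 c _ this
  · have h1 := (h.lt_low c hir).not.1 (not_lt.2 hi)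
    rw [not_not] at h1
    have h2 := mem_range.1 (h.sub c (nthSmall_mem (s := A c) (k := i) (by rw [h.card]; exact hir)))
    simp only [res, hat, if_neg (not_lt.2 h1.le), if_neg h1.ne']
    exact neg_nonpos.2 (hx.2 c _ (by omega))

theorem IsQ.nlq_of_tight {n r : ℕ} {A : Triple} (h : IsQ n r A) {x : Bdry}
    (hx : DecPos n x) (h1 : LRon A r (hat n x))
    (h2 : NLQ (n - r) (res (fun c => freeLow n (A c)) x)) : NLQ n x := by
  obtain ⟨S, hS, hU, hL⟩ := ((h.signed hx).ann h1.2).annM (h.signed hx)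
  obtain ⟨y, hy, hyl⟩ := h2
  have hP : ∀ k, ms (bef (A k) n) (res A (hat n x) k) = (lowS n (A k)).val.map (x k) := fun k => by
    refine (ms_low (hat n x k)).trans (Multiset.map_congr rfl fun i hi => ?_)
    rw [hat, if_pos (mem_filter.1 hi).2]
  have hN : ∀ k, ms (r - bef (A k) n) (fun i => res A (hat n x) k (bef (A k) n + i)) =
      (lowS n (revS (2 * n + 1) (A k))).val.map (fun i => - x k i) := fun k => by
    have e1 := ms_nthSmall (h.card k) (hat n x k)
    conv_lhs at e1 => rw [← Nat.add_sub_cancel' ((h.signed hx).le k)]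
    rw [ms_add, map_hat (h.sub k), if_neg (h.mid k), add_zero, ← hP k] at e1
    exact add_left_cancel e1
  have hcase : ∀ {k c : Fin 3}, c ≠ k → -k - c + 1 = k ∧ -k - c + 2 = c ∨
      -k - c + 1 = c ∧ -k - c + 2 = k := fun {k c} hck => by
    revert hck; fin_cases k <;> fin_cases c <;> decide
  have hne : ∀ i : Fin 3, i + 1 ≠ i + 2 := by decide
  refine nlq_of_lrm hx.1 (Y := fun i => ms (n - r) (y i) + (S (i + 1) (i + 2) + S (i + 2) (i + 1)) +
    Multiset.replicate (r - bef (A i) n) 0) (fun i => ?_) (fun i v hv => ?_) fun k => ?_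
  · have e1 := (hS _ _ (hne i)).1
    have e2 := (hS _ _ (hne i).symm).1
    have e3 : ∀ c, r - bef (A c) n = ((A c).filter (n < ·)).card := fun c => by
      have := h.low_add c; omega
    have e4 := h.neg
    rw [sum_cyc _ i] at e4
    have := h.le
    simp only [e3] at e1 e2 ⊢
    rw [Multiset.card_add, Multiset.card_add, Multiset.card_add, card_ms, Multiset.card_replicate, e1, e2]
    omega
  · rw [Multiset.mem_add, Multiset.mem_add, Multiset.mem_add] at hv
    rcases hv with (hv | hv | hv) | hv
    · obtain ⟨j, hj, rfl⟩ := mem_ms.1 hv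
      exact hy i j hj
    · exact (hS _ _ (hne i)).2 v hv
    · exact (hS _ _ (hne i).symm).2 v hv
    · rw [Multiset.eq_of_mem_replicate hv]
  · refine (((hyl k).lrm.add (hU k)).add (hL k).neg).congr fun c => ?_
    by_cases hck : c = k
    · subst hck
      simp only [if_true]
      rw [hN, hP, h.ms_split c (fun i => - x c i), ms_rev (n - r) (fun i => - res (fun c => freeLow n (A c)) x c i)]
      have e2 := ms_nthSmall (h.card_low c) (fun i => - x c i)
      change ms (n - r) (fun i => - x c (nthSmall (freeLow n (A c)) i)) + _ + _ = _
      rw [e2, Multiset.map_map]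
      simp only [Function.comp_def]
      abel
    · simp only [if_neg hck, Multiset.map_add, Multiset.map_replicate, neg_zero, Multiset.map_map,
        Function.comp_def, neg_neg, Multiset.map_id']
      rcases hcase hck with ⟨e1, e2⟩ | ⟨e1, e2⟩ <;> rw [e1, e2] <;> abel

/-- The even analogue of `hat`. -/
def hat₀ (n : ℕ) (x : Bdry) (c : Fin 3) (i : ℕ) : ℚ :=
  if i < n then x c i else - x c (n + n - 1 - i)

theorem ms_hat₀ (n : ℕ) (x : Bdry) (c : Fin 3) :
    ms (n + n) (hat₀ n x c) = ms n (x c) + ms n (fun i => - x c i) := by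
  rw [ms_add, ← ms_rev n (fun i => - x c i)]
  congr 1
  · exact ms_congr fun i hi => if_pos hi
  · refine ms_congr fun i hi => ?_
    rw [hat₀, if_neg (by omega), show n + n - 1 - (n + i) = n - 1 - i by omega]

theorem symLR₀_iff {n : ℕ} {x : Bdry} (hx : DecPos n x) :
    SymLR₀ n x ↔ LR (n + n) (hat₀ n x) := by
  refine ⟨fun h => LRM.lr h (fun c i j hij hj => ?_) (ms_hat₀ n x),
    fun h => h.lrm.congr (ms_hat₀ n x)⟩
  simp only [hat₀]
  split_ifs
  · exact hx.1 c i j hij (by omega)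
  · omega
  · have := hx.2 c i (by omega); have := hx.2 c (n + n - 1 - j) (by omega); linarith
  · exact neg_le_neg (hx.1 c _ _ (by omega) (by omega))

theorem SymLR.decompose {n : ℕ} {x : Bdry} (hx : DecPos n x) (hS : SymLR n x) :
    SymLR₀ n x ∧ NLQ n x := by
  induction n using Nat.strong_induction_on generalizing x with
  | _ n ih =>
  suffices h : DecPos n x ∧ LR (n + n) (hat₀ n x) ∧ NLQ n x from ⟨(symLR₀_iff hx).2 h.2.1, h.2.2⟩
  refine symLR_induction (fun m hm x hx h => (ih m hm hx h).1)
    (P := fun x => DecPos n x ∧ LR (n + n) (hat₀ n x) ∧ NLQ n x)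
    (fun x y hxy ⟨h1, h2, h3⟩ => ⟨⟨fun c i j hij hj => ?_, fun c i hi => ?_⟩,
      h2.congr fun c i hi => ?_, h3.congr hxy⟩)
    (fun x y a b ha hb ⟨h1, h2, h3⟩ ⟨g1, g2, g3⟩ => ⟨⟨fun c i j hij hj => ?_, fun c i hi => ?_⟩,
      ((h2.smul ha).add (g2.smul hb)).congr fun c i hi => ?_, h3.comb ha hb g3⟩)
    ⟨⟨fun _ _ _ _ _ => le_rfl, fun _ _ _ => le_rfl⟩, (LR.zero _).congr fun c i _ => ?_,
      fun _ _ => 0, fun _ _ _ => le_rfl, fun k => (LR.zero _).congr fun c i _ => ?_⟩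
    (fun x r A hx hS hr hA ht => ?_) hx hS
  · rw [← hxy c i (by omega), ← hxy c j hj]; exact h1.1 c i j hij hj
  · rw [← hxy c i hi]; exact h1.2 c i hi
  · simp only [hat₀]
    split_ifs with h
    · exact hxy c i h
    · rw [hxy c _ (by omega)]
  · exact add_le_add (mul_le_mul_of_nonneg_left (h1.1 c i j hij hj) ha)
      (mul_le_mul_of_nonneg_left (g1.1 c i j hij hj) hb)
  · exact add_nonneg (mul_nonneg ha (h1.2 c i hi)) (mul_nonneg hb (g1.2 c i hi))
  · simp only [hat₀]; split_ifs <;> ring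
  · simp [hat₀]
  · simp
  · obtain ⟨h1, h2⟩ := hA.tight hx hS ht
    have hle := hA.le
    obtain ⟨h3, h4⟩ := ih (n - r) (by omega) (hx.res (fun c => freeLow_sub n _) hA.card_low) h2
    exact ⟨hx, (symLR₀_iff hx).1 (hA.symLR₀_of_tight h1 h3), hA.nlq_of_tight hx h1 h4⟩

theorem exists_rigid_of_not_nlq {n : ℕ} {x : Bdry} (hx : DecPos n x) (h : ¬ NLQ n x) :
    ∃ r A, IsQ n r A ∧ RigidLR r (bd2 n r A) ∧ RigidLR r (bd0 n r A) ∧ evS A (hat n x) < 0 := by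
  obtain ⟨r, A, -, h1⟩ := facet (fun m _ x hx h => (SymLR.decompose hx h).1) hx
    fun hS => h (SymLR.decompose hx hS).2
  exact ⟨r, A, h1⟩

/-! ### Validity of the symmetric inequalities -/

theorem av_of_mem {f : ℕ → ℚ} {m : ℕ} {u : ℚ} (h1 : (m : ℚ) ≤ u) (h2 : u ≤ m + 1) :
    av f u = ((m : ℚ) + 1 - u) * f m + (u - m) * f (m + 1) := by
  rcases h2.eq_or_lt with rfl | h2
  · have : ((m : ℚ) + 1) = ((m + 1 : ℕ) : ℚ) := by push_cast; ring
    rw [this, av_natCast]; push_cast; ring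
  · have : ⌊u⌋₊ = m := (Nat.floor_eq_iff ((Nat.cast_nonneg m).trans h1)).2 ⟨h1, h2⟩
    rw [av, this]

theorem av_reflect (g : ℕ → ℚ) {N : ℕ} {u : ℚ} (h0 : 0 ≤ u) (hN : u + 1 ≤ N) :
    av (fun i => - g (N - 1 - i)) u = - av g ((N : ℚ) - 1 - u) := by
  obtain ⟨m, hm1, hm2⟩ : ∃ m : ℕ, (m : ℚ) ≤ u ∧ u < m + 1 :=
    ⟨⌊u⌋₊, Nat.floor_le h0, Nat.lt_floor_add_one u⟩
  rcases hm1.eq_or_lt with rfl | hlt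
  · have hmN : m + 1 ≤ N := by exact_mod_cast hN
    rw [show (N : ℚ) - 1 - m = ((N - 1 - m : ℕ) : ℚ) by
      rw [Nat.cast_sub (by omega), Nat.cast_sub (by omega)]; simp, av_natCast, av_natCast]
  · have hmN : m + 1 < N := by
      have : ((m + 1 : ℕ) : ℚ) < N := by push_cast; linarith
      exact_mod_cast this
    obtain ⟨d, rfl⟩ := Nat.exists_eq_add_of_lt hmN
    push_cast at *
    rw [av_of_mem hm1 hm2.le, av_of_mem (m := d) (by linarith) (by linarith),
      show m + 1 + d - m = d + 1 by omega, show m + 1 + d - (m + 1) = d by omega]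
    ring

/-- Extension by zeros. -/
def padZ (n : ℕ) (u : ℕ → ℚ) (i : ℕ) : ℚ := if i < n then u i else 0

theorem ms_padZ {n N : ℕ} (h : n ≤ N) (u : ℕ → ℚ) :
    ms N (padZ n u) = ms n u + Multiset.replicate (N - n) 0 := by
  conv_lhs => rw [← Nat.add_sub_cancel' h, ms_add]
  rw [← ms_const]
  exact congrArg₂ _ (ms_congr fun i hi => if_pos hi) (ms_congr fun i _ => if_neg (by omega))

theorem dec_padZ {n N : ℕ} {u : ℕ → ℚ} (h : Dec1 n u) (h0 : ∀ i < n, 0 ≤ u i) : Dec1 N (padZ n u) := by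
  intro i j hij _
  simp only [padZ]
  split_ifs
  · exact h i j hij (by omega)
  · omega
  · exact h0 i (by omega)
  · exact le_rfl

theorem NLQ.pad {n : ℕ} {x : Bdry} (hx : DecPos n x) (h : NLQ n x) :
    ∃ y : Bdry, (∀ c i, n ≤ i → y c i = 0) ∧ ∀ N, n ≤ N → ∀ k,
      LR N (fun c i => if c = k then - padZ n (x k) (N - 1 - i) else y (-k - c) i) := by
  obtain ⟨y, h0, h1⟩ := h
  refine ⟨fun c => padZ n (y c), fun c i hi => if_neg (by omega), fun N hN k =>
    ((h1 k).lrm.add (LRM.const (N - n) (s := fun _ => 0) (by simp))).lr (fun c => ?_) fun c => ?_⟩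
  · split_ifs with hc
    · exact fun i j hij hj => neg_le_neg (dec_padZ (hx.1 k) (hx.2 k) (N := N) _ _ (by omega) (by omega))
    · refine dec_padZ (fun i j hij hj => ?_) (h0 _)
      have := (h1 k).dec c i j hij hj
      simpa only [if_neg hc] using this
  · split_ifs with hc
    · rw [ms_rev N (fun i => - padZ n (x k) i), ms_rev n (fun i => - x k i)]
      have := congrArg (Multiset.map Neg.neg) (ms_padZ hN (x k))
      rw [Multiset.map_add, map_ms, map_ms, Multiset.map_replicate, neg_zero] at this
      exact this
    · exact ms_padZ hN _

theorem IsQ.valid_of_nlq {n r : ℕ} {A : Triple} (h : IsQ n r A) {x : Bdry}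
    (hx : DecPos n x) (hN : NLQ n x) : 0 ≤ evS A (hat n x) := by
  rcases Nat.eq_zero_or_pos r with rfl | hr
  · have : ∀ c, A c = ∅ := fun c => card_eq_zero.1 (h.card c)
    simp [evS, this]
  have hrn := h.le
  obtain ⟨y, hy0, hW⟩ := hN.pad hx
  set a : Fin 3 → ℕ := fun c => bef (A c) n with ha
  have hsum : ∑ c, a c = 2 * r := (h.signed hx).sum
  have hle : ∀ c, a c ≤ r := (h.signed hx).le
  set nt : Fin 3 → ℕ → ℕ := fun c l => nthSmall (A c) l with hnt
  have hntl : ∀ c l, l < a c → nt c l < n := fun c l hl =>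
    (nthSmall_lt_iff_bef (by rw [h.card]; exact lt_of_lt_of_le hl (hle c))).2 hl
  have hntg : ∀ c l, a c ≤ l → l < r → n < nt c l ∧ nt c l ≤ 2 * n := fun c l hl hlr => by
    have h1 := (h.lt_low c hlr).not.1 (not_lt.2 hl)
    have h2 := mem_range.1 (h.sub c (nthSmall_mem (s := A c) (k := l) (by rw [h.card]; exact hlr)))
    exact ⟨not_not.1 h1, by simp only [hnt]; omega⟩
  let p : Bdry := fun c l => if l < a c then (n : ℚ) + l - nt c l else (l : ℚ) + 1 - r - nt c l
  have hp : LR r p := by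
    have hv : (0 : ℚ) ≤ n - (2 * n + 1 - r) / 3 := by
      have h1 : (1 : ℚ) ≤ r := by exact_mod_cast hr
      have h2 : (0 : ℚ) ≤ n := Nat.cast_nonneg n
      linarith
    refine (h.lr_setBd.add ((h.signed hx).lr_step.smul hv)).congr fun c l hl => ?_
    simp only [setBd, p, hnt, ha]
    push_cast
    split_ifs <;> ring
  have hsp : Signed r a p := by
    refine ⟨hle, hsum, fun c i hi => ?_, fun c i hi hir => ?_⟩
    · have : (nt c i : ℚ) < n := by exact_mod_cast hntl c i hi
      have : (0 : ℚ) ≤ i := Nat.cast_nonneg i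
      simp only [p, if_pos hi]; linarith
    · have h1 : ((i + 1 : ℕ) : ℚ) ≤ r := by exact_mod_cast hir
      have h2 : (0 : ℚ) ≤ nt c i := Nat.cast_nonneg _
      push_cast at h1
      simp only [p, if_neg (not_lt.2 hi)]; linarith
  obtain ⟨σ, hσ0, hU, hL⟩ := hsp.ann hp
  have hσn : ∀ j k, j ≠ k → ∀ l < r - a k, σ j k l ≤ n := by
    intro j k hjk l hl
    have e1 := hsp.split (k := j) (c := k) hjk.symm
    have h1 := (hL j).weyl (s := fun c => if c = k then a j - 1 - l else 0) (by simp; omega)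
    rw [sum_eq_add_sum_sdiff_singleton_of_mem (mem_univ k), ] at h1
    simp only [if_true, if_neg hjk.symm] at h1
    rw [if_neg (by omega), show a j - 1 - (a j - 1 - l) = l by omega] at h1
    have h2 : ∑ c ∈ univ \ {k}, (if c = j then p j (if c = k then a j - 1 - l else 0) else
        if (if c = k then a j - 1 - l else 0) < r - a (-j - c) then 0
        else - σ j c (a j - 1 - (if c = k then a j - 1 - l else 0))) ≤
        ∑ c ∈ univ \ {k}, if c = j then (n : ℚ) else 0 := by
      refine sum_le_sum fun c hc => ?_
      have hck : c ≠ k := by simpa using hc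
      simp only [if_neg hck]
      split_ifs with h3 h4
      · simp only [p]
        rw [if_pos (by omega)]
        have : (0 : ℚ) ≤ nt j 0 := Nat.cast_nonneg _
        push_cast; linarith
      · rfl
      · have := hsp.split (k := j) (c := c) h3
        have := hσ0 j c (a j - 1 - 0) (Ne.symm h3) (by omega)
        linarith
    rw [sum_ite_eq', if_pos (by simp [hjk])] at h2
    linarith
  let T : Fin 3 → Fin 3 → ℚ := fun j k => ∑ l ∈ range (r - a k), av (y (-k - j)) (l + n - σ j k l)
  have hcomm : ∀ k j : Fin 3, -j - k = -k - j := by decide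
  have U : ∀ k, 0 ≤ ∑ c, if c = k then - ∑ l ∈ range (r - a k), x k (2 * n - nt k (a k + l))
      else T c k := by
    intro k
    have hrk := hle k
    have h1 := validity_av (N := n + (r - a k)) (UpLR.of_LR (hW _ (by omega) k)) (hU k)
      (s := fun c => if c = k then -(n : ℚ) else n)
      (by
        rw [sum_cyc _ k]
        have hc1 : k + 1 ≠ k := by fin_cases k <;> decide
        have hc2 : k + 2 ≠ k := by fin_cases k <;> decide
        simp only [if_true, hc1, hc2, if_false]; push_cast; ring)
      (fun hk c => by
        split_ifs with hc
        · have h2 := (hntg k (a k + 0) (by omega) (by omega)).1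
          have h3 : ((n + 1 : ℕ) : ℚ) ≤ nt k (a k + 0) := by exact_mod_cast h2
          have h4 : (a k : ℚ) ≤ r := by exact_mod_cast hrk
          simp only [p]
          rw [if_neg (by omega)]
          push_cast at h3 ⊢
          linarith
        · exact hσn c k hc 0 hk)
    refine h1.trans_eq (sum_congr rfl fun c _ => ?_)
    split_ifs with hc
    · rw [← sum_neg_distrib]
      refine sum_congr rfl fun l hl => ?_
      have hl := mem_range.1 hl
      obtain ⟨h2, h3⟩ := hntg k (a k + l) (by omega) (by omega)
      have h4 : (l : ℚ) + -n - p k (a k + l) = ((nt k (a k + l) - n - 1 + (r - a k) : ℕ) : ℚ) := by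
        simp only [p]
        rw [if_neg (by omega)]
        push_cast [Nat.cast_sub hrk, Nat.cast_sub (show 1 ≤ nt k (a k + l) - n by omega),
          Nat.cast_sub h2.le]
        ring
      rw [h4, av_natCast, padZ, if_pos (by omega),
        show n + (r - a k) - 1 - (nt k (a k + l) - n - 1 + (r - a k)) = 2 * n - nt k (a k + l) by omega]
    · rfl
  have V : ∀ k, 0 ≤ ∑ c, if c = k then ∑ l ∈ range (a k), x k (nt k l) else - T k c := by
    intro k
    have h1 := validity_av (N := n + a k) (UpLR.of_LR (hW _ (by omega) k).neg_rev) (hL k)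
      (s := fun c => if c = k then (n : ℚ) else 0) (by simp)
      (fun hk c => by
        split_ifs with hc h2
        · have : (0 : ℚ) ≤ nt k 0 := Nat.cast_nonneg _
          simp only [p]
          rw [if_pos hk]
          push_cast; linarith
        · rfl
        · have := hsp.split (k := k) (c := c) hc
          have := hσ0 k c (a k - 1 - 0) (Ne.symm hc) (by omega)
          linarith)
    refine h1.trans_eq (sum_congr rfl fun c _ => ?_)
    split_ifs with hc
    · refine sum_congr rfl fun l hl => ?_
      have hl := mem_range.1 hl
      have h4 : (l : ℚ) + n - p k l = (nt k l : ℕ) := by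
        simp only [p, if_pos hl]; ring
      rw [h4, av_natCast, neg_neg, padZ]
      have := hntl k l hl
      rw [show n + a k - 1 - (n + a k - 1 - nt k l) = nt k l by omega, if_pos this]
    · have e1 := hsp.split (k := k) (c := c) hc
      have h2 : ∑ l ∈ range (a k), av (fun i => - y (-k - c) (n + a k - 1 - i))
          ((l : ℚ) + 0 - if l < r - a (-k - c) then 0 else - σ k c (a k - 1 - l)) =
          ∑ l ∈ range (r - a c), - av (y (-k - c))
            (((r - a c - 1 - l : ℕ) : ℚ) + n - σ k c (r - a c - 1 - l)) := by
        conv_lhs => rw [show range (a k) = range ((r - a (-k - c)) + (r - a c)) by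
          rw [← e1]]
        rw [sum_range_add, sum_eq_zero, zero_add]
        · refine sum_congr rfl fun l hl => ?_
          have hl := mem_range.1 hl
          have h3 : a k - 1 - (r - a (-k - c) + l) = r - a c - 1 - l := by omega
          have h4 := hσ0 k c (r - a c - 1 - l) (Ne.symm hc) (by omega)
          have h5 := hσn k c (Ne.symm hc) (r - a c - 1 - l) (by omega)
          have h6 : ((r - a (-k - c) + l : ℕ) : ℚ) + 1 ≤ a k := by
            exact_mod_cast (show r - a (-k - c) + l + 1 ≤ a k by omega)
          have h7 : (0 : ℚ) ≤ (r - a (-k - c) + l : ℕ) := Nat.cast_nonneg _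
          rw [if_neg (by omega), h3, av_reflect _ (by linarith) (by push_cast at h6 ⊢; linarith)]
          have h8 : ((r - a c - 1 - l : ℕ) : ℚ) = (a k : ℚ) - 1 - (r - a (-k - c) + l : ℕ) := by
            rw [← h3, Nat.cast_sub (by omega), Nat.cast_sub (by omega)]; simp
          rw [h8]
          congr 2
          push_cast; ring
        · intro l hl
          have hl := mem_range.1 hl
          rw [if_pos hl, add_zero, sub_zero, av_natCast, hy0 _ _ (by omega), neg_zero]
      have h3 := sum_range_reflect (fun l => - av (y (-k - c)) ((l : ℚ) + n - σ k c l)) (r - a c)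
      rw [h3, sum_neg_distrib] at h2
      simp only [T, hcomm k c]
      exact h2
  have hev : evS A (hat n x) = ∑ k, (∑ l ∈ range (a k), x k (nt k l) -
      ∑ l ∈ range (r - a k), x k (2 * n - nt k (a k + l))) := by
    rw [← trace_res h.card]
    refine sum_congr rfl fun k _ => ?_
    conv_lhs => rw [← Nat.add_sub_cancel' (hle k)]
    rw [sum_range_add, sub_eq_add_neg, ← sum_neg_distrib]
    congr 1 <;> refine sum_congr rfl fun l hl => ?_ <;> have hl := mem_range.1 hl
    · exact if_pos (hntl k l hl)
    · have := hntg k (a k + l) (by omega) (by omega)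
      simp only [res, hat]
      rw [if_neg (by simp only [hnt] at this; omega), if_neg (by simp only [hnt] at this; omega)]
  rw [hev]
  have u0 := U 0; have u1 := U 1; have u2 := U 2
  have v0 := V 0; have v1 := V 1; have v2 := V 2
  simp only [Fin.sum_univ_three, Fin.isValue, show (0 : Fin 3) ≠ 1 by decide, show (0 : Fin 3) ≠ 2 by decide,
    show (1 : Fin 3) ≠ 0 by decide, show (1 : Fin 3) ≠ 2 by decide, show (2 : Fin 3) ≠ 0 by decide,
    show (2 : Fin 3) ≠ 1 by decide, if_true, if_false] at u0 u1 u2 v0 v1 v2 ⊢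
  linarith

/-! ### Littlewood–Richardson tableaux and integral hives -/

/-- The row patterns of Littlewood–Richardson tableaux with `r` rows: `b i k` is the column where
the entries larger than `k` of row `i` start. -/
structure IsPat (r : ℕ) (lam mu nu : ℕ → ℕ) (b : ℕ → ℕ → ℕ) : Prop where
  zero : ∀ i, b i 0 = lam i
  mono : ∀ i, Monotone (b i)
  le : ∀ i k, b i k ≤ nu i
  top : ∀ i, ∃ k, b i k = nu i
  col : ∀ i k, b (i + 1) (k + 1) ≤ b i k
  ball : ∀ i k, ∑ j ∈ range (i + 1), (b j (k + 2) - b j (k + 1)) ≤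
    ∑ j ∈ range i, (b j (k + 1) - b j k)
  content : ∀ k, ∑ j ∈ range r, (b j (k + 1) - b j k) = mu k

theorem ncard_rows (b : ℕ → ℕ → ℕ) (i k : ℕ) :
    ({p : ℕ × ℕ | p.1 < i ∧ b p.1 k ≤ p.2 ∧ p.2 < b p.1 (k + 1)}).Finite ∧
    {p : ℕ × ℕ | p.1 < i ∧ b p.1 k ≤ p.2 ∧ p.2 < b p.1 (k + 1)}.ncard =
      ∑ j ∈ range i, (b j (k + 1) - b j k) := by
  have : {p : ℕ × ℕ | p.1 < i ∧ b p.1 k ≤ p.2 ∧ p.2 < b p.1 (k + 1)} = Equiv.sigmaEquivProd ℕ ℕ ''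
      ((range i).sigma fun j => Ico (b j k) (b j (k + 1))) := by
    ext ⟨j, l⟩
    simp [Equiv.sigmaEquivProd]
  rw [this]
  refine ⟨(finite_toSet _).image _, ?_⟩
  rw [Set.ncard_image_of_injective _ (Equiv.injective _), Set.ncard_coe_finset, card_sigma]
  simp

/-- The relation between a tableau and its row pattern. -/
def RowRel (lam nu : ℕ → ℕ) (T b : ℕ → ℕ → ℕ) : Prop :=
  ∀ i j k, InSkew lam nu i j ∧ T i j = k + 1 ↔ b i k ≤ j ∧ j < b i (k + 1)

section Tableau

variable {r : ℕ} {lam mu nu : ℕ → ℕ} {T b : ℕ → ℕ → ℕ}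

theorem rowRel_of (h0 : ∀ i k, lam i ≤ b i k) (hle : ∀ i k, b i k ≤ nu i)
    (h : ∀ i j k, InSkew lam nu i j → (T i j ≤ k ↔ j < b i k)) : RowRel lam nu T b := by
  intro i j k
  constructor
  · rintro ⟨hj, hT⟩
    have h2 := h i j k hj
    have h3 := h i j (k + 1) hj
    omega
  · rintro ⟨h2, h3⟩
    have hj : InSkew lam nu i j := ⟨(h0 i k).trans h2, lt_of_lt_of_le h3 (hle _ _)⟩
    have h4 := h i j k hj
    have h5 := h i j (k + 1) hj
    exact ⟨hj, by omega⟩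

theorem RowRel.setOf_eq (h : RowRel lam nu T b) (hr : ∀ i, r ≤ i → nu i = 0) (k : ℕ) :
    {p : ℕ × ℕ | InSkew lam nu p.1 p.2 ∧ T p.1 p.2 = k + 1} =
      {p | p.1 < r ∧ b p.1 k ≤ p.2 ∧ p.2 < b p.1 (k + 1)} := by
  ext ⟨i, j⟩
  refine ⟨fun h' => ⟨?_, (h i j k).1 h'⟩, fun h' => (h i j k).2 h'.2⟩
  by_contra hi
  have h1 := h'.1.2
  simp only [hr i (not_lt.1 hi)] at h1
  omega

theorem IsLRTableau.exists_pat (h : IsLRTableau lam mu nu T) (hr : ∀ i, r ≤ i → nu i = 0) :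
    ∃ b, IsPat r lam mu nu b ∧ RowRel lam nu T b := by
  obtain ⟨hl, hm, hn, hln, h0, h1, hrow, hcol, hcont, hball⟩ := h
  let b : ℕ → ℕ → ℕ := fun i k => lam i + ((Ico (lam i) (nu i)).filter (T i · ≤ k)).card
  have hle : ∀ i k, b i k ≤ nu i := fun i k => by
    have := card_filter_le (Ico (lam i) (nu i)) (T i · ≤ k)
    rw [Nat.card_Ico] at this
    have := hln i
    simp only [b]; omega
  have hiff : ∀ i j k, InSkew lam nu i j → (T i j ≤ k ↔ j < b i k) := by
    intro i j k hj
    constructor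
    · intro hk
      have : Ico (lam i) (j + 1) ⊆ (Ico (lam i) (nu i)).filter (T i · ≤ k) := fun l hl => by
        have hl := mem_Ico.1 hl
        have hj2 := hj.2
        refine mem_filter.2 ⟨mem_Ico.2 ⟨hl.1, by omega⟩, le_trans ?_ hk⟩
        exact hrow i l j ⟨hl.1, by omega⟩ hj (by omega)
      have := card_le_card this
      rw [Nat.card_Ico] at this
      simp only [b]; omega
    · intro hk
      by_contra hcon
      have : (Ico (lam i) (nu i)).filter (T i · ≤ k) ⊆ Ico (lam i) j := fun l hl => by
        obtain ⟨hl, hlk⟩ := mem_filter.1 hl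
        have hl := mem_Ico.1 hl
        refine mem_Ico.2 ⟨hl.1, ?_⟩
        by_contra hlj
        exact hcon ((hrow i j l hj hl (by omega)).trans hlk)
      have := card_le_card this
      rw [Nat.card_Ico] at this
      have := hj.1
      simp only [b] at hk; omega
  have hmono : ∀ i, Monotone (b i) := fun i k k' hk => Nat.add_le_add_left (card_le_card
    (monotone_filter_right _ fun l _ h => le_trans h hk)) _
  have hrel : RowRel lam nu T b := rowRel_of (fun _ _ => Nat.le_add_right _ _) hle hiff
  have hlt : ∀ i k, b i (k + 1) < b i (k + 2) → ∑ j ∈ range (i + 1),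
      (b j (k + 2) - b j (k + 1)) ≤ ∑ j ∈ range i, (b j (k + 1) - b j k) := by
    intro i k hlt
    obtain ⟨hq, hT⟩ := (hrel i (b i (k + 1)) (k + 1)).2 ⟨le_rfl, hlt⟩
    have h2 := hball k (i, b i (k + 1)) hq hT
    rw [← (ncard_rows b _ _).2, ← (ncard_rows b _ _).2]
    refine (Set.ncard_le_ncard ?_ ((ncard_rows b (i + 1) (k + 1)).1.subset ?_)).trans
      (h2.trans (Set.ncard_le_ncard ?_ (ncard_rows b _ _).1))
    · rintro ⟨i', j⟩ ⟨hi, hj⟩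
      obtain ⟨hs, hT⟩ := (hrel i' j (k + 1)).2 hj
      refine ⟨hs, hT, ?_⟩
      rcases Nat.lt_succ_iff_lt_or_eq.1 hi with h | rfl
      · exact Or.inl h
      · exact Or.inr ⟨rfl, hj.1⟩
    · rintro ⟨i', j⟩ ⟨hs, hT, hR⟩
      have hR : i' < i ∨ (i' = i ∧ _) := hR
      exact ⟨by simp only; omega, (hrel i' j (k + 1)).1 ⟨hs, hT⟩⟩
    · rintro ⟨i', j⟩ ⟨hs, hT, hR⟩
      have h3 := (hrel i' j k).1 ⟨hs, hT⟩
      rcases hR with hR | hR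
      · exact ⟨hR, h3⟩
      · obtain ⟨rfl, hR⟩ : i' = i ∧ b i (k + 1) ≤ j := hR
        exact absurd h3.2 (by omega)
  have hball' : ∀ i k, ∑ j ∈ range (i + 1), (b j (k + 2) - b j (k + 1)) ≤
      ∑ j ∈ range i, (b j (k + 1) - b j k) := by
    intro i k
    rcases (hmono i (show k + 1 ≤ k + 2 by omega)).eq_or_lt with heq | h
    · rw [sum_range_succ, heq, Nat.sub_self, add_zero]
      induction i with
      | zero => simp
      | succ i ih =>
        rcases (hmono i (show k + 1 ≤ k + 2 by omega)).eq_or_lt with heq | h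
        · rw [sum_range_succ, heq, Nat.sub_self, add_zero]
          exact (ih heq).trans (sum_le_sum_of_subset (range_mono (Nat.le_succ i)))
        · exact (hlt i k h).trans (sum_le_sum_of_subset (range_mono (Nat.le_succ i)))
    · exact hlt i k h
  refine ⟨b, ⟨fun i => ?_, hmono, hle, fun i => ?_, fun i k => ?_, hball', fun k => ?_⟩, hrel⟩
  · refine Nat.add_eq_left.2 (card_eq_zero.2 (filter_eq_empty_iff.2 fun j hj => ?_))
    have := h1 i j (mem_Ico.1 hj)
    omega
  · refine ⟨(Ico (lam i) (nu i)).sup (T i), ?_⟩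
    have := hln i
    simp only [b]
    rw [filter_true_of_mem fun j hj => le_sup (f := T i) hj, Nat.card_Ico]
    omega
  · by_contra hcon
    have e1 := hle (i + 1) (k + 1)
    have e2 := hn.1 i (i + 1) (by omega)
    have e3 := hl.1 i (i + 1) (by omega)
    have e4 : lam i ≤ b i k := Nat.le_add_right _ _
    have s1 : InSkew lam nu i (b i k) := ⟨e4, by omega⟩
    have s2 : InSkew lam nu (i + 1) (b i k) := ⟨by omega, by omega⟩
    have t1 := (hiff _ _ (k + 1) s2).2 (by omega)
    have t2 := hcol i (i + 1) _ s1 s2 (by omega)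
    exact lt_irrefl _ ((hiff _ _ k s1).1 (by omega))
  · rw [← (ncard_rows b _ _).2, ← hcont k]
    rw [hrel.setOf_eq hr]

theorem IsPat.antitone (h : IsPat r lam mu nu b) {i i' : ℕ} (hi : i ≤ i') (k : ℕ) : b i' k ≤ b i k := by
  induction i', hi using Nat.le_induction with
  | base => exact le_rfl
  | succ m _ ih => exact ((h.mono _ (Nat.le_succ k)).trans (h.col m k)).trans ih

theorem IsPat.top_of_lt (h : IsPat r lam mu nu b) {i k : ℕ} (hk : i < k) : b i k = nu i := by
  have hC : ∀ i k, i ≤ k → ∑ j ∈ range i, (b j (k + 1) - b j k) = 0 := by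
    intro i
    induction i with
    | zero => simp
    | succ i ih =>
      rintro (- | k) hk
      · omega
      · exact Nat.le_zero.1 ((h.ball i k).trans_eq (ih k (by omega)))
  have hstep : ∀ m, i < m → b i (m + 1) = b i m := fun m hm => by
    have h1 := sum_eq_zero_iff.1 (hC (i + 1) m hm) i (by simp)
    have h2 := h.mono i (Nat.le_succ m)
    simp only [Nat.succ_eq_add_one] at h2
    omega
  obtain ⟨m, hm⟩ := h.top i
  have hcst : ∀ m, k ≤ m → b i m = b i k := fun m hm => by
    induction m, hm using Nat.le_induction with
    | base => rfl
    | succ m hm ih => rw [hstep m (by omega), ih]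
  refine le_antisymm (h.le i k) ?_
  rw [← hcst (max k m) (le_max_left _ _), ← hm]
  exact h.mono i (le_max_right _ _)

theorem IsPat.exists_tableau (h : IsPat r lam mu nu b) (hl : IsPartition lam) (hm : IsPartition mu)
    (hn : IsPartition nu) (hr : ∀ i, r ≤ i → nu i = 0) : ∃ T, IsLRTableau lam mu nu T := by
  classical
  have hex : ∀ i j, InSkew lam nu i j → ∃ k, j < b i k := fun i j hj => by
    obtain ⟨k, hk⟩ := h.top i
    exact ⟨k, hk ▸ hj.2⟩
  let T : ℕ → ℕ → ℕ := fun i j => if hj : InSkew lam nu i j then Nat.find (hex i j hj) else 0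
  have hiff : ∀ i j k, InSkew lam nu i j → (T i j ≤ k ↔ j < b i k) := fun i j k hj => by
    simp only [T, dif_pos hj, Nat.find_le_iff]
    exact ⟨fun ⟨m, hm, hjm⟩ => hjm.trans_le (h.mono i hm), fun hk => ⟨k, le_rfl, hk⟩⟩
  have hrel : RowRel lam nu T b :=
    rowRel_of (fun i k => h.zero i ▸ h.mono i (Nat.zero_le k)) h.le hiff
  have hpos : ∀ i j, InSkew lam nu i j → 1 ≤ T i j := fun i j hj => by
    have h2 := hiff i j 0 hj
    rw [h.zero] at h2
    have := hj.1
    omega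
  refine ⟨T, hl, hm, hn, fun i => h.zero i ▸ h.le i 0, fun i j hj => dif_neg hj, hpos,
    fun i j j' hj hj' hjj => ?_, fun i i' j hj hj' hii => ?_, fun k => ?_, fun k q hq hT => ?_⟩
  · exact (hiff _ _ _ hj).2 (hjj.trans_lt ((hiff _ _ _ hj').1 le_rfl))
  · have h1 := hpos i' j hj'
    have h2 := (hiff i' j (T i' j - 1 + 1) hj').1 (by omega)
    have h3 := (hiff i j (T i' j - 1) hj).2
      (h2.trans_le ((h.antitone (Nat.succ_le_of_lt hii) _).trans (h.col i _)))
    omega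
  · rw [← h.content k, ← (ncard_rows b _ _).2]
    rw [hrel.setOf_eq hr]
  · refine le_trans ?_ ((h.ball q.1 k).trans ?_)
    · rw [← (ncard_rows b _ _).2]
      refine Set.ncard_le_ncard ?_ (ncard_rows b _ _).1
      rintro ⟨i', j⟩ ⟨hs, hT, hR⟩
      have hR : i' < q.1 ∨ (i' = q.1 ∧ _) := hR
      exact ⟨by simp only; omega, (hrel i' j (k + 1)).1 ⟨hs, hT⟩⟩
    · rw [← (ncard_rows b _ _).2]
      refine Set.ncard_le_ncard ?_ ((ncard_rows b (q.1 + 1) k).1.subset ?_)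
      · rintro ⟨i', j⟩ ⟨hi, hj⟩
        obtain ⟨hs, hT⟩ := (hrel i' j k).2 hj
        exact ⟨hs, hT, Or.inl hi⟩
      · rintro ⟨i', j⟩ ⟨hs, hT, hR⟩
        have hR : i' < q.1 ∨ (i' = q.1 ∧ _) := hR
        exact ⟨by simp only; omega, (hrel i' j k).1 ⟨hs, hT⟩⟩

end Tableau

/-- The point of the triangle of size `s` in row `i` and position `k`. -/
def pt (s i k : ℕ) : Pt := ![s - i, i - k, k]

theorem pt_add_e0 {s i : ℕ} (k : ℕ) (hi : i ≤ s) : pt s i k + e 0 = pt (s + 1) i k := by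
  funext a; fin_cases a <;> simp [pt, e]; omega

theorem pt_add_e1 {i k : ℕ} (s : ℕ) (hk : k ≤ i) : pt s i k + e 1 = pt (s + 1) (i + 1) k := by
  funext a; fin_cases a <;> simp [pt, e]; omega

theorem pt_add_e2 (s i k : ℕ) : pt s i k + e 2 = pt (s + 1) (i + 1) (k + 1) := by
  funext a; fin_cases a <;> simp [pt, e]

theorem wt_pt {s i k : ℕ} (hk : k ≤ i) (hi : i ≤ s) : wt (pt s i k) = s := by
  simp [wt, pt]; omega

theorem exists_pt {w : Pt} {s : ℕ} (hw : wt w = s) : ∃ i k, k ≤ i ∧ i ≤ s ∧ w = pt s i k := by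
  rw [wt] at hw
  refine ⟨s - w 0, w 2, by omega, by omega, ?_⟩
  funext a; fin_cases a <;> simp [pt] <;> omega

theorem sd_zero (j l : ℕ) : sd 0 j l = pt (j + l) (j + l) l := by
  funext a; fin_cases a <;> simp [sd, pt]

theorem sd_one (j l : ℕ) : sd 1 j l = pt (j + l) j j := by
  funext a; fin_cases a <;> simp [sd, pt]

theorem sd_two (j l : ℕ) : sd 2 j l = pt (j + l) l 0 := by
  funext a; fin_cases a <;> simp [sd, pt]

/-- The boundary of the hives counted by a Littlewood–Richardson coefficient. -/
def lrBd (r : ℕ) (lam mu nu : ℕ → ℕ) : Fin 3 → ℕ → ℤ :=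
  ![fun i => mu i, fun i => - nu (r - 1 - i), fun i => lam i]

/-- The hive of a pattern. -/
def patHive (r : ℕ) (b : ℕ → ℕ → ℕ) (p : Pt) : ℤ := ∑ j ∈ range (r - p 0), (b j (p 2) : ℤ)

theorem patHive_pt {r i : ℕ} (b : ℕ → ℕ → ℕ) (k : ℕ) (hi : i ≤ r) :
    patHive r b (pt r i k) = ∑ j ∈ range i, (b j k : ℤ) := by
  simp [patHive, pt, Nat.sub_sub_self hi]

section Hive

variable {r : ℕ} {lam mu nu : ℕ → ℕ} {b : ℕ → ℕ → ℕ}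

theorem IsPat.sum_sub (h : IsPat r lam mu nu b) (i k : ℕ) :
    ((∑ j ∈ range i, (b j (k + 1) - b j k) : ℕ) : ℤ) =
      ∑ j ∈ range i, (b j (k + 1) : ℤ) - ∑ j ∈ range i, (b j k : ℤ) := by
  rw [Nat.cast_sum, ← sum_sub_distrib]
  exact sum_congr rfl fun j _ => Nat.cast_sub (h.mono j (Nat.le_succ k))

theorem IsPat.isHive (h : IsPat r lam mu nu b) : IsHive r (patHive r b) := by
  refine isHive_of_rhombus fun w c hw => ?_
  obtain ⟨s, rfl⟩ := Nat.exists_eq_add_of_le' (show 2 ≤ r by omega)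
  obtain ⟨i, k, hk, hi, rfl⟩ := exists_pt (w := w) (s := s) (by omega)
  have h1 := h.col i k
  have h2 := h.mono (i + 1) (Nat.le_succ k)
  have h3 := h.ball (i + 1) k
  have e1 := h.sum_sub (i + 1) k
  have e2 := h.sum_sub (i + 1 + 1) (k + 1)
  fin_cases c
  · change patHive _ b (pt s i k + e 0 + e 0) + patHive _ b (pt s i k + e 1 + e 2) ≤
      patHive _ b (pt s i k + e 0 + e 1) + patHive _ b (pt s i k + e 0 + e 2)
    rw [pt_add_e0 _ hi, pt_add_e0 _ (by omega), pt_add_e1 _ hk, pt_add_e2, pt_add_e1 _ hk, pt_add_e2,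
      patHive_pt _ _ (by omega), patHive_pt _ _ (by omega), patHive_pt _ _ (by omega),
      patHive_pt _ _ (by omega)]
    simp only [sum_range_succ]
    have : (b (i + 1) (k + 1) : ℤ) ≤ b i k := by exact_mod_cast h1
    linarith
  · change patHive _ b (pt s i k + e 1 + e 1) + patHive _ b (pt s i k + e 2 + e 0) ≤
      patHive _ b (pt s i k + e 1 + e 2) + patHive _ b (pt s i k + e 1 + e 0)
    rw [pt_add_e1 _ hk, pt_add_e1 _ (by omega), pt_add_e2, pt_add_e0 _ (by omega), pt_add_e2,
      pt_add_e0 _ (by omega), patHive_pt _ _ (by omega), patHive_pt _ _ (by omega),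
      patHive_pt _ _ (by omega), patHive_pt _ _ (by omega)]
    simp only [sum_range_succ]
    have : (b (i + 1) k : ℤ) ≤ b (i + 1) (k + 1) := by exact_mod_cast h2
    linarith
  · change patHive _ b (pt s i k + e 2 + e 2) + patHive _ b (pt s i k + e 0 + e 1) ≤
      patHive _ b (pt s i k + e 2 + e 0) + patHive _ b (pt s i k + e 2 + e 1)
    rw [pt_add_e0 _ hi, pt_add_e1 _ hk, pt_add_e2, pt_add_e2, pt_add_e0 _ (by omega),
      pt_add_e1 _ (by omega), patHive_pt _ _ (by omega), patHive_pt _ _ (by omega),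
      patHive_pt _ _ (by omega), patHive_pt _ _ (by omega)]
    have h4 : ((∑ j ∈ range (i + 1 + 1), (b j (k + 2) - b j (k + 1)) : ℕ) : ℤ) ≤
      (∑ j ∈ range (i + 1), (b j (k + 1) - b j k) : ℕ) := by exact_mod_cast h3
    rw [e1] at h4
    have h5 := e2.symm.trans_le h4
    linarith

theorem IsPat.hasBd (h : IsPat r lam mu nu b) : HasBd r (patHive r b) (lrBd r lam mu nu) := by
  intro c j l hj
  subst hj
  fin_cases c
  · change patHive _ b (sd 0 j (l + 1)) - patHive _ b (sd 0 (j + 1) l) = (mu l : ℤ)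
    rw [sd_zero, sd_zero, show j + 1 + l = j + (l + 1) by ring, ← add_assoc, patHive_pt _ _ le_rfl,
      patHive_pt _ _ le_rfl, ← h.sum_sub, h.content]
  · change patHive _ b (sd 1 j (l + 1)) - patHive _ b (sd 1 (j + 1) l) = -(nu (j + l + 1 - 1 - l) : ℤ)
    rw [sd_one, sd_one, show j + 1 + l = j + (l + 1) by ring, ← add_assoc, patHive_pt _ _ (by omega),
      patHive_pt _ _ (by omega), show j + l + 1 - 1 - l = j by omega, sum_range_succ,
      h.top_of_lt (Nat.lt_succ_self j), sum_congr rfl fun i hi => by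
        rw [h.top_of_lt (mem_range.1 hi),
          ← h.top_of_lt ((mem_range.1 hi).trans (Nat.lt_succ_self j))]]
    ring
  · change patHive _ b (sd 2 j (l + 1)) - patHive _ b (sd 2 (j + 1) l) = (lam l : ℤ)
    rw [sd_two, sd_two, show j + 1 + l = j + (l + 1) by ring, ← add_assoc, patHive_pt _ _ (by omega),
      patHive_pt _ _ (by omega), sum_range_succ, h.zero]
    ring

theorem exists_pat_of_hive {G : Pt → ℤ} (hG : IsHive r G) (hb : HasBd r G (lrBd r lam mu nu))
    (hl : ∀ i, r ≤ i → lam i = 0) (hm : ∀ i, r ≤ i → mu i = 0) (hn : ∀ i, r ≤ i → nu i = 0)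
    (hma : Antitone mu) (hna : Antitone nu) : ∃ b, IsPat r lam mu nu b := by
  let g : ℕ → ℕ → ℤ := fun i k => G (pt r (min i r) (min k (min i r)))
  have hg : ∀ {i k}, k ≤ i → i ≤ r → g i k = G (pt r i k) := fun {i k} h1 h2 => by
    simp only [g, min_eq_left h2, min_eq_left h1]
  have hgi : ∀ {i k}, i ≤ k → g i k = g i i := fun {i k} h1 => by
    simp only [g, min_eq_right ((min_le_left i r).trans h1), min_eq_right (min_le_left i r)]
  have hgr : ∀ {i} k, r ≤ i → g i k = g r k := fun {i} k h1 => by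
    simp only [g, min_eq_right h1, min_self]
  have rh : ∀ i k, k ≤ i → i + 2 ≤ r →
      g i k + g (i + 2) (k + 1) ≤ g (i + 1) k + g (i + 1) (k + 1) ∧
      g (i + 2) k + g (i + 1) (k + 1) ≤ g (i + 2) (k + 1) + g (i + 1) k ∧
      g (i + 2) (k + 2) + g (i + 1) k ≤ g (i + 1) (k + 1) + g (i + 2) (k + 1) := by
    intro i k hk hi
    obtain ⟨s, rfl⟩ := Nat.exists_eq_add_of_le' (show 2 ≤ r by omega)
    have hw : wt (pt s i k) + 2 = s + 2 := by rw [wt_pt hk (by omega)]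
    have r0 : G (pt s i k + e 0 + e 0) + G (pt s i k + e 1 + e 2) ≤
      G (pt s i k + e 0 + e 1) + G (pt s i k + e 0 + e 2) := hG.rhombus 0 hw
    have r1 : G (pt s i k + e 1 + e 1) + G (pt s i k + e 2 + e 0) ≤
      G (pt s i k + e 1 + e 2) + G (pt s i k + e 1 + e 0) := hG.rhombus 1 hw
    have r2 : G (pt s i k + e 2 + e 2) + G (pt s i k + e 0 + e 1) ≤
      G (pt s i k + e 2 + e 0) + G (pt s i k + e 2 + e 1) := hG.rhombus 2 hw
    rw [pt_add_e0 _ (by omega), pt_add_e0 _ (by omega), pt_add_e1 _ hk, pt_add_e2, pt_add_e1 _ hk,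
      pt_add_e2] at r0
    rw [pt_add_e1 _ hk, pt_add_e1 _ (by omega), pt_add_e2, pt_add_e0 _ (by omega), pt_add_e2,
      pt_add_e0 _ (by omega)] at r1
    rw [pt_add_e0 _ (by omega), pt_add_e1 _ hk, pt_add_e2, pt_add_e2, pt_add_e0 _ (by omega),
      pt_add_e1 _ (by omega)] at r2
    rw [hg hk (by omega), hg (i := i + 2) (k := k + 1) (by omega) hi, hg (i := i + 1) (k := k) (by omega) (by omega),
      hg (i := i + 1) (k := k + 1) (by omega) (by omega), hg (i := i + 2) (k := k) (by omega) hi,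
      hg (i := i + 2) (k := k + 2) (by omega) hi]
    exact ⟨r0, r1, r2⟩
  have bl : ∀ i, g (i + 1) 0 - g i 0 = lam i := fun i => by
    rcases lt_or_ge i r with h | h
    · have h1 : G (sd 2 (r - 1 - i) (i + 1)) - G (sd 2 (r - 1 - i + 1) i) = (lam i : ℤ) :=
        hb 2 (r - 1 - i) i (by omega)
      rwa [sd_two, sd_two, show r - 1 - i + (i + 1) = r by omega, show r - 1 - i + 1 + i = r by omega,
        ← hg (by omega) (by omega), ← hg (by omega) (by omega)] at h1
    · rw [hgr _ h, hgr _ (by omega), hl i h]; simp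
  have bm : ∀ k, g r (k + 1) - g r k = mu k := fun k => by
    rcases lt_or_ge k r with h | h
    · have h1 : G (sd 0 (r - 1 - k) (k + 1)) - G (sd 0 (r - 1 - k + 1) k) = (mu k : ℤ) :=
        hb 0 (r - 1 - k) k (by omega)
      rwa [sd_zero, sd_zero, show r - 1 - k + (k + 1) = r by omega, show r - 1 - k + 1 + k = r by omega,
        ← hg (by omega) (by omega), ← hg (by omega) (by omega)] at h1
    · rw [hgi (by omega), hgi h, hm k h]; simp
  have bn : ∀ i k, i < k → g (i + 1) k - g i k = nu i := fun i k hk => by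
    rw [hgi (i := i + 1) (by omega), hgi hk.le]
    rcases lt_or_ge i r with h | h
    · have h1 : G (sd 1 i (r - 1 - i + 1)) - G (sd 1 (i + 1) (r - 1 - i)) =
        -(nu (r - 1 - (r - 1 - i)) : ℤ) := hb 1 i (r - 1 - i) (by omega)
      rw [sd_one, sd_one, show i + (r - 1 - i + 1) = r by omega, show i + 1 + (r - 1 - i) = r by omega,
        ← hg (by omega) (by omega), ← hg (by omega) (by omega), show r - 1 - (r - 1 - i) = i by omega] at h1
      linarith
    · rw [hgr _ (show r ≤ i + 1 by omega), hgr _ h, hgi (show r ≤ i + 1 by omega), hgi h, hn i h]; simp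
  have D0 : ∀ i k, i ≤ k → g i (k + 1) - g i k = 0 := fun i k h => by
    rw [hgi (by omega), hgi h, sub_self]
  have ball : ∀ i k, g (i + 1) (k + 2) - g (i + 1) (k + 1) ≤ g i (k + 1) - g i k := fun i k => by
    rcases lt_or_ge i r with h | h
    · rcases Nat.lt_or_ge k i with h' | h'
      · obtain ⟨m, rfl⟩ := Nat.exists_eq_succ_of_ne_zero (show i ≠ 0 by omega)
        have := (rh m k (by omega) (by omega)).2.2
        simp only [Nat.succ_eq_add_one]
        linarith
      · rw [D0 i k h', D0 (i + 1) (k + 1) (by omega)]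
    · have h1 : (mu (k + 1) : ℤ) ≤ mu k := by exact_mod_cast hma (Nat.le_succ k)
      rw [← bm, ← bm] at h1
      simpa only [hgr _ h, hgr _ (show r ≤ i + 1 by omega)] using h1
  have Dpos : ∀ m i, i + 1 + m = r → 0 ≤ g (i + 1) (i + 1) - g (i + 1) i := by
    intro m
    induction m with
    | zero => rintro i rfl; rw [add_zero] at *; rw [bm]; exact Nat.cast_nonneg _
    | succ m ih => exact fun i hi => (ih (i + 1) (by omega)).trans (ball (i + 1) i)
  have mono : ∀ i k, g i (k + 1) - g i k ≤ g (i + 1) (k + 1) - g (i + 1) k := fun i k => by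
    rcases lt_or_ge i r with h | h
    · rcases lt_trichotomy k i with h' | rfl | h'
      · obtain ⟨m, rfl⟩ := Nat.exists_eq_succ_of_ne_zero (show i ≠ 0 by omega)
        have := (rh m k (by omega) (by omega)).2.1
        simp only [Nat.succ_eq_add_one]
        linarith
      · rw [D0 k k le_rfl]
        exact Dpos (r - 1 - k) k (by omega)
      · rw [D0 i k h'.le, D0 (i + 1) k (by omega)]
    · rw [hgr _ h, hgr _ h, hgr _ (show r ≤ i + 1 by omega), hgr _ (show r ≤ i + 1 by omega)]
  have Bmono : ∀ i, Monotone fun k => g (i + 1) k - g i k := fun i =>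
    monotone_nat_of_le_succ fun k => by have := mono i k; linarith
  have Bpos : ∀ i k, 0 ≤ g (i + 1) k - g i k := fun i k => by
    refine le_trans ?_ (Bmono i (Nat.zero_le k))
    simp only [bl]; exact Nat.cast_nonneg _
  have hcast : ∀ i k, (((g (i + 1) k - g i k).toNat : ℕ) : ℤ) = g (i + 1) k - g i k := fun i k =>
    Int.toNat_of_nonneg (Bpos i k)
  have hmn : ∀ i, Monotone fun k => (g (i + 1) k - g i k).toNat := fun i k k' h =>
    Int.toNat_le_toNat (Bmono i h)
  have hsum : ∀ i k, ((∑ j ∈ range i, ((g (j + 1) (k + 1) - g j (k + 1)).toNat -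
      (g (j + 1) k - g j k).toNat) : ℕ) : ℤ) = g i (k + 1) - g i k := fun i k => by
    have h1 : ∀ j ∈ range i, (((g (j + 1) (k + 1) - g j (k + 1)).toNat -
      (g (j + 1) k - g j k).toNat : ℕ) : ℤ) = (g (j + 1) (k + 1) - g (j + 1) k) - (g j (k + 1) - g j k) :=
      fun j _ => by rw [Nat.cast_sub (hmn j (Nat.le_succ k)), hcast, hcast]; ring
    rw [Nat.cast_sum, sum_congr rfl h1, sum_range_sub (fun j => g j (k + 1) - g j k),
      D0 0 k (Nat.zero_le k), sub_zero]
  refine ⟨fun i k => (g (i + 1) k - g i k).toNat, fun i => ?_, hmn, fun i k => ?_, fun i => ⟨i + 1, ?_⟩,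
    fun i k => ?_, fun i k => ?_, fun k => ?_⟩
  · simp only [bl, Int.toNat_natCast]
  · refine (hmn i (show k ≤ k + i + 1 by omega)).trans ?_
    simp only [bn i (k + i + 1) (by omega), Int.toNat_natCast]; exact le_rfl
  · simp only [bn i (i + 1) (by omega), Int.toNat_natCast]
  · refine Int.toNat_le_toNat ?_
    rcases lt_or_ge (i + 1) r with h | h
    · rcases Nat.lt_or_ge i k with h' | h'
      · rw [bn i k h', bn (i + 1) (k + 1) (by omega)]
        exact_mod_cast hna (Nat.le_succ i)
      · have := (rh i k h' (by omega)).1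
        linarith
    · refine le_trans (le_of_eq ?_) (Bpos i k)
      rw [hgr _ h, hgr _ (show r ≤ i + 1 + 1 by omega), sub_self]
  · have := ball i k
    rw [← hsum, ← hsum] at this
    exact_mod_cast this
  · have := (hsum r k).trans (bm k)
    exact_mod_cast this

end Hive

section Coeff

variable {r : ℕ} {lam mu nu : ℕ → ℕ} {T : ℕ → ℕ → ℕ}

theorem IsLRTableau.lr (h : IsLRTableau lam mu nu T) (hr : ∀ i, r ≤ i → nu i = 0) :
    LR r (lrBd r lam mu nu) := by
  obtain ⟨b, hb, -⟩ := h.exists_pat hr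
  exact ⟨_, hb.isHive, hb.hasBd⟩

theorem IsLRTableau.content_bound (h : IsLRTableau lam mu nu T) (hr : ∀ i, r ≤ i → nu i = 0) :
    (∀ k, mu k ≤ ∑ i ∈ range r, nu i) ∧ ∀ k, r ≤ k → mu k = 0 := by
  obtain ⟨b, hb, -⟩ := h.exists_pat hr
  refine ⟨fun k => ?_, fun k hk => ?_⟩
  · rw [← hb.content k]
    exact sum_le_sum fun i _ => (Nat.sub_le _ _).trans (hb.le i _)
  · rw [← hb.content k]
    refine sum_eq_zero fun i hi => ?_
    have := mem_range.1 hi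
    rw [hb.top_of_lt (show i < k + 1 by omega), hb.top_of_lt (show i < k by omega), Nat.sub_self]

theorem finite_tableaux (hr : ∀ i, r ≤ i → nu i = 0) : Finite {T // IsLRTableau lam mu nu T} := by
  refine Finite.of_injective (β := Fin r → Fin (nu 0) → Fin (r + 1))
    (fun T i j => ⟨min (T.1 i j) r, by omega⟩) fun T T' hTT => Subtype.ext ?_
  have hle : ∀ T, IsLRTableau lam mu nu T → ∀ i j, InSkew lam nu i j → T i j ≤ i + 1 := by
    intro T hT i j hj
    obtain ⟨b, hb, hrel⟩ := hT.exists_pat hr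
    obtain ⟨-, -, -, -, -, h1, -⟩ := hT
    have h2 := h1 i j hj
    have h3 := (hrel i j (T i j - 1)).1 ⟨hj, by omega⟩
    by_contra hcon
    rw [hb.top_of_lt (by omega)] at h3
    exact absurd hj.2 (by omega)
  funext i j
  by_cases hj : InSkew lam nu i j
  · have hi : i < r := by
      by_contra hi
      have := hj.2
      rw [hr i (by omega)] at this
      omega
    have hj0 : j < nu 0 := lt_of_lt_of_le hj.2 (T.2.2.2.1.1 0 i (Nat.zero_le i))
    have h1 := congrArg Fin.val (congrFun (congrFun hTT ⟨i, hi⟩) ⟨j, hj0⟩)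
    have h2 := hle _ T.2 i j hj
    have h3 := hle _ T'.2 i j hj
    simp only at h1
    omega
  · obtain ⟨-, -, -, -, h1, -⟩ := T.2
    obtain ⟨-, -, -, -, h2, -⟩ := T'.2
    rw [h1 i j hj, h2 i j hj]

theorem LR.lrCoeff_ne_zero (h : LR r (lrBd r lam mu nu)) (hl : MemParN r lam) (hm : MemParN r mu)
    (hn : MemParN r nu) : lrCoeff lam mu nu ≠ 0 := by
  obtain ⟨G, hG, hb⟩ := h
  obtain ⟨b, hb⟩ := exists_pat_of_hive hG hb hl.2 hm.2 hn.2 (fun i j => hm.1.1 i j) fun i j => hn.1.1 i j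
  obtain ⟨T, hT⟩ := hb.exists_tableau hl.1 hm.1 hn.1 hn.2
  have := finite_tableaux (lam := lam) (mu := mu) hn.2
  have : Nonempty {T // IsLRTableau lam mu nu T} := ⟨T, hT⟩
  exact Nat.card_pos.ne'

theorem exists_tableau_of_ne_zero (h : lrCoeff lam mu nu ≠ 0) : ∃ T, IsLRTableau lam mu nu T := by
  by_contra hcon
  have : IsEmpty {T // IsLRTableau lam mu nu T} := ⟨fun T => hcon ⟨T.1, T.2⟩⟩
  exact h Nat.card_of_isEmpty

theorem RigidLR.lrCoeff_eq_one (h : RigidLR r (lrBd r lam mu nu)) (hl : MemParN r lam)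
    (hm : MemParN r mu) (hn : MemParN r nu) : lrCoeff lam mu nu = 1 := by
  have hne := h.1.lrCoeff_ne_zero hl hm hn
  obtain ⟨T₀, hT₀⟩ := exists_tableau_of_ne_zero hne
  refine Nat.card_eq_one_iff_exists.2 ⟨⟨T₀, hT₀⟩, fun ⟨T, hT⟩ => Subtype.ext ?_⟩
  obtain ⟨b, hb, hrel⟩ := hT.exists_pat hn.2
  obtain ⟨b', hb', hrel'⟩ := hT₀.exists_pat hn.2
  have hbb : b = b' := by
    funext i k
    rcases lt_or_ge i r with hi | hi
    · rcases Nat.lt_or_ge i k with hk | hk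
      · rw [hb.top_of_lt hk, hb'.top_of_lt hk]
      · obtain ⟨s, rfl⟩ := Nat.exists_eq_succ_of_ne_zero (show r ≠ 0 by omega)
        have h1 : ∀ b, patHive (s + 1) b (pt s i k + e 1) - patHive (s + 1) b (pt s i k + e 0) = b i k := fun b => by
          rw [pt_add_e1 _ hk, pt_add_e0 _ (by omega), patHive_pt _ _ (by omega),
            patHive_pt _ _ (by omega), sum_range_succ]
          ring
        have h2 : patHive (s + 1) b (pt s i k + e 1) - patHive (s + 1) b (pt s i k + e 0) =
            patHive (s + 1) b' (pt s i k + e 1) - patHive (s + 1) b' (pt s i k + e 0) :=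
          h.2 _ _ hb.isHive hb.hasBd hb'.isHive hb'.hasBd (pt s i k) 2 (by rw [wt_pt hk (by omega)])
        rw [h1, h1] at h2
        exact_mod_cast h2
    · have h1 := hb.le i k
      have h2 := hb'.le i k
      rw [hn.2 i hi] at h1 h2
      omega
  subst hbb
  obtain ⟨-, -, -, -, h1, h2, -⟩ := hT
  obtain ⟨-, -, -, -, h1', -⟩ := hT₀
  funext i j
  by_cases hj : InSkew lam nu i j
  · have h3 := h2 i j hj
    have h4 := (hrel' i j (T i j - 1)).2 ((hrel i j (T i j - 1)).1 ⟨hj, by omega⟩)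
    change T i j = T₀ i j
    omega
  · exact (h1 i j hj).trans (h1' i j hj).symm

theorem RigidLR.refl {Z : Fin 3 → ℕ → ℤ} (h : RigidLR r Z) :
    RigidLR r (fun c i => - Z (-c) (r - 1 - i)) := by
  refine ⟨h.1.refl, fun G G' hG hb hG' hb' y c hy => ?_⟩
  have key : ∀ G : Pt → ℤ, HasBd r G (fun c i => - Z (-c) (r - 1 - i)) →
      HasBd r (fun p => G (refl3 p)) Z := fun G hb c j l hj => by
    rw [hb.refl c j l hj]
    simp only [neg_neg]
    rw [show r - 1 - (r - 1 - l) = l by omega]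
  have h1 := h.2 _ _ hG.refl (key G hb) hG'.refl (key G' hb') (refl3 y) (-c) (by rwa [wt_refl3])
  have h2 : -(-c + 2) = c + 1 ∧ -(-c + 1) = c + 2 := by fin_cases c <;> decide
  simp only [dif, refl3_add, refl3_e, refl3_refl3, h2.1, h2.2] at h1 ⊢
  linarith

end Coeff

/-! ### Index sets of the sextuples -/

/-- The index set in `{0, …, 2 * n}` of a pair of subsets of `{1, …, n}`. -/
def idx (n : ℕ) (A A' : Finset ℕ) : Finset ℕ := A.image (· - 1) ∪ A'.image (2 * n + 1 - ·)

section Idx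

variable {n r : ℕ} {A A' : Finset ℕ}

theorem mem_idx (hA : A ⊆ Icc 1 n) (hA' : A' ⊆ Icc 1 n) {i : ℕ} : i ∈ idx n A A' ↔
    i < n ∧ i + 1 ∈ A ∨ n < i ∧ i ≤ 2 * n ∧ 2 * n + 1 - i ∈ A' := by
  simp only [idx, mem_union, mem_image]
  refine or_congr ⟨?_, fun h => ⟨_, h.2, rfl⟩⟩ ⟨?_, fun h => ⟨_, h.2.2, by omega⟩⟩
  · rintro ⟨j, hj, rfl⟩
    have := mem_Icc.1 (hA hj)
    exact ⟨by omega, by rwa [Nat.sub_add_cancel this.1]⟩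
  · rintro ⟨j, hj, rfl⟩
    have := mem_Icc.1 (hA' hj)
    exact ⟨by omega, by omega, by rwa [Nat.sub_sub_self (by omega)]⟩

theorem idx_sub (hA : A ⊆ Icc 1 n) (hA' : A' ⊆ Icc 1 n) :
    idx n A A' ⊆ range (2 * n + 1) := fun i hi => by
  rw [mem_idx hA hA'] at hi
  rw [mem_range]; omega

theorem revS_idx (hA : A ⊆ Icc 1 n) (hA' : A' ⊆ Icc 1 n) :
    revS (2 * n + 1) (idx n A A') = idx n A' A := by
  ext i
  rw [mem_revS (idx_sub hA hA'), mem_idx hA hA', mem_idx hA' hA]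
  constructor
  · rintro ⟨h, h1 | h1⟩
    · exact Or.inr ⟨by omega, by omega, by
        rw [show 2 * n + 1 - i = 2 * n + 1 - 1 - i + 1 by omega]; exact h1.2⟩
    · exact Or.inl ⟨by omega, by
        rw [show i + 1 = 2 * n + 1 - (2 * n + 1 - 1 - i) by omega]; exact h1.2.2⟩
  · rintro (h | h)
    · exact ⟨by omega, Or.inr ⟨by omega, by omega, by
        rw [show 2 * n + 1 - (2 * n + 1 - 1 - i) = i + 1 by omega]; exact h.2⟩⟩
    · exact ⟨by omega, Or.inl ⟨by omega, by
        rw [show 2 * n + 1 - 1 - i + 1 = 2 * n + 1 - i by omega]; exact h.2.2⟩⟩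

theorem freeS_idx (hA : A ⊆ Icc 1 n) (hA' : A' ⊆ Icc 1 n) : freeS n (idx n A A') =
    idx n (Icc 1 n \ (A ∪ A')) (Icc 1 n \ (A ∪ A')) := by
  ext i
  rw [mem_idx sdiff_subset sdiff_subset, freeS, revS_idx hA hA', mem_erase,
    mem_sdiff, mem_union, mem_idx hA hA', mem_idx hA' hA]
  simp only [mem_sdiff, mem_union, mem_Icc, mem_range]
  rcases lt_trichotomy i n with h | rfl | h
  · have h1 : ¬ n < i := by omega
    have h2 : i < 2 * n + 1 := by omega
    have h3 : 1 ≤ i + 1 ∧ i + 1 ≤ n := by omega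
    have h4 : i ≠ n := h.ne
    tauto
  · simp
  · have h1 : ¬ i < n := by omega
    have h4 : i ≠ n := h.ne'
    by_cases h5 : i ≤ 2 * n
    · have h6 : 1 ≤ 2 * n + 1 - i ∧ 2 * n + 1 - i ≤ n := by omega
      have h7 : i < 2 * n + 1 := by omega
      simp only [h1, h, h4, h5, h6, h7, false_and, true_and, false_or, not_false_eq_true, ne_eq,
        and_self]
      tauto
    · have h7 : ¬ i < 2 * n + 1 := by omega
      simp only [h1, h5, h7, false_and, and_false, or_false]

theorem sum_idx {M : Type*} [AddCommMonoid M] (hA : A ⊆ Icc 1 n) (hA' : A' ⊆ Icc 1 n)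
    (f : ℕ → M) : ∑ i ∈ idx n A A', f i = ∑ i ∈ A, f (i - 1) + ∑ i ∈ A', f (2 * n + 1 - i) := by
  have m1 := fun i (hi : i ∈ A) => mem_Icc.1 (hA hi)
  have m2 := fun i (hi : i ∈ A') => mem_Icc.1 (hA' hi)
  rw [idx, sum_union, sum_image, sum_image]
  · intro i hi j hj h
    have := m2 i hi; have := m2 j hj
    simp only at h; omega
  · intro i hi j hj h
    have := m1 i hi; have := m1 j hj
    simp only at h; omega
  · rw [disjoint_left]
    intro i hi hi'
    obtain ⟨j, hj, rfl⟩ := mem_image.1 hi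
    obtain ⟨j', hj', h⟩ := mem_image.1 hi'
    have := m1 j hj; have := m2 j' hj'
    omega

theorem card_idx (hA : A ⊆ Icc 1 n) (hA' : A' ⊆ Icc 1 n) :
    (idx n A A').card = A.card + A'.card := by
  simp only [card_eq_sum_ones, sum_idx hA hA']

theorem bef_idx_low (hA : A ⊆ Icc 1 n) (hA' : A' ⊆ Icc 1 n) {a : ℕ}
    (ha : a ∈ Icc 1 n) : bef (idx n A A') (a - 1) = (A.filter (· < a)).card := by
  have ha := mem_Icc.1 ha
  rw [bef, card_filter, sum_idx hA hA', sum_eq_zero (s := A'), add_zero, card_filter]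
  · refine sum_congr rfl fun i hi => if_congr ?_ rfl rfl
    have := mem_Icc.1 (hA hi)
    omega
  · intro i hi
    have := mem_Icc.1 (hA' hi)
    exact if_neg (by omega)

theorem bef_idx_high (hA : A ⊆ Icc 1 n) (hA' : A' ⊆ Icc 1 n) {a : ℕ}
    (ha : a ∈ Icc 1 n) :
    bef (idx n A A') (2 * n + 1 - a) = A.card + (A'.filter (a < ·)).card := by
  have ha := mem_Icc.1 ha
  rw [bef, card_filter, sum_idx hA hA', card_filter, card_eq_sum_ones]
  congr 1 <;> refine sum_congr rfl fun i hi => ?_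
  · have := mem_Icc.1 (hA hi)
    exact if_pos (by omega)
  · have := mem_Icc.1 (hA' hi)
    exact if_congr (by omega) rfl rfl

theorem card_le_add {s : Finset ℕ} (hs : s ⊆ Icc 1 n) (a : ℕ) :
    (s ∩ Icc 1 a).card + (s.filter (a < ·)).card = s.card ∧
    (s.filter (· < a)).card + (s ∩ Icc a n).card = s.card := by
  constructor
  · rw [← card_filter_add_card_filter_not (s := s) (· ≤ a)]
    congr 2
    · ext i
      have := fun h => mem_Icc.1 (hs h : i ∈ _)
      simp only [mem_inter, mem_filter, mem_Icc]
      exact ⟨fun h => ⟨h.1, h.2.2⟩, fun h => ⟨h.1, (this h.1).1, h.2⟩⟩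
    · exact filter_congr fun i _ => not_le.symm
  · rw [← card_filter_add_card_filter_not (s := s) (· < a)]
    congr 2
    ext i
    have := fun h => mem_Icc.1 (hs h : i ∈ _)
    simp only [mem_inter, mem_filter, mem_Icc, not_lt]
    exact ⟨fun h => ⟨h.1, h.2.1⟩, fun h => ⟨h.1, h.2, (this h.1).2⟩⟩

theorem nthSmall_idx_low (hA : A ⊆ Icc 1 n) (hA' : A' ⊆ Icc 1 n) {l : ℕ}
    (hl : l < A.card) : nthSmall (idx n A A') l = nthSmall A l - 1 := by
  have hm := nthSmall_mem hl
  refine nthSmall_of_card (mem_union_left _ (mem_image_of_mem _ hm)) ?_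
  exact (bef_idx_low hA hA' (hA hm)).trans (card_lt_nthSmall hl)

theorem nthSmall_idx_high (hA : A ⊆ Icc 1 n) (hA' : A' ⊆ Icc 1 n) {l : ℕ}
    (hl : A.card ≤ l) (hl' : l < A.card + A'.card) :
    nthSmall (idx n A A') l = 2 * n + 1 - nthSmall A' (A'.card + A.card - 1 - l) := by
  have hk : A'.card + A.card - 1 - l < A'.card := by omega
  have hm := nthSmall_mem hk
  refine nthSmall_of_card (mem_union_right _ (mem_image_of_mem _ hm)) ?_
  refine (bef_idx_high hA hA' (hA' hm)).trans ?_
  have h1 := card_lt_nthSmall hk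
  have h2 := card_filter_add_card_filter_not (s := A') (· < nthSmall A' (A'.card + A.card - 1 - l))
  have h3 : A'.filter (fun i => ¬ i < nthSmall A' (A'.card + A.card - 1 - l)) =
      insert (nthSmall A' (A'.card + A.card - 1 - l))
        (A'.filter (nthSmall A' (A'.card + A.card - 1 - l) < ·)) := by
    ext i
    simp only [mem_filter, mem_insert]
    constructor
    · intro h; by_cases h' : i = nthSmall A' (A'.card + A.card - 1 - l)
      · exact Or.inl h'
      · exact Or.inr ⟨h.1, by omega⟩
    · rintro (rfl | h)
      · exact ⟨hm, by omega⟩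
      · exact ⟨h.1, by omega⟩
  rw [h3, card_insert_of_notMem (by simp)] at h2
  omega

/-- The common shape of `tau2` and `tau0`. -/
theorem tau_bef (hA : A ⊆ Icc 1 n) (hA' : A' ⊆ Icc 1 n) {U U' : Finset ℕ}
    (hU : U ⊆ Icc 1 n) (hU' : U' ⊆ Icc 1 n) {l : ℕ} (hl : l < A.card + A'.card) :
    (if l < A.card then U'.card + (U ∩ Icc (nthSmall A l) n).card
      else (U' ∩ Icc 1 (nthSmall A' (A'.card + A.card - 1 - l))).card) +
      bef (idx n U U') (nthSmall (idx n A A') l) = U.card + U'.card := by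
  split_ifs with h
  · rw [nthSmall_idx_low hA hA' h, bef_idx_low hU hU' (hA (nthSmall_mem h))]
    have := (card_le_add hU (nthSmall A l)).2
    omega
  · rw [nthSmall_idx_high hA hA' (by omega) hl, bef_idx_high hU hU' (hA' (nthSmall_mem (by omega)))]
    have := (card_le_add hU' (nthSmall A' (A'.card + A.card - 1 - l))).1
    omega

theorem tau2_bef (hA : A ⊆ Icc 1 n) (hA' : A' ⊆ Icc 1 n) (hr : A.card + A'.card = r)
    {l : ℕ} (hl : l < r) :
    tau2 n A A' l + bef (revS (2 * n + 1) (idx n A A')) (nthSmall (idx n A A') l) = r := by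
  rw [revS_idx hA hA', ← hr, add_comm A.card, ← tau_bef hA hA' hA' hA (hr ▸ hl), tau2,
    if_pos (hr ▸ hl : l < A.card + A'.card)]

theorem tau0_bef (hA : A ⊆ Icc 1 n) (hA' : A' ⊆ Icc 1 n) (hd : Disjoint A A')
    (hr : A.card + A'.card = r) {l : ℕ} (hl : l < r) :
    tau0 n A A' l + bef (freeS n (idx n A A')) (nthSmall (idx n A A') l) = 2 * n - 2 * r := by
  have hF : (Icc 1 n \ (A ∪ A')).card = n - A.card - A'.card := by
    rw [card_sdiff_of_subset (union_subset hA hA'), card_union_of_disjoint hd,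
      Nat.card_Icc]
    omega
  have h1 := tau_bef hA hA' (U := Icc 1 n \ (A ∪ A')) (U' := Icc 1 n \ (A ∪ A'))
    sdiff_subset sdiff_subset (hr ▸ hl : l < A.card + A'.card)
  rw [freeS_idx hA hA', show 2 * n - 2 * r = (Icc 1 n \ (A ∪ A')).card +
    (Icc 1 n \ (A ∪ A')).card by rw [hF]; omega, ← h1, tau0,
    if_pos (hr ▸ hl : l < A.card + A'.card)]
  congr 1
  have hI : ∀ a b, 1 ≤ a → b ≤ n → (Icc 1 n \ (A ∪ A')) ∩ Icc a b =
      Icc a b \ (A ∪ A') := fun a b ha hb => by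
    ext i
    simp only [mem_inter, mem_sdiff, mem_Icc]
    constructor
    · exact fun h => ⟨h.2, h.1.2⟩
    · exact fun h => ⟨⟨by omega, h.2⟩, h.1⟩
  split_ifs with h
  · rw [hF, hI _ _ (mem_Icc.1 (hA (nthSmall_mem h))).1 le_rfl]
  · rw [hI _ _ le_rfl (mem_Icc.1 (hA' (nthSmall_mem (by omega)))).2]

theorem tau_eq_zero (hr : A.card + A'.card = r) {l : ℕ} (hl : r ≤ l) :
    tau2 n A A' l = 0 ∧ tau0 n A A' l = 0 := by
  rw [tau2, tau0, if_neg (by omega), if_neg (by omega), if_neg (by omega), if_neg (by omega)]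
  exact ⟨rfl, rfl⟩

theorem sum_idx_hat (hA : A ⊆ Icc 1 n) (hA' : A' ⊆ Icc 1 n) (x : Bdry)
    (c : Fin 3) : ∑ i ∈ idx n A A', hat n x c i = ∑ i ∈ A, x c (i - 1) - ∑ i ∈ A', x c (i - 1) := by
  rw [sum_idx hA hA', sub_eq_add_neg, ← sum_neg_distrib]
  congr 1 <;> refine sum_congr rfl fun i hi => ?_
  · have := mem_Icc.1 (hA hi)
    rw [hat, if_pos (by omega)]
  · have := mem_Icc.1 (hA' hi)
    rw [hat, if_neg (by omega), if_neg (by omega), show 2 * n - (2 * n + 1 - i) = i - 1 by omega]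

theorem exists_idx {S : Finset ℕ} (hS : S ⊆ range (2 * n + 1)) (hn : n ∉ S) :
    ∃ A A', A ⊆ Icc 1 n ∧ A' ⊆ Icc 1 n ∧ S = idx n A A' := by
  refine ⟨(Icc 1 n).filter (· - 1 ∈ S), (Icc 1 n).filter (2 * n + 1 - · ∈ S),
    filter_subset _ _, filter_subset _ _, ?_⟩
  ext i
  rw [mem_idx (filter_subset _ _) (filter_subset _ _)]
  simp only [mem_filter, mem_Icc, Nat.add_sub_cancel]
  constructor
  · intro hi
    have h1 := mem_range.1 (hS hi)
    have h2 : i ≠ n := fun h => hn (h ▸ hi)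
    rcases lt_or_gt_of_ne h2 with h | h
    · exact Or.inl ⟨h, by omega, hi⟩
    · exact Or.inr ⟨h, by omega, by omega, by rwa [Nat.sub_sub_self (by omega)]⟩
  · rintro (h | h)
    · exact h.2.2
    · have := h.2.2.2
      rwa [Nat.sub_sub_self (by omega)] at this

end Idx

section Coeff

variable {r m : ℕ} {S V : Triple} {τ : Fin 3 → ℕ → ℕ}

theorem memParN_tau (hS : ∀ c, (S c).card = r) (h0 : ∀ c l, r ≤ l → τ c l = 0)
    (h1 : ∀ c, ∀ l < r, τ c l + bef (V c) (nthSmall (S c) l) = m) (c : Fin 3) :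
    MemParN r (τ c) ∧ MemParN r (compP m r (τ c)) := by
  have hanti : ∀ i j, i ≤ j → τ c j ≤ τ c i := fun i j hij => by
    rcases lt_or_ge j r with hj | hj
    · have e1 := h1 c j hj
      have e2 := h1 c i (by omega)
      have e3 : bef (V c) (nthSmall (S c) i) ≤ bef (V c) (nthSmall (S c) j) :=
        card_le_card (monotone_filter_right _ fun k _ hk =>
          lt_of_lt_of_le hk (nthSmall_le hij (by rw [hS]; exact hj)))
      omega
    · rw [h0 c j hj]; exact Nat.zero_le _
  have hz : ∀ i, r ≤ i → compP m r (τ c) i = 0 := fun i hi => if_neg (by omega)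
  refine ⟨⟨⟨hanti, r, h0 c⟩, h0 c⟩, ⟨⟨fun i j hij => ?_, r, hz⟩, hz⟩⟩
  simp only [compP]
  split_ifs
  · have := hanti (r - 1 - j) (r - 1 - i) (by omega); omega
  · omega
  · exact Nat.zero_le _
  · exact le_rfl

theorem lrBd_comp (h1 : ∀ c, ∀ l < r, τ c l + bef (V c) (nthSmall (S c) l) = m) (c : Fin 3) {l : ℕ}
    (hl : l < r) : - lrBd r (compP m r (τ 1)) (compP m r (τ 0)) (τ 2) (-c) (r - 1 - l) =
      (if c = 2 then (m : ℤ) else 0) - bef (V c) (nthSmall (S c) l) := by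
  have e := h1 c l hl
  have hr : r - 1 - l < r := by omega
  have hl' : r - 1 - (r - 1 - l) = l := by omega
  fin_cases c
  · change -((compP m r (τ 0) (r - 1 - l) : ℕ) : ℤ) = 0 - _
    simp only [compP, if_pos hr, hl'] at *
    simp at e ⊢; omega
  · change -((compP m r (τ 1) (r - 1 - l) : ℕ) : ℤ) = 0 - _
    simp only [compP, if_pos hr, hl'] at *
    simp at e ⊢; omega
  · change - -((τ 2 (r - 1 - (r - 1 - l)) : ℕ) : ℤ) = m - _
    rw [hl', ← e]; push_cast; simp

theorem lr_of_lrCoeff (h0 : ∀ c l, r ≤ l → τ c l = 0)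
    (h1 : ∀ c, ∀ l < r, τ c l + bef (V c) (nthSmall (S c) l) = m)
    (h : lrCoeff (compP m r (τ 1)) (compP m r (τ 0)) (τ 2) ≠ 0) :
    LR r (fun c l => (if c = 2 then (m : ℤ) else 0) - bef (V c) (nthSmall (S c) l)) := by
  obtain ⟨T, hT⟩ := exists_tableau_of_ne_zero h
  exact (hT.lr (h0 2)).refl.congr fun c l hl => lrBd_comp h1 c hl

theorem lrCoeff_of_rigid (hS : ∀ c, (S c).card = r) (h0 : ∀ c l, r ≤ l → τ c l = 0)
    (h1 : ∀ c, ∀ l < r, τ c l + bef (V c) (nthSmall (S c) l) = m)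
    (h : RigidLR r (fun c l => (if c = 2 then (m : ℤ) else 0) - bef (V c) (nthSmall (S c) l))) :
    lrCoeff (compP m r (τ 1)) (compP m r (τ 0)) (τ 2) = 1 := by
  refine (h.refl.congr fun c l hl => ?_ : RigidLR r (lrBd r _ _ _)).lrCoeff_eq_one
    (memParN_tau hS h0 h1 1).2 (memParN_tau hS h0 h1 0).2 (memParN_tau hS h0 h1 2).1
  have := lrBd_comp h1 (-c) (show r - 1 - l < r by omega)
  rw [neg_neg, show r - 1 - (r - 1 - l) = l by omega] at this
  rw [← this, neg_neg]

end Coeff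

/-! ### Newell–Littlewood numbers -/

theorem LR.rot {R : Type*} [CommRing R] [LinearOrder R] [IsStrictOrderedRing R] {n : ℕ}
    {x : Fin 3 → ℕ → R} (h : LR n x) : LR n (fun c => x (c + 1)) := by
  obtain ⟨A, hA, hb⟩ := h
  have c1 : ∀ c : Fin 3, c + 1 + 1 = c + 2 ∧ c + 1 + 2 = c ∧ c + 2 + 2 = c + 1 := fun c =>
    ⟨(fin3_add_assoc c).1, (fin3_add_assoc c).2.1, (fin3_add_assoc c).2.2.2⟩
  let rot : Pt → Pt := fun p a => p (a + 2)
  have re : ∀ c, rot (e c) = e (c + 1) := by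
    intro c; funext a; revert a c; decide
  have hd : ∀ c z, dif (fun p => A (rot p)) c z = dif A (c + 1) (rot z) := fun c z => by
    have h2 : ∀ p q, rot (p + q) = rot p + rot q := fun _ _ => rfl
    have h3 : c + 2 + 1 = c + 1 + 2 := by fin_cases c <;> rfl
    simp only [dif, h2, re, h3]
  have hw : ∀ p, wt (rot p) = wt p := fun p => by
    rw [wt_cyc p 2]; rfl
  have hs : ∀ c j l, rot (sd c j l) = sd (c + 1) j l := fun c j l => by
    have h2 : ∀ a : Fin 3, (a + 2 = c + 1 ↔ a = c + 1 + 1) ∧ (a + 2 = c + 2 ↔ a = c + 1 + 2) := by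
      revert c; decide
    funext a
    simp only [rot, sd, (h2 a).1, (h2 a).2]
  refine ⟨fun p => A (rot p), fun c p q hp hq h2 h1 => ?_, fun c j l hj => ?_⟩
  · rw [hd, hd]
    refine hA (c + 1) _ _ (by rw [hw, hp]) (by rw [hw, hq]) ?_ ?_
    · simpa only [rot, (c1 c).2.1] using h2
    · simpa only [rot, (c1 c).1, (c1 c).2.2] using h1
  · simp only [hs]
    exact hb (c + 1) j l hj

/-- The rational boundaries of three partitions. -/
def castX (lam mu nu : ℕ → ℕ) : Bdry := ![fun i => mu i, fun i => lam i, fun i => nu i]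

section NL

variable {n t : ℕ} {lam mu nu : ℕ → ℕ}

theorem nlq_of_lr (ht : 0 < t) {a b c : ℕ → ℕ}
    (h1 : LR n (lrBd n a b fun i => t * lam i)) (h2 : LR n (lrBd n b c fun i => t * mu i))
    (h3 : LR n (lrBd n c a fun i => t * nu i)) : NLQ n (castX lam mu nu) := by
  have ht' : (0 : ℚ) < t := by exact_mod_cast ht
  have hs : (0 : ℚ) ≤ (t : ℚ)⁻¹ := (inv_pos.2 ht').le
  refine ⟨fun j i => (t : ℚ)⁻¹ * (![fun i => a i, fun i => c i, fun i => b i] : Fin 3 → ℕ → ℕ) j i,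
    fun _ _ _ => mul_nonneg hs (Nat.cast_nonneg _), fun k => ?_⟩
  have key : ∀ u : ℕ, (t : ℚ)⁻¹ * ((-((t * u : ℕ) : ℤ) : ℤ) : ℚ) = - (u : ℚ) := fun u => by
    push_cast; field_simp
  fin_cases k
  · refine (h2.cast.rot.smul hs).congr fun j i _ => ?_
    fin_cases j
    · exact key _
    · rfl
    · rfl
  · refine (h1.cast.smul hs).congr fun j i _ => ?_
    fin_cases j
    · rfl
    · exact key _
    · rfl
  · refine (h3.cast.rot.rot.smul hs).congr fun j i _ => ?_
    fin_cases j
    · rfl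
    · rfl
    · exact key _

theorem LR.exists_int {x : Bdry} (h : LR n x) : ∃ Q : ℕ, 0 < Q ∧ ∀ q : ℕ,
    ∃ Z : Fin 3 → ℕ → ℤ, LR n Z ∧ ∀ c, ∀ i < n, (Z c i : ℚ) = (q * Q : ℕ) * x c i := by
  obtain ⟨Q, hQ, G, Z, -, hG, hb, -, hZ⟩ := exists_int_hive h 0
  refine ⟨Q, hQ, fun q => ⟨_, LR.smul (k := (q : ℤ)) ⟨G, hG, hb⟩ (Nat.cast_nonneg q), fun c i hi => ?_⟩⟩
  push_cast
  rw [hZ c i hi]; ring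

theorem NLQ.exists_lr (h : NLQ n (castX lam mu nu)) : ∃ t, 0 < t ∧ ∃ a b c : ℕ → ℕ,
    MemParN n a ∧ MemParN n b ∧ MemParN n c ∧ LR n (lrBd n a b fun i => t * lam i) ∧
      LR n (lrBd n b c fun i => t * mu i) ∧ LR n (lrBd n c a fun i => t * nu i) := by
  obtain ⟨y, hy, hl⟩ := h
  choose Q hQ hZ using fun k => (hl k).exists_int
  set t := Q 0 * Q 1 * Q 2 with ht
  have ht0 : 0 < t := mul_pos (mul_pos (hQ 0) (hQ 1)) (hQ 2)
  have hZ' : ∀ k, ∃ Z : Fin 3 → ℕ → ℤ, LR n Z ∧ ∀ c, ∀ i < n, (Z c i : ℚ) =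
      (t : ℚ) * (if c = k then - castX lam mu nu k (n - 1 - i) else y (-k - c) i) := fun k => by
    have : ∃ q, t = q * Q k := by
      fin_cases k
      · exact ⟨Q 1 * Q 2, (mul_assoc _ _ _).trans (mul_comm _ _)⟩
      · exact ⟨Q 0 * Q 2, mul_right_comm _ _ _⟩
      · exact ⟨Q 0 * Q 1, rfl⟩
    obtain ⟨q, hq⟩ := this
    rw [hq]
    exact hZ k q
  choose Z hZl hZv using hZ'
  let Y : Fin 3 → ℕ → ℕ := fun c i => if i < n then ⌊(t : ℚ) * y c i⌋₊ else 0
  have hYd : ∀ j : Fin 3, j + 2 ≠ j + 1 ∧ -(j + 1) - (j + 2) = j := by decide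
  have hY : ∀ c, ∀ i < n, ((Y c i : ℕ) : ℚ) = t * y c i := fun c i hi => by
    have h1 := hZv (c + 1) (c + 2) i hi
    rw [if_neg (hYd c).1, (hYd c).2] at h1
    have h2 : (0 : ℚ) ≤ t * y c i := mul_nonneg (Nat.cast_nonneg t) (hy c i hi)
    simp only [Y, if_pos hi]
    rw [← h1] at h2 ⊢
    have h3 : 0 ≤ Z (c + 1) (c + 2) i := by exact_mod_cast h2
    obtain ⟨m, hm⟩ := Int.eq_ofNat_of_zero_le h3
    rw [hm]; simp
  have hYp : ∀ c, MemParN n (Y c) := fun c => by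
    have hz : ∀ i, n ≤ i → Y c i = 0 := fun i hi => if_neg (by omega)
    refine ⟨⟨fun i j hij => ?_, n, hz⟩, hz⟩
    rcases lt_or_ge j n with hj | hj
    · have h1 := (hl (c + 1)).dec (c + 2) i j hij hj
      rw [if_neg (hYd c).1, if_neg (hYd c).1, (hYd c).2] at h1
      have h2 := mul_le_mul_of_nonneg_left h1 (Nat.cast_nonneg (α := ℚ) t)
      rw [← hY c i (by omega), ← hY c j hj] at h2
      exact_mod_cast h2
    · rw [hz j hj]; exact Nat.zero_le _
  have key : ∀ (u : ℕ → ℕ) i, (t : ℚ) * - (u i : ℚ) = ((-((t * u i : ℕ) : ℤ) : ℤ) : ℚ) := fun u i => by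
    push_cast; ring
  refine ⟨t, ht0, Y 0, Y 2, Y 1, hYp 0, hYp 2, hYp 1, (hZl 1).congr fun j i hi => ?_,
    (hZl 0).rot.rot.congr fun j i hi => ?_, (hZl 2).rot.congr fun j i hi => ?_⟩
  · refine Int.cast_injective (α := ℚ) ((hZv 1 j i hi).trans ?_)
    fin_cases j
    · exact (hY 2 i hi).symm
    · exact key lam _
    · exact (hY 0 i hi).symm
  · refine Int.cast_injective (α := ℚ) ((hZv 0 (j + 1 + 1) i hi).trans ?_)
    fin_cases j
    · exact (hY 1 i hi).symm
    · exact key mu _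
    · exact (hY 2 i hi).symm
  · refine Int.cast_injective (α := ℚ) ((hZv 2 (j + 1) i hi).trans ?_)
    fin_cases j
    · exact (hY 0 i hi).symm
    · exact key nu _
    · exact (hY 1 i hi).symm

theorem exists_ne_of_finsum_ne {α : Type*} {f : α → ℕ} (h : ∑ᶠ i, f i ≠ 0) : ∃ i, f i ≠ 0 := by
  by_contra! h'
  exact h (finsum_eq_zero_of_forall_eq_zero h')

theorem exists_of_NL_ne_zero (h : NL lam mu nu ≠ 0) : ∃ a b c,
    lrCoeff a b lam ≠ 0 ∧ lrCoeff b c mu ≠ 0 ∧ lrCoeff c a nu ≠ 0 := by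
  obtain ⟨a, ha⟩ := exists_ne_of_finsum_ne h
  obtain ⟨b, hb⟩ := exists_ne_of_finsum_ne ha
  obtain ⟨c, hc⟩ := exists_ne_of_finsum_ne hb
  exact ⟨a, b, c, left_ne_zero_of_mul (left_ne_zero_of_mul hc),
    right_ne_zero_of_mul (left_ne_zero_of_mul hc), right_ne_zero_of_mul hc⟩

theorem finite_bounded (n K : ℕ) : {f : ℕ → ℕ | (∀ i, f i ≤ K) ∧ ∀ i, n ≤ i → f i = 0}.Finite := by
  refine Set.Finite.of_injOn (f := fun f (i : Fin n) => (⟨min (f i) K, by omega⟩ : Fin (K + 1)))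
    (t := Set.univ) (fun _ _ => Set.mem_univ _) (fun f hf g hg hfg => ?_) Set.finite_univ
  funext i
  rcases lt_or_ge i n with hi | hi
  · have h1 := congrArg Fin.val (congrFun hfg ⟨i, hi⟩)
    have h2 := hf.1 i
    have h3 := hg.1 i
    simp only at h1
    omega
  · rw [hf.2 i hi, hg.2 i hi]

theorem lrCoeff_bounded {a b : ℕ → ℕ} (hn : ∀ i, n ≤ i → lam i = 0) (h : lrCoeff a b lam ≠ 0) :
    (∀ i, a i ≤ ∑ i ∈ range n, lam i) ∧ (∀ i, n ≤ i → a i = 0) ∧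
      (∀ i, b i ≤ ∑ i ∈ range n, lam i) ∧ ∀ i, n ≤ i → b i = 0 := by
  obtain ⟨T, hT⟩ := exists_tableau_of_ne_zero h
  obtain ⟨h1, h2⟩ := hT.content_bound hn
  have hle := hT.2.2.2.1
  have hz : ∀ i, n ≤ i → a i = 0 := fun i hi => Nat.le_zero.1 ((hle i).trans_eq (hn i hi))
  refine ⟨fun i => ?_, hz, h1, h2⟩
  rcases lt_or_ge i n with hi | hi
  · exact (hle i).trans (single_le_sum (fun _ _ => Nat.zero_le _) (mem_range.2 hi))
  · rw [hz i hi]; exact Nat.zero_le _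

theorem NL_ne_zero {a b c : ℕ → ℕ} (hl : ∀ i, n ≤ i → lam i = 0) (hm : ∀ i, n ≤ i → mu i = 0)
    (h1 : lrCoeff a b lam ≠ 0) (h2 : lrCoeff b c mu ≠ 0) (h3 : lrCoeff c a nu ≠ 0) :
    NL lam mu nu ≠ 0 := by
  have hA : ∀ a b c, lrCoeff a b lam * lrCoeff b c mu * lrCoeff c a nu ≠ 0 →
      a ∈ {f : ℕ → ℕ | (∀ i, f i ≤ ∑ i ∈ range n, lam i) ∧ ∀ i, n ≤ i → f i = 0} ∧
      b ∈ {f : ℕ → ℕ | (∀ i, f i ≤ ∑ i ∈ range n, lam i) ∧ ∀ i, n ≤ i → f i = 0} ∧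
      c ∈ {f : ℕ → ℕ | (∀ i, f i ≤ ∑ i ∈ range n, mu i) ∧ ∀ i, n ≤ i → f i = 0} := by
    intro a b c h
    have e1 := lrCoeff_bounded hl (left_ne_zero_of_mul (left_ne_zero_of_mul h))
    have e2 := lrCoeff_bounded hm (right_ne_zero_of_mul (left_ne_zero_of_mul h))
    exact ⟨⟨e1.1, e1.2.1⟩, e1.2.2, e2.2.2⟩
  have s1 := single_le_finsum c ((finite_bounded n _).subset fun c h => (hA a b c h).2.2)
    fun _ => Nat.zero_le _
  have s2 := single_le_finsum b ((finite_bounded n _).subset fun b h => by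
    obtain ⟨c, hc⟩ := exists_ne_of_finsum_ne h
    exact (hA a b c hc).2.1) fun _ => Nat.zero_le _
  have s3 := single_le_finsum a ((finite_bounded n _).subset fun a h => by
    obtain ⟨b, hb⟩ := exists_ne_of_finsum_ne h
    obtain ⟨c, hc⟩ := exists_ne_of_finsum_ne hb
    exact (hA a b c hc).1) fun _ => Nat.zero_le _
  exact (lt_of_lt_of_le (Nat.pos_of_ne_zero (mul_ne_zero (mul_ne_zero h1 h2) h3))
    (s1.trans (s2.trans s3))).ne'

theorem exists_NL_iff (hl : MemParN n lam) (hm : MemParN n mu) (hv : MemParN n nu) :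
    (∃ t : ℕ, 0 < t ∧ NL (fun i => t * lam i) (fun i => t * mu i) (fun i => t * nu i) ≠ 0) ↔
      NLQ n (castX lam mu nu) := by
  have hz : ∀ {f : ℕ → ℕ} (t : ℕ), MemParN n f → ∀ i, n ≤ i → t * f i = 0 := fun t hf i hi => by
    rw [hf.2 i hi, mul_zero]
  constructor
  · rintro ⟨t, ht, h⟩
    obtain ⟨a, b, c, h1, h2, h3⟩ := exists_of_NL_ne_zero h
    obtain ⟨T1, h1⟩ := exists_tableau_of_ne_zero h1
    obtain ⟨T2, h2⟩ := exists_tableau_of_ne_zero h2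
    obtain ⟨T3, h3⟩ := exists_tableau_of_ne_zero h3
    exact nlq_of_lr ht (h1.lr (hz t hl)) (h2.lr (hz t hm)) (h3.lr (hz t hv))
  · intro h
    obtain ⟨t, ht, a, b, c, ha, hb, hc, h1, h2, h3⟩ := h.exists_lr
    have hp : ∀ {f : ℕ → ℕ}, MemParN n f → MemParN n fun i => t * f i := fun hf =>
      ⟨⟨fun i j hij => Nat.mul_le_mul_left _ (hf.1.1 i j hij), n, hz t hf⟩, hz t hf⟩
    exact ⟨t, ht, NL_ne_zero (hz t hl) (hz t hm) (h1.lrCoeff_ne_zero ha hb (hp hl))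
      (h2.lrCoeff_ne_zero hb hc (hp hm)) (h3.lrCoeff_ne_zero hc ha (hp hv))⟩

end NL

section Sextuples

variable {n r : ℕ}

theorem disjoint_idx {A A' : Finset ℕ} (hA : A ⊆ Icc 1 n) (hA' : A' ⊆ Icc 1 n) :
    Disjoint (idx n A A') (revS (2 * n + 1) (idx n A A')) ↔ Disjoint A A' := by
  rw [revS_idx hA hA', disjoint_left, disjoint_left]
  constructor
  · intro h i hi hi'
    have := mem_Icc.1 (hA hi)
    refine h ((mem_idx hA hA').2 (Or.inl ⟨?_, ?_⟩)) ((mem_idx hA' hA).2 (Or.inl ⟨?_, ?_⟩)) (a := i - 1)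
    · omega
    · rwa [Nat.sub_add_cancel this.1]
    · omega
    · rwa [Nat.sub_add_cancel this.1]
  · intro h i hi hi'
    rcases (mem_idx hA hA').1 hi with h1 | h1 <;> rcases (mem_idx hA' hA).1 hi' with h2 | h2
    · exact h h1.2 h2.2
    · omega
    · omega
    · exact h h2.2.2 h1.2.2

theorem card_filter_idx {A A' : Finset ℕ} (hA : A ⊆ Icc 1 n) (hA' : A' ⊆ Icc 1 n) :
    ((idx n A A').filter (n < ·)).card = A'.card := by
  rw [card_filter, sum_idx hA hA', sum_eq_zero, zero_add, card_eq_sum_ones]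
  · refine sum_congr rfl fun i hi => if_pos ?_
    have := mem_Icc.1 (hA' hi)
    omega
  · intro i hi
    have := mem_Icc.1 (hA hi)
    exact if_neg (by omega)

variable {U U' : Triple}

theorem bd0_eq (hr : r ≤ n) (S : Triple) : bd0 n r S = fun c l =>
    (if c = 2 then ((2 * n - 2 * r : ℕ) : ℤ) else 0) - bef (freeS n (S c)) (nthSmall (S c) l) := by
  rw [Nat.cast_sub (by omega)]
  push_cast
  rfl

theorem card_le_of_disjoint (hU : ∀ c, U c ⊆ Icc 1 n) (hU' : ∀ c, U' c ⊆ Icc 1 n)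
    (hd : ∀ c, Disjoint (U c) (U' c)) (hr : ∀ c, (U c).card + (U' c).card = r) : r ≤ n := by
  have := card_le_card (union_subset (hU 0) (hU' 0))
  rwa [card_union_of_disjoint (hd 0), hr, Nat.card_Icc, Nat.add_sub_cancel] at this

theorem isQ_idx (hU : ∀ c, U c ⊆ Icc 1 n) (hU' : ∀ c, U' c ⊆ Icc 1 n)
    (hd : ∀ c, Disjoint (U c) (U' c)) (hr : ∀ c, (U c).card + (U' c).card = r)
    (hs : ∑ c, (U' c).card = r)
    (h0 : lrCoeff (compP (2 * n - 2 * r) r (tau0 n (U 1) (U' 1)))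
      (compP (2 * n - 2 * r) r (tau0 n (U 0) (U' 0))) (tau0 n (U 2) (U' 2)) ≠ 0)
    (h2 : lrCoeff (compP r r (tau2 n (U 1) (U' 1))) (compP r r (tau2 n (U 0) (U' 0)))
      (tau2 n (U 2) (U' 2)) ≠ 0) : IsQ n r fun c => idx n (U c) (U' c) where
  sub c := idx_sub (hU c) (hU' c)
  card c := (card_idx (hU c) (hU' c)).trans (hr c)
  disj c := (disjoint_idx (hU c) (hU' c)).2 (hd c)
  neg := by simpa only [card_filter_idx (hU _) (hU' _)] using hs
  lr2 := lr_of_lrCoeff (τ := fun c => tau2 n (U c) (U' c)) (fun c _ hl => (tau_eq_zero (hr c) hl).1)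
    (fun c _ hl => tau2_bef (hU c) (hU' c) (hr c) hl) h2
  lr0 := by
    rw [bd0_eq (card_le_of_disjoint hU hU' hd hr)]
    exact lr_of_lrCoeff (τ := fun c => tau0 n (U c) (U' c)) (fun c _ hl => (tau_eq_zero (hr c) hl).2)
      (fun c _ hl => tau0_bef (hU c) (hU' c) (hd c) (hr c) hl) h0

theorem lrCoeff_of_isQ (hU : ∀ c, U c ⊆ Icc 1 n) (hU' : ∀ c, U' c ⊆ Icc 1 n)
    (hd : ∀ c, Disjoint (U c) (U' c)) (hr : ∀ c, (U c).card + (U' c).card = r)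
    (h0 : RigidLR r (bd0 n r fun c => idx n (U c) (U' c)))
    (h2 : RigidLR r (bd2 n r fun c => idx n (U c) (U' c))) :
    lrCoeff (compP (2 * n - 2 * r) r (tau0 n (U 1) (U' 1)))
      (compP (2 * n - 2 * r) r (tau0 n (U 0) (U' 0))) (tau0 n (U 2) (U' 2)) = 1 ∧
    lrCoeff (compP r r (tau2 n (U 1) (U' 1))) (compP r r (tau2 n (U 0) (U' 0)))
      (tau2 n (U 2) (U' 2)) = 1 := by
  have hc := fun c => (card_idx (hU c) (hU' c)).trans (hr c)
  rw [bd0_eq (card_le_of_disjoint hU hU' hd hr)] at h0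
  exact ⟨lrCoeff_of_rigid (τ := fun c => tau0 n (U c) (U' c)) hc
    (fun c _ hl => (tau_eq_zero (hr c) hl).2)
    (fun c _ hl => tau0_bef (hU c) (hU' c) (hd c) (hr c) hl) h0,
    lrCoeff_of_rigid (τ := fun c => tau2 n (U c) (U' c)) hc
    (fun c _ hl => (tau_eq_zero (hr c) hl).1)
    (fun c _ hl => tau2_bef (hU c) (hU' c) (hr c) hl) h2⟩

theorem evS_idx (hU : ∀ c, U c ⊆ Icc 1 n) (hU' : ∀ c, U' c ⊆ Icc 1 n)
    (lam mu nu : ℕ → ℕ) : evS (fun c => idx n (U c) (U' c)) (hat n (castX lam mu nu)) =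
      (((sumParts lam (U 1) : ℤ) - (sumParts lam (U' 1) : ℤ) + (sumParts mu (U 0) : ℤ)
        - (sumParts mu (U' 0) : ℤ) + (sumParts nu (U 2) : ℤ) - (sumParts nu (U' 2) : ℤ) : ℤ) : ℚ) := by
  simp only [evS, sum_idx_hat (hU _) (hU' _), Fin.sum_univ_three, sumParts]
  push_cast
  simp only [castX, Matrix.cons_val_zero, Matrix.cons_val_one, Matrix.cons_val]
  ring

theorem decPos_castX {lam mu nu : ℕ → ℕ} (hl : MemParN n lam) (hm : MemParN n mu)
    (hv : MemParN n nu) : DecPos n (castX lam mu nu) := by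
  refine ⟨fun c i j hij _ => ?_, fun c i _ => ?_⟩ <;> fin_cases c
  · exact Nat.cast_le.2 (hm.1.1 i j hij)
  · exact Nat.cast_le.2 (hl.1.1 i j hij)
  · exact Nat.cast_le.2 (hv.1.1 i j hij)
  all_goals exact Nat.cast_nonneg _

end Sextuples

end

/-- **Theorem (minimal list of inequalities for the saturated NL-cone).**
For `(λ,μ,ν) ∈ (Par_n)³`, some multiple `N_{tλ,tμ,tν}` is nonzero iff the
inequality `0 ≤ |λ_A| − |λ_{A'}| + |μ_B| − |μ_{B'}| + |ν_C| − |ν_{C'}|` holds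
for all sextuples `(A,A',B,B',C,C')` of subsets of `[n]` satisfying
conditions (1), (2), (3). -/
theorem stmt0 (n : ℕ) (hn : 1 ≤ n) (lam mu nu : ℕ → ℕ)
    (hl : MemParN n lam) (hm : MemParN n mu) (hv : MemParN n nu) :
    (∃ t : ℕ, 0 < t ∧
        NL (fun i => t * lam i) (fun i => t * mu i) (fun i => t * nu i) ≠ 0) ↔
      ∀ A A' B B' C C' : Finset ℕ,
        A ⊆ Finset.Icc 1 n → A' ⊆ Finset.Icc 1 n → B ⊆ Finset.Icc 1 n →
        B' ⊆ Finset.Icc 1 n → C ⊆ Finset.Icc 1 n → C' ⊆ Finset.Icc 1 n →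
        A ∩ A' = ∅ → B ∩ B' = ∅ → C ∩ C' = ∅ →
        ∀ r : ℕ, A'.card + B'.card + C'.card = r →
          A.card + A'.card = r → B.card + B'.card = r → C.card + C'.card = r →
          lrCoeff (compP (2 * n - 2 * r) r (tau0 n A A'))
            (compP (2 * n - 2 * r) r (tau0 n B B')) (tau0 n C C') = 1 →
          lrCoeff (compP r r (tau2 n A A'))
            (compP r r (tau2 n B B')) (tau2 n C C') = 1 →
          (0 : ℤ) ≤ (sumParts lam A : ℤ) - (sumParts lam A' : ℤ)
            + (sumParts mu B : ℤ) - (sumParts mu B' : ℤ)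
            + (sumParts nu C : ℤ) - (sumParts nu C' : ℤ) := by
  rw [exists_NL_iff hl hm hv]
  constructor
  · intro h A A' B B' C C' hA hA' hB hB' hC hC' dA dB dC r hr rA rB rC h0 h2
    have hU : ∀ c, (![B, A, C] : Triple) c ⊆ Finset.Icc 1 n := by
      intro c; fin_cases c <;> assumption
    have hU' : ∀ c, (![B', A', C'] : Triple) c ⊆ Finset.Icc 1 n := by
      intro c; fin_cases c <;> assumption
    have hd : ∀ c, Disjoint ((![B, A, C] : Triple) c)
        ((![B', A', C'] : Triple) c) := by
      intro c; rw [Finset.disjoint_iff_inter_eq_empty]; fin_cases c <;> assumption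
    have hc : ∀ c, ((![B, A, C] : Triple) c).card +
        ((![B', A', C'] : Triple) c).card = r := by
      intro c; fin_cases c <;> assumption
    have hs : ∑ c, ((![B', A', C'] : Triple) c).card = r := by
      rw [Fin.sum_univ_three, ← hr, add_comm A'.card]; rfl
    have := (isQ_idx hU hU' hd hc hs (h0.trans_ne one_ne_zero)
      (h2.trans_ne one_ne_zero)).valid_of_nlq (decPos_castX hl hm hv) h
    rw [evS_idx hU hU'] at this
    exact_mod_cast this
  · intro h
    by_contra hN
    obtain ⟨r, S, hQ, h2, h0, hlt⟩ := exists_rigid_of_not_nlq (decPos_castX hl hm hv) hN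
    choose U U' hU hU' hS using fun c => exists_idx (hQ.sub c) (mid_notMem (hQ.sub c) (hQ.disj c))
    obtain rfl : S = fun c => idx n (U c) (U' c) := funext hS
    have hd := fun c => (disjoint_idx (hU c) (hU' c)).1 (hQ.disj c)
    have hc := fun c => (card_idx (hU c) (hU' c)).symm.trans (hQ.card c)
    have hs := hQ.neg
    simp only [card_filter_idx (hU _) (hU' _), Fin.sum_univ_three] at hs
    obtain ⟨e0, e2⟩ := lrCoeff_of_isQ hU hU' hd hc h0 h2
    rw [evS_idx hU hU'] at hlt
    have := h (U 1) (U' 1) (U 0) (U' 0) (U 2) (U' 2) (hU 1) (hU' 1) (hU 0) (hU' 0) (hU 2) (hU' 2)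
      (Finset.disjoint_iff_inter_eq_empty.1 (hd 1)) (Finset.disjoint_iff_inter_eq_empty.1 (hd 0))
      (Finset.disjoint_iff_inter_eq_empty.1 (hd 2)) r (by rw [← hs, add_comm (U' 1).card])
      (hc 1) (hc 0) (hc 2) e0 e2
    exact absurd hlt (not_lt.2 (by exact_mod_cast this))
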